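/- Let p ≥ 5 be a prime and let r be an integer with 0 < r ≤ 10^6. If x and y are integers with gcd(x, r) = 1 satisfying (x−4r)³ + (x−3r)³ + (x−2r)³ + (x−r)³ + x³ + (x+r)³ + (x+2r)³ + (x+3r)³ + (x+4r)³ = y^p (equivalently, 9x(x² + 20r²) = y^p), then xy = 0. -/

import Mathlib

theorem near_aux (c n : ℤ) (hn : 0 < n) : ∃ a : ℤ, -n ≤ 2*(c - a*n) ∧ 2*(c-a*n) ≤ n := by
  refine ⟨(2*c+n)/(2*n), ?_, ?_⟩
  · have h := Int.emod_add_mul_ediv (2*c+n) (2*n)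
    have h1 := Int.emod_nonneg (2*c+n) (show (2*n) ≠ 0 by omega)
    have h2 := Int.emod_lt_of_pos (2*c+n) (show 0 < 2*n by omega)
    nlinarith
  · have h := Int.emod_add_mul_ediv (2*c+n) (2*n)
    have h1 := Int.emod_nonneg (2*c+n) (show (2*n) ≠ 0 by omega)
    have h2 := Int.emod_lt_of_pos (2*c+n) (show 0 < 2*n by omega)
    nlinarith

theorem dh_aux (c d n : ℤ) (hn : 0 < n) :
    ∃ k : ℤ, (k = 1 ∨ k = 2) ∧ ∃ a b : ℤ, (k*c - a*n)^2 + 5*(k*d - b*n)^2 < n^2 := by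
  obtain ⟨b, hb1, hb2⟩ := near_aux d n hn
  by_cases h : 20*(d-b*n)^2 < 3*n^2
  · obtain ⟨a, ha1, ha2⟩ := near_aux c n hn
    refine ⟨1, Or.inl rfl, a, b, ?_⟩
    have : 4*(c-a*n)^2 ≤ n^2 := by nlinarith
    rw [one_mul, one_mul]
    nlinarith
  · push Not at h
    obtain ⟨a, ha1, ha2⟩ := near_aux (2*c) n hn
    have h4 : 4*(2*c-a*n)^2 ≤ n^2 := by nlinarith
    rcases le_total 0 (d-b*n) with h0 | h0
    · refine ⟨2, Or.inr rfl, a, 2*b+1, ?_⟩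
      set y := d - b*n with hy
      have e1 : 2*d - (2*b+1)*n = 2*y - n := by rw [hy]; ring
      rw [e1]
      have h5 : 3*n ≤ 8*y := by
        by_contra hc
        push Not at hc
        nlinarith
      nlinarith
    · refine ⟨2, Or.inr rfl, a, 2*b-1, ?_⟩
      set y := d - b*n with hy
      have e1 : 2*d - (2*b-1)*n = 2*y + n := by rw [hy]; ring
      rw [e1]
      have h5 : 8*y ≤ -(3*n) := by
        by_contra hc
        push Not at hc
        nlinarith
      nlinarith

abbrev R5 := ℤ√(-5)

theorem norm5 (z : R5) : z.norm = z.re^2 + 5*z.im^2 := by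
  rw [Zsqrtd.norm_def]; ring

theorem norm5_nonneg (z : R5) : 0 ≤ z.norm := by rw [norm5]; positivity

theorem norm5_zero {z : R5} (h : z.norm = 0) : z = 0 := by
  rw [norm5] at h
  have h1 : z.re = 0 := by nlinarith [sq_nonneg z.re, sq_nonneg z.im]
  have h2 : z.im = 0 := by nlinarith [sq_nonneg z.re, sq_nonneg z.im]
  exact Zsqrtd.ext h1 h2

theorem norm5_one {z : R5} (h : z.norm = 1) : z = 1 ∨ z = -1 := by
  rw [norm5] at h
  have h2 : z.im = 0 := by
    by_contra hc
    have : 1 ≤ z.im^2 := by have := sq_pos_of_ne_zero hc; omega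
    nlinarith [sq_nonneg z.re]
  have h1 : z.re = 1 ∨ z.re = -1 := by
    rw [h2] at h
    have h3 : (z.re - 1) * (z.re + 1) = 0 := by nlinarith
    rcases mul_eq_zero.mp h3 with h4 | h4
    · left; omega
    · right; omega
  rcases h1 with h1 | h1
  · left; exact Zsqrtd.ext h1 h2
  · right; exact Zsqrtd.ext h1 (by simpa using h2)

/- every ideal: two times it lies in a principal ideal generated by an element of it -/
theorem ideal5 (I : Ideal R5) (hI : I ≠ ⊥) : ∃ m ∈ I, m ≠ 0 ∧ ∀ x ∈ I, ∃ q : R5, 2 * x = m * q := by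
  classical
  have hex : ∃ n : ℕ, ∃ m ∈ I, m ≠ 0 ∧ m.norm.natAbs = n := by
    obtain ⟨m, hm, h0⟩ := Submodule.exists_mem_ne_zero_of_ne_bot hI
    exact ⟨_, m, hm, h0, rfl⟩
  obtain ⟨m, hm, hm0, hn⟩ := Nat.find_spec hex
  refine ⟨m, hm, hm0, fun x hx => ?_⟩
  have hmin : ∀ y ∈ I, y ≠ 0 → m.norm ≤ y.norm := by
    intro y hy hy0
    have := Nat.find_min' hex ⟨y, hy, hy0, rfl⟩
    rw [← hn] at this
    have h1 := norm5_nonneg m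
    have h2 := norm5_nonneg y
    omega
  have hpos : 0 < m.norm := lt_of_le_of_ne (norm5_nonneg m) (fun h => hm0 (norm5_zero h.symm))
  obtain ⟨k, hk, a, b, hab⟩ := dh_aux (x * star m).re (x * star m).im m.norm hpos
  have key : (k : R5) * x - (⟨a, b⟩ : R5) * m = 0 := by
    by_contra hne
    have hmem : (k : R5) * x - (⟨a, b⟩ : R5) * m ∈ I :=
      I.sub_mem (I.mul_mem_left _ hx) (I.mul_mem_left _ hm)
    have h1 := hmin _ hmem hne
    have h2 : (((k : R5) * x - (⟨a, b⟩ : R5) * m) * star m).norm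
        = ((k : R5) * x - (⟨a, b⟩ : R5) * m).norm * m.norm := by
      rw [Zsqrtd.norm_mul, Zsqrtd.norm_conj]
    have h3 : ((k : R5) * x - (⟨a, b⟩ : R5) * m) * star m
        = ⟨k * (x * star m).re - a * m.norm, k * (x * star m).im - b * m.norm⟩ := by
      have : m * star m = (m.norm : R5) := (Zsqrtd.norm_eq_mul_conj m).symm
      rw [sub_mul, mul_assoc, mul_assoc, this]
      ext <;> simp
    rw [h3, norm5] at h2
    simp only at h2
    nlinarith
  rcases hk with rfl | rfl
  · refine ⟨2 * ⟨a, b⟩, ?_⟩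
    have : x = (⟨a, b⟩ : R5) * m := by
      have := sub_eq_zero.mp key
      simpa using this
    rw [this]; ring
  · refine ⟨⟨a, b⟩, ?_⟩
    have := sub_eq_zero.mp key
    push_cast at this
    rw [this]; ring

instance r5NoZeroDiv : NoZeroDivisors R5 where
  eq_zero_or_eq_zero_of_mul_eq_zero := by
    intro a b h
    have h1 : a.norm * b.norm = 0 := by rw [← Zsqrtd.norm_mul, h]; simp
    rcases mul_eq_zero.mp h1 with h2 | h2
    · exact Or.inl (norm5_zero h2)
    · exact Or.inr (norm5_zero h2)

instance r5IsDomain : IsDomain R5 := NoZeroDivisors.to_isDomain R5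

theorem pth_root5 (C D w : ℤ) (p : ℕ) (hp : Odd p) (hp3 : 3 ≤ p) (hcop : IsCoprime C D) (hw : Odd w)
    (h : C^2 + 5*D^2 = w^p) : ∃ γ : R5, γ^p = ⟨C, D⟩ ∧ γ.norm = w := by
  have hwpos : 0 < w := by
    have h1 : 0 ≤ w^p := by rw [← h]; positivity
    rcases lt_trichotomy w 0 with h2 | h2 | h2
    · have := hp.pow_neg h2; omega
    · rw [h2] at hw; simp at hw
    · exact h2
  -- 5 does not divide w
  have h5w : ¬ (5:ℤ) ∣ w := by
    intro h5
    have h25 : (5:ℤ)^2 ∣ w^p := (pow_dvd_pow_of_dvd h5 2).trans (pow_dvd_pow w (by omega))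
    rw [← h] at h25
    have hC : (5:ℤ) ∣ C := by
      have : (5:ℤ) ∣ C^2 := by
        have h1 : (5:ℤ) ∣ C^2 + 5*D^2 := (by norm_num : (5:ℤ) ∣ 5^2).trans h25
        exact (Int.dvd_add_left ⟨D^2, rfl⟩).mp h1
      exact Int.Prime.dvd_pow' (by norm_num) this
    have hD : (5:ℤ) ∣ D := by
      obtain ⟨c, rfl⟩ := hC
      obtain ⟨e, he⟩ := h25
      have : (5:ℤ) ∣ D^2 := ⟨e - c^2, by nlinarith⟩
      exact Int.Prime.dvd_pow' (by norm_num) this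
    have := hcop.isUnit_of_dvd' hC hD
    rw [Int.isUnit_iff] at this
    omega
  -- coprimality
  have hcw : IsCoprime (2*C) (w^p) := by
    apply IsCoprime.mul_left
    · apply IsCoprime.pow_right
      rw [Int.isCoprime_iff_gcd_eq_one]
      rcases hw with ⟨k, rfl⟩
      rw [← Int.isCoprime_iff_gcd_eq_one]
      exact ⟨-k, 1, by ring⟩
    · have h5 : IsCoprime C (5:ℤ) := by
        rw [Int.isCoprime_iff_gcd_eq_one]
        by_contra hne
        have hd : ((Int.gcd C 5 : ℕ) : ℤ) ∣ 5 := Int.gcd_dvd_right ..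
        have hc : ((Int.gcd C 5 : ℕ) : ℤ) ∣ C := Int.gcd_dvd_left ..
        have hd' : Int.gcd C 5 ∣ 5 := by exact_mod_cast hd
        rcases (Nat.dvd_prime (by norm_num)).mp hd' with h1 | h1
        · exact hne h1
        · rw [h1] at hc
          apply h5w
          have : (5:ℤ) ∣ w^p := by
            rw [← h]
            exact dvd_add (dvd_pow hc two_ne_zero) ⟨D^2, rfl⟩
          exact Int.Prime.dvd_pow' (by norm_num) this
      rw [← h]
      have : IsCoprime C (5*D^2) := h5.mul_right hcop.pow_right
      have := this.add_mul_left_right C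
      rwa [show 5*D^2 + C*C = C^2+5*D^2 by ring] at this
  set z : R5 := ⟨C, D⟩ with hz
  have hzn : z.norm = w^p := by rw [norm5, ← h]
  have hzz : z * star z = ((w^p : ℤ) : R5) := by
    rw [← Zsqrtd.norm_eq_mul_conj, hzn]
  have hz0 : z ≠ 0 := by
    intro h0
    rw [h0] at hzn
    simp at hzn
    have := pow_pos hwpos p
    omega
  have hzcop : IsCoprime (star z) z := by
    obtain ⟨a, b, hab⟩ := hcw
    refine ⟨(a : R5), (a : R5) + (b : R5) * star z, ?_⟩
    have h1 : z + star z = ((2*C : ℤ) : R5) := by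
      ext <;> simp [hz]; ring
    have h2 : (a : R5) * ((2*C : ℤ) : R5) + (b : R5) * ((w^p : ℤ) : R5) = 1 := by
      exact_mod_cast congrArg (Int.cast : ℤ → R5) hab
    rw [← h1, ← hzz] at h2
    rw [← h2]; ring
  have hzcop' : IsCoprime (star z) (z^(p-1)) := hzcop.pow_right
  obtain ⟨e, f, hef⟩ := hzcop'
  have hzef : z = ((w^p : ℤ) : R5) * e + z^p * f := by
    have hpp : z^p = z^(p-1) * z := by rw [← pow_succ]; congr 1; omega
    calc z = z * (e * star z + f * z^(p-1)) := by rw [hef, mul_one]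
      _ = _ := by rw [hpp, ← hzz]; ring
  let I : Ideal R5 := Ideal.span {(w : R5), z}
  have hzI : z ∈ I := Ideal.subset_span (by simp)
  have hwI : (w : R5) ∈ I := Ideal.subset_span (by simp)
  obtain ⟨m, hm, hm0, hmI⟩ := ideal5 I (by
    intro hb; rw [hb] at hzI; exact hz0 (by simpa using hzI))
  obtain ⟨μ1, hμ1⟩ := hmI _ hwI
  obtain ⟨μ2, hμ2⟩ := hmI _ hzI
  obtain ⟨X, Y, hXY⟩ := Ideal.mem_span_pair.mp hm
  -- z ∣ m^p
  have hdvd : z ∣ m^p := by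
    have h1 : z ∣ (X * (w:R5))^p := by
      rw [mul_pow]
      have : z ∣ (w:R5)^p := ⟨star z, by rw [hzz]; push_cast; rfl⟩
      exact this.mul_left _
    have h2 : Y * z ∣ m^p - (X * (w:R5))^p := by
      have := sub_dvd_pow_sub_pow m (X * (w:R5)) p
      rwa [← hXY, add_sub_cancel_left, hXY] at this
    have h3 : z ∣ m^p - (X * (w:R5))^p := (Dvd.intro_left Y rfl).trans h2
    exact (dvd_sub_left h1).mp h3
  obtain ⟨l, hl⟩ := hdvd
  set n : R5 := μ1^p * e + μ2^p * f with hn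
  have h2z : (2:R5)^p * z = m^p * n := by
    have : (2:R5)^p * z = (2*(w:R5))^p * e + (2 * z)^p * f := by
      conv_lhs => rw [hzef]
      push_cast; ring
    rw [this, hμ1, hμ2, hn]; ring
  have hln : l * n = 2^p := by
    rw [hl] at h2z
    have : z * (l * n) = z * 2^p := by rw [← mul_assoc, ← h2z]; ring
    exact mul_left_cancel₀ hz0 this
  -- norms
  have hpow : ∀ (x : R5) (k : ℕ), (x^k).norm = x.norm^k := by
    intro x k
    exact map_pow (Zsqrtd.normMonoidHom (d := -5)) x k
  have hN1 : m.norm^p = w^p * l.norm := by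
    rw [← hpow, hl, Zsqrtd.norm_mul, hzn]
  have hN2 : l.norm * n.norm = 4^p := by
    rw [← Zsqrtd.norm_mul, hln, hpow]
    congr 1
  have hwm : w ∣ m.norm := (Int.pow_dvd_pow_iff (by omega)).mp ⟨_, hN1⟩
  obtain ⟨g, hg⟩ := hwm
  have hgl : g^p = l.norm := by
    rw [hg, mul_pow] at hN1
    exact mul_left_cancel₀ (pow_pos hwpos p).ne' hN1
  have hg4 : g ∣ 4 := (Int.pow_dvd_pow_iff (n := p) (by omega)).mp ⟨n.norm, by rw [hgl, hN2]⟩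
  have hgpos : 0 < g := by
    have h1 := norm5_nonneg m
    have h2 : m.norm ≠ 0 := fun h0 => hm0 (norm5_zero h0)
    rw [hg] at h1 h2
    by_contra hc
    push Not at hc
    have : w * g ≤ 0 := by nlinarith
    omega
  have hg' : g = 1 ∨ g = 2 ∨ g = 4 := by
    have : g ≤ 4 := Int.le_of_dvd (by norm_num) hg4
    have h3 : g ≠ 3 := by rintro rfl; omega
    omega
  rcases hg' with rfl | rfl | rfl
  · have hl1 : l.norm = 1 := by rw [← hgl]; simp
    rcases norm5_one hl1 with h1 | h1
    · refine ⟨m, by rw [hl, h1, mul_one], by rw [hg, mul_one]⟩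
    · refine ⟨-m, by rw [hp.neg_pow, hl, h1]; simp, by rw [Zsqrtd.norm_neg, hg, mul_one]⟩
  · exfalso
    rw [norm5] at hg
    -- mod 5
    obtain ⟨k, hk⟩ := hp
    have h5 : w % 5 = 1 ∨ w % 5 = 2 ∨ w % 5 = 3 ∨ w % 5 = 4 := by omega
    have e1 : (w^p) % 5 = (C^2) % 5 := by rw [← h]; omega
    have e2 : (m.re^2) % 5 = (2 * w) % 5 := by omega
    have hsq : ∀ t : ℤ, t^2 % 5 = 0 ∨ t^2 % 5 = 1 ∨ t^2 % 5 = 4 := by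
      intro t
      have : t % 5 = 0 ∨ t % 5 = 1 ∨ t % 5 = 2 ∨ t % 5 = 3 ∨ t % 5 = 4 := by omega
      rcases this with h | h | h | h | h <;> simp [pow_two, Int.mul_emod, h]
    have hw4 : (w^k)^2 % 5 = 1 ∨ (w^k)^2 % 5 = 4 := by
      rcases hsq (w^k) with h0 | h0 | h0
      · exfalso
        apply h5w
        have : (5:ℤ) ∣ (w^k)^2 := Int.dvd_of_emod_eq_zero h0
        exact Int.Prime.dvd_pow' (by norm_num) (Int.Prime.dvd_pow' (by norm_num) this)
      · exact Or.inl h0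
      · exact Or.inr h0
    have e3 : w^p = (w^k)^2 * w := by rw [hk]; ring
    rw [e3, Int.mul_emod] at e1
    have hC := hsq C
    have hM := hsq m.re
    rcases h5 with h5 | h5 | h5 | h5 <;> rcases hw4 with h6 | h6 <;> rw [h5, h6] at e1 <;> omega
  · rw [norm5] at hg
    have hre : m.re % 2 = 0 ∧ m.im % 2 = 0 := by
      have e : (m.re^2 + m.im^2) % 4 = 0 := by omega
      rcases Int.emod_two_eq_zero_or_one m.re with h1 | h1 <;>
      rcases Int.emod_two_eq_zero_or_one m.im with h2 | h2
      · exact ⟨h1, h2⟩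
      all_goals
        exfalso
        obtain ⟨a, ha⟩ : ∃ a, m.re = 2*a + m.re % 2 := ⟨m.re/2, by omega⟩
        obtain ⟨b, hb⟩ : ∃ b, m.im = 2*b + m.im % 2 := ⟨m.im/2, by omega⟩
        rw [h1] at ha; rw [h2] at hb
        rw [ha, hb] at e
        ring_nf at e
        omega
    set γ : R5 := ⟨m.re/2, m.im/2⟩ with hγ
    have hmγ : m = 2 * γ := by
      ext <;> simp [hγ] <;> omega
    have hγn : γ.norm = w := by
      have h1 : m.norm = 4 * γ.norm := by
        rw [hmγ, Zsqrtd.norm_mul]; rfl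
      rw [norm5] at h1
      omega
    have hn1 : n.norm = 1 := by
      rw [← hgl] at hN2
      have : (4:ℤ)^p ≠ 0 := by positivity
      exact mul_left_cancel₀ this (by rw [hN2, mul_one])
    have h2p : (2:R5)^p ≠ 0 := pow_ne_zero _ (by norm_num)
    rw [hmγ, mul_pow] at h2z
    have hzg : z = γ^p * n := mul_left_cancel₀ h2p (by rw [h2z]; ring)
    rcases norm5_one hn1 with h1 | h1
    · exact ⟨γ, by rw [hzg, h1, mul_one], hγn⟩
    · exact ⟨-γ, by rw [hp.neg_pow, hzg, h1]; ring, by rw [Zsqrtd.norm_neg, hγn]⟩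

/-- Case B data -/
def SolB (p : ℕ) (r : ℤ) (cs : ℕ) : Prop :=
  ∃ (α : R5) (A B Y ρ : ℤ), IsCoprime A B ∧ α^p = ⟨2, 1⟩ * ⟨A, B⟩ ∧ (ρ = r ∨ ρ = -r) ∧ Y ≠ 0 ∧
    Odd (A^2 + 5*B^2) ∧ ¬ (3:ℤ) ∣ Y ∧
    ((cs = 0 ∧ A = Y^p ∧ B = 2*ρ ∧ ¬ (5:ℤ) ∣ A) ∨ (cs = 1 ∧ 8*A = Y^p ∧ B = ρ ∧ ¬ (5:ℤ) ∣ A) ∨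
     (cs = 2 ∧ 25*B = Y^p ∧ A = 2*ρ) ∨ (cs = 3 ∧ 200*B = Y^p ∧ A = ρ))

/-- Case A data -/
def SolA (p : ℕ) (r : ℤ) (cs : ℕ) : Prop :=
  ∃ (γ : R5) (A B Y : ℤ), IsCoprime A B ∧ γ^p = ⟨A, B⟩ ∧ Y ≠ 0 ∧
    Odd (A^2 + 5*B^2) ∧ (3:ℤ) ∣ Y ∧
    ((cs = 0 ∧ 9*A = Y^p ∧ B = 2*r ∧ ¬ (5:ℤ) ∣ A) ∨ (cs = 1 ∧ 72*A = Y^p ∧ B = r ∧ ¬ (5:ℤ) ∣ A) ∨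
     (cs = 2 ∧ 225*B = Y^p ∧ A = 2*r) ∨ (cs = 3 ∧ 1800*B = Y^p ∧ A = r))

theorem split_pow {M N y : ℤ} {p : ℕ} (hp : Odd p) (hc : IsCoprime M N) (h : M * N = y^p) :
    ∃ Y v : ℤ, M = Y^p ∧ N = v^p := by
  obtain ⟨⟨Y, hY⟩, ⟨v, hv⟩⟩ := Int.eq_pow_of_mul_eq_pow_odd hc hp h
  exact ⟨Y, v, hY, hv⟩

/-- core: solving the norm equation in case B -/
theorem caseB_core {p : ℕ} (hp : Odd p) (hp3 : 3 ≤ p) {A B w : ℤ} (hc : IsCoprime A B)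
    (ho : Odd (A^2+5*B^2)) (h : 9*(A^2+5*B^2) = w^p) :
    (∃ α : R5, α^p = ⟨2,1⟩ * ⟨A, B⟩) ∨ (∃ α : R5, α^p = ⟨2,1⟩ * ⟨A, -B⟩) := by
  have hw : Odd w := by
    have : Odd (w^p) := by rw [← h]; exact Odd.mul (by decide) ho
    exact Int.odd_pow' (by omega) |>.mp this
  have h3 : (3:ℤ) ∣ w := by
    have : (3:ℤ) ∣ w^p := ⟨3*(A^2+5*B^2), by rw [← h]; ring⟩
    exact Int.Prime.dvd_pow' (by norm_num) this
  have h27 : (27:ℤ) ∣ w^p := by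
    have := (pow_dvd_pow_of_dvd h3 3).trans (pow_dvd_pow w hp3)
    norm_num at this; exact this
  have hn3 : (3:ℤ) ∣ A^2+5*B^2 := by omega
  have main : ∀ B' : ℤ, (B' = B ∨ B' = -B) → ¬ (3:ℤ) ∣ A + 2*B' → ∃ α : R5, α^p = ⟨2,1⟩ * ⟨A, B'⟩ := by
    intro B' hB' hnd
    have hsq : B'^2 = B^2 := by rcases hB' with h | h <;> rw [h]; ring
    have hc' : IsCoprime A B' := by
      rcases hB' with h | h <;> rw [h]
      · exact hc
      · exact hc.neg_right
    have hcop : IsCoprime (2*A-5*B') (A+2*B') := by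
      have h3c : IsCoprime (A+2*B') (9:ℤ) := by
        have : IsCoprime (A+2*B') (3:ℤ) := by
          rw [isCoprime_comm]
          exact (Int.prime_three.coprime_iff_not_dvd).mpr hnd
        have := this.pow_right (n := 2)
        norm_num at this; exact this
      have hB : IsCoprime (A+2*B') B' := by
        have := hc'.add_mul_right_left 2
        exact this
      have h9 : IsCoprime (A+2*B') (9*B') := h3c.mul_right hB
      have := (h9.neg_right).add_mul_left_right 2
      rw [isCoprime_comm]
      rwa [show -(9*B') + (A+2*B')*2 = 2*A-5*B' by ring] at this
    obtain ⟨α, hα, -⟩ := pth_root5 (2*A-5*B') (A+2*B') w p hp hp3 hcop hw (by rw [← h, ← hsq]; ring)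
    refine ⟨α, ?_⟩
    rw [hα]
    ext <;> simp <;> ring
  by_cases hd : (3:ℤ) ∣ A + 2*B
  · right
    apply main (-B) (Or.inr rfl)
    intro hd2
    have hA : (3:ℤ) ∣ A := by omega
    have hB : (3:ℤ) ∣ B := by omega
    have := hc.isUnit_of_dvd' hA hB
    rw [Int.isUnit_iff] at this
    omega
  · left
    exact main B (Or.inl rfl) hd

theorem red_generic {p : ℕ} (hp : Odd p) (hp3 : 3 ≤ p) {A B T e y : ℤ} (hc : IsCoprime A B)
    (ho : Odd (A^2+5*B^2)) (hT : T = A ∨ T = B) (hTN : IsCoprime T (A^2+5*B^2))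
    (heN : IsCoprime e (A^2+5*B^2)) (he3 : ¬ (3:ℤ) ∣ e)
    (h : 9*(e*T)*(A^2+5*B^2) = y^p) :
    (∃ (γ : R5) (Y : ℤ), γ^p = ⟨A, B⟩ ∧ 9*e*T = Y^p ∧ (3:ℤ) ∣ Y) ∨
    (∃ (α : R5) (Y : ℤ), e*T = Y^p ∧ ¬ (3:ℤ) ∣ Y ∧
      (α^p = ⟨2,1⟩ * ⟨A, B⟩ ∨ α^p = ⟨2,1⟩ * ⟨A, -B⟩)) := by
  have p3 : Prime (3:ℤ) := Int.prime_three
  by_cases h3 : (3:ℤ) ∣ T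
  · left
    have hN3 : IsCoprime (9:ℤ) (A^2+5*B^2) := by
      have : IsCoprime (3:ℤ) (A^2+5*B^2) := hTN.of_isCoprime_of_dvd_left h3
      have := this.pow_left (m := 2)
      norm_num at this; exact this
    have hcc : IsCoprime (9*e*T) (A^2+5*B^2) := (hN3.mul_left heN).mul_left hTN
    obtain ⟨Y, v, hY, hv⟩ := split_pow hp hcc (by rw [← h]; ring)
    have hvo : Odd v := by
      rw [hv] at ho
      exact Int.odd_pow' (by omega) |>.mp ho
    obtain ⟨γ, hγ, -⟩ := pth_root5 A B v p hp hp3 hc hvo hv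
    refine ⟨γ, Y, hγ, hY, ?_⟩
    have : (3:ℤ) ∣ Y^p := by rw [← hY]; exact h3.mul_left _
    exact p3.dvd_of_dvd_pow this
  · right
    have hcc : IsCoprime (e*T) (9*(A^2+5*B^2)) := by
      apply IsCoprime.mul_right
      · have : IsCoprime (e*T) (3:ℤ) := by
          rw [isCoprime_comm]
          apply (p3.coprime_iff_not_dvd).mpr
          intro hd
          rcases p3.dvd_or_dvd hd with h | h
          · exact he3 h
          · exact h3 h
        have := this.pow_right (n := 2)
        norm_num at this; exact this
      · exact heN.mul_left hTN
    obtain ⟨Y, w, hY, hw⟩ := split_pow hp hcc (by rw [← h]; ring)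
    have hY3 : ¬ (3:ℤ) ∣ Y := by
      intro hd
      have : (3:ℤ) ∣ e*T := by rw [hY]; exact dvd_pow hd (by omega)
      rcases p3.dvd_or_dvd this with h | h
      · exact he3 h
      · exact h3 h
    rcases caseB_core hp hp3 hc ho hw with ⟨α, hα⟩ | ⟨α, hα⟩
    · exact ⟨α, Y, hY, hY3, Or.inl hα⟩
    · exact ⟨α, Y, hY, hY3, Or.inr hα⟩

theorem cop_two_of_odd {N : ℤ} (h : Odd N) : IsCoprime (2:ℤ) N := by
  obtain ⟨k, rfl⟩ := h
  exact ⟨-k, 1, by ring⟩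

theorem prime_five_int : Prime (5:ℤ) := by
  have := Nat.prime_iff_prime_int.mp (show Nat.Prime 5 by norm_num); exact_mod_cast this

theorem not_two_pow_four {M y : ℤ} {p : ℕ} (hp5 : 5 ≤ p) (hM : Odd M) (h : 16*M = y^p) : False := by
  have h2 : (2:ℤ) ∣ y := by
    have : (2:ℤ) ∣ y^p := ⟨8*M, by rw [← h]; ring⟩
    exact Int.prime_two.dvd_of_dvd_pow this
  have : (2:ℤ)^5 ∣ y^p := (pow_dvd_pow_of_dvd h2 5).trans (pow_dvd_pow y hp5)
  rw [← h] at this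
  obtain ⟨k, hk⟩ := hM
  omega

theorem reduction {p : ℕ} (hp : p.Prime) (hp5 : 5 ≤ p) {x r y : ℤ} (hgcd : Int.gcd x r = 1)
    (hx : x ≠ 0) (h : 9*x*(x^2+20*r^2) = y^p) :
    ∃ cs, cs < 4 ∧ (SolA p r cs ∨ SolB p r cs) := by
  have hodd : Odd p := hp.odd_of_ne_two (by omega)
  have hp3 : 3 ≤ p := by omega
  have hc : IsCoprime x r := Int.isCoprime_iff_gcd_eq_one.mpr hgcd
  have hu : ∀ d : ℤ, 1 < d → d ∣ x → ¬ d ∣ r := by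
    intro d hd h1 h2
    have := hc.isUnit_of_dvd' h1 h2
    rw [Int.isUnit_iff] at this
    omega
  have p5 := prime_five_int
  have oddsq : ∀ t : ℤ, ¬ (2:ℤ) ∣ t → ∃ k, t^2 = 8*k+1 := by
    intro t ht
    have : Odd t := by rw [← Int.not_even_iff_odd, even_iff_two_dvd]; exact ht
    obtain ⟨k, hk⟩ := Int.eight_dvd_sq_sub_one_of_odd this
    exact ⟨k, by omega⟩
  have ne0 : ∀ {T Y e : ℤ}, T ≠ 0 → e ≠ 0 → e * T = Y^p → Y ≠ 0 := by
    rintro T Y e hT he h rfl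
    rw [zero_pow (by omega)] at h
    exact (mul_ne_zero he hT) h
  by_cases h2 : (2:ℤ) ∣ x <;> by_cases h5 : (5:ℤ) ∣ x
  · -- case 3
    obtain ⟨X, rfl⟩ : (10:ℤ) ∣ x := by omega
    have hX : X ≠ 0 := by rintro rfl; simp at hx
    have hr2 : ¬ (2:ℤ) ∣ r := hu 2 (by norm_num) (by omega)
    have hr5 : ¬ (5:ℤ) ∣ r := hu 5 (by norm_num) (by omega)
    have hcX : IsCoprime r X := (hc.of_mul_left_right).symm
    have hX2 : (2:ℤ) ∣ X := by
      by_contra hX2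
      obtain ⟨k, hk⟩ := oddsq X hX2
      obtain ⟨l, hl⟩ := oddsq r hr2
      have hXo : Odd X := by rw [← Int.not_even_iff_odd, even_iff_two_dvd]; exact hX2
      apply not_two_pow_four (M := 9*25*X*(20*k+4*l+3)) hp5 _ (y := y)
      · rw [← h]
        have : (10*X)^2+20*r^2 = 40*(20*k+4*l+3) := by rw [mul_pow, hk, hl]; ring
        rw [this]; ring
      · exact ((by decide : Odd (9*25:ℤ)).mul hXo).mul ⟨10*k+2*l+1, by ring⟩
    have ho : Odd (r^2+5*X^2) := by
      obtain ⟨l, hl⟩ := oddsq r hr2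
      obtain ⟨m, rfl⟩ := hX2
      exact ⟨4*l+10*m^2, by rw [hl]; ring⟩
    have hTN : IsCoprime X (r^2+5*X^2) := by
      have := (hcX.symm.pow_right (n := 2)).add_mul_left_right (5*X)
      rwa [show r^2 + X*(5*X) = r^2+5*X^2 by ring] at this
    have heN : IsCoprime (200:ℤ) (r^2+5*X^2) := by
      have a1 := (cop_two_of_odd ho).pow_left (m := 3)
      have a2 : IsCoprime (5:ℤ) (r^2+5*X^2) := by
        apply (p5.coprime_iff_not_dvd).mpr
        intro hd
        exact hr5 (p5.dvd_of_dvd_pow ((Int.dvd_add_left ⟨X^2, rfl⟩).mp hd))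
      have := a1.mul_left (a2.pow_left (m := 2))
      norm_num at this; exact this
    refine ⟨3, by norm_num, ?_⟩
    rcases red_generic hodd hp3 hcX ho (Or.inr rfl) hTN heN (by norm_num) (by rw [← h]; ring) with
      ⟨γ, Y, h1, h2, h3⟩ | ⟨α, Y, h1, h2, h3⟩
    · left
      exact ⟨γ, r, X, Y, hcX, h1, ne0 hX (by norm_num) h2, ho, h3, by
        right; right; right; exact ⟨rfl, by rw [← h2]; ring, rfl⟩⟩
    · right
      rcases h3 with h3 | h3
      · exact ⟨α, r, X, Y, r, hcX, h3, Or.inl rfl, ne0 hX (by norm_num) h1, ho, h2, by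
          right; right; right; exact ⟨rfl, h1, rfl⟩⟩
      · exact ⟨α, r, -X, -Y, r, hcX.neg_right, h3, Or.inl rfl, neg_ne_zero.mpr (ne0 hX (by norm_num) h1),
          by rwa [neg_sq], by rwa [dvd_neg], by
          right; right; right; exact ⟨rfl, by rw [hodd.neg_pow, ← h1]; ring, rfl⟩⟩
  · -- case 1
    obtain ⟨X, rfl⟩ := h2
    have hX : X ≠ 0 := by rintro rfl; simp at hx
    have hr2 : ¬ (2:ℤ) ∣ r := hu 2 (by norm_num) (by omega)
    have hX5 : ¬ (5:ℤ) ∣ X := by omega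
    have hcX : IsCoprime X r := hc.of_mul_left_right
    have hX2 : (2:ℤ) ∣ X := by
      by_contra hX2
      obtain ⟨k, hk⟩ := oddsq X hX2
      obtain ⟨l, hl⟩ := oddsq r hr2
      have hXo : Odd X := by rw [← Int.not_even_iff_odd, even_iff_two_dvd]; exact hX2
      apply not_two_pow_four (M := 9*X*(4*k+20*l+3)) hp5 _ (y := y)
      · rw [← h]
        have : (2*X)^2+20*r^2 = 8*(4*k+20*l+3) := by rw [mul_pow, hk, hl]; ring
        rw [this]; ring
      · exact ((by decide : Odd (9:ℤ)).mul hXo).mul ⟨2*k+10*l+1, by ring⟩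
    have ho : Odd (X^2+5*r^2) := by
      obtain ⟨l, hl⟩ := oddsq r hr2
      obtain ⟨m, rfl⟩ := hX2
      exact ⟨20*l+2*m^2+2, by rw [hl]; ring⟩
    have hTN : IsCoprime X (X^2+5*r^2) := by
      have h5X : IsCoprime X (5:ℤ) := ((p5.coprime_iff_not_dvd).mpr hX5).symm
      have := (h5X.mul_right (hcX.pow_right (n := 2))).add_mul_left_right X
      rwa [show 5*r^2 + X*X = X^2+5*r^2 by ring] at this
    have heN : IsCoprime (8:ℤ) (X^2+5*r^2) := by
      have a1 := (cop_two_of_odd ho).pow_left (m := 3)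
      norm_num at a1; exact a1
    refine ⟨1, by norm_num, ?_⟩
    rcases red_generic hodd hp3 hcX ho (Or.inl rfl) hTN heN (by norm_num) (by rw [← h]; ring) with
      ⟨γ, Y, h1, h2, h3⟩ | ⟨α, Y, h1, h2, h3⟩
    · left
      exact ⟨γ, X, r, Y, hcX, h1, ne0 hX (by norm_num) h2, ho, h3, by
        right; left; exact ⟨rfl, by rw [← h2]; ring, rfl, hX5⟩⟩
    · right
      rcases h3 with h3 | h3
      · exact ⟨α, X, r, Y, r, hcX, h3, Or.inl rfl, ne0 hX (by norm_num) h1, ho, h2, by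
          right; left; exact ⟨rfl, h1, rfl, hX5⟩⟩
      · exact ⟨α, X, -r, Y, -r, hcX.neg_right, h3, Or.inr rfl, ne0 hX (by norm_num) h1,
          by rwa [neg_sq], h2, by right; left; exact ⟨rfl, h1, rfl, hX5⟩⟩
  · -- case 2
    obtain ⟨X, rfl⟩ := h5
    have hX : X ≠ 0 := by rintro rfl; simp at hx
    have hX2 : ¬ (2:ℤ) ∣ X := by omega
    have hr5 : ¬ (5:ℤ) ∣ r := hu 5 (by norm_num) (by omega)
    have hcX' : IsCoprime r X := (hc.of_mul_left_right).symm
    have h2X : IsCoprime (2:ℤ) X := (Int.prime_two.coprime_iff_not_dvd).mpr hX2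
    have hcX : IsCoprime (2*r) X := h2X.mul_left hcX'
    have ho : Odd ((2*r)^2+5*X^2) := by
      obtain ⟨l, hl⟩ := oddsq X hX2
      exact ⟨20*l+2*r^2+2, by rw [hl]; ring⟩
    have hTN : IsCoprime X ((2*r)^2+5*X^2) := by
      have := (hcX.symm.pow_right (n := 2)).add_mul_left_right (5*X)
      rwa [show (2*r)^2 + X*(5*X) = (2*r)^2+5*X^2 by ring] at this
    have heN : IsCoprime (25:ℤ) ((2*r)^2+5*X^2) := by
      have a2 : IsCoprime (5:ℤ) ((2*r)^2+5*X^2) := by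
        apply (p5.coprime_iff_not_dvd).mpr
        intro hd
        have := (p5.dvd_of_dvd_pow ((Int.dvd_add_left ⟨X^2, rfl⟩).mp hd))
        omega
      have := (a2.pow_left (m := 2))
      norm_num at this; exact this
    refine ⟨2, by norm_num, ?_⟩
    rcases red_generic hodd hp3 hcX ho (Or.inr rfl) hTN heN (by norm_num) (by rw [← h]; ring) with
      ⟨γ, Y, h1, h2, h3⟩ | ⟨α, Y, h1, h2, h3⟩
    · left
      exact ⟨γ, 2*r, X, Y, hcX, h1, ne0 hX (by norm_num) h2, ho, h3, by
        right; right; left; exact ⟨rfl, by rw [← h2]; ring, rfl⟩⟩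
    · right
      rcases h3 with h3 | h3
      · exact ⟨α, 2*r, X, Y, r, hcX, h3, Or.inl rfl, ne0 hX (by norm_num) h1, ho, h2, by
          right; right; left; exact ⟨rfl, h1, rfl⟩⟩
      · exact ⟨α, 2*r, -X, -Y, r, hcX.neg_right, h3, Or.inl rfl, neg_ne_zero.mpr (ne0 hX (by norm_num) h1),
          by rwa [neg_sq], by rwa [dvd_neg], by
          right; right; left; exact ⟨rfl, by rw [hodd.neg_pow, ← h1]; ring, rfl⟩⟩
  · -- case 0
    have h2x : IsCoprime (2:ℤ) x := (Int.prime_two.coprime_iff_not_dvd).mpr h2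
    have hcX : IsCoprime x (2*r) := (h2x.symm).mul_right hc
    have ho : Odd (x^2+5*(2*r)^2) := by
      obtain ⟨l, hl⟩ := oddsq x h2
      exact ⟨4*l+10*r^2, by rw [hl]; ring⟩
    have hTN : IsCoprime x (x^2+5*(2*r)^2) := by
      have h5X : IsCoprime x (5:ℤ) := ((p5.coprime_iff_not_dvd).mpr h5).symm
      have := (h5X.mul_right (hcX.pow_right (n := 2))).add_mul_left_right x
      rwa [show 5*(2*r)^2 + x*x = x^2+5*(2*r)^2 by ring] at this
    refine ⟨0, by norm_num, ?_⟩
    rcases red_generic hodd hp3 hcX ho (Or.inl rfl) hTN isCoprime_one_left (by norm_num)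
      (by rw [← h]; ring) with
      ⟨γ, Y, h1, h2, h3⟩ | ⟨α, Y, h1, h2, h3⟩
    · left
      exact ⟨γ, x, 2*r, Y, hcX, h1, ne0 hx (by norm_num) h2, ho, h3, by
        left; exact ⟨rfl, by rw [← h2]; ring, rfl, h5⟩⟩
    · right
      have h1' : x = Y^p := by rw [← h1]; ring
      rcases h3 with h3 | h3
      · exact ⟨α, x, 2*r, Y, r, hcX, h3, Or.inl rfl, ne0 hx (by norm_num) h1, ho, h2, by
          left; exact ⟨rfl, h1', rfl, h5⟩⟩
      · exact ⟨α, x, -(2*r), Y, -r, hcX.neg_right, h3, Or.inr rfl, ne0 hx (by norm_num) h1,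
          by rwa [neg_sq], h2, by left; exact ⟨rfl, h1', by ring, h5⟩⟩

lemma sum_inj_lower {ι : Type*} [Fintype ι] [DecidableEq ι] (N : ℕ) (hN : Fintype.card ι = N)
    (φ : ι → ℕ) (hle : ∀ i, φ i ≤ N) (hinj : ∀ i j, φ i = φ j → φ i < N → i = j) :
    ∑ n ∈ Finset.range N, n ≤ ∑ i, φ i := by
  classical
  set A : Finset ι := Finset.univ.filter (fun i => φ i < N) with hA
  set I : Finset ℕ := A.image φ with hI
  have hinjA : Set.InjOn φ A := by
    intro i hi j hj hij
    have : φ i < N := by simpa [hA] using hi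
    exact hinj i j hij this
  have hIr : I ⊆ Finset.range N := by
    intro n hn
    rw [hI, Finset.mem_image] at hn
    obtain ⟨i, hi, rfl⟩ := hn
    simpa [hA] using hi
  have hcard : I.card = A.card := Finset.card_image_of_injOn hinjA
  have h1 : ∑ i, φ i = ∑ i ∈ A, φ i + ∑ i ∈ Finset.univ.filter (fun i => ¬ φ i < N), φ i := by
    rw [hA, Finset.sum_filter_add_sum_filter_not]
  have h2 : ∑ i ∈ A, φ i = ∑ n ∈ I, n := by
    rw [hI, Finset.sum_image hinjA]
  have h3 : ∑ i ∈ Finset.univ.filter (fun i => ¬ φ i < N), φ i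
      = (Finset.univ.filter (fun i => ¬ φ i < N)).card * N := by
    rw [Finset.sum_const_nat]
    intro i hi
    have : ¬ φ i < N := by simpa using hi
    have := hle i
    omega
  have h4 : A.card + (Finset.univ.filter (fun i => ¬ φ i < N)).card = N := by
    rw [hA, Finset.card_filter_add_card_filter_not, Finset.card_univ, hN]
  have h5 : ∑ n ∈ Finset.range N, n = ∑ n ∈ Finset.range N \ I, n + ∑ n ∈ I, n :=
    (Finset.sum_sdiff hIr).symm
  have h6 : ∑ n ∈ Finset.range N \ I, n ≤ (Finset.range N \ I).card * N := by
    rw [← smul_eq_mul]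
    apply Finset.sum_le_card_nsmul
    intro n hn
    simp at hn
    omega
  have h7 : (Finset.range N \ I).card = N - A.card := by
    rw [Finset.card_sdiff_of_subset hIr, hcard, Finset.card_range]
  have h8 : (Finset.univ.filter (fun i => ¬ φ i < N)).card = N - A.card := by omega
  rw [h1, h2, h3, h8, h5]
  rw [h7] at h6
  omega

lemma det_abs_le_rows {ι : Type*} [Fintype ι] [DecidableEq ι] (M : Matrix ι ι ℝ) (c : ι → ℝ)
    (h : ∀ i j, |M i j| ≤ c i) : |M.det| ≤ (Fintype.card ι).factorial * ∏ i, c i := by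
  rw [Matrix.det_apply]
  refine (Finset.abs_sum_le_sum_abs _ _).trans ?_
  have : ∀ σ ∈ (Finset.univ : Finset (Equiv.Perm ι)),
      |Equiv.Perm.sign σ • ∏ i, M (σ i) i| ≤ ∏ i, c i := by
    intro σ _
    have h1 : |Equiv.Perm.sign σ • ∏ i, M (σ i) i| = |∏ i, M (σ i) i| := by
      rcases Int.units_eq_one_or (Equiv.Perm.sign σ) with h | h <;> rw [h] <;> simp [Units.smul_def]
    rw [h1, Finset.abs_prod, ← Equiv.prod_comp σ c]
    exact Finset.prod_le_prod (fun i _ => abs_nonneg _) (fun i _ => h _ _)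
  refine (Finset.sum_le_card_nsmul _ _ _ this).trans ?_
  rw [Finset.card_univ, Fintype.card_perm, nsmul_eq_mul]

lemma det_zero_prop {ι : Type*} [Fintype ι] [DecidableEq ι] (M : Matrix ι ι ℝ) (i j : ι) (hne : i ≠ j)
    (v : ι → ℝ) (x y : ℝ) (hi : ∀ k, M i k = x * v k) (hj : ∀ k, M j k = y * v k) : M.det = 0 := by
  have : M = Matrix.of fun k l => (if k = i then x else if k = j then y else 1) *
      (Matrix.of (fun k l => if k = i then v l else if k = j then v l else M k l) : Matrix ι ι ℝ) k l := by
    ext k l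
    by_cases h1 : k = i
    · subst h1; simp [hi]
    · by_cases h2 : k = j
      · subst h2; simp [hj, h1]
      · simp [h1, h2]
  rw [this, Matrix.det_mul_column]
  have h0 : (Matrix.of (fun k l => if k = i then v l else if k = j then v l else M k l) : Matrix ι ι ℝ).det = 0 := by
    apply Matrix.det_zero_of_row_eq hne
    funext l
    simp [hne.symm]
  rw [h0, mul_zero]

theorem det_upper {ι : Type*} [Fintype ι] [DecidableEq ι] (N : ℕ) (hN : Fintype.card ι = N)
    (M : Matrix ι ι ℝ) (ζ : ι → ℝ) (a : ι → ℕ → ℝ) (e : ι → ι → ℝ) (Z q : ℝ) (Bd : ι → ℝ)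
    (hZ : 0 ≤ Z) (hq : 1 ≤ q) (hζ : ∀ j, |ζ j| ≤ Z) (hB : ∀ i, 0 ≤ Bd i)
    (hM : ∀ i j, M i j = ∑ n ∈ Finset.range N, a i n * ζ j ^ n + e i j)
    (ha : ∀ i, ∑ n ∈ Finset.range N, |a i n| * (q * Z) ^ n ≤ Bd i)
    (he : ∀ i j, |e i j| * q ^ N ≤ 2 * Bd i) :
    |M.det| * q ^ (∑ n ∈ Finset.range N, n) ≤ 3 ^ N * N.factorial * ∏ i, Bd i := by
  classical
  have hq0 : 0 < q := by linarith
  let g : ι → Fin (N + 1) → ι → ℝ := fun i n j => if (n : ℕ) < N then a i n * ζ j ^ (n : ℕ) else e i j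
  let c : ι → Fin (N + 1) → ℝ := fun i n => if (n : ℕ) < N then |a i n| * Z ^ (n : ℕ) else 2 * Bd i / q ^ N
  have hMg : M = fun i => ∑ n, g i n := by
    funext i j
    rw [Finset.sum_apply, hM, Fin.sum_univ_castSucc]
    simp [g, Finset.sum_range]
  have hgc : ∀ i n j, |g i n j| ≤ c i n := by
    intro i n j
    simp only [g, c]
    split_ifs with h
    · rw [abs_mul, abs_pow]
      gcongr
      exact hζ j
    · rw [le_div_iff₀ (by positivity)]
      exact he i j
  have hc0 : ∀ i n, 0 ≤ c i n := by
    intro i n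
    simp only [c]
    have := hB i
    split_ifs <;> positivity
  have hdet : M.det = ∑ φ : ι → Fin (N + 1), Matrix.det (fun i => g i (φ i)) := by
    have := (Matrix.detRowAlternating (R := ℝ) (n := ι)).toMultilinearMap.map_sum (g := g)
    rw [hMg]
    exact this
  have hterm : ∀ φ : ι → Fin (N + 1), |Matrix.det (fun i => g i (φ i))| * q ^ (∑ n ∈ Finset.range N, n)
      ≤ N.factorial * ∏ i, (c i (φ i) * q ^ (φ i : ℕ)) := by
    intro φ
    by_cases hinj : ∀ i j, φ i = φ j → (φ i : ℕ) < N → i = j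
    · have h1 := det_abs_le_rows (fun i => g i (φ i)) (fun i => c i (φ i)) (fun i j => hgc i (φ i) j)
      have h2 := sum_inj_lower N hN (fun i => (φ i : ℕ)) (fun i => by have := (φ i).2; omega)
        (fun i j hij hlt => hinj i j (Fin.ext hij) hlt)
      rw [Finset.prod_mul_distrib, Finset.prod_pow_eq_pow_sum, ← mul_assoc]
      rw [hN] at h1
      have h3 : q ^ (∑ n ∈ Finset.range N, n) ≤ q ^ (∑ i, (φ i : ℕ)) := pow_le_pow_right₀ hq h2
      exact mul_le_mul h1 h3 (by positivity)
        (mul_nonneg (by positivity) (Finset.prod_nonneg fun i _ => hc0 _ _))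
    · push Not at hinj
      obtain ⟨i, j, hij, hlt, hne⟩ := hinj
      have hlt2 : (φ j : ℕ) < N := by rw [← hij]; exact hlt
      have hz : Matrix.det (fun i => g i (φ i)) = 0 := by
        apply det_zero_prop (fun i => g i (φ i)) i j hne (fun k => ζ k ^ (φ i : ℕ)) (a i (φ i)) (a j (φ j))
        · intro k
          simp [g, hlt]
        · intro k
          simp [g, hlt2, hij]
      rw [hz]
      simp only [abs_zero, zero_mul]
      exact mul_nonneg (by positivity) (Finset.prod_nonneg fun i _ => mul_nonneg (hc0 _ _) (by positivity))
  have hrowsum : ∀ i, ∑ n, c i n * q ^ (n : ℕ) ≤ 3 * Bd i := by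
    intro i
    rw [Fin.sum_univ_castSucc]
    have h1 : ∑ n : Fin N, c i n.castSucc * q ^ ((n.castSucc : Fin (N + 1)) : ℕ) ≤ Bd i := by
      refine le_trans (le_of_eq ?_) (ha i)
      rw [Finset.sum_range]
      apply Finset.sum_congr rfl
      intro n _
      simp [c, mul_pow]
      ring
    have h2 : c i (Fin.last N) * q ^ ((Fin.last N : Fin (N + 1)) : ℕ) = 2 * Bd i := by
      simp [c]
      field_simp
    linarith
  calc |M.det| * q ^ (∑ n ∈ Finset.range N, n)
      ≤ (∑ φ : ι → Fin (N + 1), |Matrix.det (fun i => g i (φ i))|) * q ^ (∑ n ∈ Finset.range N, n) := by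
        rw [hdet]
        gcongr
        exact Finset.abs_sum_le_sum_abs _ _
    _ = ∑ φ : ι → Fin (N + 1), |Matrix.det (fun i => g i (φ i))| * q ^ (∑ n ∈ Finset.range N, n) := by
        rw [Finset.sum_mul]
    _ ≤ ∑ φ : ι → Fin (N + 1), N.factorial * ∏ i, (c i (φ i) * q ^ (φ i : ℕ)) :=
        Finset.sum_le_sum fun φ _ => hterm φ
    _ = N.factorial * ∏ i, ∑ n, c i n * q ^ (n : ℕ) := by
        rw [← Finset.mul_sum, Finset.prod_univ_sum, Fintype.piFinset_univ]
    _ ≤ N.factorial * ∏ i, (3 * Bd i) := by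
        gcongr with i _
        · intro i _
          exact Finset.sum_nonneg fun n _ => mul_nonneg (hc0 _ _) (by positivity)
        · exact hrowsum i
    _ = 3 ^ N * N.factorial * ∏ i, Bd i := by
        rw [Finset.prod_mul_distrib, Finset.prod_const, Finset.card_univ, hN]
        ring

open Polynomial in
lemma poly_det_ne {J : Type*} [Fintype J] [DecidableEq J] (P : J → ℝ[X]) (hP : ∀ j, P j ≠ 0)
    (x : J → ℝ) (hx : Function.Injective x) (sh : J → ℝ) (e : J ≃ Fin (Fintype.card J)) :
    let Q : ℝ[X] := Matrix.det (Matrix.of fun j k => (P j).comp (X + C (sh k)) * C (x j ^ (e k : ℕ)))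
    Q ≠ 0 ∧ Q.natDegree ≤ ∑ j, (P j).natDegree := by
  intro Q
  have hQ : Q = ∑ σ : Equiv.Perm J, Equiv.Perm.sign σ •
      ∏ k, ((P (σ k)).comp (X + C (sh k)) * C (x (σ k) ^ (e k : ℕ))) := by
    simp only [Q, Matrix.det_apply]
    rfl
  have hdX : ∀ a : ℝ, (X + C a : ℝ[X]).natDegree = 1 := fun a => natDegree_X_add_C a
  have hne : ∀ (j k : J), (P j).comp (X + C (sh k)) ≠ 0 := by
    intro j k h
    have h1 : ((P j).comp (X + C (sh k))).leadingCoeff = 0 := by rw [h]; simp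
    rw [leadingCoeff_comp (by rw [hdX]; norm_num), leadingCoeff_X_add_C, one_pow, mul_one] at h1
    exact hP j (leadingCoeff_eq_zero.1 h1)
  have hdeg : ∀ σ : Equiv.Perm J, (∏ k, (P (σ k)).comp (X + C (sh k))).natDegree = ∑ j, (P j).natDegree := by
    intro σ
    rw [natDegree_prod _ _ (fun k _ => hne _ _)]
    rw [← Equiv.sum_comp σ (fun j => (P j).natDegree)]
    apply Finset.sum_congr rfl
    intro k _
    rw [natDegree_comp, hdX, mul_one]
  have hlead : ∀ σ : Equiv.Perm J, (∏ k, (P (σ k)).comp (X + C (sh k))).leadingCoeff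
      = ∏ j, (P j).leadingCoeff := by
    intro σ
    rw [leadingCoeff_prod, ← Equiv.prod_comp σ (fun j => (P j).leadingCoeff)]
    apply Finset.prod_congr rfl
    intro k _
    rw [leadingCoeff_comp (by rw [hdX]; norm_num), leadingCoeff_X_add_C, one_pow, mul_one]
  have hterm : ∀ σ : Equiv.Perm J, ∏ k, ((P (σ k)).comp (X + C (sh k)) * C (x (σ k) ^ (e k : ℕ)))
      = (∏ k, (P (σ k)).comp (X + C (sh k))) * C (∏ k, x (σ k) ^ (e k : ℕ)) := by
    intro σ
    rw [Finset.prod_mul_distrib, ← map_prod]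
  constructor
  · intro h0
    have hc : Q.coeff (∑ j, (P j).natDegree) = (∏ j, (P j).leadingCoeff) *
        Matrix.det (Matrix.of fun j k => x j ^ (e k : ℕ)) := by
      rw [hQ, finsetSum_coeff, Matrix.det_apply, Finset.mul_sum]
      apply Finset.sum_congr rfl
      intro σ _
      rw [coeff_smul, hterm, coeff_mul_C, mul_smul_comm]
      congr 1
      rw [← hlead σ, leadingCoeff, hdeg σ]
      rfl
    rw [h0, coeff_zero] at hc
    have hv : Matrix.det (Matrix.of fun j k => x j ^ (e k : ℕ)) ≠ 0 := by
      have : (Matrix.of fun j k => x j ^ (e k : ℕ)) =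
          (Matrix.vandermonde (fun a => x (e.symm a))).submatrix e e := by
        ext j k
        simp [Matrix.vandermonde]
      rw [this, Matrix.det_submatrix_equiv_self, Matrix.det_vandermonde_ne_zero_iff]
      exact hx.comp e.symm.injective
    have hl : (∏ j, (P j).leadingCoeff) ≠ 0 :=
      Finset.prod_ne_zero_iff.2 fun j _ => leadingCoeff_ne_zero.2 (hP j)
    exact (mul_ne_zero hl hv) hc.symm
  · rw [hQ]
    apply natDegree_sum_le_of_forall_le
    intro σ _
    refine (natDegree_smul_le _ _).trans ?_
    rw [hterm]
    refine (natDegree_mul_C_le _ _).trans (le_of_eq (hdeg σ))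

open Polynomial in
theorem zero_est (K R S2 p : ℕ) (t ρ : ℝ) (hρ0 : 0 < ρ) (hρ1 : ρ ≠ 1) (ht : t ≠ 0) (hRp : R ≤ p)
    (hcount : 4 * (K - 1) < R * S2) (c : Fin K × Fin 4 → ℝ)
    (h : ∀ m < R, ∀ s < S2 + 3, ∑ l : Fin K × Fin 4,
      c l * ((Nat.choose (m + s * p) l.1 : ℝ) * t ^ ((l.2 : ℕ) * m) * ρ ^ ((l.2 : ℕ) * s)) = 0) :
    c = 0 := by
  classical
  let P : Fin 4 → ℝ[X] := fun j => ∑ i : Fin K, C (c (i, j) / (i : ℕ).factorial) * descPochhammer ℝ i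
  have hPe : ∀ j (n : ℕ), (P j).eval (n : ℝ) = ∑ i : Fin K, c (i, j) * (Nat.choose n i : ℝ) := by
    intro j n
    simp only [P, eval_finsetSum, eval_mul, eval_C]
    apply Finset.sum_congr rfl
    intro i _
    rw [descPochhammer_eval_eq_descFactorial, Nat.descFactorial_eq_factorial_mul_choose]
    have : ((i : ℕ).factorial : ℝ) ≠ 0 := by positivity
    push_cast
    field_simp
  have hPd : ∀ j, (P j).natDegree ≤ K - 1 := by
    intro j
    apply natDegree_sum_le_of_forall_le
    intro i _
    refine (natDegree_C_mul_le _ _).trans ?_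
    rw [descPochhammer_natDegree]
    have := i.2
    omega
  have hP0 : ∀ j, P j = 0 → ∀ i, c (i, j) = 0 := by
    intro j hj
    have h1 : ∀ n : ℕ, ∑ i : Fin K, c (i, j) * (Nat.choose n i : ℝ) = 0 := by
      intro n
      rw [← hPe, hj, eval_zero]
    have h2 : ∀ n : ℕ, ∀ hn : n < K, c (⟨n, hn⟩, j) = 0 := by
      intro n
      induction n using Nat.strong_induction_on with
      | _ n ih =>
        intro hn
        have h3 := h1 n
        rw [Finset.sum_eq_single ⟨n, hn⟩] at h3
        · simpa using h3
        · intro i _ hi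
          rcases lt_trichotomy (i : ℕ) n with hlt | heq | hgt
          · rw [ih i hlt i.2, zero_mul]
          · exact absurd (Fin.ext heq) hi
          · rw [Nat.choose_eq_zero_of_lt hgt]; simp
        · simp
    intro i
    exact h2 i i.2
  by_contra hc
  let J := {j : Fin 4 // P j ≠ 0}
  have hJ : Nonempty J := by
    by_contra hne
    apply hc
    funext l
    have : P l.2 = 0 := by
      by_contra h'
      exact hne ⟨⟨l.2, h'⟩⟩
    exact hP0 l.2 this l.1
  have hcardJ : Fintype.card J ≤ 4 := by
    have := Fintype.card_subtype_le (fun j : Fin 4 => P j ≠ 0)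
    rwa [Fintype.card_fin] at this
  let e : J ≃ Fin (Fintype.card J) := Fintype.equivFin J
  let x : J → ℝ := fun j => ρ ^ ((j : Fin 4) : ℕ)
  have hx : Function.Injective x := by
    intro a b hab
    have := pow_right_injective₀ hρ0 hρ1 hab
    exact Subtype.ext (Fin.ext this)
  obtain ⟨hQ0, hQd⟩ := poly_det_ne (fun j : J => P j) (fun j => j.2) x hx
    (fun k => ((e k : ℕ) * p : ℝ)) e
  apply hQ0
  let Z : Finset ℝ := (Finset.range R ×ˢ Finset.range S2).image (fun a => ((a.1 + a.2 * p : ℕ) : ℝ))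
  have hZc : Z.card = R * S2 := by
    rw [Finset.card_image_of_injOn, Finset.card_product, Finset.card_range, Finset.card_range]
    rintro ⟨m, s⟩ hms ⟨m', s'⟩ hms' heq
    simp only [Finset.coe_product, Finset.coe_range, Set.mem_prod, Set.mem_Iio] at hms hms'
    have heq2 : m + s * p = m' + s' * p := by
      simp only at heq
      exact_mod_cast heq
    have hm : m < p := by omega
    have hm' : m' < p := by omega
    have h1 : (m + s * p) % p = m := by rw [Nat.add_mul_mod_self_right, Nat.mod_eq_of_lt hm]
    have h2 : (m' + s' * p) % p = m' := by rw [Nat.add_mul_mod_self_right, Nat.mod_eq_of_lt hm']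
    have h3 : m = m' := by rw [← h1, ← h2, heq2]
    subst h3
    have h4 : s * p = s' * p := by omega
    have : s = s' := Nat.eq_of_mul_eq_mul_right (by omega) h4
    simp [this]
  apply Polynomial.eq_zero_of_natDegree_lt_card_of_eval_eq_zero' _ Z
  · intro X0 hX0
    rw [Finset.mem_image] at hX0
    obtain ⟨⟨m, s0⟩, hms, rfl⟩ := hX0
    simp only [Finset.mem_product, Finset.mem_range] at hms
    rw [← coe_evalRingHom, RingHom.map_det]
    rw [← Matrix.exists_vecMul_eq_zero_iff]
    refine ⟨fun j => t ^ (((j : Fin 4) : ℕ) * m) * ρ ^ (((j : Fin 4) : ℕ) * s0), ?_, ?_⟩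
    · intro h0
      obtain ⟨j⟩ := hJ
      have := congrFun h0 j
      simp only [Pi.zero_apply] at this
      exact (mul_ne_zero (pow_ne_zero _ ht) (pow_ne_zero _ hρ0.ne')) this
    · funext k
      have hk : (e k : ℕ) < 4 := lt_of_lt_of_le (e k).2 hcardJ
      have h5 := h m hms.1 (s0 + e k) (by omega)
      rw [Fintype.sum_prod_type_right] at h5
      have h6 : ∀ j : Fin 4, ∑ i : Fin K, c (i, j) * ((Nat.choose (m + (s0 + e k) * p) i : ℝ) *
          t ^ ((j : ℕ) * m) * ρ ^ ((j : ℕ) * (s0 + e k))) =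
          (t ^ ((j : ℕ) * m) * ρ ^ ((j : ℕ) * s0)) * ((P j).eval ((m + (s0 + e k) * p : ℕ) : ℝ) * (ρ ^ (j : ℕ)) ^ (e k : ℕ)) := by
        intro j
        rw [hPe, Finset.sum_mul, Finset.mul_sum]
        apply Finset.sum_congr rfl
        intro i _
        rw [← pow_mul, mul_add (j : ℕ), pow_add]
        ring
      simp only [h6] at h5
      simp only [Matrix.vecMul, dotProduct, Pi.zero_apply, RingHom.mapMatrix_apply, Matrix.map_apply,
        Matrix.of_apply, coe_evalRingHom, eval_mul, eval_comp, eval_add, eval_X, eval_C]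
      rw [← h5]
      have h7 := Finset.sum_subtype_of_mem (p := fun j => P j ≠ 0) (s := (Finset.univ.filter (fun j : Fin 4 => P j ≠ 0)))
        (f := fun j : Fin 4 => (t ^ ((j : ℕ) * m) * ρ ^ ((j : ℕ) * s0)) * ((P j).eval ((m + (s0 + e k) * p : ℕ) : ℝ) * (ρ ^ (j : ℕ)) ^ (e k : ℕ)))
        (by intro j hj; simpa using hj)
      have h8 : (Finset.univ.filter (fun j : Fin 4 => P j ≠ 0)).subtype (fun j => P j ≠ 0) = Finset.univ := by
        ext j; simp [j.2]
      rw [h8, Finset.sum_filter_of_ne] at h7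
      · rw [← h7]
        apply Finset.sum_congr rfl
        intro j _
        have : ((m + s0 * p : ℕ) : ℝ) + (e k : ℕ) * p = ((m + (s0 + e k) * p : ℕ) : ℝ) := by
          push_cast; ring
        rw [this]
      · intro j _ hne h0
        apply hne
        rw [h0]
        simp
  · rw [hZc]
    refine lt_of_le_of_lt hQd (lt_of_le_of_lt ?_ hcount)
    refine (Finset.sum_le_card_nsmul _ _ (K - 1) (fun (j : J) _ => hPd j)).trans ?_
    rw [Finset.card_univ, smul_eq_mul]
    exact Nat.mul_le_mul_right _ hcardJ

theorem exists_cols {ι κ : Type*} [Fintype ι] [DecidableEq ι] (E : ι → κ → ℝ)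
    (h : ∀ c : ι → ℝ, (∀ k, ∑ i, c i * E i k = 0) → c = 0) :
    ∃ col : ι → κ, Matrix.det (Matrix.of fun i j => E i (col j)) ≠ 0 := by
  classical
  let s : Set (ι → ℝ) := Set.range (fun k i => E i k)
  have hs : Submodule.span ℝ s = ⊤ := by
    by_contra hne
    obtain ⟨f, hf0, hf⟩ := Submodule.exists_le_ker_of_lt_top _ (lt_top_iff_ne_top.2 hne)
    apply hf0
    have hfx : ∀ v : ι → ℝ, f v = ∑ i, f (Pi.single i 1) * v i := by
      intro v
      conv_lhs => rw [pi_eq_sum_univ' v]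
      rw [map_sum]
      apply Finset.sum_congr rfl
      intro i _
      rw [map_smul, smul_eq_mul, mul_comm]
    have h0 := h (fun i => f (Pi.single i 1)) (by
      intro k
      rw [← hfx (fun i => E i k)]
      exact hf (Submodule.subset_span ⟨k, rfl⟩))
    ext v
    rw [LinearMap.comp_apply, LinearMap.zero_comp, LinearMap.zero_apply, hfx]
    apply Finset.sum_eq_zero
    intro i _
    have := congrFun h0 i
    simp only [Pi.zero_apply] at this
    rw [this, zero_mul]
  obtain ⟨f, hfs, _, hli⟩ := Submodule.exists_fun_fin_finrank_span_eq ℝ s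
  have hcard : Fintype.card ι = Fintype.card (Fin (Module.finrank ℝ (Submodule.span ℝ s))) := by
    rw [hs, finrank_top, Module.finrank_fintype_fun_eq_card, Fintype.card_fin]
  let e := Fintype.equivOfCardEq hcard
  choose g hg using hfs
  refine ⟨fun j => g (e j), ?_⟩
  have h1 : LinearIndependent ℝ (Matrix.of fun i j => E i (g (e j))).col := by
    have : (Matrix.of fun i j => E i (g (e j))).col = f ∘ e := by
      funext j i
      exact congrFun (hg (e j)) i
    rw [this]
    exact hli.comp _ e.injective
  rw [Matrix.linearIndependent_cols_iff_isUnit, Matrix.isUnit_iff_isUnit_det] at h1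
  exact h1.ne_zero

def Maj (f : ℝ → ℝ) (R B : ℝ) : Prop :=
  ∃ a : ℕ → ℝ, Summable (fun n => |a n| * R ^ n) ∧ ∑' n, |a n| * R ^ n ≤ B ∧
    ∀ z, |z| ≤ R → HasSum (fun n => a n * z ^ n) (f z)

lemma maj_summ {a : ℕ → ℝ} {R z : ℝ} (h : Summable (fun n => |a n| * R ^ n)) (hz : |z| ≤ R) :
    Summable (fun n => ‖a n * z ^ n‖) := by
  refine Summable.of_nonneg_of_le (fun n => norm_nonneg _) (fun n => ?_) h
  rw [Real.norm_eq_abs, abs_mul, abs_pow]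
  gcongr

lemma Maj.mul {f g : ℝ → ℝ} {R B C : ℝ} (hR : 0 ≤ R) (hf : Maj f R B) (hg : Maj g R C) :
    Maj (fun z => f z * g z) R (B * C) := by
  obtain ⟨a, ha, haB, haf⟩ := hf
  obtain ⟨b, hb, hbC, hbg⟩ := hg
  have ha' : Summable (fun n => ‖|a n| * R ^ n‖) := by
    simpa [abs_mul, abs_of_nonneg hR] using ha
  have hb' : Summable (fun n => ‖|b n| * R ^ n‖) := by
    simpa [abs_mul, abs_of_nonneg hR] using hb
  have hle : ∀ n, |∑ kl ∈ Finset.HasAntidiagonal.antidiagonal n, a kl.1 * b kl.2| * R ^ n ≤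
      ∑ kl ∈ Finset.HasAntidiagonal.antidiagonal n, (|a kl.1| * R ^ kl.1) * (|b kl.2| * R ^ kl.2) := by
    intro n
    have h9 : |∑ kl ∈ Finset.HasAntidiagonal.antidiagonal n, a kl.1 * b kl.2| * R ^ n ≤
        (∑ kl ∈ Finset.HasAntidiagonal.antidiagonal n, |a kl.1 * b kl.2|) * R ^ n :=
      mul_le_mul_of_nonneg_right (Finset.abs_sum_le_sum_abs _ _) (pow_nonneg hR n)
    apply h9.trans
    rw [Finset.sum_mul]
    apply Finset.sum_le_sum
    intro kl hkl
    rw [Finset.HasAntidiagonal.mem_antidiagonal] at hkl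
    rw [abs_mul, ← hkl, pow_add]
    apply le_of_eq
    ring
  have hs := (summable_norm_sum_mul_antidiagonal_of_summable_norm ha' hb').of_norm
  have hsum : Summable (fun n => |∑ kl ∈ Finset.HasAntidiagonal.antidiagonal n, a kl.1 * b kl.2| * R ^ n) :=
    Summable.of_nonneg_of_le (fun n => by positivity) hle hs
  refine ⟨fun n => ∑ kl ∈ Finset.HasAntidiagonal.antidiagonal n, a kl.1 * b kl.2, hsum, ?_, ?_⟩
  · have h9 : ∑' n, |∑ kl ∈ Finset.HasAntidiagonal.antidiagonal n, a kl.1 * b kl.2| * R ^ n ≤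
        ∑' n, ∑ kl ∈ Finset.HasAntidiagonal.antidiagonal n, (|a kl.1| * R ^ kl.1) * (|b kl.2| * R ^ kl.2) :=
      hsum.tsum_le_tsum hle hs
    apply h9.trans
    rw [← tsum_mul_tsum_eq_tsum_sum_antidiagonal_of_summable_norm ha' hb']
    have h1 : 0 ≤ ∑' n, |a n| * R ^ n := tsum_nonneg fun n => by positivity
    have h2 : 0 ≤ ∑' n, |b n| * R ^ n := tsum_nonneg fun n => by positivity
    exact mul_le_mul haB hbC h2 (h1.trans haB)
  · intro z hz
    have h1 := maj_summ ha hz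
    have h2 := maj_summ hb hz
    have h3 := (summable_norm_sum_mul_antidiagonal_of_summable_norm h1 h2).of_norm.hasSum
    rw [← tsum_mul_tsum_eq_tsum_sum_antidiagonal_of_summable_norm h1 h2, (haf z hz).tsum_eq,
      (hbg z hz).tsum_eq] at h3
    have e : (fun n => (∑ kl ∈ Finset.HasAntidiagonal.antidiagonal n, a kl.1 * b kl.2) * z ^ n) =
        fun n => ∑ kl ∈ Finset.HasAntidiagonal.antidiagonal n, a kl.1 * z ^ kl.1 * (b kl.2 * z ^ kl.2) := by
      funext n
      rw [Finset.sum_mul]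
      apply Finset.sum_congr rfl
      intro kl hkl
      rw [Finset.HasAntidiagonal.mem_antidiagonal] at hkl
      rw [← hkl, pow_add]
      ring
    rw [← e] at h3
    exact h3

lemma Maj.mono {f : ℝ → ℝ} {R B C : ℝ} (hf : Maj f R B) (h : B ≤ C) : Maj f R C := by
  obtain ⟨a, ha, haB, haf⟩ := hf
  exact ⟨a, ha, haB.trans h, haf⟩

lemma maj_finite (a : ℕ → ℝ) (s : Finset ℕ) (h : ∀ n ∉ s, a n = 0) (R : ℝ) :
    Maj (fun z => ∑ n ∈ s, a n * z ^ n) R (∑ n ∈ s, |a n| * R ^ n) := by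
  have h0 : ∀ n ∉ s, |a n| * R ^ n = 0 := by
    intro n hn
    rw [h n hn]; simp
  have hs : Summable (fun n => |a n| * R ^ n) := summable_of_ne_finset_zero h0
  have ht : ∑' n, |a n| * R ^ n = ∑ n ∈ s, |a n| * R ^ n := tsum_eq_sum h0
  refine ⟨a, hs, ht.le, ?_⟩
  intro z _
  apply hasSum_sum_of_ne_finset_zero
  intro n hn
  rw [h n hn]; simp

lemma maj_const (c R : ℝ) : Maj (fun _ => c) R |c| := by
  have := maj_finite (fun n => if n = 0 then c else 0) {0} (by
    intro n hn
    simp at hn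
    simp [hn]) R
  simpa using this

lemma maj_lin (c R : ℝ) : Maj (fun z => z + c) R (R + |c|) := by
  have := maj_finite (fun n => if n = 0 then c else if n = 1 then 1 else 0) (Finset.range 2) (by
    intro n hn
    simp at hn
    simp [show n ≠ 0 by omega, show n ≠ 1 by omega]) R
  have h1 : (fun z : ℝ => z + c) = fun z : ℝ => c + z := by funext z; ring
  rw [h1, add_comm R]
  simpa [Finset.sum_range_succ] using this

lemma maj_exp (c R : ℝ)  : Maj (fun z => Real.exp (c * z)) R (Real.exp (|c| * R)) := by
  have h : ∀ x : ℝ, HasSum (fun n : ℕ => x ^ n / n.factorial) (Real.exp x) := by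
    intro x
    rw [Real.exp_eq_exp_ℝ]
    exact NormedSpace.expSeries_div_hasSum_exp x
  have e1 : (fun n : ℕ => |c ^ n / n.factorial| * R ^ n) = fun n : ℕ => (|c| * R) ^ n / n.factorial := by
    funext n
    rw [abs_div, abs_pow, mul_pow]
    simp
    ring
  refine ⟨fun n => c ^ n / n.factorial, ?_, ?_, ?_⟩
  · rw [e1]; exact (h _).summable
  · rw [e1, (h _).tsum_eq]
  · intro z _
    have e : (fun n : ℕ => (c * z) ^ n / n.factorial) = fun n : ℕ => c ^ n / n.factorial * z ^ n := by
      funext n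
      rw [mul_pow]
      ring
    have h2 := h (c * z)
    rw [e] at h2
    exact h2

lemma maj_prod (n : ℕ) (c : ℕ → ℝ) (R C : ℝ) (hR : 0 ≤ R) (hC : ∀ l < n, |c l| ≤ C) :
    Maj (fun z => ∏ l ∈ Finset.range n, (z + c l)) R ((R + C) ^ n) := by
  induction n with
  | zero => simpa using maj_const 1 R
  | succ n ih =>
    have h1 := ih (fun l hl => hC l (by omega))
    have h2 := (maj_lin (c n) R).mono (show R + |c n| ≤ R + C by have := hC n (by omega); linarith)
    have := h1.mul hR h2
    simp only [Finset.prod_range_succ, pow_succ]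
    exact this

lemma Maj.taylor {f : ℝ → ℝ} {q Z B : ℝ} (hq : 1 ≤ q) (hZ : 0 ≤ Z) (h : Maj f (q * Z) B) (N : ℕ) :
    ∃ a : ℕ → ℝ, ∑ n ∈ Finset.range N, |a n| * (q * Z) ^ n ≤ B ∧
      ∀ z, |z| ≤ Z → |f z - ∑ n ∈ Finset.range N, a n * z ^ n| * q ^ N ≤ B ∧ |f z| ≤ B := by
  obtain ⟨a, ha, haB, haf⟩ := h
  have hR : 0 ≤ q * Z := by positivity
  have hpos : ∀ n, 0 ≤ |a n| * (q * Z) ^ n := fun n => mul_nonneg (abs_nonneg _) (pow_nonneg hR n)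
  have hfin : ∑ n ∈ Finset.range N, |a n| * (q * Z) ^ n ≤ ∑' n, |a n| * (q * Z) ^ n :=
    ha.sum_le_tsum _ fun n _ => hpos n
  have hfB := hfin.trans haB
  use a
  apply And.intro hfB
  intro z hz
  have hzq : |z| ≤ q * Z := hz.trans (by nlinarith)
  have h1 := haf z hzq
  have h2 := maj_summ ha hzq
  have h3 : f z - ∑ n ∈ Finset.range N, a n * z ^ n = ∑' n, a (n + N) * z ^ (n + N) := by
    rw [← h1.tsum_eq, ← h1.summable.sum_add_tsum_nat_add N]
    ring
  constructor
  · rewrite [h3, mul_comm]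
    have h4 : Summable (fun n => ‖a (n + N) * z ^ (n + N)‖) :=
      (summable_nat_add_iff (f := fun n => ‖a n * z ^ n‖) N).2 h2
    have h5 : Summable (fun n => |a (n + N)| * (q * Z) ^ (n + N)) :=
      (summable_nat_add_iff (f := fun n => |a n| * (q * Z) ^ n) N).2 ha
    have h6 : |∑' n, a (n + N) * z ^ (n + N)| ≤ ∑' n, ‖a (n + N) * z ^ (n + N)‖ := norm_tsum_le_tsum_norm h4
    have h7 : q ^ N * ∑' n, ‖a (n + N) * z ^ (n + N)‖ ≤ ∑' n, |a (n + N)| * (q * Z) ^ (n + N) := by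
      rewrite [← tsum_mul_left]
      have h40 : Summable (fun n => q ^ N * ‖a (n + N) * z ^ (n + N)‖) := h4.mul_left _
      apply h40.tsum_le_tsum _ h5
      intro n
      rewrite [Real.norm_eq_abs, abs_mul, abs_pow, mul_pow]
      have : q ^ N ≤ q ^ (n + N) := pow_le_pow_right₀ hq (by omega)
      have t1 : |a (n + N)| * |z| ^ (n + N) ≤ |a (n + N)| * Z ^ (n + N) :=
        mul_le_mul_of_nonneg_left (pow_le_pow_left₀ (abs_nonneg _) hz _) (abs_nonneg _)
      have t2 : q ^ N * (|a (n + N)| * |z| ^ (n + N)) ≤ q ^ (n + N) * (|a (n + N)| * Z ^ (n + N)) :=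
        mul_le_mul this t1 (by positivity) (by positivity)
      have t3 : q ^ (n + N) * (|a (n + N)| * Z ^ (n + N)) = |a (n + N)| * (q ^ (n + N) * Z ^ (n + N)) := by ring
      rewrite [← t3]
      exact t2
    have h8 : ∑' n, |a (n + N)| * (q * Z) ^ (n + N) ≤ ∑' n, |a n| * (q * Z) ^ n := by
      rewrite [← ha.sum_add_tsum_nat_add N]
      have : 0 ≤ ∑ n ∈ Finset.range N, |a n| * (q * Z) ^ n := Finset.sum_nonneg fun n _ => by positivity
      linarith
    have h9 : q ^ N * |∑' n, a (n + N) * z ^ (n + N)| ≤ q ^ N * ∑' n, ‖a (n + N) * z ^ (n + N)‖ :=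
      mul_le_mul_of_nonneg_left h6 (by positivity)
    exact h9.trans (h7.trans (h8.trans haB))
  · rewrite [← h1.tsum_eq]
    have h6 : |∑' n, a n * z ^ n| ≤ ∑' n, ‖a n * z ^ n‖ := norm_tsum_le_tsum_norm h2
    have h7 : ∀ n, ‖a n * z ^ n‖ ≤ |a n| * (q * Z) ^ n := by
      intro n
      rewrite [Real.norm_eq_abs, abs_mul, abs_pow]
      exact mul_le_mul_of_nonneg_left (pow_le_pow_left₀ (abs_nonneg _) hzq n) (abs_nonneg _)
    have h8 : ∑' n, ‖a n * z ^ n‖ ≤ ∑' n, |a n| * (q * Z) ^ n := h2.tsum_le_tsum h7 ha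
    exact h6.trans (h8.trans haB)

lemma maj_entry (i j : ℕ) (K : ℕ) (hi : i < K) (τ Z q ℓS : ℝ) (hZ : 0 ≤ Z) (hq : 1 ≤ q)
    (hKZ : (K : ℝ) ≤ Z) (hx : (q + 1) * Z ≤ K * q ^ 2) (hτ : |τ| * Z ≤ ℓS) :
    Maj (fun z => (∏ l ∈ Finset.range i, (z + (Z - l))) * (1 / (i.factorial : ℝ)) *
      (Real.exp ((j * τ) * z) * Real.exp ((j * τ) * Z))) (q * Z)
      ((q ^ 2) ^ i * Real.exp K * Real.exp ((q + 1) * ℓS) ^ j) := by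
  have hqZ : 0 ≤ q * Z := by positivity
  have h1 := maj_prod i (fun l => Z - l) (q * Z) Z hqZ (by
    intro l hl
    have : (l : ℝ) ≤ K := by exact_mod_cast (by omega : l ≤ K)
    have hl0 : (0 : ℝ) ≤ l := Nat.cast_nonneg l
    rw [abs_le]
    constructor <;> linarith)
  have h2 := h1.mul hqZ (maj_const (1 / (i.factorial : ℝ)) (q * Z))
  have h3 := (maj_exp (j * τ) (q * Z)).mul hqZ (maj_const (Real.exp ((j * τ) * Z)) (q * Z))
  refine (h2.mul hqZ h3).mono ?_
  have e1 : (q * Z + Z) ^ i * |1 / (i.factorial : ℝ)| ≤ (q ^ 2) ^ i * Real.exp K := by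
    have : |1 / (i.factorial : ℝ)| = 1 / (i.factorial : ℝ) := abs_of_nonneg (by positivity)
    rw [this]
    have h4 : (q * Z + Z) ^ i ≤ (K * q ^ 2) ^ i := pow_le_pow_left₀ (by positivity) (by linarith) i
    have h5 : (K : ℝ) ^ i / i.factorial ≤ Real.exp K := Real.pow_div_factorial_le_exp K (by positivity) i
    calc (q * Z + Z) ^ i * (1 / (i.factorial : ℝ)) ≤ (K * q ^ 2) ^ i * (1 / (i.factorial : ℝ)) := by gcongr
      _ = (q ^ 2) ^ i * ((K : ℝ) ^ i / i.factorial) := by rw [mul_pow]; ring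
      _ ≤ _ := by gcongr
  have e2 : Real.exp (|j * τ| * (q * Z)) * |Real.exp ((j * τ) * Z)| ≤ Real.exp ((q + 1) * ℓS) ^ j := by
    rw [Real.abs_exp, ← Real.exp_add, ← Real.exp_nat_mul]
    apply Real.exp_le_exp.2
    have h6 : |(j : ℝ) * τ| = j * |τ| := by rw [abs_mul, Nat.abs_cast]
    have h7 : (j : ℝ) * τ * Z ≤ j * |τ| * Z := by
      rw [← h6]
      exact mul_le_mul_of_nonneg_right (le_abs_self _) hZ
    have h8 : (j : ℝ) * ((q + 1) * (|τ| * Z)) ≤ j * ((q + 1) * ℓS) := by gcongr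
    rw [h6]
    nlinarith
  exact mul_le_mul e1 e2 (by positivity) (by positivity)

lemma entry_val (i j m s p : ℕ) (t ρ δ Z : ℝ) (ht : 0 < t) (hδ : 0 ≤ δ) (hpt : t ^ p = ρ * (1 + δ)) :
    ((Nat.choose (m + s * p) i : ℝ) * t ^ (j * m) * ρ ^ (j * s)) * (1 + δ) ^ (j * s) =
    (∏ l ∈ Finset.range i, ((((m + s * p : ℕ) : ℝ) - Z) + (Z - l))) * (1 / (i.factorial : ℝ)) *
      (Real.exp ((j * Real.log t) * (((m + s * p : ℕ) : ℝ) - Z)) * Real.exp ((j * Real.log t) * Z)) := by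
  rw [← Real.exp_add]
  have e1 : (j * Real.log t) * (((m + s * p : ℕ) : ℝ) - Z) + (j * Real.log t) * Z
      = ((j * (m + s * p) : ℕ) : ℝ) * Real.log t := by push_cast; ring
  rw [e1, Real.exp_nat_mul, Real.exp_log ht]
  have e2 : ∏ l ∈ Finset.range i, ((((m + s * p : ℕ) : ℝ) - Z) + (Z - l)) = (Nat.descFactorial (m + s * p) i : ℝ) := by
    rw [← descPochhammer_eval_eq_descFactorial, descPochhammer_eval_eq_prod_range]
    apply Finset.prod_congr rfl
    intro l _
    ring
  rw [e2, Nat.descFactorial_eq_factorial_mul_choose]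
  have hf : (i.factorial : ℝ) ≠ 0 := by positivity
  have e3 : t ^ (j * (m + s * p)) = t ^ (j * m) * (ρ ^ (j * s) * (1 + δ) ^ (j * s)) := by
    rw [← mul_pow, ← hpt, ← pow_mul, ← pow_add]
    congr 1
    ring
  rw [e3]
  push_cast
  field_simp

lemma pert_bound (n : ℕ) (δ a b : ℝ) (hδ : 0 ≤ δ) (h : a * (1 + δ) ^ n = b) :
    |a - b| ≤ n * δ * |b| := by
  have h1 : (1 + δ) ≠ 0 := by positivity
  have ha : a = (1 + (-(δ / (1 + δ)))) ^ n * b := by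
    rw [← h]
    have : 1 + (-(δ / (1 + δ))) = 1 / (1 + δ) := by field_simp; ring
    rw [this, div_pow, one_pow]
    field_simp
  have hu : δ / (1 + δ) ≤ δ := div_le_self hδ (by linarith)
  have hu1 : δ / (1 + δ) ≤ 1 := by rw [div_le_one (by positivity)]; linarith
  have hu0 : 0 ≤ δ / (1 + δ) := by positivity
  have h2 := one_add_mul_le_pow (show (-2 : ℝ) ≤ -(δ / (1 + δ)) by linarith) n
  have h3 : (1 + (-(δ / (1 + δ)))) ^ n ≤ 1 := pow_le_one₀ (by linarith) (by linarith)
  have h4 : a - b = -((1 - (1 + (-(δ / (1 + δ)))) ^ n) * b) := by rw [ha]; ring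
  rw [h4, abs_neg, abs_mul]
  apply mul_le_mul_of_nonneg_right _ (abs_nonneg _)
  rw [abs_of_nonneg (by linarith)]
  have h5 : (n : ℝ) * (δ / (1 + δ)) ≤ n * δ := by gcongr
  linarith

lemma interp_final_aux (K lq l3 l4 lf P Q : ℝ)
    (h : 2 * K * (4 * K - 1) * lq ≤ 6 * K * P + (4 * K * l3 + lf + (4 * (K * (K - 1) / 2) * (2 * lq) + 4 * K * K + 6 * K * Q)))
    (h4 : lf ≤ 4 * K * l4) :
    K * ((4 * K + 2) * lq) ≤ K * (4 * (l3 + l4) + 6 * P + 4 * K + 6 * Q) := by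
  linarith

set_option maxHeartbeats 1000000 in
theorem interp_ineq (K R S2 p w W A B : ℕ) (q ℓ δ : ℝ) (hK : 1 ≤ K) (hw : 0 < w) (hW : 0 < W)
    (hA : 0 < A) (hB : 0 < B) (hAB : A ≠ B) (hRp : R ≤ p) (hcount : 4 * (K - 1) < R * S2)
    (ht : ((w : ℝ) / W) ^ p = (A : ℝ) / B * (1 + δ)) (hδ : 0 ≤ δ)
    (hℓ : p * |Real.log ((w : ℝ) / W)| ≤ ℓ) (hq : 1 ≤ q)
    (hx : (q + 1) * (((S2 + 3 : ℕ) : ℝ) * p / 2) ≤ K * q ^ 2)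
    (hKX : (K : ℝ) ≤ ((S2 + 3 : ℕ) : ℝ) * p / 2)
    (hδq : 3 * ((S2 + 3 : ℕ) : ℝ) * δ * q ^ (4 * K) ≤ 1) :
    (4 * K + 2) * Real.log q ≤ 4 * Real.log (12 * K) +
      6 * (R * Real.log W + ((S2 + 3 : ℕ) : ℝ) * Real.log B) + 4 * K
      + 6 * ((q + 1) * (ℓ * ((S2 + 3 : ℕ) : ℝ) / 2)) := by
  classical
  set S := S2 + 3 with hS
  set t : ℝ := (w : ℝ) / W with htdef
  set ρ : ℝ := (A : ℝ) / B with hρdef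
  have hWr : (0 : ℝ) < W := by exact_mod_cast hW
  have hBr : (0 : ℝ) < B := by exact_mod_cast hB
  have hwr : (0 : ℝ) < w := by exact_mod_cast hw
  have hAr : (0 : ℝ) < A := by exact_mod_cast hA
  have ht0 : 0 < t := by positivity
  have hρ0 : 0 < ρ := by positivity
  have hρ1 : ρ ≠ 1 := by
    intro h
    rw [hρdef, div_eq_one_iff_eq hBr.ne'] at h
    exact hAB (by exact_mod_cast h)
  set Z : ℝ := (S : ℝ) * p / 2 with hZdef
  have hZ : 0 ≤ Z := by positivity
  set ℓS : ℝ := ℓ * S / 2 with hℓS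
  have hτ : |Real.log t| * Z ≤ ℓS := by
    rw [hZdef, hℓS]
    have : (S : ℝ) * (p * |Real.log t|) ≤ S * ℓ := by gcongr
    linarith
  let E : Fin K × Fin 4 → Fin R × Fin S → ℝ := fun l k =>
    (Nat.choose (k.1 + k.2 * p) l.1 : ℝ) * t ^ ((l.2 : ℕ) * k.1) * ρ ^ ((l.2 : ℕ) * k.2)
  obtain ⟨col, hcol⟩ := exists_cols E (by
    intro c hc
    apply zero_est K R S2 p t ρ hρ0 hρ1 ht0.ne' hRp hcount c
    intro m hm s hs
    exact hc (⟨m, hm⟩, ⟨s, hs⟩))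
  set M : Matrix (Fin K × Fin 4) (Fin K × Fin 4) ℝ := Matrix.of fun i j => E i (col j) with hM
  -- upper bound
  let Bd : Fin K × Fin 4 → ℝ := fun l =>
    (q ^ 2) ^ (l.1 : ℕ) * Real.exp K * Real.exp ((q + 1) * ℓS) ^ (l.2 : ℕ)
  have hBd : ∀ l, 0 < Bd l := fun l => by positivity
  let f : Fin K × Fin 4 → ℝ → ℝ := fun l z =>
    (∏ u ∈ Finset.range (l.1 : ℕ), (z + (Z - u))) * (1 / ((l.1 : ℕ).factorial : ℝ)) *
      (Real.exp ((((l.2 : ℕ) : ℝ) * Real.log t) * z) * Real.exp ((((l.2 : ℕ) : ℝ) * Real.log t) * Z))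
  have hmaj : ∀ l, Maj (f l) (q * Z) (Bd l) := fun l =>
    maj_entry l.1 l.2 K l.1.2 (Real.log t) Z q ℓS hZ hq hKX hx hτ
  choose a ha1 ha2 using fun l => (hmaj l).taylor hq hZ (4 * K)
  let ζ : Fin K × Fin 4 → ℝ := fun j => (((col j).1 + (col j).2 * p : ℕ) : ℝ) - Z
  have hζ : ∀ j, |ζ j| ≤ Z := by
    intro j
    have h1 : ((col j).1 : ℕ) + (col j).2 * p ≤ S * p := by
      have h2 := (col j).1.2
      have h3 := (col j).2.2
      calc ((col j).1 : ℕ) + (col j).2 * p ≤ p + (col j).2 * p := by omega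
        _ = ((col j).2 + 1) * p := by ring
        _ ≤ S * p := Nat.mul_le_mul_right _ (by omega)
    have h4 : ((((col j).1 + (col j).2 * p : ℕ)) : ℝ) ≤ 2 * Z := by
      have : ((((col j).1 + (col j).2 * p : ℕ)) : ℝ) ≤ ((S * p : ℕ) : ℝ) := by exact_mod_cast h1
      rw [hZdef]
      push_cast at this ⊢
      linarith
    have h5 : (0 : ℝ) ≤ (((col j).1 + (col j).2 * p : ℕ) : ℝ) := Nat.cast_nonneg _
    rw [abs_le]
    constructor
    · simp only [ζ]; linarith
    · simp only [ζ]; linarith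
  have hq0 : 0 < q := by linarith
  have hcard : Fintype.card (Fin K × Fin 4) = 4 * K := by simp [mul_comm]
  have hup := det_upper (4 * K) hcard M ζ a
    (fun i j => M i j - ∑ n ∈ Finset.range (4 * K), a i n * ζ j ^ n) Z q Bd hZ hq hζ
    (fun i => (hBd i).le) (fun i j => by ring) ha1 (by
      intro l k
      obtain ⟨h1, h2⟩ := ha2 l (ζ k) (hζ k)
      have h3 := entry_val l.1 l.2 (col k).1 (col k).2 p t ρ δ Z ht0 hδ ht
      have h4 := pert_bound _ δ (M l k) (f l (ζ k)) hδ h3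
      have h5 : (((l.2 : ℕ) * ((col k).2 : ℕ) : ℕ) : ℝ) ≤ 3 * (S : ℝ) := by
        have := l.2.2
        have := (col k).2.2
        have : (l.2 : ℕ) * ((col k).2 : ℕ) ≤ 3 * S := Nat.mul_le_mul (by omega) (by omega)
        exact_mod_cast this
      have h6 : |M l k - f l (ζ k)| ≤ (3 * S * δ) * Bd l := by
        refine h4.trans ?_
        have : (((l.2 : ℕ) * ((col k).2 : ℕ) : ℕ) : ℝ) * δ ≤ 3 * S * δ := by gcongr
        exact mul_le_mul this h2 (abs_nonneg _) (by positivity)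
      have h7 : |M l k - ∑ n ∈ Finset.range (4 * K), a l n * ζ k ^ n| ≤
          |M l k - f l (ζ k)| + |f l (ζ k) - ∑ n ∈ Finset.range (4 * K), a l n * ζ k ^ n| := by
        have := abs_add_le (M l k - f l (ζ k)) (f l (ζ k) - ∑ n ∈ Finset.range (4 * K), a l n * ζ k ^ n)
        rwa [sub_add_sub_cancel] at this
      have hqp : 0 < q ^ (4 * K) := by positivity
      have h8 : |M l k - f l (ζ k)| * q ^ (4 * K) ≤ Bd l := by
        calc |M l k - f l (ζ k)| * q ^ (4 * K) ≤ (3 * S * δ) * Bd l * q ^ (4 * K) := by gcongr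
          _ = (3 * S * δ * q ^ (4 * K)) * Bd l := by ring
          _ ≤ 1 * Bd l := by
            have := (hBd l).le
            gcongr
          _ = Bd l := one_mul _
      calc _ ≤ (|M l k - f l (ζ k)| + |f l (ζ k) - ∑ n ∈ Finset.range (4 * K), a l n * ζ k ^ n|) * q ^ (4 * K) :=
            mul_le_mul_of_nonneg_right h7 hqp.le
        _ ≤ 2 * Bd l := by rw [add_mul]; linarith)
  -- lower bound
  let sc : Fin K × Fin 4 → ℝ := fun l => ((W : ℝ) ^ R * (B : ℝ) ^ S) ^ (l.2 : ℕ)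
  let MI : Matrix (Fin K × Fin 4) (Fin K × Fin 4) ℤ := Matrix.of fun l k =>
    (Nat.choose ((col k).1 + (col k).2 * p) l.1 : ℤ) *
     ((w : ℤ) ^ ((col k).1 : ℕ) * (W : ℤ) ^ (R - (col k).1)) ^ (l.2 : ℕ) *
     ((A : ℤ) ^ ((col k).2 : ℕ) * (B : ℤ) ^ (S - (col k).2)) ^ (l.2 : ℕ)
  have hMI : MI.map (Int.castRingHom ℝ) = Matrix.of fun l k => sc l * M l k := by
    ext l k
    simp only [MI, sc, hM, E, Matrix.map_apply, Matrix.of_apply, eq_intCast]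
    push_cast
    have e1 : (w : ℝ) ^ ((col k).1 : ℕ) * (W : ℝ) ^ (R - (col k).1) = W ^ R * t ^ ((col k).1 : ℕ) := by
      rw [htdef, div_pow]
      have : (W : ℝ) ^ R = W ^ (R - (col k).1) * W ^ ((col k).1 : ℕ) := by
        rw [← pow_add]; congr 1; have := (col k).1.2; omega
      rw [this]
      field_simp
    have e2 : (A : ℝ) ^ ((col k).2 : ℕ) * (B : ℝ) ^ (S - (col k).2) = B ^ S * ρ ^ ((col k).2 : ℕ) := by
      rw [hρdef, div_pow]
      have : (B : ℝ) ^ S = B ^ (S - (col k).2) * B ^ ((col k).2 : ℕ) := by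
        rw [← pow_add]; congr 1; have := (col k).2.2; omega
      rw [this]
      field_simp
    rw [e1, e2, mul_comm (l.2 : ℕ), mul_comm (l.2 : ℕ), pow_mul, pow_mul, mul_pow, mul_pow, mul_pow]
    ring
  have hdet : ((MI.det : ℤ) : ℝ) = (∏ l, sc l) * M.det := by
    rw [← Matrix.det_mul_column, ← hMI]
    exact (Int.castRingHom ℝ).map_det MI
  have hsc : ∀ l, 0 < sc l := fun l => by positivity
  have hscp : 0 < ∏ l, sc l := Finset.prod_pos fun l _ => hsc l
  have hlow : 1 ≤ (∏ l, sc l) * |M.det| := by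
    have h1 : MI.det ≠ 0 := by
      intro h0
      rw [h0] at hdet
      simp only [Int.cast_zero] at hdet
      exact (mul_ne_zero hscp.ne' hcol) hdet.symm
    have h2 : (1 : ℝ) ≤ |((MI.det : ℤ) : ℝ)| := by exact_mod_cast Int.one_le_abs h1
    rwa [hdet, abs_mul, abs_of_pos hscp] at h2
  have hcomb : q ^ (∑ n ∈ Finset.range (4 * K), n) ≤
      (∏ l, sc l) * (3 ^ (4 * K) * (4 * K).factorial * ∏ i, Bd i) := by
    have hqp : 0 < q ^ (∑ n ∈ Finset.range (4 * K), n) := by positivity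
    calc q ^ (∑ n ∈ Finset.range (4 * K), n) ≤
        ((∏ l, sc l) * |M.det|) * q ^ (∑ n ∈ Finset.range (4 * K), n) := by
          exact le_mul_of_one_le_left hqp.le hlow
      _ = (∏ l, sc l) * (|M.det| * q ^ (∑ n ∈ Finset.range (4 * K), n)) := by ring
      _ ≤ _ := mul_le_mul_of_nonneg_left hup hscp.le
  have hKr : (1 : ℝ) ≤ K := by exact_mod_cast hK
  have hlog := Real.log_le_log (by positivity) hcomb
  have hBdp : 0 < ∏ i, Bd i := Finset.prod_pos fun l _ => hBd l
  rw [Real.log_pow, Real.log_mul hscp.ne' (by positivity), Real.log_mul (by positivity) hBdp.ne',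
    Real.log_mul (by positivity) (by positivity), Real.log_pow,
    Real.log_prod (fun l _ => (hsc l).ne'), Real.log_prod (fun l _ => (hBd l).ne')] at hlog
  have hs1 : ∑ l, Real.log (sc l) = 6 * K * (R * Real.log W + S * Real.log B) := by
    simp only [sc, Real.log_pow]
    rw [Fintype.sum_prod_type]
    simp only [Fin.sum_univ_four, Finset.sum_const, Finset.card_univ, Fintype.card_fin, nsmul_eq_mul]
    rw [Real.log_mul (by positivity) (by positivity), Real.log_pow, Real.log_pow]
    push_cast [Fin.val_two, Fin.val_one, Fin.val_zero, show ((3 : Fin 4) : ℕ) = 3 from rfl]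
    ring
  have hsi : ∑ i : Fin K, ((i : ℕ) : ℝ) = K * (K - 1) / 2 := by
    rw [Fin.sum_univ_eq_sum_range (fun n => (n : ℝ))]
    have := Finset.sum_range_id_mul_two K
    have h2 : ((∑ i ∈ Finset.range K, i : ℕ) : ℝ) * 2 = K * (K - 1) := by
      have h3 : ((K - 1 : ℕ) : ℝ) = K - 1 := by rw [Nat.cast_sub hK]; simp
      rw [← h3]
      exact_mod_cast this
    push_cast at h2
    linarith
  have hs2 : ∑ l, Real.log (Bd l) = 4 * (K * (K - 1) / 2) * (2 * Real.log q) + 4 * K * K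
      + 6 * K * ((q + 1) * ℓS) := by
    have : ∀ l, Real.log (Bd l) = (l.1 : ℕ) * (2 * Real.log q) + K + (l.2 : ℕ) * ((q + 1) * ℓS) := by
      intro l
      simp only [Bd]
      rw [Real.log_mul (by positivity) (by positivity), Real.log_mul (by positivity) (by positivity),
        Real.log_pow, Real.log_pow, Real.log_pow, Real.log_exp, Real.log_exp]
      push_cast
      ring
    simp only [this]
    rw [Fintype.sum_prod_type]
    simp only [Fin.sum_univ_four]
    push_cast [Fin.val_two, Fin.val_one, Fin.val_zero, show ((3 : Fin 4) : ℕ) = 3 from rfl]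
    have h9 : ∀ i : Fin K, ((i : ℕ) : ℝ) * (2 * Real.log q) + K + 0 * ((q + 1) * ℓS) +
        (((i : ℕ) : ℝ) * (2 * Real.log q) + K + 1 * ((q + 1) * ℓS)) +
        (((i : ℕ) : ℝ) * (2 * Real.log q) + K + 2 * ((q + 1) * ℓS)) +
        (((i : ℕ) : ℝ) * (2 * Real.log q) + K + 3 * ((q + 1) * ℓS)) =
        ((i : ℕ) : ℝ) * (8 * Real.log q) + (4 * K + 6 * ((q + 1) * ℓS)) := by intro i; ring
    simp only [h9]
    rw [Finset.sum_add_distrib, ← Finset.sum_mul, hsi]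
    simp only [Finset.sum_const, Finset.card_univ, Fintype.card_fin, nsmul_eq_mul]
    ring
  have hs3 : ((∑ n ∈ Finset.range (4 * K), n : ℕ) : ℝ) = 2 * K * (4 * K - 1) := by
    have := Finset.sum_range_id_mul_two (4 * K)
    have h2 : ((∑ i ∈ Finset.range (4 * K), i : ℕ) : ℝ) * 2 = 4 * K * (4 * K - 1) := by
      have h3 : ((4 * K - 1 : ℕ) : ℝ) = 4 * K - 1 := by rw [Nat.cast_sub (by omega)]; simp
      rw [← h3]
      exact_mod_cast this
    linarith
  have hs4 : Real.log ((4 * K).factorial : ℝ) ≤ 4 * K * Real.log (4 * K) := by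
    have h1 : ((4 * K).factorial : ℝ) ≤ (4 * K : ℝ) ^ (4 * K) := by
      exact_mod_cast Nat.factorial_le_pow (4 * K)
    have := Real.log_le_log (by positivity) h1
    rw [Real.log_pow] at this
    push_cast at this
    exact this
  have hs5 : Real.log (12 * K) = Real.log 3 + Real.log (4 * K) := by
    rw [← Real.log_mul (by norm_num) (by positivity)]
    congr 1
    ring
  rw [hs1, hs2, hs3] at hlog
  push_cast at hlog
  have hfin : K * ((4 * K + 2) * Real.log q) ≤ K * (4 * Real.log (12 * K) +
      6 * (R * Real.log W + (S : ℝ) * Real.log B) + 4 * K + 6 * ((q + 1) * ℓS)) := by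
    rw [hs5]
    exact interp_final_aux _ _ _ _ _ _ _ hlog hs4
  exact le_of_mul_le_mul_left hfin (by linarith)

lemma log_le_lin (x : ℝ) (k : ℕ) (hx : 0 < x) : Real.log x ≤ x / 2 ^ k + k * 0.6931471808 - 1 := by
  have h1 := Real.log_le_sub_one_of_pos (show 0 < x / 2 ^ k by positivity)
  rw [Real.log_div hx.ne' (by positivity), Real.log_pow] at h1
  have h2 := Real.log_two_lt_d9
  have h3 : (k : ℝ) * Real.log 2 ≤ k * 0.6931471808 := by
    apply mul_le_mul_of_nonneg_left h2.le (by positivity)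
  linarith

lemma num_x (d p s2 s : ℝ) (hd : 140 ≤ d) (hp0 : 0 ≤ p) (hp2 : p ≤ d ^ 2 + 2 * d) (hs2 : 30 ≤ s2) (hs : s = s2 + 3) :
    (d / 3 + 1) * (s * p / 2) ≤ (2 * d * s2) * (d / 3) ^ 2 := by
  have h1 : s ≤ 1.1 * s2 := by linarith
  have h2 : s * p ≤ 1.1 * s2 * (d ^ 2 + 2 * d) :=
    mul_le_mul h1 hp2 hp0 (by positivity)
  have h3 : (d / 3 + 1) * (s * p / 2) ≤ (d / 3 + 1) * (1.1 * s2 * (d ^ 2 + 2 * d) / 2) := by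
    gcongr
  refine h3.trans ?_
  have h4 : (2 * d * s2) * (d / 3) ^ 2 - (d / 3 + 1) * (1.1 * s2 * (d ^ 2 + 2 * d) / 2)
      = s2 * d * (2 * d ^ 2 / 9 - (d / 3 + 1) * (d + 2) * 0.55) := by ring
  have h5 : 0 ≤ 2 * d ^ 2 / 9 - (d / 3 + 1) * (d + 2) * 0.55 := by nlinarith
  have h6 : 0 ≤ s2 * d := by positivity
  have := mul_nonneg h6 h5
  linarith

lemma num_delta (d p s2 lam lq l3 : ℝ) (hd : 140 ≤ d) (hp1 : d ^ 2 ≤ p) (hlam : 7.5 ≤ lam)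
    (hs2 : s2 ≤ 4 * lam + 1) (hs0 : 30 ≤ s2) (hlq : lq ≤ d / 192 + 3.159) (hlq0 : 0 ≤ lq)
    (hl3 : l3 ≤ 3 * (s2 + 3)) :
    l3 + 41 + 8 * d * s2 * lq ≤ p * lam := by
  have h1 : s2 ≤ 4.134 * lam := by linarith
  have h2 : 8 * d * s2 * lq ≤ 8 * d * (4.134 * lam) * (d / 192 + 3.159) := by gcongr
  have h3 : d ^ 2 * lam ≤ p * lam := by gcongr
  have h4 : 0 ≤ d ^ 2 - 8 * d * 4.134 * (d / 192 + 3.159) - 1000 := by nlinarith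
  have h5 := mul_nonneg (show 0 ≤ lam by linarith) h4
  nlinarith

lemma num_final (d k s2 s lam lq lB lK : ℝ) (hd : 140 ≤ d) (hk : k = 2 * d * s2) (hs2 : 30 ≤ s2)
    (hs : s = s2 + 3) (hlam : 4 * lam ≤ s2) (hlq : 3.7 ≤ lq) (hlB : lB ≤ 9)
    (hlK : lK ≤ 12 * k / 65536 + 10.1)
    (h : (4 * k + 2) * lq ≤ 4 * lK + 6 * ((8 * d) * lam + s * lB) + 4 * k + 6 * ((d / 3 + 1) * (7 * s / 2))) :
    False := by
  have h1 : s ≤ 1.1 * s2 := by linarith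
  have hk1 : 280 * s2 ≤ k := by rw [hk]; nlinarith
  have h2 : s * lB ≤ 1.1 * s2 * 9 := by
    calc s * lB ≤ s * 9 := by apply mul_le_mul_of_nonneg_left hlB; linarith
      _ ≤ _ := by linarith
  have h3 : 8 * d * lam ≤ k := by rw [hk]; nlinarith
  have h4 : (d / 3 + 1) * (7 * s / 2) ≤ (d / 3 + 1) * (7 * (1.1 * s2) / 2) := by gcongr
  have h5 : (d / 3 + 1) * (7 * (1.1 * s2) / 2) = 3.85 * k / 6 + 3.85 * s2 := by rw [hk]; ring
  have h6 : (4 * k + 2) * 3.7 ≤ (4 * k + 2) * lq := by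
    apply mul_le_mul_of_nonneg_left hlq; linarith
  linarith

set_option maxHeartbeats 1000000 in
theorem big_core (p w W B e r : ℕ) (hp : 19600 ≤ p) (hB0 : 0 < B) (hB : B ≤ 8000) (hB9 : 9 ≠ B)
    (he : e ≤ 180) (hr : r ≤ 10 ^ 6) (he0 : 0 < e) (hr0 : 0 < r) (hW : 2 ≤ W) (hw : 0 < w)
    (h : B * w ^ p = 9 * W ^ p + B * e * r ^ 2) : False := by
  have hBe : B * e * r ^ 2 ≤ 2 ^ 61 := by
    calc B * e * r ^ 2 ≤ 8000 * 180 * (10 ^ 6) ^ 2 := by gcongr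
      _ ≤ 2 ^ 61 := by norm_num
  have hWp : 2 ^ 100 ≤ W ^ p := by
    calc 2 ^ 100 ≤ 2 ^ p := Nat.pow_le_pow_right (by norm_num) (by omega)
      _ ≤ W ^ p := Nat.pow_le_pow_left hW p
  have hBr : (0 : ℝ) < B := by exact_mod_cast hB0
  have hWr : (0 : ℝ) < W := by exact_mod_cast (by omega : 0 < W)
  have hwr : (0 : ℝ) < w := by exact_mod_cast hw
  have hWpr : (0 : ℝ) < (W : ℝ) ^ p := by positivity
  set t : ℝ := (w : ℝ) / W with ht
  have ht0 : 0 < t := by positivity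
  set δ : ℝ := (B * e * r ^ 2 : ℕ) / (9 * (W : ℝ) ^ p) with hδdef
  have hδ : 0 ≤ δ := by positivity
  have hBeR : ((B * e * r ^ 2 : ℕ) : ℝ) ≤ 2 ^ 61 := by exact_mod_cast hBe
  have hδ1 : δ ≤ 1 / 100 := by
    rw [hδdef, div_le_iff₀ (by positivity)]
    have : (2 : ℝ) ^ 100 ≤ (W : ℝ) ^ p := by exact_mod_cast hWp
    norm_num at this hBeR ⊢
    linarith
  have htp : t ^ p = (9 : ℕ) / (B : ℝ) * (1 + δ) := by
    have hR : (B : ℝ) * (w : ℝ) ^ p = 9 * (W : ℝ) ^ p + (B * e * r ^ 2 : ℕ) := by exact_mod_cast h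
    rw [ht, div_pow, hδdef]
    push_cast at hR ⊢
    field_simp
    linarith
  have hB8 : (B : ℝ) ≤ 8000 := by exact_mod_cast hB
  have hB1 : (1 : ℝ) ≤ B := by exact_mod_cast hB0
  have hexp := Real.exp_one_gt_d9
  have hexp7 : (1000 : ℝ) ≤ Real.exp 7 := by
    have : Real.exp 7 = Real.exp 1 ^ 7 := by rw [← Real.exp_nat_mul]; norm_num
    rw [this]
    calc (1000 : ℝ) ≤ 2.7182818283 ^ 7 := by norm_num
      _ ≤ _ := by gcongr
  have hexp9 : (8000 : ℝ) ≤ Real.exp 9 := by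
    have : Real.exp 9 = Real.exp 1 ^ 9 := by rw [← Real.exp_nat_mul]; norm_num
    rw [this]
    calc (8000 : ℝ) ≤ 2.7182818283 ^ 9 := by norm_num
      _ ≤ _ := by gcongr
  have hlogB : Real.log B ≤ 9 := by
    rw [Real.log_le_iff_le_exp hBr]; linarith
  have hplog : (p : ℝ) * |Real.log t| ≤ 7 := by
    have e1 : (p : ℝ) * |Real.log t| = |Real.log (t ^ p)| := by
      rw [Real.log_pow, abs_mul, Nat.abs_cast]
    rw [e1, abs_le]
    have htp0 : 0 < t ^ p := by positivity
    have hu : t ^ p ≤ 1000 := by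
      rw [htp]
      have : (9 : ℕ) / (B : ℝ) ≤ 9 := by
        push_cast
        rw [div_le_iff₀ hBr]; linarith
      calc (9 : ℕ) / (B : ℝ) * (1 + δ) ≤ 9 * (1 + 1 / 100) := by gcongr
        _ ≤ 1000 := by norm_num
    have hl : 1 / 1000 ≤ t ^ p := by
      rw [htp]
      have h1 : 9 / 8000 ≤ (9 : ℕ) / (B : ℝ) := by
        push_cast
        gcongr
      calc (1 / 1000 : ℝ) ≤ 9 / 8000 * 1 := by norm_num
        _ ≤ _ := by
          apply mul_le_mul h1 (by linarith) (by norm_num) (by positivity)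
    constructor
    · rw [Real.le_log_iff_exp_le htp0, Real.exp_neg]
      refine le_trans ?_ hl
      rw [one_div]
      exact inv_anti₀ (by norm_num) hexp7
    · rw [Real.log_le_iff_le_exp htp0]; linarith
  -- t ≠ 1 and lower bound for W
  have hne : w ≠ W := by
    rintro rfl
    rcases lt_or_gt_of_ne hB9 with h9 | h9
    · have : (9 + 1) * w ^ p ≤ B * w ^ p := Nat.mul_le_mul_right _ h9
      have : 2 ^ 100 ≤ 2 ^ 61 := by omega
      norm_num at this
    · have : B * w ^ p ≤ 9 * w ^ p := Nat.mul_le_mul_right _ h9.le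
      have : 0 < B * e * r ^ 2 := by positivity
      omega
  have hlogt : 1 / ((W : ℝ) + 1) ≤ |Real.log t| := by
    rcases lt_or_gt_of_ne hne with hlt | hgt
    · have h1 := Real.log_le_sub_one_of_pos ht0
      have h2 : t - 1 ≤ -(1 / W) := by
        rw [ht]
        have : (w : ℝ) + 1 ≤ W := by exact_mod_cast hlt
        have h3 : (w : ℝ) / W - 1 = (w - W) / W := by field_simp
        rw [h3, ← neg_div]
        gcongr
        linarith
      have h3 : 1 / ((W : ℝ) + 1) ≤ 1 / W := by gcongr; linarith
      rw [abs_of_nonpos (by have : 0 < 1 / (W : ℝ) := by positivity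
                            linarith)]
      linarith
    · have h1 := Real.one_sub_inv_le_log_of_pos ht0
      have h2 : 1 / ((W : ℝ) + 1) ≤ 1 - t⁻¹ := by
        rw [ht, inv_div]
        have h5 : (W : ℝ) + 1 ≤ w := by exact_mod_cast hgt
        have h3 : (W : ℝ) / w ≤ W / (W + 1) := by gcongr
        have h4 : 1 - (W : ℝ) / (W + 1) = 1 / (W + 1) := by field_simp; ring
        linarith
      exact (h2.trans h1).trans (le_abs_self _)
  have hpr : (19600 : ℝ) ≤ p := by exact_mod_cast hp
  have hWbig : (2048 : ℝ) ≤ W := by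
    have h1 : (p : ℝ) * (1 / ((W : ℝ) + 1)) ≤ 7 :=
      le_trans (mul_le_mul_of_nonneg_left hlogt (by positivity)) hplog
    rw [mul_one_div, div_le_iff₀ (by positivity)] at h1
    linarith
  set lam : ℝ := Real.log W with hlamdef
  have hlam : 7.5 ≤ lam := by
    have h1 : Real.log 2048 ≤ lam := Real.log_le_log (by norm_num) hWbig
    have h2 : Real.log 2048 = 11 * Real.log 2 := by
      rw [show (2048 : ℝ) = 2 ^ 11 by norm_num, Real.log_pow]; norm_num
    have h3 := Real.log_two_gt_d9
    norm_num at h3 ⊢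
    linarith
  -- parameters
  set D := Nat.sqrt p with hD
  have hD1 : D * D ≤ p := Nat.sqrt_le p
  have hD2 : p < (D + 1) * (D + 1) := Nat.lt_succ_sqrt p
  have hD140 : 140 ≤ D := by
    rw [hD, Nat.le_sqrt]; omega
  have hdr : (140 : ℝ) ≤ D := by exact_mod_cast hD140
  set S2 := ⌈4 * lam⌉₊ with hS2
  have hS2a : 4 * lam ≤ S2 := Nat.le_ceil _
  have hS2b : (S2 : ℝ) ≤ 4 * lam + 1 := (Nat.ceil_lt_add_one (by linarith)).le
  have hS30 : (30 : ℝ) ≤ S2 := by linarith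
  have hS30n : 30 ≤ S2 := by exact_mod_cast hS30
  have hp1r : (D : ℝ) ^ 2 ≤ p := by rw [sq]; exact_mod_cast hD1
  have hp2r : (p : ℝ) ≤ (D : ℝ) ^ 2 + 2 * D := by
    have : p ≤ D ^ 2 + 2 * D := by nlinarith
    exact_mod_cast this
  set q : ℝ := (D : ℝ) / 3 with hq
  have hq1 : 1 ≤ q := by rw [hq]; linarith
  have hq0 : 0 < q := by linarith
  have hlq1 : Real.log q ≤ (D : ℝ) / 192 + 3.159 := by
    have := log_le_lin q 6 hq0
    rw [hq] at this ⊢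
    norm_num at this ⊢
    linarith
  have hlq2 : 3.7 ≤ Real.log q := by
    have h1 : Real.log (140 / 3) ≤ Real.log q := Real.log_le_log (by norm_num) (by rw [hq]; linarith)
    have h2 : Real.log (140 / 3) = 6 * Real.log 2 - Real.log (192 / 140) := by
      rw [show (140 / 3 : ℝ) = 2 ^ 6 / (192 / 140) by norm_num, Real.log_div (by norm_num) (by norm_num), Real.log_pow]
      norm_num
    have h3 := Real.log_two_gt_d9
    have h4 := Real.log_le_sub_one_of_pos (show (0 : ℝ) < 192 / 140 by norm_num)
    norm_num at h3 h4 ⊢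
    linarith
  have hSr : ((S2 + 3 : ℕ) : ℝ) = (S2 : ℝ) + 3 := by push_cast; ring
  have hKr : ((2 * D * S2 : ℕ) : ℝ) = 2 * (D : ℝ) * S2 := by push_cast; ring
  have hδq : 3 * ((S2 + 3 : ℕ) : ℝ) * δ * q ^ (4 * (2 * D * S2)) ≤ 1 := by
    have h1 : δ ≤ 2 ^ 59 / (W : ℝ) ^ p := by
      rw [hδdef, div_le_div_iff₀ (by positivity) hWpr]
      have : ((B * e * r ^ 2 : ℕ) : ℝ) ≤ 2 ^ 59 * 9 := by norm_num at hBeR ⊢; linarith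
      calc ((B * e * r ^ 2 : ℕ) : ℝ) * (W : ℝ) ^ p ≤ (2 ^ 59 * 9) * (W : ℝ) ^ p := by gcongr
        _ = _ := by ring
    have h2 : 3 * ((S2 + 3 : ℕ) : ℝ) * (2 ^ 59 / (W : ℝ) ^ p) * q ^ (4 * (2 * D * S2)) ≤ 1 := by
      rw [mul_div_assoc', div_mul_eq_mul_div, div_le_one hWpr]
      rw [← Real.log_le_log_iff (by positivity) hWpr, Real.log_mul (by positivity) (by positivity),
        Real.log_mul (by positivity) (by positivity), Real.log_pow, Real.log_pow, Real.log_pow]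
      have h3 : Real.log (3 * ((S2 + 3 : ℕ) : ℝ)) ≤ 3 * ((S2 : ℝ) + 3) := by
        rw [hSr]
        have := Real.log_le_sub_one_of_pos (show 0 < 3 * ((S2 : ℝ) + 3) by positivity)
        linarith
      have h4 := num_delta D p S2 lam (Real.log q) _ hdr hp1r hlam hS2b hS30 hlq1 (by linarith) h3
      have h5 := Real.log_two_lt_d9
      have h6 : ((59 : ℕ) : ℝ) * Real.log 2 ≤ 41 := by
        norm_num at h5 ⊢
        linarith
      have h7 : ((4 * (2 * D * S2) : ℕ) : ℝ) * Real.log q = 8 * D * S2 * Real.log q := by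
        push_cast; ring
      rw [h7]
      linarith
    refine le_trans ?_ h2
    gcongr
  have hmain := interp_ineq (2 * D * S2) (8 * D) S2 p w W 9 B q 7 δ
    (by have : 0 < 2 * D * S2 := by positivity
        omega) hw (by omega) (by norm_num) hB0 hB9 (by nlinarith)
    (by have : 0 < 2 * D * S2 := by positivity
        have : 8 * D * S2 = 4 * (2 * D * S2) := by ring
        omega) htp hδ hplog hq1
    (by rw [hKr]; exact num_x D p S2 _ hdr (Nat.cast_nonneg _) hp2r hS30 hSr)
    (by rw [hKr, hSr]
        have : (140 : ℝ) * D ≤ p := by nlinarith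
        nlinarith) hδq
  rw [hKr] at hmain
  have hlK := log_le_lin (12 * (2 * (D : ℝ) * S2)) 16 (by positivity)
  refine num_final D (2 * D * S2) S2 _ lam (Real.log q) (Real.log B) (Real.log (12 * (2 * (D : ℝ) * S2))) hdr rfl hS30 hSr hS2a hlq2 hlogB ?_ ?_
  · norm_num at hlK ⊢
    linarith
  · have e8 : ((8 * D : ℕ) : ℝ) = 8 * (D : ℝ) := by push_cast; ring
    rw [e8] at hmain
    exact hmain

lemma norm_eqB {p : ℕ} {α : R5} {A B : ℤ} (h : α^p = ⟨2,1⟩ * ⟨A,B⟩) :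
    α.norm ^ p = 9 * (A^2+5*B^2) := by
  have h1 := congrArg Zsqrtd.norm h
  have h2 : (α^p).norm = α.norm^p := by
    have := map_pow (Zsqrtd.normMonoidHom (d := -5)) α p
    exact this
  rw [h2, Zsqrtd.norm_mul, norm5 ⟨2,1⟩, norm5 ⟨A,B⟩] at h1
  rw [h1]; norm_num

lemma large_aux {p : ℕ} (hp : 19600 ≤ p) {w Y ρ B e : ℤ} {r : ℤ} (hr0 : 0 < r) (hr : r ≤ 10^6)
    (hρ : ρ = r ∨ ρ = -r) (hw : 0 ≤ w) (hY : Y ≠ 0) (hB0 : 0 < B) (hB : B ≤ 8000) (hB9 : B ≠ 9)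
    (he0 : 0 < e) (he : e ≤ 180) (hY1 : B ≠ 1 → Y.natAbs ≠ 1)
    (h : B * w^p = 9 * (Y^2)^p + B * e * ρ^2) : False := by
  have hρ2 : ρ^2 = r^2 := by rcases hρ with h | h <;> rw [h]; ring
  rw [hρ2] at h
  lift w to ℕ using hw
  lift r to ℕ using hr0.le
  lift B to ℕ using hB0.le
  lift e to ℕ using he0.le
  have hYY : Y^2 = ((Y.natAbs^2 : ℕ) : ℤ) := by push_cast; exact (sq_abs Y).symm
  rw [hYY] at h
  have h' : B * w^p = 9 * (Y.natAbs^2)^p + B * e * r^2 := by exact_mod_cast h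
  have hYn : 0 < Y.natAbs := Int.natAbs_pos.mpr hY
  have hr' : r ≤ 10^6 := by exact_mod_cast hr
  have hr0' : 0 < r := by exact_mod_cast hr0
  have hB0' : 0 < B := by exact_mod_cast hB0
  have he0' : 0 < e := by exact_mod_cast he0
  have he' : e ≤ 180 := by exact_mod_cast he
  have hw0 : 0 < w := by
    rcases Nat.eq_zero_or_pos w with h0 | h0
    · rw [h0, zero_pow (by omega)] at h'
      have : 0 < B * e * r^2 := by positivity
      omega
    · exact h0
  by_cases hY2 : Y.natAbs = 1
  · have hB1 : B = 1 := by
      by_contra hne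
      exact hY1 (by exact_mod_cast hne) hY2
    rw [hY2, hB1] at h'
    simp only [one_mul, one_pow, mul_one] at h'
    rcases Nat.lt_or_ge w 2 with h2 | h2
    · have : w = 1 := by omega
      rw [this] at h'; simp at h'
      omega
    · have h3 : 2^64 ≤ w^p := (Nat.pow_le_pow_right (by norm_num) (by omega)).trans (Nat.pow_le_pow_left h2 p)
      have h4 : e * r^2 ≤ 180 * (10^6)^2 := by gcongr
      omega
  · have hW : 2 ≤ Y.natAbs^2 := by
      have : 2 ≤ Y.natAbs := by omega
      nlinarith
    exact big_core p w _ B e r hp hB0' (by exact_mod_cast hB) (by exact_mod_cast hB9.symm) he' hr' he0' hr0' hW hw0 h'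

theorem large_p {p : ℕ} (hp : 19600 ≤ p) {r : ℤ} {cs : ℕ} (hr0 : 0 < r) (hr : r ≤ 10^6)
    (h : SolB p r cs) : False := by
  obtain ⟨α, A, B, Y, ρ, hc, hα, hρ, hY, ho, h3, hcs⟩ := h
  have hn := norm_eqB hα
  have hw := norm5_nonneg α
  have sw : (Y^2)^p = (Y^p)^2 := by ring
  have hns : ∀ k : ℤ, ¬ IsUnit k → k ∣ Y^p → Y.natAbs ≠ 1 := by
    intro k hk hd h1
    apply hk
    apply isUnit_of_dvd_unit hd
    exact (Int.isUnit_iff_natAbs_eq.mpr h1).pow p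
  rcases hcs with ⟨-, h1, h2, -⟩ | ⟨-, h1, h2, -⟩ | ⟨-, h1, h2⟩ | ⟨-, h1, h2⟩
  · refine large_aux hp (B := 1) (e := 180) hr0 hr hρ hw hY (by norm_num) (by norm_num) (by norm_num) (by norm_num) (by norm_num) (by norm_num) ?_
    rw [hn, sw, ← h1, h2]; ring
  · refine large_aux hp (B := 64) (e := 45) hr0 hr hρ hw hY (by norm_num) (by norm_num) (by norm_num) (by norm_num) (by norm_num) (fun _ => hns 8 (by decide) ⟨A, h1.symm⟩) ?_
    rw [hn, sw, ← h1, h2]; ring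
  · refine large_aux hp (B := 125) (e := 36) hr0 hr hρ hw hY (by norm_num) (by norm_num) (by norm_num) (by norm_num) (by norm_num) (fun _ => hns 25 (by decide) ⟨B, h1.symm⟩) ?_
    rw [hn, sw, ← h1, h2]; ring
  · refine large_aux hp (B := 8000) (e := 9) hr0 hr hρ hw hY (by norm_num) (by norm_num) (by norm_num) (by norm_num) (by norm_num) (fun _ => hns 200 (by decide) ⟨B, h1.symm⟩) ?_
    rw [hn, sw, ← h1, h2]; ring

/-- Pocklington-style primality test for q = 2kp+1 -/
theorem pock {p k a q : ℕ} (hp : p.Prime) (hp2 : p ≠ 2) (hk0 : 0 < k) (hq : q = 2*k*p+1)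
    (hk : k < 2*p+2) (h1 : (a^p % q)^(2*k) % q = 1) (h2 : Nat.gcd (a^(2*k) % q + (q - 1)) q = 1) : q.Prime := by
  have hp3 : 3 ≤ p := by
    have := hp.two_le
    omega
  have hkp : 0 < k * p := by positivity
  have hq1 : q ≠ 1 := by
    have : 2*k*p = 2*(k*p) := by ring
    omega
  have hq0 : 0 < q := by omega
  by_contra hnp
  have hl : (q.minFac).Prime := Nat.minFac_prime hq1
  set l := q.minFac with hldef
  have hlq : l ∣ q := Nat.minFac_dvd q
  have : Fact l.Prime := ⟨hl⟩
  have : Fact p.Prime := ⟨hp⟩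
  have hqz : ((q : ℕ) : ZMod l) = 0 := (ZMod.natCast_eq_zero_iff q l).mpr hlq
  have cm : ∀ n : ℕ, ((n % q : ℕ) : ZMod l) = n := by
    intro n
    have := congrArg (Nat.cast (R := ZMod l)) (Nat.mod_add_div n q)
    push_cast at this
    rw [hqz, zero_mul, add_zero] at this
    exact this
  have e1 : ((a : ZMod l)^(2*k))^p = 1 := by
    have := congrArg (Nat.cast (R := ZMod l)) h1
    rw [cm] at this
    push_cast at this
    rw [cm] at this
    push_cast at this
    rw [← this, ← pow_mul, ← pow_mul, mul_comm]
  have e2 : (a : ZMod l)^(2*k) ≠ 1 := by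
    intro hh
    have h3 : ((a^(2*k) % q + (q-1) : ℕ) : ZMod l) = 0 := by
      rw [Nat.cast_add, cm, Nat.cast_sub (by omega), hqz]
      push_cast
      rw [hh]; ring
    have h4 := (ZMod.natCast_eq_zero_iff _ l).mp h3
    have h5 := Nat.dvd_gcd h4 hlq
    rw [h2] at h5
    exact hl.one_lt.ne' (Nat.dvd_one.mp h5)
  have e3 : orderOf ((a : ZMod l)^(2*k)) = p := orderOf_eq_prime e1 e2
  have hne : (a : ZMod l)^(2*k) ≠ 0 := by
    intro h0
    rw [h0, zero_pow hp.ne_zero] at e1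
    exact zero_ne_one e1
  have e4 : p ∣ l - 1 := by
    rw [← e3]; exact ZMod.orderOf_dvd_card_sub_one hne
  obtain ⟨m, hm⟩ := e4
  have hlodd : l % 2 = 1 := by
    rcases hl.eq_two_or_odd with h | h
    · rw [h] at hlq
      have : 2*k*p = 2*(k*p) := by ring
      omega
    · exact h
  have hl2 := hl.two_le
  have hpodd : p % 2 = 1 := hp.eq_two_or_odd.resolve_left hp2
  have hm2 : 2 ≤ m := by
    rcases m with _ | _ | m
    · omega
    · simp at hm; omega
    · omega
  have hlb : 2*p+1 ≤ l := by
    have : p*2 ≤ p*m := Nat.mul_le_mul_left p hm2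
    omega
  have hsq := Nat.minFac_sq_le_self hq0 hnp
  rw [← hldef] at hsq
  have h6 : (2*p+1)^2 ≤ l^2 := Nat.pow_le_pow_left hlb 2
  have h7 : 2*k*p ≤ 2*(2*p+1)*p := by
    apply Nat.mul_le_mul_right; omega
  nlinarith

def red5 {q : ℕ} (s : ZMod q) (hs : s^2 = -5) : R5 →+* ZMod q :=
  Zsqrtd.lift ⟨s, by rw [← sq, hs]; push_cast; ring⟩

lemma red5_apply {q : ℕ} (s : ZMod q) (hs : s^2 = -5) (a b : ℤ) : red5 s hs ⟨a,b⟩ = a + b * s := by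
  simp [red5, Zsqrtd.lift]

/-- local information: exists ξ1 ξ2, each zero or 2k-th roots of unity, not both zero -/
theorem local_pair {p k q : ℕ} [Fact q.Prime] (hq : q = 2*k*p+1) (hk : 0 < k) (hp : 3 < p)
    {s : ZMod q} (hs : s^2 = -5) {α : R5} {A B : ℤ} (hc : IsCoprime A B) (h : α^p = ⟨2,1⟩*⟨A,B⟩) :
    ∃ x1 x2 : ZMod q, (x1 = 0 ∨ x1^(2*k) = 1) ∧ (x2 = 0 ∨ x2^(2*k) = 1) ∧ ¬ (x1 = 0 ∧ x2 = 0) ∧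
      x1 = (2+s)*(A+B*s) ∧ x2 = (2-s)*(A-B*s) := by
  have hs' : (-s)^2 = -5 := by rw [neg_sq, hs]
  have h1 := congrArg (red5 s hs) h
  have h2 := congrArg (red5 (-s) hs') h
  rw [map_pow, map_mul, red5_apply _ _ 2 1, red5_apply _ _ A B] at h1 h2
  have key : ∀ z : ZMod q, z^p = 0 ∨ (z^p)^(2*k) = 1 := by
    intro z
    by_cases hz : z = 0
    · left; rw [hz, zero_pow (by omega)]
    · right
      rw [← pow_mul, show p*(2*k) = q - 1 by rw [hq]; simp; ring]
      exact ZMod.pow_card_sub_one_eq_one hz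
  have hkp : p ≤ k * p := Nat.le_mul_of_pos_left p hk
  have hq8 : 8 < q := by
    have : 2*k*p = 2*(k*p) := by ring
    omega
  have hn0 : ∀ n : ℕ, 0 < n → n < q → ((n:ℕ) : ZMod q) ≠ 0 := by
    intro n hn hnq h0
    exact absurd (Nat.le_of_dvd hn ((ZMod.natCast_eq_zero_iff n q).mp h0)) (by omega)
  have h20 : (2 : ZMod q) ≠ 0 := by exact_mod_cast hn0 2 (by norm_num) (by omega)
  have h30 : (3 : ZMod q) ≠ 0 := by exact_mod_cast hn0 3 (by norm_num) (by omega)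
  have h50 : (5 : ZMod q) ≠ 0 := by exact_mod_cast hn0 5 (by norm_num) (by omega)
  have hs0 : s ≠ 0 := by
    rintro rfl
    apply h50
    have : (0:ZMod q)^2 = 0 := by norm_num
    rw [this] at hs
    linear_combination hs
  refine ⟨(red5 s hs α)^p, (red5 (-s) hs' α)^p, key _, key _, ?_, ?_, ?_⟩
  · rintro ⟨h3, h4⟩
    rw [h3] at h1; rw [h4] at h2
    push_cast at h1 h2
    have hprod : (2+s)*(2-s) = 3^2 := by linear_combination -hs
    have hA : (A : ZMod q) = 0 := by
      have : (2*3^2 : ZMod q) * A = 0 := by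
        linear_combination -(2-s)*h1 - (2+s)*h2 - 2*A*hprod
      rcases mul_eq_zero.mp this with h | h
      · exact absurd h (mul_ne_zero h20 (pow_ne_zero 2 h30))
      · exact h
    have hB : (B : ZMod q) = 0 := by
      have : (2*3^2*s : ZMod q) * B = 0 := by
        linear_combination -(2-s)*h1 + (2+s)*h2 - 2*s*B*hprod
      rcases mul_eq_zero.mp this with h | h
      · exact absurd h (mul_ne_zero (mul_ne_zero h20 (pow_ne_zero 2 h30)) hs0)
      · exact h
    obtain ⟨u, v, huv⟩ := hc
    have := congrArg (Int.cast (R := ZMod q)) huv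
    push_cast at this
    rw [hA, hB] at this
    simp at this
  · rw [h1]; push_cast; ring
  · rw [h2]; push_cast; ring

def sFac (q n E0 F0 E1 F1 E2 F2 E3 F3 y : ℕ) : ℕ :=
  (fun T => T*((T*E0+F0)*((T*E1+F1)*((T*E2+F2)*(T*E3+F3))))) (y^n % q)

def sLoop (q g : ℕ) (f : ℕ → ℕ) (n : ℕ) : ℕ → ℕ → ℕ :=
  Nat.rec (fun _ acc => acc) (fun _ ih u acc => ih (u*g%q) (acc * ((u+(q-1)) * f u) % q)) n

def sChk (p k a s m0 m1 m2 m3 : ℕ) : Bool :=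
  (fun q n =>
    (fun g P1 P2 F G =>
      (fun f => 
        (Nat.ble k (2*p+1)) && ((Nat.ble 1 k) && ((Nat.beq (g^n % q) 1) && ((Nat.beq (Nat.gcd (a^n % q + (q-1)) q) 1) &&
        ((Nat.beq ((s*s+5)%q) 0) && ((Nat.ble s q) &&
         Nat.ble 1 (sLoop q g (fun u => f (P2+P1*u)) (n-1) g (f 4 * (f P1 * f P2) % q)))))))) 
      (sFac q n 1 (F*m0) (1 + m1*(8^n-1)) (F*m1) (1 + m2*(25^n-1)) (G*m2) (1+m3*(200^n-1)) (G*m3)))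
      (a^p%q) (2+s) (2+(q-s)) (q - (18^n%q)) (q - ((18^n*(q-5)^k)%q)))
   (2*k*p+1) (2*k)

/-- odd k : square root of -5 -/
def sRt (p k : ℕ) : ℕ := (fun q => ((5^p%q)^((k-1)/2) * 5^((p+1)/2)) % q) (2*k*p+1)

lemma sLoop_succ (q g : ℕ) (f : ℕ → ℕ) (n u acc : ℕ) :
    sLoop q g f (n+1) u acc = sLoop q g f n (u*g%q) (acc * ((u+(q-1)) * f u) % q) := rfl

lemma sLoop_lt {q : ℕ} (hq : 0 < q) (g : ℕ) (f : ℕ → ℕ) (n : ℕ) : ∀ u acc, acc < q → sLoop q g f n u acc < q := by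
  induction n with
  | zero => intro u acc h; exact h
  | succ n ih => intro u acc h; rw [sLoop_succ]; exact ih _ _ (Nat.mod_lt _ hq)

lemma sLoop_spec {q : ℕ} [Fact q.Prime] (g : ℕ) (f : ℕ → ℕ) (F : ZMod q → ZMod q)
    (hf : ∀ u : ℕ, ((f u : ℕ) : ZMod q) = F u) (n : ℕ) : ∀ u acc : ℕ,
    ((sLoop q g f n u acc : ℕ) : ZMod q) ≠ 0 →
    ((acc : ℕ) : ZMod q) ≠ 0 ∧ ∀ i < n, (u : ZMod q) * g^i ≠ 1 ∧ F ((u : ZMod q) * g^i) ≠ 0 := by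
  have hq1 : 1 ≤ q := (Fact.out : q.Prime).one_le
  induction n with
  | zero => intro u acc h; exact ⟨h, by intro i hi; omega⟩
  | succ n ih =>
    intro u acc h
    rw [sLoop_succ] at h
    obtain ⟨h1, h2⟩ := ih _ _ h
    rw [ZMod.natCast_mod] at h1
    push_cast [Nat.cast_sub hq1] at h1
    rw [hf, ZMod.natCast_self] at h1
    have h3 : (acc : ZMod q) ≠ 0 := left_ne_zero_of_mul h1
    have h4 := right_ne_zero_of_mul h1
    refine ⟨h3, ?_⟩
    intro i hi
    rcases i with _ | i
    · rw [pow_zero, mul_one]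
      refine ⟨?_, right_ne_zero_of_mul h4⟩
      intro h5
      apply left_ne_zero_of_mul h4
      rw [h5]; ring
    · have := h2 i (by omega)
      rw [ZMod.natCast_mod] at this
      push_cast at this
      rw [show (u : ZMod q) * g^(i+1) = u * g * g^i by ring]
      exact this

/-- relation in each of the cases -/
lemma caseB_rel {p k q : ℕ} [Fact q.Prime] (hp3 : 3 < p) (hk : 0 < k) (hq : q = 2*k*p+1)
    {s : ZMod q} (hs : s^2 = -5) {r : ℤ} {cs : ℕ} (h : SolB p r cs) :
    ∃ (y c E : ZMod q) (ξ : ZMod q), (ξ = 0 ∨ ξ^(2*k) = 1) ∧ (y = (2-s) + (2+s)*ξ ∨ y = 2+s) ∧ 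
     (y = 0 ∨ (E*y)^(2*k) = c^(2*k)) ∧ 
     ((cs = 0 ∧ E = 1 ∧ c = 18) ∨ (cs = 1 ∧ E = 8 ∧ c = 18) ∨ (cs = 2 ∧ E = 25 ∧ c = 18*s) ∨ (cs = 3 ∧ E = 200 ∧ c = 18*s)) := by
  obtain ⟨α, A, B, Y, ρ, hc, hα, hρ, hY, ho, h3, hcs⟩ := h
  obtain ⟨x1, x2, hx1, hx2, hne, e1, e2⟩ := local_pair hq hk hp3 hs hc hα
  have hA : (2-s)*x1 + (2+s)*x2 = 18*A := by
    rw [e1, e2]; linear_combination (-2*A)*hs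
  have hB : (2-s)*x1 - (2+s)*x2 = 18*s*B := by
    rw [e1, e2]; linear_combination (-2*s*B)*hs
  have hm1 : (-1 : ZMod q)^(2*k) = 1 := by rw [pow_mul]; simp
  have hyp : ((Y : ZMod q)^p) = 0 ∨ ((Y : ZMod q)^p)^(2*k) = 1 := by
    by_cases hz : (Y : ZMod q) = 0
    · left; rw [hz, zero_pow (by omega)]
    · right
      rw [← pow_mul, show p*(2*k) = q - 1 by rw [hq]; simp; ring]
      exact ZMod.pow_card_sub_one_eq_one hz
  -- normalise: for sign σ=±1
  have hq18 : ∀ (E c σ : ZMod q), σ^2 = 1 → σ^(2*k) = 1 → E ≠ 0 → E * ((2-s)*x1 + σ*((2+s)*x2)) = c * (Y : ZMod q)^p → 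
      ∃ (y ξ : ZMod q), (ξ = 0 ∨ ξ^(2*k) = 1) ∧ (y = (2-s) + (2+s)*ξ ∨ y = 2+s) ∧ (y = 0 ∨ (E*y)^(2*k) = c^(2*k)) := by
    intro E c σ hσ2 hσ hE heq
    by_cases h10 : x1 = 0
    · have h20 : x2 ≠ 0 := fun h => hne ⟨h10, h⟩
      have hx2' := hx2.resolve_left h20
      refine ⟨2+s, 0, Or.inl rfl, Or.inr rfl, ?_⟩
      rw [h10, mul_zero, zero_add] at heq
      rcases hyp with h0 | h1
      · left
        rw [h0, mul_zero] at heq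
        have hσ0 : σ ≠ 0 := by rintro rfl; simp at hσ2
        have := (mul_eq_zero.mp heq).resolve_left hE
        have := (mul_eq_zero.mp this).resolve_left hσ0
        exact (mul_eq_zero.mp this).resolve_right h20
      · right
        have := congrArg (· ^ (2*k)) heq
        simp only [mul_pow] at this
        rw [hσ, hx2', ← mul_pow c, mul_pow c, h1] at this
        rw [mul_pow]
        linear_combination this
    · have hx1' := hx1.resolve_left h10
      refine ⟨(2-s)+(2+s)*(σ*x2/x1), σ*x2/x1, ?_, Or.inl rfl, ?_⟩
      · rcases hx2 with h | h
        · left; rw [h]; simp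
        · right; rw [div_pow, mul_pow, hσ, h, hx1']; simp
      · have heq2 : E * ((2-s)+(2+s)*(σ*x2/x1)) * x1 = c * (Y : ZMod q)^p := by
          rw [← heq]; field_simp
        rcases hyp with h0 | h1
        · left
          rw [h0, mul_zero] at heq2
          have := (mul_eq_zero.mp heq2).resolve_right h10
          exact (mul_eq_zero.mp this).resolve_left hE
        · right
          have := congrArg (· ^ (2*k)) heq2
          beta_reduce at this
          rw [mul_pow _ x1, mul_pow c, h1, hx1', mul_one, mul_one] at this
          exact this
  have hkp : p ≤ k * p := Nat.le_mul_of_pos_left p hk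
  have hq8 : 8 < q := by
    have : 2*k*p = 2*(k*p) := by ring
    omega
  have hn0 : ∀ n : ℕ, 0 < n → n < q → ((n:ℕ) : ZMod q) ≠ 0 := by
    intro n hn hnq h0
    exact absurd (Nat.le_of_dvd hn ((ZMod.natCast_eq_zero_iff n q).mp h0)) (by omega)
  have h20 : (2 : ZMod q) ≠ 0 := by exact_mod_cast hn0 2 (by norm_num) (by omega)
  have h50 : (5 : ZMod q) ≠ 0 := by exact_mod_cast hn0 5 (by norm_num) (by omega)
  have h80 : (8 : ZMod q) ≠ 0 := by exact_mod_cast hn0 8 (by norm_num) (by omega)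
  have h250 : (25 : ZMod q) ≠ 0 := by
    rw [show (25 : ZMod q) = 5*5 by norm_num]; exact mul_ne_zero h50 h50
  have h200 : (200 : ZMod q) ≠ 0 := by
    rw [show (200 : ZMod q) = 8*25 by norm_num]; exact mul_ne_zero h80 h250
  rcases hcs with ⟨hc0, h1, h2, -⟩ | ⟨hc0, h1, h2, -⟩ | ⟨hc0, h1, h2⟩ | ⟨hc0, h1, h2⟩
  · obtain ⟨y, ξ, i1, i2, i3⟩ := hq18 1 18 1 (by ring) (by simp) one_ne_zero (by
      have := congrArg (Int.cast (R := ZMod q)) h1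
      push_cast at this
      linear_combination hA + 18 * this)
    exact ⟨y, 18, 1, ξ, i1, i2, i3, Or.inl ⟨hc0, rfl, rfl⟩⟩
  · obtain ⟨y, ξ, i1, i2, i3⟩ := hq18 8 18 1 (by ring) (by simp) h80 (by
      have := congrArg (Int.cast (R := ZMod q)) h1
      push_cast at this
      linear_combination 8*hA + 18 * this)
    exact ⟨y, 18, 8, ξ, i1, i2, i3, Or.inr (Or.inl ⟨hc0, rfl, rfl⟩)⟩
  · obtain ⟨y, ξ, i1, i2, i3⟩ := hq18 25 (18*s) (-1) (by ring) hm1 h250 (by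
      have := congrArg (Int.cast (R := ZMod q)) h1
      push_cast at this
      linear_combination 25*hB + 18 *s * this)
    exact ⟨y, 18*s, 25, ξ, i1, i2, i3, Or.inr (Or.inr (Or.inl ⟨hc0, rfl, rfl⟩))⟩
  · obtain ⟨y, ξ, i1, i2, i3⟩ := hq18 200 (18*s) (-1) (by ring) hm1 h200 (by
      have := congrArg (Int.cast (R := ZMod q)) h1
      push_cast at this
      linear_combination 200*hB + 18 *s* this)
    exact ⟨y, 18*s, 200, ξ, i1, i2, i3, Or.inr (Or.inr (Or.inr ⟨hc0, rfl, rfl⟩))⟩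

/-- roots of unity enumerated by a generator -/
lemma roots_enum {q n : ℕ} [Fact q.Prime] (hn : 0 < n) {g : ZMod q} (hg : g^n = 1)
    (hne : ∀ i < n - 1, g * g^i ≠ 1) {ξ : ZMod q} (hξ : ξ^n = 1) : ξ = 1 ∨ ∃ i < n - 1, ξ = g * g^i := by
  have hord : orderOf g = n := by
    rw [orderOf_eq_iff hn]
    refine ⟨hg, ?_⟩
    intro m hm hm0
    have := hne (m-1) (by omega)
    rwa [← pow_succ', show m - 1 + 1 = m by omega] at this
  have hprim : IsPrimitiveRoot g n := hord ▸ IsPrimitiveRoot.orderOf g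
  have : NeZero n := ⟨hn.ne'⟩
  obtain ⟨i, hi, hi2⟩ := hprim.eq_pow_of_pow_eq_one hξ
  rcases i with _ | i
  · left; rw [← hi2, pow_zero]
  · right; exact ⟨i, by omega, by rw [← hi2, pow_succ']⟩

def cbit (cs m0 m1 m2 m3 : ℕ) : ℕ := if cs = 0 then m0 else if cs = 1 then m1 else if cs = 2 then m2 else m3

theorem sChk_sound {p k a s m0 m1 m2 m3 : ℕ} (hp : p.Prime) (hp3 : 3 < p)
    (h : sChk p k a s m0 m1 m2 m3 = true) {r : ℤ} {cs : ℕ} (hm : cbit cs m0 m1 m2 m3 = 1)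
    (hsol : SolB p r cs) : False := by
  unfold sChk at h
  simp only [Bool.and_eq_true, Nat.ble_eq, Nat.beq_eq] at h
  obtain ⟨hk2, hk1, hg, hgcd, hs, hsq, hl⟩ := h
  generalize hq : 2*k*p+1 = q at *
  have hqp : q.Prime := pock hp (by omega) hk1 hq.symm (by omega) hg hgcd
  have : Fact q.Prime := ⟨hqp⟩
  have hq0 : 0 < q := hqp.pos
  set n := 2*k with hn
  have hkp : p ≤ k * p := Nat.le_mul_of_pos_left p hk1
  have hq8 : 8 < q := by
    have : n*p = 2*(k*p) := by rw [hn]; ring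
    omega
  have hsz : (s : ZMod q)^2 = -5 := by
    have h1 : ((s*s+5 : ℕ) : ZMod q) = 0 := by
      rw [ZMod.natCast_eq_zero_iff]; exact Nat.dvd_of_mod_eq_zero hs
    push_cast at h1
    linear_combination h1
  set g := a^p % q with hgdef
  have hgz : (g : ZMod q)^n = 1 := by
    have h1 := congrArg (Nat.cast (R := ZMod q)) hg
    rw [ZMod.natCast_mod] at h1
    push_cast at h1
    exact h1
  set f : ℕ → ℕ := sFac q n 1 ((q - (18^n%q))*m0) (1 + m1*(8^n-1)) ((q - (18^n%q))*m1) (1 + m2*(25^n-1))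
    ((q - ((18^n*(q-5)^k)%q))*m2) (1+m3*(200^n-1)) ((q - ((18^n*(q-5)^k)%q))*m3) with hf
  have c1 : (((q - (18^n%q) : ℕ)) : ZMod q) = -18^n := by
    rw [Nat.cast_sub (Nat.mod_lt _ hq0).le, ZMod.natCast_mod, ZMod.natCast_self]
    push_cast; ring
  have c2 : (((q - ((18^n*(q-5)^k)%q) : ℕ)) : ZMod q) = -(18*(s:ZMod q))^n := by
    rw [Nat.cast_sub (Nat.mod_lt _ hq0).le, ZMod.natCast_mod, ZMod.natCast_self]
    push_cast [Nat.cast_sub (show 5 ≤ q by omega)]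
    rw [ZMod.natCast_self, mul_pow, hn, pow_mul (s : ZMod q), hsz]; ring
  have c3 : ∀ e : ℕ, 0 < e → ((e^n - 1 : ℕ) : ZMod q) = (e : ZMod q)^n - 1 := by
    intro e he
    rw [Nat.cast_sub (Nat.one_le_pow _ _ he)]; push_cast; ring
  let Φ : ZMod q → ZMod q := fun y => y^n * ((y^n*1 + (-18^n)*m0) * ((y^n*(1+m1*(8^n-1)) + (-18^n)*m1) *
    ((y^n*(1+m2*(25^n-1)) + (-(18*(s:ZMod q))^n)*m2) * (y^n*(1+m3*(200^n-1)) + (-(18*(s:ZMod q))^n)*m3))))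
  have hfΦ : ∀ y : ℕ, ((f y : ℕ) : ZMod q) = Φ y := by
    intro y
    simp only [hf, sFac, Φ]
    have d1 := c3 8 (by norm_num)
    have d2 := c3 25 (by norm_num)
    have d3 := c3 200 (by norm_num)
    simp only [Nat.cast_mul, Nat.cast_add, ZMod.natCast_mod, c1, c2, d1, d2, d3, Nat.cast_pow, Nat.cast_one, Nat.cast_ofNat]
  have hP2 : ((2 + (q - s) : ℕ) : ZMod q) = 2 - s := by
    push_cast [Nat.cast_sub hsq]; rw [ZMod.natCast_self]; ring
  have hl0 : ((sLoop q g (fun u => f (2 + (q - s) + (2+s)*u)) (n-1) g (f 4 * (f (2+s) * f (2+(q-s))) % q) : ℕ) : ZMod q) ≠ 0 := by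
    intro h0
    rw [ZMod.natCast_eq_zero_iff] at h0
    have h1 := sLoop_lt hq0 g (fun u => f (2 + (q - s) + (2+s)*u)) (n-1) g _ (Nat.mod_lt (f 4 * (f (2+s) * f (2+(q-s)))) hq0)
    have h2 := Nat.le_of_dvd hl h0
    omega
  have hspec := sLoop_spec g _ (fun u => Φ ((2 - s) + (2+s)*u)) (by
    intro u
    rw [hfΦ, Nat.cast_add, hP2]; push_cast; rfl) (n-1) g _ hl0
  obtain ⟨ha, hi⟩ := hspec
  rw [ZMod.natCast_mod] at ha
  push_cast at ha
  rw [hfΦ, hfΦ, hfΦ] at ha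
  have ha4 := left_ne_zero_of_mul ha
  have ha5 := right_ne_zero_of_mul ha
  have haP1 := left_ne_zero_of_mul ha5
  have haP2 := right_ne_zero_of_mul ha5
  rw [hP2] at haP2
  push_cast at ha4 haP1
  obtain ⟨y, c, E, ξ, hξ, hy, hrel, hcs⟩ := caseB_rel hp3 hk1 hq.symm hsz hsol
  have hΦy : Φ y ≠ 0 := by
    rcases hy with hy | hy
    · rcases hξ with h0 | h1
      · rw [hy, h0, mul_zero, add_zero]; exact haP2
      · rcases roots_enum (by omega) hgz (fun i hi' => (hi i hi').1) h1 with h2 | ⟨i, hi', h2⟩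
        · rw [hy, h2]
          rw [show (2 - (s : ZMod q) + (2+s)*1) = 4 by ring]; exact ha4
        · rw [hy, h2]; exact (hi i hi').2
    · rw [hy]; exact haP1
  apply hΦy
  rcases hrel with h0 | h1
  · simp only [Φ]; rw [h0, zero_pow (by omega)]; ring
  · rw [mul_pow] at h1
    rcases hcs with ⟨h2, h3, h4⟩ | ⟨h2, h3, h4⟩ | ⟨h2, h3, h4⟩ | ⟨h2, h3, h4⟩
    · simp only [cbit, h2, if_true] at hm
      have : y^n*1 + (-18^n)*(m0 : ZMod q) = 0 := by
        rw [hm, ← h4, ← h1, h3]; push_cast; ring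
      simp only [Φ]; rw [this]; ring
    · simp [cbit, h2] at hm
      have : y^n*(1+m1*(8^n-1)) + (-18^n)*(m1 : ZMod q) = 0 := by
        rw [hm, ← h4, ← h1, h3]; push_cast; ring
      simp only [Φ]; rw [this]; ring
    · simp [cbit, h2] at hm
      have : y^n*(1+m2*(25^n-1)) + (-(18*(s:ZMod q))^n)*(m2 : ZMod q) = 0 := by
        rw [hm, ← h4, ← h1, h3]; push_cast; ring
      simp only [Φ]; rw [this]; ring
    · simp [cbit, h2] at hm
      have : y^n*(1+m3*(200^n-1)) + (-(18*(s:ZMod q))^n)*(m3 : ZMod q) = 0 := by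
        rw [hm, ← h4, ← h1, h3]; push_cast; ring
      simp only [Φ]; rw [this]; ring

def sPR : ℕ := 10014646650599190067509233131649940057366334653200433090
def sEX : ℕ := 24218556528021278204540194287821

/-- driver: entry i is k + 256 a -/
def sDrv (N fuel : ℕ) : ℕ → ℕ → Bool :=
  Nat.rec (fun _ _ => true) (fun _ ih m i =>
    cond (Nat.beq (Nat.gcd m sPR) 1)
      ((fun e => cond (Nat.beq e 0) (Nat.beq (sEX % m) 0) (sChk m (e % 256) (e / 256) (sRt m (e % 256)) 1 1 1 1))
        ((N >>> (16 * i)) % 65536) && ih (m+2) (i+1))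
      (ih (m+2) i)) fuel

lemma sPR_no (m : ℕ) (hm : 140 ≤ m) (hp : m.Prime) (hd : m ∣ sPR) : False := by
  have key : sPR = ((List.range 140).filter Nat.Prime).prod := by decide +kernel
  rw [key, hp.prime.dvd_prod_iff] at hd
  obtain ⟨a, ha, hda⟩ := hd
  simp only [List.mem_filter, List.mem_range, decide_eq_true_eq] at ha
  have := Nat.le_of_dvd ha.2.pos hda
  omega

lemma sDrv_sound (N fuel : ℕ) : ∀ m i, sDrv N fuel m i = true → 140 ≤ m → ∀ j < fuel, (m+2*j).Prime → ¬ (m+2*j) ∣ sEX →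
    ∀ (r : ℤ) (cs : ℕ), SolB (m+2*j) r cs → False := by
  induction fuel with
  | zero => intro m i _ _ j hj; omega
  | succ n ih =>
    intro m i h hm j hj hpr hex r cs hsol
    have h' : cond (Nat.beq (Nat.gcd m sPR) 1)
      ((fun e => cond (Nat.beq e 0) (Nat.beq (sEX % m) 0) (sChk m (e % 256) (e / 256) (sRt m (e % 256)) 1 1 1 1))
        ((N >>> (16 * i)) % 65536) && sDrv N n (m+2) (i+1))
      (sDrv N n (m+2) i) = true := h
    rcases j with _ | j
    · simp only [mul_zero, add_zero] at hpr hex hsol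
      have hg : Nat.gcd m sPR = 1 := by
        by_contra hne
        have h1 := Nat.minFac_prime hne
        have h2 := Nat.minFac_dvd (Nat.gcd m sPR)
        have h3 := h2.trans (Nat.gcd_dvd_left m sPR)
        have h4 := (Nat.prime_dvd_prime_iff_eq h1 hpr).mp h3
        have h5 : m ∣ sPR := h4 ▸ h2.trans (Nat.gcd_dvd_right m sPR)
        exact sPR_no m hm hpr h5
      rw [hg] at h'
      simp only [show Nat.beq 1 1 = true from rfl, cond_true, Bool.and_eq_true] at h'
      have h1 := h'.1
      generalize (N >>> (16 * i)) % 65536 = e at h1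
      rcases he : Nat.beq e 0 with _ | _
      · rw [he, cond_false] at h1
        refine sChk_sound hpr (by omega) h1 (cs := cs) ?_ hsol
        simp [cbit]
      · rw [he, cond_true, Nat.beq_eq] at h1
        exact hex (Nat.dvd_of_mod_eq_zero h1)
    · have e : m + 2*(j+1) = m+2+2*j := by ring
      rw [e] at hpr hex hsol
      rcases hb : Nat.beq (Nat.gcd m sPR) 1 with _ | _
      · rw [hb, cond_false] at h'
        exact ih _ _ h' (by omega) j (by omega) hpr hex r cs hsol
      · rw [hb, cond_true, Bool.and_eq_true] at h'
        exact ih _ _ h'.2 (by omega) j (by omega) hpr hex r cs hsol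

lemma sD149 : sDrv 0x20b020103030233031b021103150207031b0309020b030302090501051b0207020905030209051505010309063f02110503031b0201020b0209051b05010507020302010225022705131533050d051d03150203020302070501050b02090203020b03030309050b0217050b0201020b071f0209051d020d031b02110213020b0321051305090517021b031b021d02030201021d0501051d031503030213023903090351030305070501032705070211020305110201020b030902150501034506070507151b0203020b0507050903030315050d030305030303030902130315020d0517050b050703150511020d02070209053b052905070501020d050b03030507033f020d02030315050b0203020905330000050705010513051b0203033f031b05150303035100000511050b0501054702130201052f0a17020b020702210203051d0201020303030503050705110501020305030315050d0209021f051d000002a10213020903090247020d02170309060302030225024502010209020305010511050b02030207020903330315050102210d1b060302070201050d05290201020b00000513050b02030503020702010609030300000709020705030217050b0511051f05070207021b050106210309020303150303000007070501051d02110501051505070545020d05030513051503090215050300000707021102030209020300000215020300000201051102010303030305070315050305010303020702010627050d05110315030902090511050103030213020100000000000002030507 1000 149 0 = true := by decide +kernel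

lemma sD2149 : sDrv 0x507035705090203031503090239020302070201021d050b05070217050b0207051b020306151103054f0321073f031b0515061b0615051d020905010b090209020d033f050103330501030903330233020105010303022903090e0903090201021b02110521020703090515051705030503071503030539020b0321170305010513051b03090201022f03030217030902310b03030302070507212702030517020305090501021d0549031b022105030513050b020102030303022502150351050b02130321020b032105430507030902111303050b0207020b0511030302110203061b0715021d07070507053d030913030211035d0233020905170b25031b0209023303810509030305390249030305010511023f02350213020302250501020d02110309050d053b0509050105030a210227030302090303031b0249050b0213020b0567051702030507051302030201052f0201020b0209022f02110303033f02130201031b021305150503020b0315051102310217111b0303021d0507070b032102070209030303270501051d02030215051103090215032103090303020d030902070303050d060702010509051102150509020b030305010303050b0213021502330507020d0547020303030201031b050d020b0615021b03270303050703090511053903030633 1000 2149 0 = true := by decide +kernel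

lemma sD4149 : sDrv 0x21f031b05010351020102010217050703090211051d0201022b020b051705070503060902030215021105090213020b0501054f05170207053b0309052b021d02030527061503270203022107150203030302030507022f020905150201023511030501050b061b0357021b05070309020d050b0315023f025d0509020b0203060303150211020b0303050d0309035102070213020b0201021b051d020d053d0211020b0201053f0203021b0303050b0203051b05070203020d031502030201022f0a130501020d0303020705070603020d050b0501032702090303050705110501021702250309050905330203050b0207050d02010209021b050103090315020d0529020905010309050b03090507020907030309020b05010209021502030327021d020b0507052b050103030233050d02110b0302070201031b0203050b0511050d0201021d0511051f0207050d06090507020b0503031502310507051d0603050b020b03030217025b0309030303090503031506090303051102030507020b02010207020d0a0d0203030305110c150513020905010201020b03090707051d0321051d0309031b021f050b050102210207031503150303020b0507021b0303050105170527022705030339 1000 4149 0 = true := by decide +kernel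

lemma sD6149 : sDrv 0x203050705130501050b020102090303050307070309050b02130309020b0309052f0515021706310303050b020303090309020105010511020d050b023b05070201051305010321050702110509050903150303050d051105170207054d0501021705290239021105130501051d050b0713020b051502090207020d031b02150525052f05210201032705070207020d02270207021102130503020903090209050d0201073f05290515051d06210209024d0203071702750a0d0303020705430309020b05090507023b052f050102170201021303030b1b0501053b03090201050705010309021103270501030903090227051f020d0603050305010303021f030902150213031b050d02210e0302030207052902030507031503030503021502110309050b052503510321050b02070333020103030211030902090715052b031502250609050b050b031b031b055302270309020702010209020b0507050102150501051d0211020105010215021502090203031b023f050b021d0327051d050b0535030302130333020b0209050705010513021f0d15060903090303051505070501020d0203134502210517051502071527020d020105110321 1000 6149 0 = true := by decide +kernel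

lemma sD8149 : sDrv 0x50b0509050702170207051d0211050102070509052702010227030302390213050b030905090215023f03270507020303030b090515020b0511020902030525021502090627020b061505010345060302090203051302070509051502150207021d05070589033f02150209054d020305070315021b022902150321053d02030327031b020d02470303022b020702010213051103030511051305470515030302430a0705290303020b0303050107390511020d030902070a1105150201052903330303020902210207024f02011527021b021b030903210215024903270203020d050b0521021105110303020302070657052f021502090339050d0535022903090217031b021f0501021505070209020b02750203022b021b020d0507051d020d022b0315021306090233050703450303051f054902010517020303090211030902130201031b0279021d0507050105170229021d050d031b022505110209030302390511021b0511063f0309050b0201051f030905030203020b0e03051307150e1b0211050903030507055b0211031b0517065d03030b150303051d0201053b050b0501050d0333050d05170207052702170511050d0d030517 1000 8149 0 = true := by decide +kernel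

lemma sD10149 : sDrv 0x207020705070211020302010209050b05150527051102010303050105030309030303210209021b0211030302130515020302330709020702090321024f020b0511036f05010b21023502010203020105070501022703030511052903090209050303270209052b03090527031b0a33021d052b03330217021b0217054f020302070511051702030209021f050105090203022f0577051b050d052502010315050705330315052f02010327020306090503020705070303020907150525051d0515020905130215050105170207051b031502570345021107070203051105150245026b0503051d050d0207050b050902130507021d0507051105130245022f03210309050102030503020702510213021d0217021b020902010503031b031b02010627051102170245050102030309020b0209020305110315051d0201050d03030517051305090207032103090215021502070309021d055b03390703051b05070211030305110303056b03031115051303330501030302010715051f0245050b05010203024f02010203050b031503150225051f021d0231050105450a0d 1000 10149 0 = true := by decide +kernel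

lemma sD12149 : sDrv 0x351023b0203051102010515051303030215062702030209030905030327020b02110521050b02010203020b02010501021b020d0511020703030529050713450525050903150501051d020d02030211020b0321020305131503050b050d023b053302070211020902110227020705070e0903030503051d02010503053d0211021b02030303031b050102090501050b0303021d03150309020d030305090511020d020303210201023902090515051d0645032705150513021b0513050d020b0503020b0525051d050d05590309051f0507021f06090229020b0707020702450211052f050d023302010207022f033303090525031b030305010227020d05150521021b05070209050b0303021d0511020105070309050105150511030302070a1d050b031b0511051705070501021302010203020d0509021b0211051f050b0211020b033f05130333023f0533021b021302090333031502090549050305310215022102030303050b030307070211023d020b0309020902110309035105070525021502090215021d031b0501031b0315021505250503020b05010309020b051f0627029d 1000 12149 0 = true := by decide +kernel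

lemma sD14149 : sDrv 0x303073105030203021b06270501051d0a0702090345051502150517031b020302010203031505490213053f05010309050b03030517021d0531030302210309021b03030507050102490501020302010503051f0513023b05090211050d051d021f051b022b02170b0302090509051103150513034503090303028306030309051102030715050d0529020902110215021303030203051506090309051f02010503021f052b050b022105250245020b0507031b050b052103390239050905170a210209021f07110333020102270303021b050b0509020102010209022f0603030305170509020102030515051305150521031502030309050b020b05070513050d051d0207072f05110231023305350639050902030203021f05010535050b0225055305010309031505090207050705310201060303150207050d02290213020b05130303031502070633020903090201050b0203020b0201020905290245053d0303050b021305390225021b0303021d050902090303020705110203051d0547053b0203050702030321023f05290201050107150315021705070207050b030303210327050b021b02010211 1000 14149 0 = true := by decide +kernel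

lemma sD16149 : sDrv 0x207021105010217030305090209070705030221020702110309020b02010229020902030201055305030227023103391139161b020d0203070702070203050b022f020b0511020d0303050d02030245021f0a0b02090531021d0543050b0303020b0201022505110303022b020b050703090d1302150309061b0509053505090213021d053f05030513021f022103030303061b0247020b030902090315051f02090503020b051705110501050302010203021503030511050b05010309051d050302110321020b0315020905010309021b02090315030907030207031b053b031b0309070b0507052f050d051f03150547052105170207020b020703090501150905030511020d0d1b050105110715020b020305070501050105090507051b03030303070903151109031b050d0201020d051702030209052f0203052503030315050b023b0303020102130209021b0201060903030209050b050d0309050702030201053b030302150357020b020d050703090a0b02270201031b0b090201020902030507031503030215051103090333 1000 16149 0 = true := by decide +kernel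

lemma sD18149 : sDrv 0x21d0207073f02030207020105290215050b0203022103090315020902030507021b03270535051702010239022b020b050d020903150501023b050b021302010211024f020902010327050b02030227053b0321020b05750211033303090615052b050102210603021b0333051d05030309031b05090715051303150507021103150509021102070203021b05130211030303090507051d0309050102090239030902010303031b0315050102430507050302170309070d021505530209023903450529021102350207022f03030603021f031b050b0201066302170501051d050b02030507020d0209030903150309051b020105130215050d02030503031b030905070245050b02030201051b05110303020303090501050b0327051b 726 18149 0 = true := by decide +kernel

theorem sieve_mid {p : ℕ} (hp : p.Prime) (h1 : 149 ≤ p) (h2 : p < 19600) (hex : ¬ p ∣ sEX) (r : ℤ) (cs : ℕ)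
    (h : SolB p r cs) : False := by
  have hodd : p % 2 = 1 := hp.eq_two_or_odd.resolve_left (by omega)
  have go : ∀ {m fuel N : ℕ}, sDrv N fuel m 0 = true → 149 ≤ m → m % 2 = 1 → m ≤ p → p < m + 2*fuel → False := by
    intro m fuel N hD hm hm2 hle hlt
    have e : m + 2*((p-m)/2) = p := by omega
    exact sDrv_sound N fuel m 0 hD (by omega) ((p-m)/2) (by omega) (by rwa [e]) (by rwa [e]) r cs (by rwa [e])
  rcases Nat.lt_or_ge p 2149 with hlt | hge
  · exact go sD149 (by norm_num) (by norm_num) (by omega) (by omega)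
  rcases Nat.lt_or_ge p 4149 with hlt | hge
  · exact go sD2149 (by norm_num) (by norm_num) (by omega) (by omega)
  rcases Nat.lt_or_ge p 6149 with hlt | hge
  · exact go sD4149 (by norm_num) (by norm_num) (by omega) (by omega)
  rcases Nat.lt_or_ge p 8149 with hlt | hge
  · exact go sD6149 (by norm_num) (by norm_num) (by omega) (by omega)
  rcases Nat.lt_or_ge p 10149 with hlt | hge
  · exact go sD8149 (by norm_num) (by norm_num) (by omega) (by omega)
  rcases Nat.lt_or_ge p 12149 with hlt | hge
  · exact go sD10149 (by norm_num) (by norm_num) (by omega) (by omega)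
  rcases Nat.lt_or_ge p 14149 with hlt | hge
  · exact go sD12149 (by norm_num) (by norm_num) (by omega) (by omega)
  rcases Nat.lt_or_ge p 16149 with hlt | hge
  · exact go sD14149 (by norm_num) (by norm_num) (by omega) (by omega)
  rcases Nat.lt_or_ge p 18149 with hlt | hge
  · exact go sD16149 (by norm_num) (by norm_num) (by omega) (by omega)
  exact go sD18149 (by norm_num) (by norm_num) (by omega) (by omega)

def sTab : List (ℕ×ℕ×ℕ×ℕ×ℕ×ℕ×ℕ×ℕ) := [(11, 1, 5, 8, 1, 1, 1, 1), (17, 9, 5, 84, 0, 1, 0, 0), (17, 12, 21, 182, 0, 0, 1, 1), (19, 6, 6, 37, 0, 0, 1, 1), (23, 10, 2, 220, 1, 1, 1, 1), (29, 16, 3, 255, 1, 1, 1, 0), (31, 11, 5, 307, 1, 1, 1, 1), (37, 3, 3, 21, 1, 1, 1, 1), (41, 10, 2, 238, 1, 1, 1, 1), (43, 18, 2, 252, 0, 0, 1, 1), (47, 3, 3, 109, 1, 0, 1, 1), (47, 13, 5, 424, 0, 1, 0, 1), (53, 1, 2, 40, 1, 1, 1, 1), (59, 6, 2, 122, 1,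 1, 1, 1), (61, 3, 6, 27, 1, 1, 0, 1), (61, 20, 6, 121, 0, 1, 1, 1), (67, 12, 7, 216, 1, 1, 1, 1), (71, 4, 3, 160, 0, 1, 0, 1), (71, 13, 5, 547, 0, 1, 1, 0), (71, 30, 2, 1140, 1, 0, 0, 0), (73, 27, 3, 1259, 1, 0, 1, 1), (79, 9, 3, 196, 1, 1, 1, 0), (79, 17, 5, 920, 1, 1, 0, 1), (83, 1, 5, 50, 1, 1, 1, 1), (89, 6, 6, 367, 1, 1, 1, 1), (97, 2, 2, 165, 1, 1, 1, 1), (101, 3, 3, 128, 1, 1, 1, 1), (103, 18, 2, 1374, 1, 1, 1, 1), (107, 3, 11, 150, 1, 1, 1, 1), (109, 26, 3, 1291, 1, 1, 0, 0), (109, 29, 2, 2758, 0, 0, 1, 0), (113, 1, 2, 26, 1, 1, 1, 1), (127, 2, 2, 153, 1, 1, 1, 1), (131, 1, 5, 28, 1, 1, 1, 1), (137, 3, 3, 337, 1, 1, 1, 1), (139, 6, 2, 464, 1, 1, 1, 1), (157, 12, 7, 844, 1, 0, 0, 1), (157, 62, 2, 5157, 0, 1, 1, 1), (163, 8, 3,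 806, 1, 1, 1, 1), (167, 42, 6, 2200, 1, 1, 1, 1), (307, 2, 2, 366, 1, 1, 1, 1), (317, 52, 3, 13354, 1, 1, 1, 1), (359, 16, 3, 3696, 1, 1, 1, 1), (457, 23, 5, 7339, 1, 0, 1, 1), (457, 59, 5, 19231, 0, 1, 1, 1), (571, 24, 13, 5937, 1, 1, 1, 1), (619, 26, 2, 3502, 0, 0, 1, 1), (619, 27, 2, 9883, 1, 1, 0, 1), (857, 30, 2, 19153, 1, 1, 1, 1), (1049, 6, 2, 4159, 1, 1, 1, 1), (1117, 3, 5, 908, 1, 1, 0, 1), (1117, 9, 2, 5606, 1, 1, 1, 0)]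

def sExc : List (ℕ×ℕ) := [(13, 0), (13, 1), (13, 2), (13, 3), (17, 0), (19, 0), (19, 1), (29, 3), (43, 0), (43, 1), (73, 1), (109, 3)]

lemma sTab_ok : sTab.all (fun t => sChk t.1 t.2.1 t.2.2.1 t.2.2.2.1 t.2.2.2.2.1 t.2.2.2.2.2.1 t.2.2.2.2.2.2.1 t.2.2.2.2.2.2.2) = true := by
  decide +kernel

def sPs : List ℕ := [11, 13, 17, 19, 23, 29, 31, 37, 41, 43, 47, 53, 59, 61, 67, 71, 73, 79, 83, 89, 97, 101, 103, 107, 109, 113, 127, 131, 137, 139, 157, 163, 167, 307, 317, 359, 457, 571, 619, 857, 1049, 1117]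

lemma sTab_cov : sPs.all (fun p => (List.range 4).all (fun cs => sExc.contains (p,cs) || sTab.any (fun t => Nat.beq t.1 p && Nat.beq (cbit cs t.2.2.2.2.1 t.2.2.2.2.2.1 t.2.2.2.2.2.2.1 t.2.2.2.2.2.2.2) 1))) = true := by
  decide +kernel

theorem sieve_tab {p : ℕ} (hp : p.Prime) (h3 : 3 < p) (h1 : p ∈ sPs) {cs : ℕ} (hcs : cs < 4) {r : ℤ} (h : SolB p r cs) :
    (p, cs) ∈ sExc := by
  have h2 := (List.all_eq_true.mp sTab_cov) p h1
  have h4 := (List.all_eq_true.mp h2) cs (List.mem_range.mpr hcs)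
  rw [Bool.or_eq_true] at h4
  rcases h4 with h4 | h4
  · simpa using h4
  · obtain ⟨t, ht, ht2⟩ := List.any_eq_true.mp h4
    rw [Bool.and_eq_true, Nat.beq_eq, Nat.beq_eq] at ht2
    have h5 := (List.all_eq_true.mp sTab_ok) t ht
    rw [ht2.1] at h5
    exact (sChk_sound hp h3 h5 ht2.2 h).elim

lemma mem_sPs {p : ℕ} (hp : p.Prime) (h1 : 11 ≤ p) (h2 : p < 149 ∨ p ∣ sEX) : p ∈ sPs := by
  rcases h2 with h2 | h2
  · have key : ∀ p < 149, 11 ≤ p → (∀ l ∈ [2,3,5,7,11], l ∣ p → l = p) → p ∈ sPs := by decide +kernel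
    refine key p h2 h1 ?_
    intro l hl hd
    have hl1 : l ≠ 1 := by
      rintro rfl
      simp at hl
    exact (Nat.dvd_prime hp).mp hd |>.resolve_left hl1
  · have key : sEX = ([157, 163, 167, 307, 317, 359, 457, 571, 619, 857, 1049, 1117] : List ℕ).prod := by decide +kernel
    rw [key, hp.prime.dvd_prod_iff] at h2
    obtain ⟨a, ha, hda⟩ := h2
    have hall : ∀ a ∈ ([157, 163, 167, 307, 317, 359, 457, 571, 619, 857, 1049, 1117] : List ℕ), a.Prime ∧ a ∈ sPs := by
      intro a ha
      fin_cases ha <;> exact ⟨by norm_num, by decide⟩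
    rw [(Nat.prime_dvd_prime_iff_eq hp (hall a ha).1).mp hda]
    exact (hall a ha).2

theorem sieve_all {p : ℕ} (hp : p.Prime) (h1 : 11 ≤ p) (h2 : p < 19600) {cs : ℕ} (hcs : cs < 4) {r : ℤ} (h : SolB p r cs) :
    (p, cs) ∈ sExc := by
  by_cases h3 : p < 149 ∨ p ∣ sEX
  · exact sieve_tab hp (by omega) (mem_sPs hp h1 h3) hcs h
  · push Not at h3
    exact (sieve_mid hp h3.1 h2 h3.2 r cs h).elim

def mCos (q g fuel : ℕ) : ℕ → ℕ → ℕ :=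
  Nat.rec (fun _ M => M) (fun _ ih v M => ih (v*g%q) (M ||| (1 <<< v))) fuel

def mAdd (q g n E C y r0 M : ℕ) : ℕ :=
  cond (Nat.beq (y%q) 0 || Nat.beq (y^n%q*E%q) C) (mCos q g n (r0%q) M) M

def mOut (q g n E C P1 P2 iv fuel : ℕ) : ℕ → ℕ → ℕ :=
  Nat.rec (fun _ M => M) (fun _ ih u M => ih (u*g%q) (mAdd q g n E C (P2+P1*u) ((P2+P1*(q-u))*iv) M)) fuel

def mEf (cs : ℕ) : ℕ := if cs = 0 then 1 else if cs = 1 then 8 else if cs = 2 then 25 else 200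
def mCf (s cs : ℕ) : ℕ := if cs = 0 then 18 else if cs = 1 then 18 else if cs = 2 then 18*s else 18*s
def mDf (s cs : ℕ) : ℕ := if cs = 0 then 36*s else if cs = 1 then 18*s else if cs = 2 then 36 else 18

def mMask (p k a s iv cs : ℕ) : ℕ :=
  (fun q n => (fun g P1 P2 E C =>
    mOut q g n E C P1 P2 iv n 1 (mAdd q g n E C P2 (P2*iv) (mAdd q g n E C P1 (P1*iv) 0)))
    (a^p%q) (2+s) (2+(q-s)) (mEf cs^n) (mCf s cs^n%q)) (2*k*p+1) (2*k)

def mOK (p k a s iv cs : ℕ) : Bool :=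
  (fun q n => (fun g =>
    Nat.ble 1 k && (Nat.ble 149 q && (Nat.ble q 19599 && (Nat.beq (Nat.gcd q sPR) 1 && (Nat.beq (g^n%q) 1 &&
    (Nat.beq ((s*s+5)%q) 0 && (Nat.ble s q && (Nat.beq (iv * mDf s cs % q) 1 &&
    Nat.ble 1 (sLoop q g (fun _ => 1) (n-1) g 1)))))))))
   (a^p%q)) (2*k*p+1) (2*k)

lemma prime_of_gcd {q : ℕ} (h1 : 149 ≤ q) (h2 : q ≤ 19599) (h : Nat.gcd q sPR = 1) : q.Prime := by
  by_contra hnp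
  have hl : (q.minFac).Prime := Nat.minFac_prime (by omega)
  have hsq := Nat.minFac_sq_le_self (by omega) hnp
  have hlt : q.minFac < 140 := by nlinarith
  have key : sPR = ((List.range 140).filter Nat.Prime).prod := by decide +kernel
  have hd : q.minFac ∣ sPR := by
    rw [key]
    apply List.dvd_prod
    simp [hlt, hl]
  have := Nat.dvd_gcd (Nat.minFac_dvd q) hd
  rw [h] at this
  exact hl.one_lt.ne' (Nat.dvd_one.mp this)

lemma mCos_succ (q g n v M : ℕ) : mCos q g (n+1) v M = mCos q g n (v*g%q) (M ||| (1 <<< v)) := rfl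

lemma mCos_mono (q g n : ℕ) : ∀ v M b, M.testBit b = true → (mCos q g n v M).testBit b = true := by
  induction n with
  | zero => intro v M b h; exact h
  | succ n ih =>
    intro v M b h
    rw [mCos_succ]
    apply ih
    simp [Nat.testBit_lor, h]

lemma mCos_mem {q g : ℕ} (hq : 0 < q) (n : ℕ) : ∀ v M b, v < q → b < q →
    (∃ i < n, (b : ZMod q) = v * g^i) → (mCos q g n v M).testBit b = true := by
  induction n with
  | zero => rintro v M b _ _ ⟨i, hi, _⟩; omega
  | succ n ih =>
    rintro v M b hv hb ⟨i, hi, he⟩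
    rw [mCos_succ]
    rcases i with _ | i
    · apply mCos_mono
      rw [pow_zero, mul_one, ZMod.natCast_eq_natCast_iff, Nat.ModEq, Nat.mod_eq_of_lt hb, Nat.mod_eq_of_lt hv] at he
      rw [he]
      simp [Nat.testBit_lor, Nat.testBit_shiftLeft]
    · refine ih _ _ _ (Nat.mod_lt _ hq) hb ⟨i, by omega, ?_⟩
      rw [he, ZMod.natCast_mod]; push_cast; ring

lemma mAdd_mono (q g n E C y r0 M b : ℕ) (h : M.testBit b = true) : (mAdd q g n E C y r0 M).testBit b = true := by
  unfold mAdd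
  cases (Nat.beq (y%q) 0 || Nat.beq (y^n%q*E%q) C)
  · exact h
  · exact mCos_mono _ _ _ _ _ _ h

lemma mAdd_mem {q g n E C y r0 M b : ℕ} (hq : 0 < q) (hC : C < q)
    (hy : (y : ZMod q) = 0 ∨ (y : ZMod q)^n * E = C) (hb : b < q)
    (h : ∃ i < n, (b : ZMod q) = r0 * g^i) : (mAdd q g n E C y r0 M).testBit b = true := by
  have hc : (Nat.beq (y%q) 0 || Nat.beq (y^n%q*E%q) C) = true := by
    rw [Bool.or_eq_true, Nat.beq_eq, Nat.beq_eq]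
    rcases hy with hy | hy
    · left; exact Nat.mod_eq_zero_of_dvd ((ZMod.natCast_eq_zero_iff _ _).mp hy)
    · right
      have h1 : ((y^n%q*E : ℕ) : ZMod q) = (C : ℕ) := by
        push_cast; rw [ZMod.natCast_mod]; push_cast; exact hy
      rw [ZMod.natCast_eq_natCast_iff, Nat.ModEq, Nat.mod_eq_of_lt hC] at h1
      exact h1
  unfold mAdd
  rw [hc]
  refine mCos_mem hq n _ _ _ (Nat.mod_lt _ hq) hb ?_
  rw [ZMod.natCast_mod]; exact h

lemma mOut_succ (q g n E C P1 P2 iv f u M : ℕ) : mOut q g n E C P1 P2 iv (f+1) u M =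
  mOut q g n E C P1 P2 iv f (u*g%q) (mAdd q g n E C (P2+P1*u) ((P2+P1*(q-u))*iv) M) := rfl

lemma mOut_mono (q g n E C P1 P2 iv f : ℕ) : ∀ u M b, M.testBit b = true → (mOut q g n E C P1 P2 iv f u M).testBit b = true := by
  induction f with
  | zero => intro u M b h; exact h
  | succ f ih => intro u M b h; rw [mOut_succ]; exact ih _ _ _ (mAdd_mono _ _ _ _ _ _ _ _ _ h)

lemma mOut_mem {q g n E C P1 P2 iv : ℕ} (hq : 0 < q) (hC : C < q) (f : ℕ) : ∀ u M b, u < q → b < q →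
    (∃ j < f, ∃ ξ : ZMod q, ξ = u * g^j ∧ ((P2 + P1 * ξ : ZMod q) = 0 ∨ (P2 + P1 * ξ : ZMod q)^n * E = C) ∧ 
       ∃ i < n, (b : ZMod q) = (P2 - P1*ξ)*iv * g^i) → (mOut q g n E C P1 P2 iv f u M).testBit b = true := by
  induction f with
  | zero => rintro u M b _ _ ⟨j, hj, _⟩; omega
  | succ f ih =>
    rintro u M b hu hb ⟨j, hj, ξ, hξ, hv, hi⟩
    rw [mOut_succ]
    rcases j with _ | j
    · apply mOut_mono
      rw [pow_zero, mul_one] at hξ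
      apply mAdd_mem hq hC _ hb
      · push_cast [Nat.cast_sub hu.le]
        rw [ZMod.natCast_self, ← hξ, zero_sub, mul_neg, ← sub_eq_add_neg]
        exact hi
      · push_cast; rw [← hξ]; exact hv
    · refine ih _ _ _ (Nat.mod_lt _ hq) hb ⟨j, by omega, ξ, ?_, hv, hi⟩
      rw [hξ, ZMod.natCast_mod]; push_cast; ring

/-- relation with r -/
lemma caseB_relR {p k q s : ℕ} [Fact q.Prime] (hp3 : 3 < p) (hk : 0 < k) (hq : q = 2*k*p+1)
    (hs : (s : ZMod q)^2 = -5) {r : ℤ} {cs : ℕ} (h : SolB p r cs) :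
    ∃ (x1 x2 Z ρ : ZMod q), (x1 = 0 ∨ x1^(2*k) = 1) ∧ (x2 = 0 ∨ x2^(2*k) = 1) ∧ ¬ (x1 = 0 ∧ x2 = 0) ∧ 
     (Z = 0 ∨ Z^(2*k) = 1) ∧ (mEf cs : ZMod q) * ((2-s)*x1 + (2+s)*x2) = mCf s cs * Z ∧ 
     (ρ = r ∨ ρ = -r) ∧ (mDf s cs : ZMod q) * ρ = (2-s)*x1 - (2+s)*x2 := by
  obtain ⟨α, A, B, Y, ρ, hc, hα, hρ, hY, ho, h3, hcs⟩ := h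
  obtain ⟨x1, x2, hx1, hx2, hne, e1, e2⟩ := local_pair hq hk hp3 hs hc hα
  have hA : (2-s)*x1 + (2+s)*x2 = 18*A := by
    rw [e1, e2]; linear_combination (-2*A)*hs
  have hB : (2-s)*x1 - (2+s)*x2 = 18*s*B := by
    rw [e1, e2]; linear_combination (-2*s*B)*hs
  have hm1 : (-1 : ZMod q)^(2*k) = 1 := by rw [pow_mul]; simp
  have hx2' : -x2 = 0 ∨ (-x2)^(2*k) = 1 := by
    rcases hx2 with h | h
    · left; rw [h, neg_zero]
    · right; rw [← neg_one_mul, mul_pow, hm1, h, one_mul]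
  have hne' : ¬ (x1 = 0 ∧ -x2 = 0) := by rw [neg_eq_zero]; exact hne
  have hyp : ((Y : ZMod q)^p) = 0 ∨ ((Y : ZMod q)^p)^(2*k) = 1 := by
    by_cases hz : (Y : ZMod q) = 0
    · left; rw [hz, zero_pow (by omega)]
    · right
      rw [← pow_mul, show p*(2*k) = q - 1 by rw [hq]; simp; ring]
      exact ZMod.pow_card_sub_one_eq_one hz
  have hρ' : (ρ : ZMod q) = r ∨ (ρ : ZMod q) = -r := by
    rcases hρ with h | h
    · left; rw [h]
    · right; rw [h]; push_cast; rfl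
  rcases hcs with ⟨hc0, h1, h2, -⟩ | ⟨hc0, h1, h2, -⟩ | ⟨hc0, h1, h2⟩ | ⟨hc0, h1, h2⟩
  · refine ⟨x1, x2, (Y : ZMod q)^p, ρ, hx1, hx2, hne, hyp, ?_, hρ', ?_⟩
    · have := congrArg (Int.cast (R := ZMod q)) h1
      simp [mEf, mCf, hc0]; push_cast at this
      linear_combination hA + 18 * this
    · simp [mDf, hc0]; rw [hB, h2]; push_cast; ring
  · refine ⟨x1, x2, (Y : ZMod q)^p, ρ, hx1, hx2, hne, hyp, ?_, hρ', ?_⟩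
    · have := congrArg (Int.cast (R := ZMod q)) h1
      simp [mEf, mCf, hc0]; push_cast at this
      linear_combination 8*hA + 18 * this
    · simp [mDf, hc0]; rw [hB, h2]
  · refine ⟨x1, -x2, (Y : ZMod q)^p, ρ, hx1, hx2', hne', hyp, ?_, hρ', ?_⟩
    · have := congrArg (Int.cast (R := ZMod q)) h1
      simp [mEf, mCf, hc0]; push_cast at this
      linear_combination 25*hB + 18*s * this
    · simp [mDf, hc0]; rw [hA, h2]; push_cast; ring
  · refine ⟨x1, -x2, (Y : ZMod q)^p, ρ, hx1, hx2', hne', hyp, ?_, hρ', ?_⟩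
    · have := congrArg (Int.cast (R := ZMod q)) h1
      simp [mEf, mCf, hc0]; push_cast at this
      linear_combination 200*hB + 18*s * this
    · simp [mDf, hc0]; rw [hA, h2]

theorem mMask_sound {p k a s iv cs : ℕ} (hp3 : 3 < p) (hok : mOK p k a s iv cs = true) {r : ℕ}
    (hsol : SolB p r cs) : (mMask p k a s iv cs).testBit (r % (2*k*p+1)) = true := by
  unfold mOK at hok
  simp only [Bool.and_eq_true, Nat.ble_eq, Nat.beq_eq] at hok
  obtain ⟨hk1, hq1, hq2, hgcd, hg, hs, hsq, hiv, hl⟩ := hok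
  unfold mMask
  beta_reduce
  generalize hq : 2*k*p+1 = q at *
  have hqp : q.Prime := prime_of_gcd hq1 hq2 hgcd
  have : Fact q.Prime := ⟨hqp⟩
  have hq0 : 0 < q := hqp.pos
  set n := 2*k with hn
  have hsz : (s : ZMod q)^2 = -5 := by
    have h1 : ((s*s+5 : ℕ) : ZMod q) = 0 := by
      rw [ZMod.natCast_eq_zero_iff]; exact Nat.dvd_of_mod_eq_zero hs
    push_cast at h1
    linear_combination h1
  set g := a^p % q with hgdef
  have hgz : (g : ZMod q)^n = 1 := by
    have h1 := congrArg (Nat.cast (R := ZMod q)) hg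
    rw [ZMod.natCast_mod] at h1
    push_cast at h1
    exact h1
  have hivz : (iv : ZMod q) * mDf s cs = 1 := by
    have h1 := congrArg (Nat.cast (R := ZMod q)) hiv
    rw [ZMod.natCast_mod] at h1
    push_cast at h1
    exact h1
  have hl0 : ((sLoop q g (fun _ => 1) (n-1) g 1 : ℕ) : ZMod q) ≠ 0 := by
    intro h0
    rw [ZMod.natCast_eq_zero_iff] at h0
    have h1 := sLoop_lt hq0 g (fun _ => 1) (n-1) g 1 hqp.one_lt
    have h2 := Nat.le_of_dvd hl h0
    omega
  have hspec := (sLoop_spec g _ (fun _ => 1) (by intro u; simp) (n-1) g _ hl0).2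
  have hroot : ∀ ξ : ZMod q, ξ^n = 1 → ∃ i < n, ξ = (g : ZMod q)^i := by
    intro ξ hξ
    rcases roots_enum (by omega) hgz (fun i hi => (hspec i hi).1) hξ with h | ⟨i, hi, h⟩
    · exact ⟨0, by omega, by rw [h, pow_zero]⟩
    · exact ⟨i+1, by omega, by rw [h, pow_succ']⟩
  have hm1 : (-1 : ZMod q)^n = 1 := by rw [hn, pow_mul]; simp
  have hP2 : ((2 + (q - s) : ℕ) : ZMod q) = 2 - s := by
    push_cast [Nat.cast_sub hsq]; rw [ZMod.natCast_self]; ring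
  obtain ⟨x1, x2, Z, ρ, hx1, hx2, hne, hZ, hrel, hρ, hD⟩ := caseB_relR hp3 hk1 hq.symm hsz hsol
  have hb : r % q < q := Nat.mod_lt _ hq0
  have hC : mCf s cs ^ n % q < q := Nat.mod_lt _ hq0
  have hρ2 : ρ = ((2-s)*x1 - (2+s)*x2) * iv := by
    rw [← hD]; linear_combination -ρ*hivz
  have hE0 : (mEf cs : ZMod q) ≠ 0 := by
    have hn0 : ∀ n : ℕ, 0 < n → n < q → ((n:ℕ) : ZMod q) ≠ 0 := by
      intro n hn hnq h0
      exact absurd (Nat.le_of_dvd hn ((ZMod.natCast_eq_zero_iff n q).mp h0)) (by omega)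
    have h8 := hn0 8 (by norm_num) (by omega)
    have h25 := hn0 25 (by norm_num) (by omega)
    have h1 := hn0 1 (by norm_num) (by omega)
    unfold mEf
    split_ifs
    · exact h1
    · exact h8
    · exact h25
    · rw [show (200:ℕ) = 8*25 by norm_num, Nat.cast_mul]; exact mul_ne_zero h8 h25
  -- r = ρ * ±1
  obtain ⟨σ, hσ, hrσ⟩ : ∃ σ : ZMod q, σ^n = 1 ∧ (r : ZMod q) = ρ * σ := by
    rcases hρ with h | h
    · exact ⟨1, one_pow _, by rw [h]; simp⟩
    · exact ⟨-1, hm1, by rw [h]; simp⟩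
  have valid : ∀ (y x : ZMod q), x ≠ 0 → x^n = 1 → (mEf cs : ZMod q) * (y * x) = mCf s cs * Z →
      (y = 0 ∨ y^n * ((mEf cs ^ n : ℕ) : ZMod q) = ((mCf s cs ^ n % q : ℕ) : ZMod q)) := by
    intro y x hx0 hx h
    rcases hZ with h0 | h1
    · left
      rw [h0, mul_zero] at h
      have := (mul_eq_zero.mp h).resolve_left hE0
      exact (mul_eq_zero.mp this).resolve_right hx0
    · right
      rw [ZMod.natCast_mod]
      have := congrArg (· ^ n) h
      simp only [mul_pow] at this
      rw [hx, h1] at this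
      push_cast
      linear_combination this
  by_cases h10 : x1 = 0
  · have h20 : x2 ≠ 0 := fun h => hne ⟨h10, h⟩
    have hx2' := hx2.resolve_left h20
    apply mOut_mono
    apply mAdd_mono
    apply mAdd_mem hq0 hC _ hb
    · obtain ⟨i, hi, he⟩ := hroot (-1 * (x2 * σ)) (by rw [mul_pow, mul_pow, hm1, hx2', hσ]; ring)
      refine ⟨i, hi, ?_⟩
      rw [← he, ZMod.natCast_mod, hrσ, hρ2, h10]; push_cast; ring
    · push_cast
      have := valid (2+s) x2 h20 hx2' (by rw [← hrel, h10]; ring)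
      push_cast at this
      exact this
  · have hx1' := hx1.resolve_left h10
    obtain ⟨i, hi, he⟩ := hroot (x1 * σ) (by rw [mul_pow, hx1', hσ]; ring)
    by_cases h20 : x2 = 0
    · apply mOut_mono
      apply mAdd_mem hq0 hC _ hb
      · refine ⟨i, hi, ?_⟩
        rw [← he, ZMod.natCast_mod, hrσ, hρ2, h20, Nat.cast_mul, hP2]; ring
      · rw [hP2]
        exact valid (2-s) x1 h10 hx1' (by rw [← hrel, h20]; ring)
    · have hx2' := hx2.resolve_left h20
      obtain ⟨j, hj, hje⟩ := hroot (x2/x1) (by rw [div_pow, hx1', hx2', div_one])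
      refine mOut_mem hq0 hC n 1 _ _ hqp.one_lt hb ⟨j, hj, x2/x1, ?_, ?_, i, hi, ?_⟩
      · rw [hje]; simp
      · rw [hP2]
        have := valid (2-s+(2+s)*(x2/x1)) x1 h10 hx1' (by rw [← hrel]; field_simp)
        push_cast at this ⊢
        exact this
      · rw [← he, ZMod.natCast_mod, hrσ, hρ2, hP2]; push_cast; field_simp

/-- periodic extension by doubling -/
def mExt (fuel : ℕ) : ℕ → ℕ → ℕ :=
  Nat.rec (fun _ M => M) (fun _ ih L M => ih (2*L) (M ||| (M <<< L))) fuel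

lemma mExt_spec (f : ℕ) : ∀ L M b, b < L * 2^f → M.testBit (b % L) = true → (∀ i, M.testBit i = true → True) →
    (mExt f L M).testBit b = true := by
  induction f with
  | zero => intro L M b hb h _; rw [Nat.mod_eq_of_lt (by simpa using hb)] at h; exact h
  | succ f ih =>
    intro L M b hb h _
    show (mExt f (2*L) (M ||| (M <<< L))).testBit b = true
    apply ih
    · rw [pow_succ] at hb; nlinarith
    · have hL : 0 < L := by
        rcases Nat.eq_zero_or_pos L with h0 | h0
        · rw [h0] at hb; omega
        · exact h0
      have h2 : b % (2*L) < 2*L := Nat.mod_lt _ (by omega)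
      have h3 : b % (2*L) % L = b % L := Nat.mod_mul_left_mod b 2 L
      rw [Nat.testBit_lor]
      rcases Nat.lt_or_ge (b % (2*L)) L with h4 | h4
      · rw [Nat.mod_eq_of_lt h4] at h3
        rw [h3, h]; simp
      · have h5 : b % (2*L) - L = b % L := by
          rw [← h3]
          generalize b % (2*L) = c at *
          rw [Nat.mod_eq_sub_mod h4, Nat.mod_eq_of_lt (by omega)]
        rw [Nat.testBit_shiftLeft, h5, h]
        simp [h4]
    · intros; trivial

/-- all conditions combined -/
def mAll (p cs : ℕ) (l : List (ℕ×ℕ×ℕ×ℕ)) : Bool × ℕ → Bool × ℕ :=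
  l.rec (fun x => x) (fun t _ ih x => ih (x.1 && mOK p t.1 t.2.1 t.2.2.1 t.2.2.2 cs,
    x.2 &&& mExt (20 - Nat.log2 (2*t.1*p+1)) (2*t.1*p+1) (mMask p t.1 t.2.1 t.2.2.1 t.2.2.2 cs)))

lemma mAll_sound {p cs : ℕ} (hp3 : 3 < p) {r : ℕ} (hr : r ≤ 10^6) (hsol : SolB p r cs) (l : List (ℕ×ℕ×ℕ×ℕ)) :
    ∀ x : Bool × ℕ, (mAll p cs l x).1 = true → x.1 = true ∧ (x.2.testBit r = true → (mAll p cs l x).2.testBit r = true) := by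
  induction l with
  | nil => intro x h; exact ⟨h, fun h => h⟩
  | cons t l ih =>
    intro x h
    obtain ⟨h1, h2⟩ := ih (x.1 && mOK p t.1 t.2.1 t.2.2.1 t.2.2.2 cs,
      x.2 &&& mExt (20 - Nat.log2 (2*t.1*p+1)) (2*t.1*p+1) (mMask p t.1 t.2.1 t.2.2.1 t.2.2.2 cs)) h
    simp only [Bool.and_eq_true] at h1
    refine ⟨h1.1, fun hx => h2 ?_⟩
    rw [Nat.testBit_land, hx, Bool.true_and]
    apply mExt_spec
    · have h0 : 2*t.1*p+1 ≠ 0 := by omega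
      have h3 := Nat.log2_self_le h0
      generalize 2*t.1*p+1 = q at *
      generalize q.log2 = l at *
      have h4 : 2^20 ≤ 2^l * 2^(20-l) := by rw [← pow_add]; exact Nat.pow_le_pow_right (by norm_num) (by omega)
      have h5 := Nat.mul_le_mul_right (2^(20-l)) h3
      omega
    · exact mMask_sound hp3 h1.2 hsol
    · intros; trivial

lemma sideB3 {p : ℕ} (hp5 : 5 ≤ p) {r : ℤ} {cs : ℕ} (h : SolB p r cs) : ¬ (3:ℤ) ∣ r := by
  obtain ⟨α, A, B, Y, ρ, hc, he, hρ, hY, ho, h3, hcs⟩ := h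
  intro h3r
  have hρ3 : (3:ℤ) ∣ ρ := by rcases hρ with h | h <;> rw [h] <;> simpa using h3r
  have hn := norm_eqB he
  have h1 : (3:ℤ) ∣ α.norm := by
    apply Int.prime_three.dvd_of_dvd_pow (n := p)
    rw [hn]; exact Dvd.dvd.mul_right (by norm_num) _
  have h2 : (3:ℤ) ∣ A^2+5*B^2 := by
    have : (3:ℤ)^5 ∣ α.norm^p := (pow_dvd_pow _ hp5).trans (pow_dvd_pow_of_dvd h1 p)
    rw [hn] at this
    have h4 : (9:ℤ) * 3 ∣ 9 * (A^2+5*B^2) := Dvd.dvd.trans (by norm_num) this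
    exact Int.dvd_of_mul_dvd_mul_left (by norm_num) h4
  have hAB : (3:ℤ) ∣ A ∨ (3:ℤ) ∣ B := by
    rcases hcs with ⟨_, _, hB, _⟩ | ⟨_, _, hB, _⟩ | ⟨_, _, hB⟩ | ⟨_, _, hB⟩
    · right; rw [hB]; exact Dvd.dvd.mul_left hρ3 _
    · right; rw [hB]; exact hρ3
    · left; rw [hB]; exact Dvd.dvd.mul_left hρ3 _
    · left; rw [hB]; exact hρ3
  have hboth : (3:ℤ) ∣ A ∧ (3:ℤ) ∣ B := by
    rcases hAB with h | h
    · refine ⟨h, ?_⟩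
      have h5 : (3:ℤ) ∣ 5*B^2 := (Int.dvd_add_right (dvd_pow h two_ne_zero)).mp h2
      rcases Int.prime_three.dvd_or_dvd h5 with h6 | h6
      · norm_num at h6
      · exact Int.prime_three.dvd_of_dvd_pow h6
    · refine ⟨?_, h⟩
      have h5 : (3:ℤ) ∣ A^2 := (Int.dvd_add_left (Dvd.dvd.mul_left (dvd_pow h two_ne_zero) _)).mp h2
      exact Int.prime_three.dvd_of_dvd_pow h5
  exact Int.prime_three.not_isUnit (hc.isUnit_of_dvd' hboth.1 hboth.2)

lemma sideB2 {p : ℕ} (hp5 : 5 ≤ p) {r : ℤ} {cs : ℕ} (hcs' : cs = 1 ∨ cs = 3) (h : SolB p r cs) : ¬ (2:ℤ) ∣ r := by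
  obtain ⟨α, A, B, Y, ρ, hc, he, hρ, hY, ho, h3, hcs⟩ := h
  intro h3r
  have hρ3 : (2:ℤ) ∣ ρ := by rcases hρ with h | h <;> rw [h] <;> simpa using h3r
  have key : ∀ C : ℤ, 200*C = Y^p → (2:ℤ) ∣ C := by
    intro C hC
    have h1 : (2:ℤ) ∣ Y := Int.prime_two.dvd_of_dvd_pow (n := p) (by rw [← hC]; exact Dvd.dvd.mul_right (by norm_num) _)
    have : (2:ℤ)^5 ∣ Y^p := (pow_dvd_pow _ hp5).trans (pow_dvd_pow_of_dvd h1 p)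
    rw [← hC] at this; omega
  have key' : ∀ C : ℤ, 8*C = Y^p → (2:ℤ) ∣ C := by
    intro C hC
    have h1 : (2:ℤ) ∣ Y := Int.prime_two.dvd_of_dvd_pow (n := p) (by rw [← hC]; exact Dvd.dvd.mul_right (by norm_num) _)
    have : (2:ℤ)^5 ∣ Y^p := (pow_dvd_pow _ hp5).trans (pow_dvd_pow_of_dvd h1 p)
    rw [← hC] at this; omega
  have : (2:ℤ) ∣ A ∧ (2:ℤ) ∣ B := by
    rcases hcs with ⟨_, hA, hB, _⟩ | ⟨_, hA, hB, _⟩ | ⟨_, hA, hB⟩ | ⟨_, hA, hB⟩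
    · omega
    · exact ⟨key' _ hA, hB ▸ hρ3⟩
    · omega
    · exact ⟨hB ▸ hρ3, key _ hA⟩
  exact Int.prime_two.not_isUnit (hc.isUnit_of_dvd' this.1 this.2)

lemma sideB5 {p : ℕ} (hp5 : 5 ≤ p) {r : ℤ} {cs : ℕ} (hcs' : cs = 2 ∨ cs = 3) (h : SolB p r cs) : ¬ (5:ℤ) ∣ r := by
  obtain ⟨α, A, B, Y, ρ, hc, he, hρ, hY, ho, h3, hcs⟩ := h
  intro h3r
  have p5 : Prime (5:ℤ) := Int.prime_ofNat_iff.mpr (by norm_num)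
  have hρ3 : (5:ℤ) ∣ ρ := by rcases hρ with h | h <;> rw [h] <;> simpa using h3r
  have key : ∀ C : ℤ, 200*C = Y^p → (5:ℤ) ∣ C := by
    intro C hC
    have h1 : (5:ℤ) ∣ Y := p5.dvd_of_dvd_pow (n := p) (by rw [← hC]; exact Dvd.dvd.mul_right (by norm_num) _)
    have : (5:ℤ)^5 ∣ Y^p := (pow_dvd_pow _ hp5).trans (pow_dvd_pow_of_dvd h1 p)
    rw [← hC] at this; omega
  have key' : ∀ C : ℤ, 25*C = Y^p → (5:ℤ) ∣ C := by
    intro C hC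
    have h1 : (5:ℤ) ∣ Y := p5.dvd_of_dvd_pow (n := p) (by rw [← hC]; exact Dvd.dvd.mul_right (by norm_num) _)
    have : (5:ℤ)^5 ∣ Y^p := (pow_dvd_pow _ hp5).trans (pow_dvd_pow_of_dvd h1 p)
    rw [← hC] at this; omega
  have : (5:ℤ) ∣ A ∧ (5:ℤ) ∣ B := by
    rcases hcs with ⟨_, hA, hB, _⟩ | ⟨_, hA, hB, _⟩ | ⟨_, hA, hB⟩ | ⟨_, hA, hB⟩
    · omega
    · omega
    · exact ⟨hB ▸ Dvd.dvd.mul_left hρ3 _, key' _ hA⟩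
    · exact ⟨hB ▸ hρ3, key _ hA⟩
  exact p5.not_isUnit (hc.isUnit_of_dvd' this.1 this.2)

def zq (a b : ℕ) (n : ℕ) : ℤ × ℤ :=
  Nat.rec (1,0) (fun _ x => (x.1*a - 5*x.2*b, x.1*b + x.2*a)) n

lemma zq_spec (a b n : ℕ) : (⟨a,b⟩ : R5)^n = ⟨(zq a b n).1, (zq a b n).2⟩ := by
  induction n with
  | zero => rfl
  | succ n ih =>
    rw [pow_succ, ih]
    show _ = (⟨(zq a b n).1*a - 5*(zq a b n).2*b, (zq a b n).1*b + (zq a b n).2*a⟩ : R5)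
    ext <;> simp <;> ring

/-- `p`-th powers mod `p^2` -/
lemma modsq {p : ℕ} (hp : p.Prime) (α : R5) : ∃ a < p, ∃ b < p,
    ((p:ℤ)^2 ∣ (α^p).re - (zq a b p).1) ∧ ((p:ℤ)^2 ∣ (α^p).im - (zq a b p).2) := by
  have hp0 : (0:ℤ) < p := by exact_mod_cast hp.pos
  refine ⟨(α.re % p).toNat, ?_, (α.im % p).toNat, ?_, ?_⟩
  · have := Int.emod_lt_of_pos α.re hp0; omega
  · have := Int.emod_lt_of_pos α.im hp0; omega
  set a := (α.re % p).toNat with ha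
  set b := (α.im % p).toNat with hb
  have ha' : (a:ℤ) = α.re % p := Int.toNat_of_nonneg (Int.emod_nonneg _ hp0.ne')
  have hb' : (b:ℤ) = α.im % p := Int.toNat_of_nonneg (Int.emod_nonneg _ hp0.ne')
  have h1 : (p : R5) ∣ α - ⟨a,b⟩ := by
    have := (Zsqrtd.intCast_dvd (d := -5) (p:ℤ) (α - ⟨a,b⟩)).mpr ⟨?_, ?_⟩
    · simpa using this
    · simp [ha']; exact Int.dvd_self_sub_emod
    · simp [hb']; exact Int.dvd_self_sub_emod
  have h2 := dvd_sub_pow_of_dvd_sub h1 1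
  rw [pow_one, zq_spec] at h2
  have h3 := (Zsqrtd.intCast_dvd (d := -5) ((p:ℤ)^2) _).mp (by simpa using h2)
  simpa using h3

lemma modsqZ {p : ℕ} (hp : p.Prime) (Y : ℤ) : ∃ t < p, (p:ℤ)^2 ∣ Y^p - (t:ℤ)^p := by
  have hp0 : (0:ℤ) < p := by exact_mod_cast hp.pos
  refine ⟨(Y % p).toNat, ?_, ?_⟩
  · have := Int.emod_lt_of_pos Y hp0; omega
  have ha' : ((Y % p).toNat:ℤ) = Y % p := Int.toNat_of_nonneg (Int.emod_nonneg _ hp0.ne')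
  rw [ha']
  have h2 := dvd_sub_pow_of_dvd_sub (R := ℤ) (p := p) (a := Y) (b := Y % p) (Int.dvd_self_sub_emod) 1
  simpa using h2

def sqW (cs : ℕ) (X Z : ℤ) : ℤ := if cs = 0 then 2*X+5*Z else if cs = 1 then 8*(2*X+5*Z) else if cs = 2 then 25*(2*Z-X) else 200*(2*Z-X)
def sqR (cs : ℕ) (X Z : ℤ) : ℤ := if cs = 0 then 2*Z-X else if cs = 1 then 2*(2*Z-X) else if cs = 2 then 2*X+5*Z else 2*(2*X+5*Z)

/-- the mod p^2 information -/
lemma sqinfo {p : ℕ} (hp : p.Prime) {r : ℤ} {cs : ℕ} (h : SolB p r cs) :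
    ∃ a < p, ∃ b < p, ∃ t < p, (p:ℤ)^2 ∣ sqW cs (zq a b p).1 (zq a b p).2 - 9*(t:ℤ)^p ∧
     ((p:ℤ)^2 ∣ 18*r - sqR cs (zq a b p).1 (zq a b p).2 ∨ (p:ℤ)^2 ∣ 18*r + sqR cs (zq a b p).1 (zq a b p).2) := by
  obtain ⟨α, A, B, Y, ρ, hc, he, hρ, hY, ho, h3, hcs⟩ := h
  obtain ⟨a, ha, b, hb, ⟨x, hx⟩, ⟨z, hz⟩⟩ := modsq hp α
  obtain ⟨t, ht, ⟨y, hy⟩⟩ := modsqZ hp Y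
  refine ⟨a, ha, b, hb, t, ht, ?_⟩
  generalize (zq a b p).1 = X at *
  generalize (zq a b p).2 = Z at *
  have e1 : (α^p).re = 2*A - 5*B := by rw [he]; simp; ring
  have e2 : (α^p).im = A + 2*B := by rw [he]; simp; ring
  rw [e1] at hx
  rw [e2] at hz
  rcases hcs with ⟨c, hA, hB, _⟩ | ⟨c, hA, hB, _⟩ | ⟨c, hA, hB⟩ | ⟨c, hA, hB⟩ <;> subst c <;> simp only [sqW, sqR] <;> norm_num <;>
    rw [← hA] at hy <;> subst hB
  · refine ⟨⟨9*y - 2*x-5*z, by linear_combination 9*hy-2*hx-5*hz⟩, ?_⟩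
    rcases hρ with h | h
    · left; exact ⟨2*z - x, by rw [h] at hx hz; linear_combination 2*hz - hx⟩
    · right; exact ⟨-(2*z - x), by rw [h] at hx hz; linear_combination -2*hz + hx⟩
  · refine ⟨⟨9*y - 8*(2*x+5*z), by linear_combination 9*hy-8*(2*hx+5*hz)⟩, ?_⟩
    rcases hρ with h | h
    · left; exact ⟨2*(2*z - x), by rw [h] at hx hz; linear_combination 2*(2*hz - hx)⟩
    · right; exact ⟨-2*(2*z - x), by rw [h] at hx hz; linear_combination 2*(-2*hz + hx)⟩
  · refine ⟨⟨9*y - 25*(2*z-x), by linear_combination 9*hy-25*(2*hz-hx)⟩, ?_⟩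
    rcases hρ with h | h
    · left; exact ⟨(2*x+5*z), by rw [h] at hx hz; linear_combination (2*hx+5*hz)⟩
    · right; exact ⟨-(2*x+5*z), by rw [h] at hx hz; linear_combination -(2*hx+5*hz)⟩
  · refine ⟨⟨9*y - 200*(2*z-x), by linear_combination 9*hy-200*(2*hz-hx)⟩, ?_⟩
    rcases hρ with h | h
    · left; exact ⟨2*(2*x+5*z), by rw [h] at hx hz; linear_combination 2*(2*hx+5*hz)⟩
    · right; exact ⟨-2*(2*x+5*z), by rw [h] at hx hz; linear_combination -2*(2*hx+5*hz)⟩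

def s13 (cs : ℕ) : ℕ := (if cs = 0 then [0, 20, 42, 47, 48, 67, 79, 90, 102, 121, 122, 127, 149] else
  if cs = 1 then [0, 4, 7, 8, 15, 17, 18, 36, 53, 58, 76, 77, 81, 88, 92, 93, 111, 116, 133, 151, 152, 154, 161, 162, 165] else
  if cs = 2 then [0, 13, 26, 39, 52, 65, 78, 91, 104, 117, 130, 143, 156] else
  [0, 5, 11, 12, 35, 40, 54, 59, 62, 73, 74, 75, 84, 85, 94, 95, 96, 107, 110, 115, 129, 134, 157, 158, 164]).foldl
  (fun m i => m ||| 1 <<< i) 0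

def sqB (cs a b t : ℕ) : Bool := (fun X Z => (decide ((sqW cs X Z - 9*(t:ℤ)^13) % 169 ≠ 0)) ||
    ((s13 cs).testBit (((47 * sqR cs X Z) % 169).toNat) &&
    (s13 cs).testBit (((-47 * sqR cs X Z) % 169).toNat))) (zq a b 13).1 (zq a b 13).2

lemma s13_chk' : ∀ cs < 4, ∀ a < 13, ∀ b < 13, ∀ t < 13, sqB cs a b t = true := by
  decide +kernel

lemma s13_chk (cs) (hcs : cs < 4) (a) (ha : a < 13) (b) (hb : b < 13) (t : ℕ) (ht : t < 13) :
   (sqW cs (zq a b 13).1 (zq a b 13).2 - 9*(t:ℤ)^13) % 169 = 0 →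
    (s13 cs).testBit (((47 * sqR cs (zq a b 13).1 (zq a b 13).2) % 169).toNat) = true ∧
    (s13 cs).testBit (((-47 * sqR cs (zq a b 13).1 (zq a b 13).2) % 169).toNat) = true := by
  intro h
  have := s13_chk' cs hcs a ha b hb t ht
  unfold sqB at this
  simp only [Bool.or_eq_true, decide_eq_true_eq, Bool.and_eq_true] at this
  exact this.resolve_left (fun h' => h' h)

lemma s13_sound {r : ℕ} {cs : ℕ} (hcs : cs < 4) (h : SolB 13 r cs) : (s13 cs).testBit (r % 169) = true := by
  obtain ⟨a, ha, b, hb, t, ht, h1, h2⟩ := sqinfo (by norm_num) h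
  norm_num at h1 h2
  have := s13_chk cs hcs a ha b hb t ht (Int.emod_eq_zero_of_dvd h1)
  generalize sqR cs (zq a b 13).1 (zq a b 13).2 = R at *
  rcases h2 with h2 | h2
  · rw [show r % 169 = ((47*R)%169).toNat by omega]; exact this.1
  · rw [show r % 169 = ((-47*R)%169).toNat by omega]; exact this.2

def mSide (p cs : ℕ) : ℕ :=
  mExt 19 3 6 &&& (if cs = 1 ∨ cs = 3 then mExt 19 2 2 else 2^1048576-1) &&& 
   (if cs = 2 ∨ cs = 3 then mExt 18 5 30 else 2^1048576-1) &&& (if p = 13 then mExt 13 169 (s13 cs) else 2^1048576-1) &&& (2^1000001 - 2)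

lemma mSide_sound {p cs r : ℕ} (hp5 : 5 ≤ p) (hcs : cs < 4) (hr0 : 0 < r) (hr : r ≤ 10^6) (h : SolB p r cs) : (mSide p cs).testBit r = true := by
  have hfull : (2^1048576-1 : ℕ).testBit r = true := by
    rw [Nat.testBit_two_pow_sub_one]; simp; omega
  unfold mSide
  simp only [Nat.testBit_land, Bool.and_eq_true]
  refine ⟨⟨⟨⟨?_, ?_⟩, ?_⟩, ?_⟩, ?_⟩
  · apply mExt_spec _ _ _ _ (by omega) _ (by intros; trivial)
    have := sideB3 hp5 h
    have h1 : r % 3 = 1 ∨ r % 3 = 2 := by omega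
    rcases h1 with h1 | h1 <;> rw [h1] <;> decide
  · split_ifs with hc
    · apply mExt_spec _ _ _ _ (by omega) _ (by intros; trivial)
      have := sideB2 hp5 hc h
      have h1 : r % 2 = 1 := by omega
      rw [h1]; decide
    · exact hfull
  · split_ifs with hc
    · apply mExt_spec _ _ _ _ (by omega) _ (by intros; trivial)
      have := sideB5 hp5 hc h
      have h1 : r % 5 = 1 ∨ r % 5 = 2 ∨ r % 5 = 3 ∨ r % 5 = 4 := by omega
      rcases h1 with h1 | h1 | h1 | h1 <;> rw [h1] <;> decide
    · exact hfull
  · split_ifs with hc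
    · apply mExt_spec _ _ _ _ (by omega) _ (by intros; trivial)
      subst hc
      exact s13_sound hcs h
    · exact hfull
  · have e : (2^1000001 - 2 : ℕ) = 2^1 * (2^1000000 - 1) := by
      rw [Nat.mul_sub, mul_one, pow_one]; rw [pow_succ 2 1000000]; ring_nf
    rw [e, Nat.testBit_two_pow_mul, Nat.testBit_two_pow_sub_one]
    simp; omega

def mFin (p cs : ℕ) (l : List (ℕ×ℕ×ℕ×ℕ)) : Bool :=
  (fun x : Bool × ℕ => x.1 && Nat.beq x.2 0) (mAll p cs l (true, mSide p cs))

lemma mFin_sound {p cs r : ℕ} (hp5 : 5 ≤ p) (hcs : cs < 4) (hr0 : 0 < r) (hr : r ≤ 10^6) (l)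
    (hl : mFin p cs l = true) (h : SolB p r cs) : False := by
  unfold mFin at hl
  simp only [Bool.and_eq_true, Nat.beq_eq] at hl
  have := (mAll_sound (by omega) hr h l _ hl.1).2 (mSide_sound hp5 hcs hr0 hr h)
  rw [hl.2] at this
  simp at this

lemma mx_13_0 : mFin 13 0 [(17,2,138,14), (21,2,33,483), (20,3,125,419), (47,5,424,52), (48,7,106,1068), (50,2,36,260), (77,5,520,1555), (90,7,265,1104), (80,3,936,411), (71,5,547,1649)] = true := by decide +kernel
lemma mx_13_1 : mFin 13 1 [(17,2,138,28), (21,2,33,419), (20,3,125,317), (51,3,404,25), (78,2,331,1101), (50,2,36,520), (48,7,106,887), (57,2,264,788)] = true := by decide +kernel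
lemma mx_13_2 : mFin 13 2 [(17,2,138,160), (20,3,125,275), (21,2,33,76), (47,5,424,34), (57,2,264,206), (48,7,106,798), (90,7,265,2276), (50,2,36,253)] = true := by decide +kernel
lemma mx_13_3 : mFin 13 3 [(17,2,138,320), (21,2,33,152), (20,3,125,29), (47,5,424,68), (50,2,36,506), (51,3,404,811), (57,2,264,412), (48,7,106,347), (98,2,371,1841), (111,5,915,802)] = true := by decide +kernel
lemma mx_17_0 : mFin 17 0 [(9,5,84,20), (12,7,182,358), (13,2,138,14), (19,5,44,618), (33,2,58,661), (49,2,108,1333)] = true := by decide +kernel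
lemma mx_19_0 : mFin 19 0 [(6,6,37,169), (20,6,288,455), (29,5,105,459), (17,5,44,618), (39,2,264,394), (50,2,688,1348), (59,2,82,174)] = true := by decide +kernel
lemma mx_19_1 : mFin 19 1 [(6,6,37,109), (17,5,44,589), (20,6,288,149), (29,5,105,918), (47,2,679,330), (50,2,688,795)] = true := by decide +kernel
lemma mx_29_3 : mFin 29 3 [(6,2,56,97), (9,2,97,494), (16,3,255,671), (19,5,105,429)] = true := by decide +kernel
lemma mx_43_0 : mFin 43 0 [(11,2,330,156), (18,2,252,928), (20,3,324,1375), (41,5,230,2546)] = true := by decide +kernel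
lemma mx_43_1 : mFin 43 1 [(18,2,252,307), (11,2,330,312), (20,3,324,1029), (41,5,230,1565)] = true := by decide +kernel
lemma mx_73_1 : mFin 73 1 [(11,5,363,1228), (21,2,964,739), (27,3,1259,2308), (41,2,134,1462)] = true := by decide +kernel
lemma mx_109_3 : mFin 109 3 [(26,3,1291,315), (29,2,2758,2459), (66,2,5602,3997)] = true := by decide +kernel

theorem masks_exc {p : ℕ} {cs : ℕ} (hm : (p, cs) ∈ sExc) {r : ℤ} (hr0 : 0 < r) (hr : r ≤ 10^6) (h : SolB p r cs) : False := by
  obtain ⟨n, rfl⟩ := Int.eq_ofNat_of_zero_le hr0.le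
  have h0 : 0 < n := by omega
  have h1 : n ≤ 10^6 := by omega
  simp only [sExc, List.mem_cons, Prod.mk.injEq, List.not_mem_nil, or_false] at hm
  rcases hm with ⟨rfl, rfl⟩ | ⟨rfl, rfl⟩ | ⟨rfl, rfl⟩ | ⟨rfl, rfl⟩ | ⟨rfl, rfl⟩ | ⟨rfl, rfl⟩ | ⟨rfl, rfl⟩ | ⟨rfl, rfl⟩ | ⟨rfl, rfl⟩ | ⟨rfl, rfl⟩ | ⟨rfl, rfl⟩ | ⟨rfl, rfl⟩
  · exact mFin_sound (by norm_num) (by norm_num) h0 h1 _ mx_13_0 h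
  · exact mFin_sound (by norm_num) (by norm_num) h0 h1 _ mx_13_1 h
  · exact mFin_sound (by norm_num) (by norm_num) h0 h1 _ mx_13_2 h
  · exact mFin_sound (by norm_num) (by norm_num) h0 h1 _ mx_13_3 h
  · exact mFin_sound (by norm_num) (by norm_num) h0 h1 _ mx_17_0 h
  · exact mFin_sound (by norm_num) (by norm_num) h0 h1 _ mx_19_0 h
  · exact mFin_sound (by norm_num) (by norm_num) h0 h1 _ mx_19_1 h
  · exact mFin_sound (by norm_num) (by norm_num) h0 h1 _ mx_29_3 h
  · exact mFin_sound (by norm_num) (by norm_num) h0 h1 _ mx_43_0 h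
  · exact mFin_sound (by norm_num) (by norm_num) h0 h1 _ mx_43_1 h
  · exact mFin_sound (by norm_num) (by norm_num) h0 h1 _ mx_73_1 h
  · exact mFin_sound (by norm_num) (by norm_num) h0 h1 _ mx_109_3 h

open ZMod in
/-- Jacobi symbol with integer modulus -/
def jz (a b : ℤ) : ℤ := jacobiSym a b.natAbs

def qs (a b : ℤ) : ℤ := if a % 4 = 3 ∧ b % 4 = 3 then -1 else 1

lemma jz_mul (a b c : ℤ) : jz (a*b) c = jz a c * jz b c := jacobiSym.mul_left _ _ _

lemma jz_mod {a a' b : ℤ} (h : b ∣ a - a') : jz a b = jz a' b := by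
  unfold jz
  apply jacobiSym.mod_left'
  apply Int.emod_emod_of_dvd _ (dvd_refl _) |>.symm.trans
  have : ((b.natAbs : ℕ):ℤ) ∣ a - a' := Int.natAbs_dvd.mpr h
  rw [Int.emod_emod_of_dvd _ (dvd_refl _)]
  exact Int.emod_emod_of_dvd _ (dvd_refl _) |>.symm.trans (by
    rw [Int.emod_emod_of_dvd _ (dvd_refl _)]
    exact Int.ModEq.symm ((Int.modEq_iff_dvd).mpr this))

lemma jz_sq {a b : ℤ} (h : IsCoprime a b) : jz (a^2) b = 1 := by
  unfold jz
  apply jacobiSym.sq_one'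
  have := Int.isCoprime_iff_gcd_eq_one.mp h
  simpa [Int.gcd, Int.natAbs_abs] using this

lemma jz_sq' {a b : ℤ} (h : IsCoprime a b) : jz a b * jz a b = 1 := by
  rw [← jz_mul, ← sq, jz_sq h]

lemma qs_comm (a b : ℤ) : qs a b = qs b a := by unfold qs; simp only [and_comm]

lemma qs_sq (a b : ℤ) : qs a b * qs a b = 1 := by unfold qs; split_ifs <;> norm_num

lemma jz_neg_one {b : ℤ} (hb : 0 < b) (h : Odd b) : jz (-1) b = if b % 4 = 3 then -1 else 1 := by
  unfold jz
  obtain ⟨n, rfl⟩ := Int.eq_ofNat_of_zero_le hb.le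
  have hn : Odd n := by exact_mod_cast h
  rw [Int.natAbs_natCast, jacobiSym.at_neg_one hn]
  have h2 := Nat.odd_iff.mp hn
  split_ifs with h1
  · exact ZMod.χ₄_nat_three_mod_four (by omega)
  · exact ZMod.χ₄_nat_one_mod_four (by omega)

lemma jz_two {b : ℤ} (h : Odd b) : jz 2 b = if b % 8 = 1 ∨ b % 8 = 7 then 1 else -1 := by
  unfold jz
  have hn : Odd b.natAbs := Int.natAbs_odd.mpr h
  rw [jacobiSym.at_two hn]
  rw [ZMod.χ₈_nat_eq_if_mod_eight]
  have := Int.odd_iff.mp h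
  have hb := Nat.odd_iff.mp hn
  rw [if_neg (by omega)]
  split_ifs <;> omega

lemma jz_rec_pos {a b : ℤ} (ha : Odd a) (hb : Odd b) (hb0 : 0 < b) : jz a b = qs a b * jz b a := by
  obtain ⟨n, rfl⟩ := Int.eq_ofNat_of_zero_le hb0.le
  have hn : Odd n := by exact_mod_cast hb
  have hn2 := Nat.odd_iff.mp hn
  have ha2 := Int.odd_iff.mp ha
  have haa : Odd a.natAbs := Int.natAbs_odd.mpr ha
  have key := jacobiSym.quadratic_reciprocity_if (Nat.odd_iff.mp haa) hn2
  rcases le_or_gt 0 a with h0 | h0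
  · have e : ((a.natAbs : ℕ) : ℤ) = a := Int.natAbs_of_nonneg h0
    unfold jz qs
    rw [Int.natAbs_natCast]
    rw [e] at key
    rw [← key]
    split_ifs <;> omega
  · have e : a = -1 * ((a.natAbs : ℕ) : ℤ) := by omega
    have h1 : jz a n = jz (-1) n * jz (a.natAbs) n := by
      conv_lhs => rw [e]
      exact jz_mul _ _ _
    rw [h1, jz_neg_one hb0 hb]
    unfold jz qs
    rw [Int.natAbs_natCast, ← key]
    split_ifs <;> omega

lemma jz_rec {a b : ℤ} (ha : Odd a) (hb : Odd b) (h : 0 < a ∨ 0 < b) : jz a b = qs a b * jz b a := by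
  rcases h with h | h
  · rw [jz_rec_pos hb ha h, qs_comm b a, ← mul_assoc, qs_sq, one_mul]
  · exact jz_rec_pos ha hb h

lemma jz_congr {a b n : ℤ} (h : ∀ l : ℕ, l.Prime → (l:ℤ) ∣ n → jacobiSym a l = jacobiSym b l) : jz a n = jz b n := by
  unfold jz jacobiSym
  congr 1
  apply List.pmap_congr_left
  intro l hl h1 h2
  have hlp := Nat.prime_of_mem_primeFactorsList hl
  have := h l hlp (Int.natCast_dvd.mpr (Nat.dvd_of_mem_primeFactorsList hl))
  have : Fact l.Prime := ⟨hlp⟩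
  rw [jacobiSym.legendreSym.to_jacobiSym, jacobiSym.legendreSym.to_jacobiSym]
  assumption

lemma jac_sq_prime {l : ℕ} (hl : l.Prime) {G K s t : ℤ} (hs : ¬ (l:ℤ) ∣ s) (ht : ¬ (l:ℤ) ∣ t)
    (h : (l:ℤ) ∣ s^2*G - K*t^2) : jacobiSym G l = jacobiSym K l := by
  have cop : ∀ x : ℤ, ¬ (l:ℤ) ∣ x → x.gcd l = 1 := by
    intro x hx
    rw [← Int.isCoprime_iff_gcd_eq_one, isCoprime_comm]
    exact ((Nat.prime_iff_prime_int.mp hl).coprime_iff_not_dvd).mpr hx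
  have h1 : jacobiSym (s^2*G) l = jacobiSym (K*t^2) l :=
    jacobiSym.mod_left' (Int.ModEq.symm ((Int.modEq_iff_dvd).mpr h))
  rwa [jacobiSym.mul_left, jacobiSym.mul_left, jacobiSym.sq_one' (cop s hs), jacobiSym.sq_one' (cop t ht), one_mul, mul_one] at h1

lemma jz_transfer {a b w U G K m' : ℤ} (hab : IsCoprime a b) (hwU : IsCoprime w U)
    (hm : m' ∣ a*w+b*U) (h1 : m' ∣ a^2*G - K*U^2) (h2 : m' ∣ b^2*G - K*w^2) : jz G m' = jz K m' := by
  apply jz_congr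
  intro l hl hd
  have hlp := Nat.prime_iff_prime_int.mp hl
  have hm' := hd.trans hm
  by_cases ha : (l:ℤ) ∣ a
  · have hb : ¬ (l:ℤ) ∣ b := fun hb => hlp.not_isUnit (hab.isUnit_of_dvd' ha hb)
    have hU : (l:ℤ) ∣ U := by
      have : (l:ℤ) ∣ b*U := (Int.dvd_add_right (Dvd.dvd.mul_right ha w)).mp hm'
      exact (hlp.dvd_or_dvd this).resolve_left hb
    have hw : ¬ (l:ℤ) ∣ w := fun hb => hlp.not_isUnit (hwU.isUnit_of_dvd' hb hU)
    exact jac_sq_prime hl hb hw (hd.trans h2)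
  · by_cases hU : (l:ℤ) ∣ U
    · have : (l:ℤ) ∣ a*w := (Int.dvd_add_left (Dvd.dvd.mul_left hU b)).mp hm'
      have hw := (hlp.dvd_or_dvd this).resolve_left ha
      exact absurd (hwU.isUnit_of_dvd' hw hU) hlp.not_isUnit
    · exact jac_sq_prime hl ha hU (hd.trans h1)

/-- squares are not non-residues -/
lemma jz_sq_ne {e s z H : ℤ} (hs : IsCoprime s H) (h : H ∣ e*s^2 - z^2) : jz e H ≠ -1 := by
  intro hneg
  have h1 : jz (e*s^2) H = jz (z^2) H := jz_mod h
  rw [jz_mul, jz_sq hs, hneg] at h1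
  unfold jz at h1
  rw [jacobiSym.pow_left] at h1
  nlinarith [sq_nonneg (jacobiSym z H.natAbs)]

lemma jz_kill {c m0 m' a b w U g H K s z : ℤ} (hab : IsCoprime a b) (hwU : IsCoprime w U)
    (hm : a*w+b*U = m0*m') (h1 : m' ∣ a^2*(g*H) - K*U^2) (h2 : m' ∣ b^2*(g*H) - K*w^2)
    (hs : IsCoprime s H) (hz : H ∣ c*(a*w+b*U)*s^2 - z^2) (hH : Odd H) (hmo : Odd m') (hpos : 0 < H ∨ 0 < m')
    (hg : IsCoprime g m') : jz (c*m0) H * qs m' H * jz (g*K) m' ≠ -1 := by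
  have h3 : jz (c*(a*w+b*U)) H ≠ -1 := jz_sq_ne hs hz
  rw [hm, ← mul_assoc, jz_mul, jz_rec hmo hH hpos.symm] at h3
  have h4 := jz_transfer hab hwU ⟨m0, by rw [hm]; ring⟩ h1 h2
  rw [jz_mul] at h4
  rw [jz_mul g, ← h4, ← mul_assoc (jz g m'), jz_sq' hg, one_mul, mul_assoc]
  exact h3

/-- evaluate a symbol with small top -/
lemma jz_flip {q H : ℤ} (t : ℤ) (hq0 : 0 < q) (hq : Odd q) (hH : Odd H) (ht : q ∣ H - t) :
    jz q H = qs q H * jz t q := by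
  rw [jz_rec hq hH (Or.inl hq0), jz_mod ht]

lemma qs_one_left {a b : ℤ} (h : a % 4 = 1) : qs a b = 1 := by
  unfold qs; rw [if_neg]; omega
lemma qs_one_right {a b : ℤ} (h : b % 4 = 1) : qs a b = 1 := by
  unfold qs; rw [if_neg]; omega
lemma qs_neg {a b : ℤ} (h : a % 4 = 3) (h' : b % 4 = 3) : qs a b = -1 := by
  unfold qs; rw [if_pos ⟨h, h'⟩]

def allB (f : ℕ → Bool) (n : ℕ) : Bool := Nat.rec true (fun k ih => f k && ih) n
lemma allB_spec {f : ℕ → Bool} {n : ℕ} (h : allB f n = true) : ∀ k < n, f k = true := by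
  induction n with
  | zero => intro k hk; omega
  | succ n ih =>
    have h' : (f n && allB f n) = true := h
    rw [Bool.and_eq_true] at h'
    intro k hk
    rcases Nat.lt_succ_iff_lt_or_eq.mp hk with h1 | h1
    · exact ih h'.2 k h1
    · rw [h1]; exact h'.1

def stc (q c' e : ℕ) (T : ℕ → ℕ → ℕ) (S : List ℕ) : Bool :=
  allB (fun a => allB (fun b => (Nat.beq a 0 && Nat.beq b 0) ||
    (!(Nat.beq (((T a b) * c')^e % q) 0) && S.any (fun s => Nat.beq ((a*a+5*(b*b)) % q) (s * (((T a b) * c')^e % q)^2 % q)))) q) q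

lemma red_alpha {q : ℕ} (hq : q.Prime) (p : ℕ) (α : R5) : ∃ a < q, ∃ b < q, (q:ℤ) ∣ α.re - a ∧ (q:ℤ) ∣ α.im - b ∧
    (q:ℤ) ∣ (α^p).re - ((⟨a,b⟩:R5)^p).re ∧ (q:ℤ) ∣ (α^p).im - ((⟨a,b⟩:R5)^p).im := by
  have hp0 : (0:ℤ) < q := by exact_mod_cast hq.pos
  refine ⟨(α.re % q).toNat, ?_, (α.im % q).toNat, ?_, ?_⟩
  · have := Int.emod_lt_of_pos α.re hp0; omega
  · have := Int.emod_lt_of_pos α.im hp0; omega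
  have ha' : (((α.re % q).toNat : ℕ):ℤ) = α.re % q := Int.toNat_of_nonneg (Int.emod_nonneg _ hp0.ne')
  have hb' : (((α.im % q).toNat : ℕ):ℤ) = α.im % q := Int.toNat_of_nonneg (Int.emod_nonneg _ hp0.ne')
  rw [ha', hb']
  have h1 : (q : R5) ∣ α - ⟨α.re % q, α.im % q⟩ := by
    have := (Zsqrtd.intCast_dvd (d := -5) (q:ℤ) (α - ⟨α.re % q, α.im % q⟩)).mpr ⟨?_, ?_⟩
    · simpa using this
    · simp; exact Int.dvd_self_sub_emod
    · simp; exact Int.dvd_self_sub_emod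
  have h2 := h1.trans (sub_dvd_pow_sub_pow α ⟨α.re % q, α.im % q⟩ p)
  have h3 := (Zsqrtd.intCast_dvd (d := -5) (q:ℤ) _).mp (by simpa using h2)
  refine ⟨Int.dvd_self_sub_emod, Int.dvd_self_sub_emod, ?_, ?_⟩
  · simpa using h3.1
  · simpa using h3.2

lemma zq_of_dvd {q : ℕ} {x y : ℤ} (h : (q:ℤ) ∣ x - y) : (x : ZMod q) = y := by
  have := (ZMod.intCast_zmod_eq_zero_iff_dvd (x-y) q).mpr h
  push_cast at this
  exact sub_eq_zero.mp this

lemma dvd_of_zq {q : ℕ} {x y : ℤ} (h : (x : ZMod q) = y) : (q:ℤ) ∣ x - y := by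
  rw [← ZMod.intCast_zmod_eq_zero_iff_dvd]; push_cast; rw [h]; ring

lemma state {p q c c' e k : ℕ} (hq : q.Prime) (hcc : c*c' % q = 1) (he : p*e = (q-1)*k+1) {T : ℕ → ℕ → ℕ} {t1 t2 : ℤ}
    (hF : ∀ a b : ℕ, (q:ℤ) ∣ T a b - (t1 * ((⟨a,b⟩:R5)^p).re + t2 * ((⟨a,b⟩:R5)^p).im)) {S : List ℕ}
    (chk : stc q c' e T S = true) {α : R5} (hne : ¬ ((q:ℤ) ∣ α.re ∧ (q:ℤ) ∣ α.im)) {u : ℤ}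
    (h : (q:ℤ) ∣ t1*(α^p).re + t2*(α^p).im - c*u^p) : ∃ s ∈ S, (q:ℤ) ∣ α.norm - s*u^2 ∧ ¬ (q:ℤ) ∣ u := by
  have : Fact q.Prime := ⟨hq⟩
  obtain ⟨a, ha, b, hb, h1, h2, h3, h4⟩ := red_alpha hq p α
  have hc := allB_spec (allB_spec chk a ha) b hb
  have e1 := zq_of_dvd h1
  have e2 := zq_of_dvd h2
  have e3 := zq_of_dvd h3
  have e4 := zq_of_dvd h4
  have e5 := zq_of_dvd (hF a b)
  have e6 := zq_of_dvd h
  push_cast at e1 e2 e3 e4 e5 e6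
  rw [← e3, ← e4, e6] at e5
  have hc1 : ((c*c' : ℕ) : ZMod q) = 1 := by
    rw [← ZMod.natCast_mod, hcc, Nat.cast_one]
  push_cast at hc1
  have e7 : ((((T a b) * c')^e % q : ℕ) : ZMod q) = u := by
    rw [ZMod.natCast_mod]
    push_cast
    rw [e5]
    rw [show (c:ZMod q) * (u:ZMod q)^p * c' = (c*c')*u^p by ring, hc1, one_mul, ← pow_mul, he]
    by_cases h0 : (u : ZMod q) = 0
    · rw [h0]; simp
    · rw [pow_succ, pow_mul, ZMod.pow_card_sub_one_eq_one h0, one_pow, one_mul]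
  have hvq : ((T a b) * c')^e % q < q := Nat.mod_lt _ hq.pos
  generalize ((T a b) * c')^e % q = v at *
  rw [Bool.or_eq_true, Bool.and_eq_true, Bool.and_eq_true] at hc
  rcases hc with ⟨ha0, hb0⟩ | ⟨hv, hS⟩
  · exfalso; apply hne
    have ha0 := Nat.eq_of_beq_eq_true ha0
    have hb0 := Nat.eq_of_beq_eq_true hb0
    subst ha0 hb0
    simpa using And.intro h1 h2
  · rw [List.any_eq_true] at hS
    obtain ⟨s, hs, hs'⟩ := hS
    refine ⟨s, hs, ?_, ?_⟩
    · have h5 := congrArg (Nat.cast (R := ZMod q)) (Nat.eq_of_beq_eq_true hs')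
      rw [ZMod.natCast_mod, ZMod.natCast_mod] at h5
      push_cast at h5
      apply dvd_of_zq
      rw [norm5]; push_cast
      rw [e1, e2, ← e7, ← h5]; ring
    · intro hu
      have := (ZMod.intCast_zmod_eq_zero_iff_dvd u q).mpr hu
      rw [← e7] at this
      by_cases hv0 : v = 0
      · rw [hv0] at hv; simp at hv
      exact hv0 (Nat.eq_zero_of_dvd_of_lt ((ZMod.natCast_eq_zero_iff v q).mp this) hvq)

def T5 (d a b : ℕ) : ℕ := 2*(a^5+10*a^3*b^2*d+5*a*b^4*d^2) + 5*(5*a^4*b+10*a^2*b^3*d+b^5*d^2)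
def T7 (d a b : ℕ) : ℕ := 2*(a^7+21*a^5*b^2*d+35*a^3*b^4*d^2+7*a*b^6*d^3) + 5*(7*a^6*b+35*a^4*b^3*d+21*a^2*b^5*d^2+b^7*d^3)

lemma T5_spec (q d : ℕ) (hd : q = d + 5) (a b : ℕ) : (q:ℤ) ∣ T5 d a b - (2 * ((⟨a,b⟩:R5)^5).re + 5 * ((⟨a,b⟩:R5)^5).im) := by
  have : ((⟨a,b⟩:R5)^5) = ⟨(a:ℤ)^5-50*a^3*b^2+125*a*b^4, 5*a^4*b-50*a^2*b^3+25*b^5⟩ := by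
    simp only [pow_succ, pow_zero, one_mul]
    ext <;> simp <;> ring
  rw [this]; subst hd; unfold T5; push_cast
  exact ⟨20*a^3*b^2+(10*a*b^4)*(d-5) + 50*a^2*b^3 + 5*b^5*(d-5), by ring⟩

lemma T7_spec (q d : ℕ) (hd : q = d + 5) (a b : ℕ) : (q:ℤ) ∣ T7 d a b - (2 * ((⟨a,b⟩:R5)^7).re + 5 * ((⟨a,b⟩:R5)^7).im) := by
  have : ((⟨a,b⟩:R5)^7) = ⟨(a:ℤ)^7-105*a^5*b^2+875*a^3*b^4-875*a*b^6, 7*a^6*b-175*a^4*b^3+525*a^2*b^5-125*b^7⟩ := by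
    simp only [pow_succ, pow_zero, one_mul]
    ext <;> simp <;> ring
  rw [this]; subst hd; unfold T7; push_cast
  exact ⟨42*a^5*b^2+(70*a^3*b^4)*(d-5) + 14*a*b^6*(d^2-5*d+25) + 5*(35*a^4*b^3 + 21*a^2*b^5*(d-5)+ b^7*(d^2-5*d+25)), by ring⟩

lemma st19 : stc 19 9 11 (T5 14) [1,9,8,18] = true := by decide +kernel
lemma st59 : stc 59 41 35 (T5 54) [57,23,12,29,43,30,46,53,39,40,34,21] = true := by decide +kernel
lemma st13 : stc 13 1 7 (T7 8) [10,5] = true := by decide +kernel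

/-- the residue class of a linear form -/
lemma lin_state {q : ℤ} {α β w u s : ℤ} (h : q ∣ w - s*u^2) (hc : IsCoprime u q) : jz (α*w+β*u^2) q = jz (α*s+β) q := by
  rw [jz_mod (a' := (α*s+β)*u^2) (by obtain ⟨t, ht⟩ := h; exact ⟨α*t, by linear_combination α*ht⟩), jz_mul, jz_sq hc, mul_one]

lemma zmod_of {x : ℤ} {n : ℕ} {t : ℤ} (h : x % n = t % n) : (x : ZMod n) = (t : ZMod n) :=
  (ZMod.intCast_eq_intCast_iff' x t n).mpr h
lemma of_zmod {x : ℤ} {n : ℕ} {t : ℤ} (h : (x : ZMod n) = (t : ZMod n)) : x % n = t % n :=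
  (ZMod.intCast_eq_intCast_iff' x t n).mp h

/-- primes dividing alpha are impossible -/
lemma alpha_prim {p : ℕ} (hp2 : 2 ≤ p) {q : ℕ} (hq : q.Prime) (hq3 : q ≠ 3) {α : R5} {A B : ℤ} (hc : IsCoprime A B)
    (he : α^p = ⟨2,1⟩*⟨A,B⟩) : ¬ ((q:ℤ) ∣ α.re ∧ (q:ℤ) ∣ α.im) := by
  rintro ⟨h1, h2⟩
  have hqp := Nat.prime_iff_prime_int.mp hq
  have h3 : ((q:ℤ) : R5) ∣ α := (Zsqrtd.intCast_dvd (d := -5) _ _).mpr ⟨h1, h2⟩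
  have h4 : ((q:ℤ) : R5) ∣ α^p := h3.trans (dvd_pow_self α (by omega))
  have h5 := (Zsqrtd.intCast_dvd (d := -5) _ _).mp h4
  rw [he] at h5
  simp only [Zsqrtd.re_mul, Zsqrtd.im_mul] at h5
  have hn9 : ¬ (q:ℤ) ∣ 9 := by
    intro h
    have h' : (q:ℤ) ∣ 3 := hqp.dvd_of_dvd_pow (n := 2) (by norm_num; exact h)
    have : q ∣ 3 := by exact_mod_cast h'
    exact hq3 ((Nat.prime_dvd_prime_iff_eq hq Nat.prime_three).mp this)
  obtain ⟨⟨x, hx⟩, ⟨z, hz⟩⟩ := h5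
  have hA : (q:ℤ) ∣ 9*A := ⟨2*x+5*z, by linear_combination 2*hx+5*hz⟩
  have hB : (q:ℤ) ∣ 9*B := ⟨2*z-x, by linear_combination 2*hz-hx⟩
  exact hqp.not_isUnit (hc.isUnit_of_dvd' ((hqp.dvd_or_dvd hA).resolve_left hn9) ((hqp.dvd_or_dvd hB).resolve_left hn9))

lemma odd_r_of {p : ℕ} (hp5 : 5 ≤ p) {r : ℤ} {cs : ℕ} (hcs' : cs = 1 ∨ cs = 3) (h : SolB p r cs) : Odd r := by
  have := sideB2 hp5 hcs' h
  rw [Int.odd_iff]; omega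

lemma three_dvd_norm {p : ℕ} {w N : ℤ} (h : w^p = 9*N) : (3:ℤ) ∣ w := by
  apply Int.prime_three.dvd_of_dvd_pow (n := p)
  rw [h]; exact Dvd.dvd.mul_right (by norm_num) _

lemma cop_of {x y : ℤ} (h : ∀ l : ℕ, l.Prime → (l:ℤ) ∣ x → (l:ℤ) ∣ y → False) : IsCoprime x y := by
  rw [Int.isCoprime_iff_gcd_eq_one]
  by_contra hne
  obtain ⟨l, hl, hd⟩ := Nat.exists_prime_and_dvd hne
  exact h l hl ((Int.natCast_dvd_natCast.mpr hd).trans (Int.gcd_dvd_left _ _)) ((Int.natCast_dvd_natCast.mpr hd).trans (Int.gcd_dvd_right _ _))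

lemma cop_prime {q : ℕ} (hq : q.Prime) {x : ℤ} (h : ¬ (q:ℤ) ∣ x) : IsCoprime x (q:ℤ) :=
  ((Nat.prime_iff_prime_int.mp hq).coprime_iff_not_dvd.mpr h).symm

lemma cop_two {m : ℤ} (h : Odd m) (k : ℕ) : IsCoprime ((2:ℤ)^k) m := by
  apply IsCoprime.pow_left
  apply (Int.prime_two.coprime_iff_not_dvd).mpr
  have := Int.odd_iff.mp h; omega

lemma cop_three {m : ℤ} (h : m % 3 ≠ 0) : IsCoprime (3:ℤ) m :=
  (Int.prime_three.coprime_iff_not_dvd).mpr (by omega)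

/-- extract the p = 5, case 1 data -/
lemma p5c1 {r : ℤ} (h : SolB 5 r 1) : ∃ w u : ℤ, w^5 = 144*u^10+45*r^2 ∧ Odd r ∧ ¬ (5:ℤ) ∣ u ∧ ¬ (3:ℤ) ∣ u ∧ (3:ℤ) ∣ w ∧
    IsCoprime w u ∧ (∃ s ∈ [1,9,8,18], ((19:ℕ):ℤ) ∣ w - (s:ℕ)*u^2 ∧ ¬ ((19:ℕ):ℤ) ∣ u) ∧
    (∃ s ∈ [57,23,12,29,43,30,46,53,39,40,34,21], ((59:ℕ):ℤ) ∣ w - (s:ℕ)*u^2 ∧ ¬ ((59:ℕ):ℤ) ∣ u) := by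
  have hro := odd_r_of (by norm_num) (Or.inl rfl) h
  obtain ⟨α, A, B, Y, ρ, hc, he, hρ, hY, ho, h3, hcs⟩ := h
  have hρ2 : ρ^2 = r^2 := by rcases hρ with h | h <;> rw [h]; ring
  rcases hcs with ⟨c, _⟩ | ⟨_, hA, hB, h5⟩ | ⟨c, _⟩ | ⟨c, _⟩
  · norm_num at c
  · have hY2 : (2:ℤ) ∣ Y := by
      apply Int.prime_two.dvd_of_dvd_pow (n := 5)
      rw [← hA]; exact ⟨4*A, by ring⟩
    obtain ⟨u, rfl⟩ := hY2
    have hA' : A = 4*u^5 := by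
      have : 8*A = 8*(4*u^5) := by rw [hA]; ring
      omega
    have hu5 : ¬ (5:ℤ) ∣ u := fun hh => h5 (by rw [hA']; exact Dvd.dvd.mul_left (dvd_pow hh (by norm_num)) _)
    have hu3 : ¬ (3:ℤ) ∣ u := fun hh => h3 (Dvd.dvd.mul_left hh _)
    have hn := norm_eqB he
    have e1 : (α^5).re = 2*A - 5*B := by rw [he]; simp; ring
    have e2 : (α^5).im = A + 2*B := by rw [he]; simp; ring
    have hlin : 2*(α^5).re + 5*(α^5).im = 36*u^5 := by rw [e1, e2, hA']; ring
    have hw : α.norm^5 = 144*u^10+45*r^2 := by rw [hn, hA', hB, hρ2]; ring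
    refine ⟨α.norm, u, hw, hro, hu5, hu3, three_dvd_norm hn, ?_, ?_, ?_⟩
    · apply cop_of
      intro l hl h1 h2
      have hlp := Nat.prime_iff_prime_int.mp hl
      have h6 : (l:ℤ) ∣ 45*r^2 := by
        have : 45*r^2 = α.norm^5 - 144*u^10 := by rw [hw]; ring
        rw [this]
        exact dvd_sub (dvd_pow h1 (by norm_num)) (Dvd.dvd.mul_left (dvd_pow h2 (by norm_num)) _)
      rcases hlp.dvd_or_dvd h6 with h7 | h7
      · have h7' : l ∣ 45 := by exact_mod_cast h7
        have : l ∈ Nat.primeFactors 45 := by simp [hl, h7']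
        have hpf : Nat.primeFactors 45 = {3,5} := by decide +kernel
        rw [hpf] at this
        simp at this
        rcases this with rfl | rfl
        · exact hu3 h2
        · exact hu5 h2
      · have h8 := hlp.dvd_of_dvd_pow h7
        refine hlp.not_isUnit (hc.isUnit_of_dvd' (x := (l:ℤ)) ?_ ?_)
        · rw [hA']; exact Dvd.dvd.mul_left (dvd_pow h2 (by norm_num)) _
        · rw [hB]; rcases hρ with h | h <;> rw [h]
          · exact h8
          · exact (dvd_neg).mpr h8
    · exact state (p := 5) (c := 36) (c' := 9) (e := 11) (k := 3) (by norm_num) (by norm_num) (by norm_num) (T5_spec 19 14 rfl) st19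
        (alpha_prim (by norm_num) (by norm_num) (by norm_num) hc he) (by rw [hlin]; simp)
    · exact state (p := 5) (c := 36) (c' := 41) (e := 35) (k := 3) (by norm_num) (by norm_num) (by norm_num) (T5_spec 59 54 rfl) st59
        (alpha_prim (by norm_num) (by norm_num) (by norm_num) hc he) (by rw [hlin]; simp)
  · norm_num at c
  · norm_num at c

lemma z8_5 : ∀ w u k : ZMod 8, w^5 = 144*u^10+45*(2*k+1)^2 → w = 5 := by decide +kernel
lemma z5_5 : ∀ w u r : ZMod 5, w^5 = 144*u^10+45*r^2 → w = -u^2 := by decide +kernel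

lemma p5_w8 {w u r : ℤ} (h : w^5 = 144*u^10+45*r^2) (hr : Odd r) : w % 8 = 5 := by
  obtain ⟨k, rfl⟩ := hr
  have := congrArg (Int.cast (R := ZMod 8)) h
  push_cast at this
  exact of_zmod (n := 8) (t := 5) (z8_5 _ _ _ this)
lemma p5_w5 {w u r : ℤ} (h : w^5 = 144*u^10+45*r^2) : (5:ℤ) ∣ w + u^2 := by
  have := congrArg (Int.cast (R := ZMod 5)) h
  push_cast at this
  have := z5_5 _ _ _ this
  have h2 : ((w:ℤ) : ZMod 5) = ((-u^2 : ℤ) : ZMod 5) := by push_cast; exact this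
  simpa using dvd_of_zq h2

lemma sq8_even {u : ℤ} (h : Even u) : u^2 % 8 = 0 ∨ u^2 % 8 = 4 := by
  obtain ⟨k, rfl⟩ := h
  have : (k+k)^2 = 4*(k*k) := by ring
  rw [this]; omega
lemma sq8_odd {u : ℤ} (h : Odd u) : u^2 % 8 = 1 := by
  have := Int.eight_dvd_sq_sub_one_of_odd h
  omega
lemma sq3 {u : ℤ} (h : ¬ (3:ℤ) ∣ u) : u^2 % 3 = 1 := by
  have : u % 3 = 1 ∨ u % 3 = 2 := by omega
  rcases this with h | h <;> simp [pow_two, Int.mul_emod, h]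

/-- reduction of a quadratic form value mod n -/
lemma qf_mod (n : ℕ) {w U a b : ℤ} (hw : w % n = a % n) (hU : U % n = b % n) (x y z : ℤ) :
    (x*w^2+y*(w*U)+z*U^2) % n = (x*a^2+y*(a*b)+z*b^2) % n := by
  apply of_zmod
  push_cast
  rw [zmod_of hw, zmod_of hU]
lemma lf_mod (n : ℕ) {w U a b : ℤ} (hw : w % n = a % n) (hU : U % n = b % n) (x y : ℤ) :
    (x*w+y*U) % n = (x*a+y*b) % n := by
  apply of_zmod
  push_cast
  rw [zmod_of hw, zmod_of hU]

lemma jz_pow_cop {q : ℕ} (hq : q.Prime) {u : ℤ} (h : ¬ (q:ℤ) ∣ u) (x : ℤ) : jz (x*(u^2)^2) q = jz x q := by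
  rw [jz_mul, jz_sq ((cop_prime hq h).pow_left), mul_one]

lemma cop_qf {w U y z H g : ℤ} (x : ℤ) (hx : x = 1 ∨ (x = 2 ∧ Odd H) ∨ (x = 3 ∧ H % 3 ≠ 0)) (h : IsCoprime w U) (hG : x*w^2+y*(w*U)+z*U^2 = g*H) : IsCoprime U H := by
  apply cop_of
  intro l hl h1 h2
  have hlp := Nat.prime_iff_prime_int.mp hl
  have h3 : (l:ℤ) ∣ x*w^2 := by
    have : x*w^2 = g*H - U*(y*w+z*U) := by rw [← hG]; ring
    rw [this]; exact dvd_sub (Dvd.dvd.mul_left h2 _) (Dvd.dvd.mul_right h1 _)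
  rcases hlp.dvd_or_dvd h3 with h4 | h4
  · rcases hx with rfl | ⟨rfl, ho⟩ | ⟨rfl, ho⟩
    · exact hlp.not_isUnit (isUnit_of_dvd_one h4)
    · have : l = 2 := (Nat.prime_dvd_prime_iff_eq hl Nat.prime_two).mp (by exact_mod_cast h4)
      subst this
      have := Int.odd_iff.mp ho
      push_cast at h2; omega
    · have : l = 3 := (Nat.prime_dvd_prime_iff_eq hl Nat.prime_three).mp (by exact_mod_cast h4)
      subst this
      push_cast at h2; omega
  · exact hlp.not_isUnit (h.isUnit_of_dvd' (hlp.dvd_of_dvd_pow h4) h1)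

/-- the kill lemma for G = g H a quadratic form -/
lemma jz_kill' {c m0 m' a b w U g H K s0 z x y t: ℤ} (hab : IsCoprime a b) (hwU : IsCoprime w U)
    (hm : a*w+b*U = m0*m') (hG : x*w^2+y*(w*U)+t*U^2 = g*H) (hK : a^2*t - (a*y-b*x)*b = K)
    (hx : x = 1 ∨ (x = 2 ∧ Odd H) ∨ (x = 3 ∧ H % 3 ≠ 0))
    (hs : IsCoprime s0 H) (hz : H ∣ c*(a*w+b*U)*(s0*U^2)^2 - z^2) (hH : Odd H) (hmo : Odd m') (hpos : 0 < H ∨ 0 < m')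
    (hg : IsCoprime g m') : jz (c*m0) H * qs m' H * jz (g*K) m' ≠ -1 := by
  refine jz_kill (K := K) hab hwU hm ?_ ?_ (hs.mul_left (cop_qf x hx hwU hG).pow_left) hz hH hmo hpos hg
  · rw [← hG, ← hK]; exact ⟨m0*(a*x*w+(a*y-b*x)*U), by linear_combination (a*x*w+(a*y-b*x)*U)*hm⟩
  · rw [← hG, ← hK]; exact ⟨m0*(b*t*U+(b*y-a*t)*w), by linear_combination (b*t*U+(b*y-a*t)*w)*hm⟩

lemma cop_4 {m : ℤ} (h : Odd m) : IsCoprime (4:ℤ) m := by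
  have := cop_two h 2; norm_num at this; exact this
lemma cop_16 {m : ℤ} (h : Odd m) : IsCoprime (16:ℤ) m := by
  have := cop_two h 4; norm_num at this; exact this
lemma cop_6 {m : ℤ} (h : Odd m) (h3 : m % 3 ≠ 0) : IsCoprime (6:ℤ) m := by
  have := (cop_two h 1).mul_left (cop_three h3); norm_num at this; exact this

lemma jz5U {u : ℤ} (h5 : ¬ (5:ℤ) ∣ u) (x : ℤ) : jz (x*(u^2)^2) 5 = jz x 5 := jz_pow_cop (q := 5) (by norm_num) h5 x

lemma F1e {H m u : ℤ} (hH0 : 0 < H) (hH4 : H % 4 = 3) (hm8 : m % 8 = 1) (m3 : m % 3 = 1) (h5 : ¬ (5:ℤ) ∣ u)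
    (hd : (5:ℤ) ∣ H - 3*(u^2)^2) (hq : jz m 19 = -1) : jz (-5*1) H * qs m H * jz (3*(4^2*19)) m = -1 := by
  have hHo : Odd H := Int.odd_iff.mpr (by omega)
  have hmo : Odd m := Int.odd_iff.mpr (by omega)
  have e1 : jz (-5*1) H = 1 := by
    rw [show (-5*1:ℤ) = -1*5 by norm_num, jz_mul, jz_neg_one hH0 hHo, if_pos hH4, jz_flip (3*(u^2)^2) (by norm_num) (by decide) hHo hd,
        qs_one_left (by norm_num), jz5U h5]
    norm_num [jz]
  have e2 : jz (3*(4^2*19)) m = -1 := by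
    rw [jz_mul, jz_mul, jz_sq (cop_4 hmo), jz_flip 1 (by norm_num) (by decide) hmo (by omega),
       jz_rec (a := 19) (by decide) hmo (Or.inl (by norm_num)), hq, qs_one_right (by omega), qs_one_right (by omega)]
    norm_num [jz]
  rw [e1, e2, qs_one_left (by omega)]; norm_num

lemma F1o {H m u : ℤ} (hH0 : 0 < H) (hH4 : H % 4 = 1) (hm8 : m % 8 = 7) (m3 : m % 3 = 1) (h5 : ¬ (5:ℤ) ∣ u)
    (hd : (5:ℤ) ∣ H - 4*(u^2)^2) (hq : jz m 19 = -1) : jz (-5*1) H * qs m H * jz (6*(4^2*19)) m = -1 := by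
  have hHo : Odd H := Int.odd_iff.mpr (by omega)
  have hmo : Odd m := Int.odd_iff.mpr (by omega)
  have e1 : jz (-5*1) H = 1 := by
    rw [show (-5*1:ℤ) = -1*5 by norm_num, jz_mul, jz_neg_one hH0 hHo, if_neg (by omega), jz_flip (4*(u^2)^2) (by norm_num) (by decide) hHo hd,
        qs_one_left (by norm_num), jz5U h5]
    norm_num [jz]
  have e2 : jz (6*(4^2*19)) m = -1 := by
    rw [show (6*(4^2*19):ℤ) = 2*(3*(4^2*19)) by norm_num, jz_mul, jz_two hmo, if_pos (by omega), jz_mul, jz_mul, jz_sq (cop_4 hmo), jz_flip 1 (by norm_num) (by decide) hmo (by omega),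
       jz_rec (a := 19) (by decide) hmo (Or.inl (by norm_num)), hq, qs_neg (by norm_num) (by omega), qs_neg (by norm_num) (by omega)]
    norm_num [jz]
  rw [e1, e2, qs_one_right (by omega)]; norm_num

lemma p5_F1 {w u r : ℤ} (h : w^5 = 144*u^10+45*r^2) (hr : Odd r) (h5 : ¬ (5:ℤ) ∣ u) (hu3 : ¬ (3:ℤ) ∣ u) (hw3 : (3:ℤ) ∣ w)
    (hc : IsCoprime w u) (hq : jz (5*w+22*u^2) 19 = -1) : False := by
  have hw8 := p5_w8 h hr
  have hw5 := p5_w5 h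
  have hU3 := sq3 hu3
  have hw0 : 0 < w := by
    rw [← Odd.pow_pos_iff (n := 5) (by decide), h]
    have : r ≠ 0 := by rintro rfl; simp at hr
    positivity
  have hcU : IsCoprime w (u^2) := hc.pow_right
  have hm0 : 0 < 5*w+22*u^2 := by positivity
  have m3 : (5*w+22*u^2) % 3 = 1 := by omega
  have hdG : ∀ H g : ℤ, 1*w^2+3*(w*u^2)+6*(u^2)^2 = g*H → H ∣ (-5)*(5*w+22*u^2)*(3*(u^2)^2)^2 - (15*r)^2 := by
    intro H g hg
    exact ⟨-g*5*(9*(u^2)^3+3*w*(u^2)^2-3*w^2*u^2+w^3), by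
      linear_combination 5*h - 5*(9*(u^2)^3+3*w*(u^2)^2-3*w^2*u^2+w^3)*hg⟩
  have hGp : 0 < 1*w^2+3*(w*u^2)+6*(u^2)^2 := by positivity
  have G5 : (5:ℤ) ∣ (1*w^2+3*(w*u^2)+6*(u^2)^2) - 4*(u^2)^2 := by
    obtain ⟨v, hv⟩ := hw5
    have : w = 5*v - u^2 := by omega
    exact ⟨5*v^2+v*u^2, by rw [this]; ring⟩
  have G3 : ∃ v, 1*w^2+3*(w*u^2)+6*(u^2)^2 = 3*(3*v+2) := by
    obtain ⟨k, rfl⟩ := hw3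
    have : u^2 = 3*(u^2/3)+1 := by omega
    generalize u^2/3 = n at this
    rw [this]
    exact ⟨k^2+k*(3*n+1)+2*(3*n^2+2*n), by ring⟩
  obtain ⟨v, hv⟩ := G3
  have hK : (5:ℤ)^2*6 - (5*3-22*1)*22 = 4^2*19 := by norm_num
  have hab : IsCoprime (5:ℤ) 22 := by norm_num
  rcases Int.even_or_odd u with he | ho
  · have hU8 := sq8_even he
    have g8 : (1*w^2+3*(w*u^2)+6*(u^2)^2) % 8 = 1 ∨ (1*w^2+3*(w*u^2)+6*(u^2)^2) % 8 = 5 := by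
      rcases hU8 with h8 | h8
      · left; exact qf_mod 8 (w := w) (U := u^2) (a := 5) (b := 0) hw8 h8 1 3 6
      · right; exact qf_mod 8 (w := w) (U := u^2) (a := 5) (b := 4) hw8 h8 1 3 6
    have m8 : (5*w+22*u^2) % 8 = 1 := by clear * - hU8 hw8; omega
    have hH4 : (3*v+2) % 4 = 3 := by clear * - g8 hv; omega
    have hz := hdG _ 3 hv
    have hH0 : 0 < 3*v+2 := by clear * - hGp hv; omega
    have hd : (5:ℤ) ∣ (3*v+2) - 3*(u^2)^2 := by clear * - G5 hv; omega
    have hHo : Odd (3*v+2) := Int.odd_iff.mpr (by clear * - hH4; omega)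
    have hmo : Odd (5*w+22*u^2) := Int.odd_iff.mpr (by clear * - m8; omega)
    have hc3 : IsCoprime (3:ℤ) (3*v+2) := cop_three (by clear * -; omega)
    have hc3' : IsCoprime (3:ℤ) (5*w+22*u^2) := cop_three (by clear * - m3; omega)
    exact jz_kill' hab hcU (one_mul _).symm hv hK (Or.inl rfl) hc3 hz hHo hmo (Or.inr hm0) hc3' (F1e hH0 hH4 m8 m3 h5 hd hq)
  · have hU8 := sq8_odd ho
    have g8 : (1*w^2+3*(w*u^2)+6*(u^2)^2) % 8 = 6 := 
      qf_mod 8 (w := w) (U := u^2) (a := 5) (b := 1) hw8 hU8 1 3 6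
    have m8 : (5*w+22*u^2) % 8 = 7 := by clear * - hU8 hw8; omega
    obtain ⟨H, hH⟩ : ∃ H, 3*v+2 = 2*H := ⟨(3*v+2)/2, by clear * - g8 hv; omega⟩
    have hv' : 1*w^2+3*(w*u^2)+6*(u^2)^2 = 6*H := by clear * - hH hv; omega
    have hH4 : H % 4 = 1 := by clear * - g8 hv'; omega
    have hz := hdG _ 6 hv'
    have hH0 : 0 < H := by clear * - hGp hv'; omega
    have hd : (5:ℤ) ∣ H - 4*(u^2)^2 := by clear * - G5 hv'; omega
    have hHo : Odd H := Int.odd_iff.mpr (by clear * - hH4; omega)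
    have hmo : Odd (5*w+22*u^2) := Int.odd_iff.mpr (by clear * - m8; omega)
    have hc3 : IsCoprime (3:ℤ) H := cop_three (by clear * - hH; omega)
    have hc3' : IsCoprime (6:ℤ) (5*w+22*u^2) := cop_6 hmo (by clear * - m3; omega)
    exact jz_kill' hab hcU (one_mul _).symm hv' hK (Or.inl rfl) hc3 hz hHo hmo (Or.inr hm0) hc3' (F1o hH0 hH4 m8 m3 h5 hd hq)

lemma F2K {m : ℤ} (hm0 : 0 < m) (hm8 : m % 8 = 7) (hq : jz m 59 = 1) : jz (4^2*(-1*59)) m = 1 := by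
  have hmo : Odd m := Int.odd_iff.mpr (by omega)
  rw [jz_mul, jz_sq (cop_4 hmo), jz_mul, jz_neg_one hm0 hmo, if_pos (by omega), jz_rec (a := 59) (by decide) hmo (Or.inl (by norm_num)), hq,
    qs_neg (by norm_num) (by omega)]
  norm_num

lemma F2e {H m u : ℤ} (hH4 : H % 4 = 1) (hm0 : 0 < m) (hm8 : m % 8 = 7) (h5 : ¬ (5:ℤ) ∣ u)
    (hd : (5:ℤ) ∣ H - 1*(u^2)^2) (h19 : jz H 19 = -1) (hq : jz m 59 = 1) : jz (95*1) H * qs m H * jz (1*(4^2*(-1*59))) m = -1 := by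
  have hHo : Odd H := Int.odd_iff.mpr (by omega)
  have e1 : jz (95*1) H = -1 := by
    rw [show (95*1:ℤ) = 5*19 by norm_num, jz_mul, jz_flip (1*(u^2)^2) (by norm_num) (by decide) hHo hd,
        qs_one_left (by norm_num), jz5U h5, jz_rec (a := 19) (by decide) hHo (Or.inl (by norm_num)), h19, qs_one_right (by omega)]
    norm_num [jz]
  rw [one_mul, F2K hm0 hm8 hq, e1, qs_one_right (by omega)]; norm_num

lemma F2o {H m u : ℤ} (hH4 : H % 4 = 1) (hm0 : 0 < m) (hm8 : m % 8 = 7) (h5 : ¬ (5:ℤ) ∣ u)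
    (hd : (5:ℤ) ∣ H - 3*(u^2)^2) (h19 : jz (2*H) 19 = -1) (hq : jz m 59 = 1) : jz (95*1) H * qs m H * jz (2*(4^2*(-1*59))) m = -1 := by
  have hHo : Odd H := Int.odd_iff.mpr (by omega)
  have hmo : Odd m := Int.odd_iff.mpr (by omega)
  have h19' : jz H 19 = 1 := by
    rw [jz_mul, show jz 2 19 = -1 by norm_num [jz]] at h19
    omega
  have e1 : jz (95*1) H = -1 := by
    rw [show (95*1:ℤ) = 5*19 by norm_num, jz_mul, jz_flip (3*(u^2)^2) (by norm_num) (by decide) hHo hd,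
        qs_one_left (by norm_num), jz5U h5, jz_rec (a := 19) (by decide) hHo (Or.inl (by norm_num)), h19', qs_one_right (by omega)]
    norm_num [jz]
  rw [jz_mul 2, jz_two hmo, if_pos (by omega), one_mul, F2K hm0 hm8 hq, e1, qs_one_right (by omega)]; norm_num

lemma p5_F2 {w u r : ℤ} (h : w^5 = 144*u^10+45*r^2) (hr : Odd r) (h5 : ¬ (5:ℤ) ∣ u)
    (hc : IsCoprime w u) (h19 : jz (1*w^2+(-3)*(w*u^2)+(-8)*(u^2)^2) 19 = -1) (hq : jz (19*w+24*u^2) 59 = 1) : False := by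
  have hw8 := p5_w8 h hr
  have hw5 := p5_w5 h
  have hw0 : 0 < w := by
    rw [← Odd.pow_pos_iff (n := 5) (by decide), h]
    have : r ≠ 0 := by rintro rfl; simp at hr
    positivity
  have hcU : IsCoprime w (u^2) := hc.pow_right
  have hm0 : 0 < 19*w+24*u^2 := by positivity
  have hdG : ∀ H g : ℤ, 1*w^2+(-3)*(w*u^2)+(-8)*(u^2)^2 = g*H → H ∣ 95*(19*w+24*u^2)*(1*(u^2)^2)^2 - (15*r)^2 := by
    intro H g hg
    exact ⟨-g*5*(75*(u^2)^3+17*w*(u^2)^2+3*w^2*u^2+w^3), by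
      linear_combination 5*h - 5*(75*(u^2)^3+17*w*(u^2)^2+3*w^2*u^2+w^3)*hg⟩
  have G5 : (5:ℤ) ∣ (1*w^2+(-3)*(w*u^2)+(-8)*(u^2)^2) - 1*(u^2)^2 := by
    obtain ⟨v, hv⟩ := hw5
    have : w = 5*v - u^2 := by omega
    exact ⟨5*v^2-5*v*u^2-(u^2)^2, by rw [this]; ring⟩
  have hK : (19:ℤ)^2*(-8) - (19*(-3)-24*1)*24 = 4^2*(-1*59) := by norm_num
  have hab : IsCoprime (19:ℤ) 24 := by norm_num
  rcases Int.even_or_odd u with he | ho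
  · have hU8 := sq8_even he
    have g8 : (1*w^2+(-3)*(w*u^2)+(-8)*(u^2)^2) % 8 = 1 ∨ (1*w^2+(-3)*(w*u^2)+(-8)*(u^2)^2) % 8 = 5 := by
      rcases hU8 with h8 | h8
      · left; exact qf_mod 8 (w := w) (U := u^2) (a := 5) (b := 0) hw8 h8 1 (-3) (-8)
      · right; exact qf_mod 8 (w := w) (U := u^2) (a := 5) (b := 4) hw8 h8 1 (-3) (-8)
    have m8 : (19*w+24*u^2) % 8 = 7 := by clear * - hU8 hw8; omega
    obtain ⟨H, hv⟩ : ∃ H, 1*w^2+(-3)*(w*u^2)+(-8)*(u^2)^2 = 1*H := ⟨_, (one_mul _).symm⟩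
    have hz := hdG _ _ hv
    rw [hv] at g8 G5 h19
    rw [one_mul] at g8 G5 h19
    have hH4 : H % 4 = 1 := by clear * - g8; omega
    have hHo : Odd H := Int.odd_iff.mpr (by clear * - hH4; omega)
    have hmo : Odd (19*w+24*u^2) := Int.odd_iff.mpr (by clear * - m8; omega)
    exact jz_kill' hab hcU (one_mul _).symm hv hK (Or.inl rfl) isCoprime_one_left hz hHo hmo (Or.inr hm0) isCoprime_one_left (F2e hH4 hm0 m8 h5 G5 h19 hq)
  · have hU8 := sq8_odd ho
    have g8 : (1*w^2+(-3)*(w*u^2)+(-8)*(u^2)^2) % 8 = 2 := 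
      qf_mod 8 (w := w) (U := u^2) (a := 5) (b := 1) hw8 hU8 1 (-3) (-8)
    have m8 : (19*w+24*u^2) % 8 = 7 := by clear * - hU8 hw8; omega
    obtain ⟨H, hv⟩ : ∃ H, 1*w^2+(-3)*(w*u^2)+(-8)*(u^2)^2 = 2*H := 
      ⟨(1*w^2+(-3)*(w*u^2)+(-8)*(u^2)^2)/2, by generalize 1*w^2+(-3)*(w*u^2)+(-8)*(u^2)^2 = G at g8; clear * - g8; omega⟩
    have hz := hdG _ _ hv
    rw [hv] at g8 G5 h19
    have hH4 : H % 4 = 1 := by clear * - g8; omega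
    have hd : (5:ℤ) ∣ H - 3*(u^2)^2 := by clear * - G5; omega
    have hHo : Odd H := Int.odd_iff.mpr (by clear * - hH4; omega)
    have hmo : Odd (19*w+24*u^2) := Int.odd_iff.mpr (by clear * - m8; omega)
    exact jz_kill' hab hcU (one_mul _).symm hv hK (Or.inl rfl) isCoprime_one_left hz hHo hmo (Or.inr hm0) (cop_two hmo 1) (F2o hH4 hm0 m8 h5 hd h19 hq)

lemma F3e {H m u : ℤ} (hHo : Odd H) (hm8 : m % 8 = 1) (m3 : m % 3 = 2) (h5 : ¬ (5:ℤ) ∣ u)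
    (hd : (5:ℤ) ∣ H - (-1)*(u^2)^2) (hq : jz m 59 = 1) : jz (5*1) H * qs m H * jz (6*(16^2*59)) m = -1 := by
  have hmo : Odd m := Int.odd_iff.mpr (by omega)
  have e1 : jz (5*1) H = 1 := by
    rw [mul_one, jz_flip ((-1)*(u^2)^2) (by norm_num) (by decide) hHo hd,
        qs_one_left (by norm_num), jz5U h5]
    norm_num [jz]
  have e2 : jz (6*(16^2*59)) m = -1 := by
    rw [show (6*(16^2*59):ℤ) = 2*(3*(16^2*59)) by norm_num, jz_mul, jz_two hmo, if_pos (by omega), jz_mul, jz_mul, jz_sq (cop_16 hmo), jz_flip 2 (by norm_num) (by decide) hmo (by omega),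
       jz_rec (a := 59) (by decide) hmo (Or.inl (by norm_num)), hq, qs_one_right (by omega), qs_one_right (by omega)]
    norm_num [jz]
  rw [e1, e2, qs_one_left (by omega)]; norm_num

lemma F3o {H m u : ℤ} (hH4 : H % 4 = 3) (hm8 : m % 8 = 3) (m3 : m % 3 = 2) (h5 : ¬ (5:ℤ) ∣ u)
    (hd : (5:ℤ) ∣ H - 3*(u^2)^2) (hq : jz m 59 = 1) : jz (5*1) H * qs m H * jz (3*(16^2*59)) m = -1 := by
  have hHo : Odd H := Int.odd_iff.mpr (by omega)
  have hmo : Odd m := Int.odd_iff.mpr (by omega)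
  have e1 : jz (5*1) H = -1 := by
    rw [mul_one, jz_flip (3*(u^2)^2) (by norm_num) (by decide) hHo hd,
        qs_one_left (by norm_num), jz5U h5]
    norm_num [jz]
  have e2 : jz (3*(16^2*59)) m = -1 := by
    rw [jz_mul, jz_mul, jz_sq (cop_16 hmo), jz_flip 2 (by norm_num) (by decide) hmo (by omega),
       jz_rec (a := 59) (by decide) hmo (Or.inl (by norm_num)), hq, qs_neg (by norm_num) (by omega), qs_neg (by norm_num) (by omega)]
    norm_num [jz]
  rw [e1, e2, qs_neg (by omega) (by omega)]; norm_num

lemma p5_F3 {w u r : ℤ} (h : w^5 = 144*u^10+45*r^2) (hr : Odd r) (h5 : ¬ (5:ℤ) ∣ u) (hu3 : ¬ (3:ℤ) ∣ u) (hw3 : (3:ℤ) ∣ w)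
    (hc : IsCoprime w u) (hq : jz (61*w+(-190)*u^2) 59 = 1) : False := by
  have hw8 := p5_w8 h hr
  have hw5 := p5_w5 h
  have hU3 := sq3 hu3
  have hr0 : 0 < r^2 := by
    have : r ≠ 0 := by rintro rfl; simp at hr
    positivity
  have hu0 : 0 < u^2 := by
    have : u ≠ 0 := by rintro rfl; simp at h5
    positivity
  have hcU : IsCoprime w (u^2) := hc.pow_right
  have hGp : 0 < 2*w^2+(-3)*(w*u^2)+(-6)*(u^2)^2 := by
    have h1 : 8*u^2 < 3*w := by
      by_contra hle
      push Not at hle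
      have h2 : (3*w)^5 ≤ (8*u^2)^5 := Odd.pow_le_pow (by decide) |>.mpr hle
      have h3 : 0 ≤ (u^2)^5 := by positivity
      nlinarith
    nlinarith [mul_pos (sub_pos.mpr h1) hu0, mul_pos (sub_pos.mpr h1) (sub_pos.mpr h1)]
  have m3 : (61*w+(-190)*u^2) % 3 = 2 := by omega
  have hdG : ∀ H g : ℤ, 2*w^2+(-3)*(w*u^2)+(-6)*(u^2)^2 = g*H → H ∣ 5*(61*w+(-190)*u^2)*(3*(u^2)^2)^2 - (60*r)^2 := by
    intro H g hg
    exact ⟨-g*5*(99*(u^2)^3+42*w*(u^2)^2+12*w^2*u^2+8*w^3), by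
      linear_combination 80*h - 5*(99*(u^2)^3+42*w*(u^2)^2+12*w^2*u^2+8*w^3)*hg⟩
  have G5 : (5:ℤ) ∣ (2*w^2+(-3)*(w*u^2)+(-6)*(u^2)^2) - (-1)*(u^2)^2 := by
    obtain ⟨v, hv⟩ := hw5
    have : w = 5*v - u^2 := by omega
    exact ⟨10*v^2-7*v*u^2, by rw [this]; ring⟩
  have G3 : ∃ v, 2*w^2+(-3)*(w*u^2)+(-6)*(u^2)^2 = 3*(3*v+1) := by
    obtain ⟨k, rfl⟩ := hw3
    have : u^2 = 3*(u^2/3)+1 := by omega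
    generalize u^2/3 = n at this
    rw [this]
    exact ⟨2*k^2-k*(3*n+1)-2*(3*n^2+2*n)-1, by ring⟩
  obtain ⟨v, hv⟩ := G3
  have hK : (61:ℤ)^2*(-6) - (61*(-3)-(-190)*2)*(-190) = 16^2*59 := by norm_num
  have hab : IsCoprime (61:ℤ) (-190) := by norm_num
  rcases Int.even_or_odd u with he | ho
  · have hU8 := sq8_even he
    have g8 : (2*w^2+(-3)*(w*u^2)+(-6)*(u^2)^2) % 8 = 2 ∨ (2*w^2+(-3)*(w*u^2)+(-6)*(u^2)^2) % 8 = 6 := by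
      rcases hU8 with h8 | h8
      · left; exact qf_mod 8 (w := w) (U := u^2) (a := 5) (b := 0) hw8 h8 2 (-3) (-6)
      · right; exact qf_mod 8 (w := w) (U := u^2) (a := 5) (b := 4) hw8 h8 2 (-3) (-6)
    have m8 : (61*w+(-190)*u^2) % 8 = 1 := by clear * - hU8 hw8; omega
    obtain ⟨H, hH⟩ : ∃ H, 3*v+1 = 2*H := ⟨(3*v+1)/2, by rw [hv] at g8; clear * - g8; omega⟩
    have hv' : 2*w^2+(-3)*(w*u^2)+(-6)*(u^2)^2 = 6*H := by rw [hv, hH]; ring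
    have hz := hdG _ _ hv'
    rw [hv'] at g8 G5 hGp
    have hd : (5:ℤ) ∣ H - (-1)*(u^2)^2 := by clear * - G5; omega
    have hHo : Odd H := Int.odd_iff.mpr (by clear * - g8; omega)
    have hmo : Odd (61*w+(-190)*u^2) := Int.odd_iff.mpr (by clear * - m8; omega)
    have hc3 : IsCoprime (3:ℤ) H := cop_three (by clear * - hH; omega)
    have hc3' : IsCoprime (6:ℤ) (61*w+(-190)*u^2) := cop_6 hmo (by clear * - m3; omega)
    exact jz_kill' hab hcU (one_mul _).symm hv' hK (Or.inr (Or.inl ⟨rfl, hHo⟩)) hc3 hz hHo hmo (Or.inl (by omega)) hc3' (F3e hHo m8 m3 h5 hd hq)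
  · have hU8 := sq8_odd ho
    have g8 : (2*w^2+(-3)*(w*u^2)+(-6)*(u^2)^2) % 8 = 5 := 
      qf_mod 8 (w := w) (U := u^2) (a := 5) (b := 1) hw8 hU8 2 (-3) (-6)
    have m8 : (61*w+(-190)*u^2) % 8 = 3 := by clear * - hU8 hw8; omega
    have hz := hdG _ _ hv
    rw [hv] at g8 G5 hGp
    have hH4 : (3*v+1) % 4 = 3 := by clear * - g8; omega
    have hd : (5:ℤ) ∣ (3*v+1) - 3*(u^2)^2 := by clear * - G5; omega
    have hHo : Odd (3*v+1) := Int.odd_iff.mpr (by clear * - hH4; omega)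
    have hmo : Odd (61*w+(-190)*u^2) := Int.odd_iff.mpr (by clear * - m8; omega)
    have hc3 : IsCoprime (3:ℤ) (3*v+1) := cop_three (by clear * -; omega)
    have hc3' : IsCoprime (3:ℤ) (61*w+(-190)*u^2) := cop_three (by clear * - m3; omega)
    exact jz_kill' hab hcU (one_mul _).symm hv hK (Or.inr (Or.inl ⟨rfl, hHo⟩)) hc3 hz hHo hmo (Or.inl (by omega)) hc3' (F3o hH4 m8 m3 h5 hd hq)

lemma p5c1_false {r : ℤ} (h : SolB 5 r 1) : False := by
  obtain ⟨w, u, h, hr, h5, hu3, hw3, hc, ⟨s, hs, hs19, hu19⟩, ⟨t, ht, ht59, hu59⟩⟩ := p5c1 h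
  have hc19 := cop_prime (q := 19) (by norm_num) hu19
  have hc59 := cop_prime (q := 59) (by norm_num) hu59
  by_cases hb : s = 1 ∨ s = 9
  · refine p5_F1 h hr h5 hu3 hw3 hc ?_
    have := lin_state (α := 5) (β := 22) hs19 hc19
    push_cast at this
    rw [this]
    rcases hb with rfl | rfl <;> norm_num [jz]
  · have hs2 : s = 8 ∨ s = 18 := by
      simp only [List.mem_cons, List.not_mem_nil, or_false] at hs; omega
    have h19 : jz (1*w^2+(-3)*(w*u^2)+(-8)*(u^2)^2) 19 = -1 := by
      obtain ⟨v, hv⟩ := hs19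
      rw [jz_mod (a' := ((s:ℤ)^2-3*s-8)*(u^2)^2) ⟨v*(w+s*u^2-3*u^2), by push_cast at hv; linear_combination (w+s*u^2-3*u^2)*hv⟩]
      have := jz_pow_cop (q := 19) (by norm_num) hu19 ((s:ℤ)^2-3*s-8)
      push_cast at this
      rw [this]
      rcases hs2 with rfl | rfl <;> norm_num [jz]
    have f2 := p5_F2 h hr h5 hc h19
    have f3 := p5_F3 h hr h5 hu3 hw3 hc
    have l2 := lin_state (α := 19) (β := 24) ht59 hc59
    have l3 := lin_state (α := 61) (β := -190) ht59 hc59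
    push_cast at l2 l3
    rw [l2] at f2
    rw [l3] at f3
    simp only [List.mem_cons, List.not_mem_nil, or_false] at ht
    rcases ht with rfl | rfl | rfl | rfl | rfl | rfl | rfl | rfl | rfl | rfl | rfl | rfl <;> first | (refine f2 ?_; norm_num [jz]; done) | (refine f3 ?_; norm_num [jz]; done)

lemma pow5c (a b : ℤ) : ((⟨a,b⟩:R5)^5) = ⟨a^5-50*a^3*b^2+125*a*b^4, 5*a^4*b-50*a^2*b^3+25*b^5⟩ := by
  simp only [pow_succ, pow_zero, one_mul]
  ext <;> simp <;> ring

lemma z25_0 : ∀ y a : ZMod 25, 9*y^5 = 2*a^5 → 5*y = 0 := by decide +kernel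

lemma p5c023 {r : ℤ} {cs : ℕ} (h1 : cs ≠ 1) (h : SolB 5 r cs) : False := by
  have s5 : cs = 2 ∨ cs = 3 → ¬ (5:ℤ) ∣ r := fun hh => sideB5 (by norm_num) hh h
  obtain ⟨α, A, B, Y, ρ, hc, he, hρ, hY, ho, h3, hcs⟩ := h
  obtain ⟨a, b⟩ := α
  rw [pow5c] at he
  have e1 := congrArg Zsqrtd.re he
  have e2 := congrArg Zsqrtd.im he
  simp only [Zsqrtd.re_mul, Zsqrtd.im_mul] at e1 e2
  have key : (5:ℤ) ∣ B → (5:ℤ) ∣ A := by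
    rintro ⟨B', hB'⟩
    have ha : (5:ℤ) ∣ a := by
      apply Int.Prime.dvd_pow' (k := 5) (p := 5) (by norm_num)
      exact ⟨10*a^3*b^2-25*a*b^4 - 9*B'+2*(a^4*b-10*a^2*b^3+5*b^5), by push_cast; rw [hB'] at e1 e2; linear_combination -2*e2+e1⟩
    obtain ⟨a', rfl⟩ := ha
    have h9 : (5:ℤ) ∣ 9*A := 
      ⟨2*a'*(5*a')^4-20*a'*(5*a')^2*b^2*5+250*a'*b^4 + (5*(5*a')^4*b-50*(5*a')^2*b^3+25*b^5), by linear_combination -2*e1-5*e2⟩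
    omega
  have k2 : (5:ℤ) ∣ B → False := fun hB => by
    have := hc.isUnit_of_dvd' (key hB) hB
    rw [Int.isUnit_iff] at this; omega
  rcases hcs with ⟨rfl, hA, hB, h5⟩ | ⟨c, _⟩ | ⟨rfl, hB, hA⟩ | ⟨rfl, hB, hA⟩
  · have h9 : 9*Y^5 = 2*a^5 + 25*(-4*a^3*b^2+10*a*b^4+a^4*b-10*a^2*b^3+5*b^5) := by
      rw [← hA]; linear_combination -2*e1-5*e2
    have := congrArg (Int.cast (R := ZMod 25)) h9
    push_cast at this
    rw [show (25:ZMod 25) = 0 by rfl, zero_mul, add_zero] at this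
    have h5y := z25_0 _ _ this
    have : ((5*Y : ℤ) : ZMod 25) = 0 := by push_cast; exact h5y
    rw [ZMod.intCast_zmod_eq_zero_iff_dvd] at this
    apply h5
    rw [hA]
    exact dvd_pow (by push_cast at this; omega) (by norm_num)
  · exact h1 c
  · have : (5:ℤ) ∣ Y := Int.Prime.dvd_pow' (k := 5) (p := 5) (by norm_num) ⟨5*B, by push_cast; rw [← hB]; ring⟩
    obtain ⟨v, rfl⟩ := this
    exact k2 ⟨25*v^5, by have : 25*B = 25*(5*(25*v^5)) := by { rw [hB]; ring }
                         omega⟩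
  · have : (5:ℤ) ∣ Y := Int.Prime.dvd_pow' (k := 5) (p := 5) (by norm_num) ⟨40*B, by push_cast; rw [← hB]; ring⟩
    obtain ⟨v, rfl⟩ := this
    have : 200*B = 25*(5*(25*v^5)) := by { rw [hB]; ring }
    exact k2 (by omega)

theorem p5_false {r : ℤ} {cs : ℕ} (h : SolB 5 r cs) : False := by
  by_cases h1 : cs = 1
  · subst h1; exact p5c1_false h
  · exact p5c023 h1 h

lemma p7c3 {r : ℤ} (h : SolB 7 r 3) : False :=
  sChk_sound (p := 7) (k := 2) (a := 2) (s := 13) (m0 := 0) (m1 := 0) (m2 := 0) (m3 := 1) (by norm_num) (by norm_num) (by decide +kernel) rfl h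

lemma p7c0x {r : ℤ} (h : SolB 7 r 0) : ∃ w u : ℤ, w^7 = 9*u^14+180*r^2 ∧ Odd u ∧ ¬ (5:ℤ) ∣ u ∧ IsCoprime w u := by
  obtain ⟨α, A, B, Y, ρ, hc, he, hρ, hY, ho, h3, hcs⟩ := h
  have hρ2 : ρ^2 = r^2 := by rcases hρ with h | h <;> rw [h]; ring
  rcases hcs with ⟨_, hA, hB, h5⟩ | ⟨c, _⟩ | ⟨c, _⟩ | ⟨c, _⟩
  · have hu5 : ¬ (5:ℤ) ∣ Y := fun hh => h5 (by rw [hA]; exact (dvd_pow hh (by norm_num)))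
    have hn := norm_eqB he
    have hw : α.norm^7 = 9*Y^14+180*r^2 := by rw [hn, hA, hB]; linear_combination 180*hρ2
    have hYo : Odd Y := by
      rw [hA, hB] at ho
      by_contra hne
      rw [Int.not_odd_iff_even] at hne
      obtain ⟨k, rfl⟩ := hne
      rw [Int.odd_iff] at ho
      have : ((k+k)^7)^2+5*(2*ρ)^2 = 2*(8192*k^14+10*ρ^2) := by ring
      omega
    refine ⟨α.norm, Y, hw, hYo, hu5, ?_⟩
    · apply cop_of
      intro l hl h1 h2
      have hlp := Nat.prime_iff_prime_int.mp hl
      have h6 : (l:ℤ) ∣ 180*r^2 := by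
        have : 180*r^2 = α.norm^7 - 9*Y^14 := by rw [hw]; ring
        rw [this]
        exact dvd_sub (dvd_pow h1 (by norm_num)) (Dvd.dvd.mul_left (dvd_pow h2 (by norm_num)) _)
      rcases hlp.dvd_or_dvd h6 with h7 | h7
      · have h7' : l ∣ 180 := by exact_mod_cast h7
        have : l ∈ Nat.primeFactors 180 := by simp [hl, h7']
        have hpf : Nat.primeFactors 180 = {2,3,5} := by decide +kernel
        rw [hpf] at this
        simp at this
        rcases this with rfl | rfl | rfl
        · rw [Int.odd_iff] at hYo; push_cast at h2; omega
        · exact h3 h2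
        · exact hu5 h2
      · have h8 := hlp.dvd_of_dvd_pow h7
        refine hlp.not_isUnit (hc.isUnit_of_dvd' (x := (l:ℤ)) ?_ ?_)
        · rw [hA]; exact (dvd_pow h2 (by norm_num))
        · rw [hB]; rcases hρ with h | h <;> rw [h]
          · exact Dvd.dvd.mul_left h8 _
          · exact Dvd.dvd.mul_left ((dvd_neg).mpr h8) _
  · norm_num at c
  · norm_num at c
  · norm_num at c

lemma z16_7 : ∀ w k l : ZMod 16, w^7 = 9*(2*k+1)^14+180*(2*l+1)^2 → w + (2*k+1)^2 = 6 := by decide +kernel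
lemma z8_7 : ∀ w k l : ZMod 8, w^7 = 9*(2*k+1)^14+180*(l+l)^2 → w = (2*k+1)^2 := by decide +kernel
lemma z5_7 : ∀ w u r : ZMod 5, w^7 = 9*u^14+180*r^2 → w = -u^2 := by decide +kernel

lemma p7c0a {w u r : ℤ} (h : w^7 = 9*u^14+180*r^2) (hu : Odd u) (hc : IsCoprime w u) (hr : Odd r) (hw5 : (5:ℤ) ∣ w + u^2) : False := by
  have hw0 : 0 < w := by
    rw [← Odd.pow_pos_iff (n := 7) (by decide), h]
    have : r ≠ 0 := by rintro rfl; simp at hr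
    positivity
  have h16 : (w+u^2) % 16 = 6 := by
    obtain ⟨k, rfl⟩ := hu
    obtain ⟨l, rfl⟩ := hr
    have := congrArg (Int.cast (R := ZMod 16)) h
    push_cast at this
    apply of_zmod (n := 16) (t := 6)
    push_cast
    exact z16_7 _ _ _ this
  obtain ⟨n, hn⟩ : ∃ n, w + u^2 = 10*n := ⟨(w+u^2)/10, by omega⟩
  have hn0 : 0 < n := by have : 0 < w+u^2 := by positivity
                         omega
  have hn8 : n % 8 = 7 := by omega
  have hno : Odd n := Int.odd_iff.mpr (by omega)
  have hd : n ∣ (-2)*(u^7)^2 - (6*r)^2 := by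
    refine ⟨-2*(w^6-w^5*u^2+w^4*u^4-w^3*u^6+w^2*u^8-w*u^10+u^12), ?_⟩
    have : 10*((-2)*(u^7)^2 - (6*r)^2) = 10*(n*(-2*(w^6-w^5*u^2+w^4*u^4-w^3*u^6+w^2*u^8-w*u^10+u^12))) := by
      linear_combination -2*(w^6-w^5*u^2+w^4*u^4-w^3*u^6+w^2*u^8-w*u^10+u^12)*hn + 2*h
    omega
  have hcop : IsCoprime (u^7) n := by
    apply IsCoprime.pow_left
    apply cop_of
    intro l hl h1 h2
    have hlp := Nat.prime_iff_prime_int.mp hl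
    refine hlp.not_isUnit (hc.isUnit_of_dvd' (x := (l:ℤ)) ?_ h1)
    have : w = 10*n-u*u := by rw [← hn]; ring
    rw [this]; exact dvd_sub (Dvd.dvd.mul_left h2 _) (Dvd.dvd.mul_left h1 _)
  apply jz_sq_ne hcop hd
  rw [show (-2:ℤ) = -1*2 by norm_num, jz_mul, jz_neg_one hn0 hno, jz_two hno, if_pos (by omega), if_pos (by omega)]; norm_num

lemma p7c0b {w u s : ℤ} (h : w^7 = 9*u^14+180*(s+s)^2) (hs : s ≠ 0) (hu : Odd u) (hc : IsCoprime w u) (h5 : ¬ (5:ℤ) ∣ u) (hw5 : (5:ℤ) ∣ w + u^2) : False := by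
  have hwU : u^2 < w := by
    by_contra hle
    push Not at hle
    have h2 : w^7 ≤ (u^2)^7 := Odd.pow_le_pow (by decide) |>.mpr hle
    have h3 : 0 ≤ (u^2)^7 := by positivity
    have h4 : 0 < s^2 := by positivity
    nlinarith
  have hU8 := sq8_odd hu
  have h8 : w % 8 = 1 := by
    have : (w : ZMod 8) = ((u^2 : ℤ) : ZMod 8) := by
      obtain ⟨k, rfl⟩ := hu
      have := congrArg (Int.cast (R := ZMod 8)) h
      push_cast at this
      push_cast
      exact z8_7 _ _ _ this
    have := of_zmod this
    push_cast at this
    omega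
  obtain ⟨n, hn⟩ : ∃ n, w - u^2 = 8*n := ⟨(w-u^2)/8, by omega⟩
  have hn0 : 0 < n := by omega
  have hnK : n*(w^6+w^5*u^2+w^4*u^4+w^3*u^6+w^2*u^8+w*u^10+u^12) = u^14+90*s^2 := by
    have : 8*(n*(w^6+w^5*u^2+w^4*u^4+w^3*u^6+w^2*u^8+w*u^10+u^12)) = 8*(u^14+90*s^2) := by
      linear_combination -(w^6+w^5*u^2+w^4*u^4+w^3*u^6+w^2*u^8+w*u^10+u^12)*hn + h
    omega
  have hn8 : n % 8 = 7 ∨ n % 8 = 5 := by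
    have e := congrArg (Int.cast (R := ZMod 8)) hnK
    have hwz : (w : ZMod 8) = ((1:ℤ) : ZMod 8) := zmod_of (by push_cast; omega)
    have hUz : ((u^2:ℤ) : ZMod 8) = ((1:ℤ) : ZMod 8) := zmod_of (by push_cast; omega)
    push_cast at e hwz hUz
    rw [show (u:ZMod 8)^4 = (u^2)^2 by ring, show (u:ZMod 8)^6 = (u^2)^3 by ring, show (u:ZMod 8)^8 = (u^2)^4 by ring, show (u:ZMod 8)^10 = (u^2)^5 by ring, show (u:ZMod 8)^12 = (u^2)^6 by ring, show (u:ZMod 8)^14 = (u^2)^7 by ring, hwz, hUz] at e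
    have : ∀ n s : ZMod 8, n*(1^6+1^5*1+1^4*1^2+1^3*1^3+1^2*1^4+1*1^5+1^6) = 1^7+90*s^2 → n = 7 ∨ n = 5 := by decide
    rcases this _ _ e with h | h
    · left; exact of_zmod (n := 8) (t := 7) h
    · right; exact of_zmod (n := 8) (t := 5) h
  have hno : Odd n := Int.odd_iff.mpr (by omega)
  have hd : n ∣ (-10)*(u^7)^2 - (30*s)^2 :=
    ⟨-10*(w^6+w^5*u^2+w^4*u^4+w^3*u^6+w^2*u^8+w*u^10+u^12), by linear_combination 10*hnK⟩
  have hcop : IsCoprime (u^7) n := by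
    apply IsCoprime.pow_left
    apply cop_of
    intro l hl h1 h2
    have hlp := Nat.prime_iff_prime_int.mp hl
    refine hlp.not_isUnit (hc.isUnit_of_dvd' (x := (l:ℤ)) ?_ h1)
    have : w = 8*n+u*u := by rw [← hn]; ring
    rw [this]; exact dvd_add (Dvd.dvd.mul_left h2 _) (Dvd.dvd.mul_left h1 _)
  apply jz_sq_ne hcop hd
  have e5 : jz 5 n = 1 := by
    rw [jz_flip (u^2) (by norm_num) (by decide) hno (by omega), qs_one_left (by norm_num)]
    have := jz_sq (cop_prime (q := 5) (by norm_num) h5)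
    push_cast at this
    rw [this]; norm_num
  rw [show (-10:ℤ) = -1*2*5 by norm_num, jz_mul, jz_mul, jz_neg_one hn0 hno, jz_two hno, e5]
  rcases hn8 with h | h
  · rw [if_pos (by omega), if_pos (by omega)]; norm_num
  · rw [if_neg (by omega), if_neg (by omega)]; norm_num

lemma p7c0 {r : ℤ} (hr0 : 0 < r) (h : SolB 7 r 0) : False := by
  obtain ⟨w, u, h, hu, h5, hc⟩ := p7c0x h
  have hw5 : (5:ℤ) ∣ w + u^2 := by
    have := congrArg (Int.cast (R := ZMod 5)) h
    push_cast at this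
    have := z5_7 _ _ _ this
    have h2 : ((w:ℤ) : ZMod 5) = ((-u^2 : ℤ) : ZMod 5) := by push_cast; exact this
    simpa using dvd_of_zq h2
  rcases Int.even_or_odd r with ⟨s, rfl⟩ | hr
  · exact p7c0b h (by omega) hu hc h5 hw5
  · exact p7c0a h hu hc hr hw5

lemma p7c1x {r : ℤ} (h : SolB 7 r 1) : ∃ w u : ℤ, w^7 = 2304*u^14+45*r^2 ∧ Odd r ∧ ¬ (5:ℤ) ∣ u ∧
    IsCoprime w u ∧ (∃ s ∈ [10,5], ((13:ℕ):ℤ) ∣ w - (s:ℕ)*u^2 ∧ ¬ ((13:ℕ):ℤ) ∣ u) := by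
  have hro := odd_r_of (by norm_num) (Or.inl rfl) h
  obtain ⟨α, A, B, Y, ρ, hc, he, hρ, hY, ho, h3, hcs⟩ := h
  have hρ2 : ρ^2 = r^2 := by rcases hρ with h | h <;> rw [h]; ring
  rcases hcs with ⟨c, _⟩ | ⟨_, hA, hB, h5⟩ | ⟨c, _⟩ | ⟨c, _⟩
  · norm_num at c
  · have hY2 : (2:ℤ) ∣ Y := by
      apply Int.prime_two.dvd_of_dvd_pow (n := 7)
      rw [← hA]; exact ⟨4*A, by ring⟩
    obtain ⟨u, rfl⟩ := hY2
    have hA' : A = 16*u^7 := by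
      have : 8*A = 8*(16*u^7) := by rw [hA]; ring
      omega
    have hu5 : ¬ (5:ℤ) ∣ u := fun hh => h5 (by rw [hA']; exact Dvd.dvd.mul_left (dvd_pow hh (by norm_num)) _)
    have hu3 : ¬ (3:ℤ) ∣ u := fun hh => h3 (Dvd.dvd.mul_left hh _)
    have hn := norm_eqB he
    have e1 : (α^7).re = 2*A - 5*B := by rw [he]; simp; ring
    have e2 : (α^7).im = A + 2*B := by rw [he]; simp; ring
    have hlin : 2*(α^7).re + 5*(α^7).im = 144*u^7 := by rw [e1, e2, hA']; ring
    have hw : α.norm^7 = 2304*u^14+45*r^2 := by rw [hn, hA', hB, hρ2]; ring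
    refine ⟨α.norm, u, hw, hro, hu5, ?_, ?_⟩
    · apply cop_of
      intro l hl h1 h2
      have hlp := Nat.prime_iff_prime_int.mp hl
      have h6 : (l:ℤ) ∣ 45*r^2 := by
        have : 45*r^2 = α.norm^7 - 2304*u^14 := by rw [hw]; ring
        rw [this]
        exact dvd_sub (dvd_pow h1 (by norm_num)) (Dvd.dvd.mul_left (dvd_pow h2 (by norm_num)) _)
      rcases hlp.dvd_or_dvd h6 with h7 | h7
      · have h7' : l ∣ 45 := by exact_mod_cast h7
        have : l ∈ Nat.primeFactors 45 := by simp [hl, h7']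
        have hpf : Nat.primeFactors 45 = {3,5} := by decide +kernel
        rw [hpf] at this
        simp at this
        rcases this with rfl | rfl
        · exact hu3 h2
        · exact hu5 h2
      · have h8 := hlp.dvd_of_dvd_pow h7
        refine hlp.not_isUnit (hc.isUnit_of_dvd' (x := (l:ℤ)) ?_ ?_)
        · rw [hA']; exact Dvd.dvd.mul_left (dvd_pow h2 (by norm_num)) _
        · rw [hB]; rcases hρ with h | h <;> rw [h]
          · exact h8
          · exact (dvd_neg).mpr h8
    · exact state (p := 7) (c := 144) (c' := 1) (e := 7) (k := 4) (by norm_num) (by norm_num) (by norm_num) (T7_spec 13 8 rfl) st13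
        (alpha_prim (by norm_num) (by norm_num) (by norm_num) hc he) (by rw [hlin]; simp)
  · norm_num at c
  · norm_num at c

lemma z5_71 : ∀ w y r : ZMod 5, w^7 = 18*y^7+45*r^2 → w = 2*y := by decide +kernel
lemma z5_72 : ∀ y z r : ZMod 5, y ≠ 0 → 22*y^7+448*y^6*z = 9*r^2 → y^2+4*y*z = 2*r^2*y^3 ∧ 4*y+z = 3*r^2*y^2 := by decide +kernel
lemma z5_73 : ∀ y t : ZMod 5, y ≠ 0 → -24488802*y^7+238085568*t*y^6 = 0 → t = 4*y := by decide +kernel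

/-- common part -/
lemma p7c1_core {w y r g m' H : ℤ} (h : w^7 = 18*y^7+45*r^2) (hc : IsCoprime w y) (hm : 1*w+18*y = g*m') (hG : w^2+y^2 = g*H)
    (hH4 : H % 4 = 1) (hH0 : 0 < H) (hmo : Odd m') (hg : IsCoprime g m') : jz ((-5)*g) H * qs m' H * jz (g*325) m' ≠ -1 := by
  have hHo : Odd H := Int.odd_iff.mpr (by omega)
  have hcH : IsCoprime (y^3) H := by
    apply IsCoprime.pow_left
    exact cop_qf (w := w) (y := 0) (z := 1) (g := g) 1 (Or.inl rfl) hc (by rw [← hG]; ring)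
  refine jz_kill (a := 1) (b := 18) (w := w) (U := y) (s := y^3) (z := 15*r) (by norm_num) hc hm ?_ ?_ hcH ?_ hHo hmo (Or.inl hH0) hg
  · rw [← hG]; exact ⟨g*(w-18*y), by linear_combination (w-18*y)*hm⟩
  · rw [← hG]; exact ⟨g*(18*y-w), by linear_combination (18*y-w)*hm⟩
  · exact ⟨-5*g*(w^5-w^3*y^2+w*y^4), by linear_combination 5*h - 5*(w^5-w^3*y^2+w*y^4)*hG⟩

lemma five_ne {y : ℤ} (h : ¬ (5:ℤ) ∣ y) : (y : ZMod 5) ≠ 0 := by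
  intro hh; exact h (by exact_mod_cast (ZMod.intCast_zmod_eq_zero_iff_dvd y 5).mp hh)

lemma jz5sq {y : ℤ} (h5 : ¬ (5:ℤ) ∣ y) : jz (y^2) 5 = 1 := by
  have := jz_sq (cop_prime (q := 5) (by norm_num) h5)
  exact_mod_cast this

lemma p7c1_a {y z r : ℤ} (h : (2*y+5*z)^7 = 18*y^7+45*r^2) (hc : IsCoprime (2*y+5*z) y) (hy2 : Even y) (hw : Odd (2*y+5*z)) (h5 : ¬ (5:ℤ) ∣ y)
    (h5r : ¬ (5:ℤ) ∣ r) (h13 : jz (2*y+5*z+18*y) 13 = -1) : False := by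
  have hy4 : y^2 % 4 = 0 := by obtain ⟨k, rfl⟩ := hy2; rw [show (k+k)^2 = 4*(k*k) by ring]; omega
  have hw4 := sq8_odd hw
  have hpos : 0 < (2*y+5*z)^2+y^2 := by
    have : y ≠ 0 := by rintro rfl; simp at h5
    positivity
  have hG : (2*y+5*z)^2+y^2 = 5*(y^2+4*y*z+5*z^2) := by ring
  have hm : 1*(2*y+5*z)+18*y = 5*(4*y+z) := by ring
  have hrel : 22*y^7+448*y^6*z + 5*(672*y^5*z^2+2800*y^4*z^3+7000*y^3*z^4+10500*y^2*z^5+8750*y*z^6+3125*z^7) = 9*r^2 := by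
    have : 5*(22*y^7+448*y^6*z + 5*(672*y^5*z^2+2800*y^4*z^3+7000*y^3*z^4+10500*y^2*z^5+8750*y*z^6+3125*z^7)) = 5*(9*r^2) := by
      linear_combination h
    exact mul_left_cancel₀ (by norm_num) this
  have hz := congrArg (Int.cast (R := ZMod 5)) hrel
  push_cast at hz
  rw [show (5:ZMod 5) = 0 by rfl, zero_mul, add_zero] at hz
  obtain ⟨k1, k2⟩ := z5_72 _ _ _ (five_ne h5) hz
  have d2 : (5:ℤ) ∣ (4*y+z) - 3*(r*y)^2 := by
    have : ((4*y+z : ℤ) : ZMod 5) = ((3*(r*y)^2 : ℤ) : ZMod 5) := by push_cast; rw [k2]; ring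
    exact_mod_cast dvd_of_zq this
  have d1 : (5:ℤ) ∣ (y^2+4*y*z+5*z^2) - 2*r^2*y^3 := by
    have : ((y^2+4*y*z : ℤ) : ZMod 5) = ((2*r^2*y^3 : ℤ) : ZMod 5) := by push_cast; rw [k1]
    have := dvd_of_zq this
    push_cast at this
    omega
  have h5ry : ¬ (5:ℤ) ∣ r*y := by
    intro hh; rcases Int.Prime.dvd_mul' (p := 5) (by norm_num) hh with h | h
    · exact h5r (by exact_mod_cast h)
    · exact h5 (by exact_mod_cast h)
  have hm5 : jz (4*y+z) 5 = -1 := by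
    rw [jz_mod d2, jz_mul, jz5sq h5ry]; norm_num [jz]
  have hcm : IsCoprime (5:ℤ) (4*y+z) := by
    apply ((Int.prime_iff_natAbs_prime.mpr (by norm_num)).coprime_iff_not_dvd).mpr
    intro hh
    rw [jz_mod (a' := 0) (by simpa using hh)] at hm5
    norm_num [jz] at hm5
  have hH5 : ¬ (5:ℤ) ∣ (y^2+4*y*z+5*z^2) := by
    intro hh
    have h1 : (5:ℤ) ∣ 2*(r^2*y^3) := by rw [← mul_assoc]; omega
    have h2 : (5:ℤ) ∣ r^2*y^3 := by omega
    have h3 : (5:ℤ) ∣ (r*y)^3 := h2.trans ⟨r, by ring⟩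
    exact h5ry (by exact_mod_cast Int.Prime.dvd_pow' (p := 5) (by norm_num) h3)
  have hmo : Odd (4*y+z) := by
    rw [Int.odd_iff] at hw ⊢
    obtain ⟨k, rfl⟩ := hy2
    omega
  have hcH : IsCoprime (5:ℤ) (y^2+4*y*z+5*z^2) := ((Int.prime_iff_natAbs_prime.mpr (by norm_num)).coprime_iff_not_dvd).mpr hH5
  generalize hHd : y^2+4*y*z+5*z^2 = H at *
  have hH4 : H % 4 = 1 := by omega
  have hH0 : 0 < H := by omega
  have hHo : Odd H := Int.odd_iff.mpr (by omega)
  apply p7c1_core h hc hm hG hH4 hH0 hmo hcm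
  have e1 : jz ((-5)*5) H = 1 := by
    rw [show ((-5)*5:ℤ) = -1*5^2 by norm_num, jz_mul, jz_neg_one hH0 hHo, if_neg (by omega), jz_sq hcH]; norm_num
  have e13 : jz (4*y+z) 13 = 1 := by
    have h' : jz (5*(4*y+z)) 13 = -1 := by rw [← h13]; congr 1; ring
    rw [jz_mul, show jz 5 13 = -1 by norm_num [jz]] at h'
    omega
  have e2 : jz (5*325) (4*y+z) = -1 := by
    rw [show (5*325:ℤ) = 5^2*(5*13) by norm_num, jz_mul, jz_sq hcm, jz_mul, jz_rec (a := 5) (by decide) hmo (Or.inl (by norm_num)),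
      jz_rec (a := 13) (by decide) hmo (Or.inl (by norm_num)), e13, hm5, qs_one_left (by norm_num), qs_one_left (by norm_num)]; norm_num
  rw [e1, e2, qs_one_right hH4]; norm_num

lemma p7c1_b {y t r : ℤ} (h : ((-18)*y+25*t)^7 = 18*y^7+45*(5*r)^2) (hc : IsCoprime ((-18)*y+25*t) y) (hy2 : Even y) (hw : Odd ((-18)*y+25*t)) (h5 : ¬ (5:ℤ) ∣ y)
    (h13 : jz ((-18)*y+25*t+18*y) 13 = -1) : False := by
  have hy4 : y^2 % 4 = 0 := by obtain ⟨k, rfl⟩ := hy2; rw [show (k+k)^2 = 4*(k*k) by ring]; omega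
  have hw4 := sq8_odd hw
  have hpos : 0 < ((-18)*y+25*t)^2+y^2 := by
    have : y ≠ 0 := by rintro rfl; simp at h5
    positivity
  have hG : ((-18)*y+25*t)^2+y^2 = 25*(13*y^2-36*y*t+25*t^2) := by ring
  have hm : 1*((-18)*y+25*t)+18*y = 25*t := by ring
  have hrel : -24488802*y^7+238085568*t*y^6 + 5*(5*(21*(-18)^5*t^2*y^5+875*18^4*t^3*y^4+21875*(-18)^3*t^4*y^3+328125*324*t^5*y^2+2734375*(-18)*t^6*y+9765625*t^7)-9*r^2) = 0 := by
    have : 25*(-24488802*y^7+238085568*t*y^6 + 5*(5*(21*(-18)^5*t^2*y^5+875*18^4*t^3*y^4+21875*(-18)^3*t^4*y^3+328125*324*t^5*y^2+2734375*(-18)*t^6*y+9765625*t^7)-9*r^2)) = 25*0 := by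
      linear_combination h
    exact mul_left_cancel₀ (by norm_num) this
  have hz := congrArg (Int.cast (R := ZMod 5)) hrel
  push_cast at hz
  rw [show (5:ZMod 5) = 0 by rfl, zero_mul, add_zero] at hz
  have k1 := z5_73 _ _ (five_ne h5) hz
  have d2 : (5:ℤ) ∣ t - 4*y := by
    have : ((t : ℤ) : ZMod 5) = ((4*y : ℤ) : ZMod 5) := by push_cast; exact k1
    exact_mod_cast dvd_of_zq this
  have d1 : (5:ℤ) ∣ (13*y^2-36*y*t+25*t^2) - (-1)*y^2 := by
    obtain ⟨v, hv⟩ := d2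
    have : t = 4*y+5*v := by omega
    exact ⟨2*y^2*(-13)-36*y*v+5*t^2, by rw [this]; ring⟩
  have hcm : IsCoprime (5:ℤ) t := by
    apply ((Int.prime_iff_natAbs_prime.mpr (by norm_num)).coprime_iff_not_dvd).mpr
    intro hh; omega
  have hmo : Odd t := by
    rw [Int.odd_iff] at hw ⊢; omega
  generalize hHd : 13*y^2-36*y*t+25*t^2 = H at *
  have hH4 : H % 4 = 1 := by omega
  have hH0 : 0 < H := by omega
  have hHo : Odd H := Int.odd_iff.mpr (by omega)
  have hcH : IsCoprime (5:ℤ) H := by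
    apply ((Int.prime_iff_natAbs_prime.mpr (by norm_num)).coprime_iff_not_dvd).mpr
    intro hh
    have : (5:ℤ) ∣ y^2 := by omega
    exact h5 (by exact_mod_cast Int.Prime.dvd_pow' (p := 5) (by norm_num) this)
  apply p7c1_core h hc hm hG hH4 hH0 hmo (by have := hcm.pow_left (m := 2); norm_num at this; exact this)
  have e1 : jz ((-5)*25) H = 1 := by
    rw [show ((-5)*25:ℤ) = -1*5^2*5 by norm_num, jz_mul, jz_mul, jz_neg_one hH0 hHo, if_neg (by omega), jz_sq hcH,
      jz_flip _ (by norm_num) (by decide) hHo d1, qs_one_left (by norm_num), jz_mul, jz5sq h5]; norm_num [jz]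
  have e13 : jz t 13 = -1 := by
    have h' : jz (5^2*t) 13 = -1 := by rw [← h13]; congr 1; ring
    rw [jz_mul, show jz (5^2) 13 = 1 by norm_num [jz]] at h'
    omega
  have e2 : jz (25*325) t = -1 := by
    rw [show (25*325:ℤ) = 5^2*(5^2*13) by norm_num, jz_mul, jz_sq hcm, jz_mul, jz_sq hcm, 
      jz_rec (a := 13) (by decide) hmo (Or.inl (by norm_num)), e13, qs_one_left (by norm_num)]; norm_num
  rw [e1, e2, qs_one_right hH4]; norm_num

lemma p7c1 {r : ℤ} (h : SolB 7 r 1) : False := by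
  obtain ⟨w, u, h, hr, h5, hc, s, hs, hs13, hu13⟩ := p7c1x h
  have hwo : Odd w := by
    by_contra hne
    rw [Int.not_odd_iff_even] at hne
    obtain ⟨k, rfl⟩ := hne
    obtain ⟨l, rfl⟩ := hr
    have : 2*(64*k^7 - 1152*u^14 - 90*l^2-90*l-22) = 1 := by linear_combination h
    omega
  obtain ⟨y, hy⟩ : ∃ y, y = 2*u^2 := ⟨_, rfl⟩
  have h5y : ¬ (5:ℤ) ∣ y := by
    intro hh
    have : (5:ℤ) ∣ u^2 := by omega
    exact h5 (by exact_mod_cast Int.Prime.dvd_pow' (p := 5) (by norm_num) this)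
  have hcy : IsCoprime w y := by
    rw [hy]; exact IsCoprime.mul_right (by have := cop_two hwo 1; rw [pow_one] at this; exact this.symm) hc.pow_right
  have hye : Even y := ⟨u^2, by rw [hy]; ring⟩
  have h' : w^7 = 18*y^7+45*r^2 := by rw [h, hy]; ring
  have h13 : jz (w+18*y) 13 = -1 := by
    have := lin_state (α := 1) (β := 36) hs13 (cop_prime (q := 13) (by norm_num) hu13)
    push_cast at this
    rw [show w+18*y = 1*w+36*u^2 by rw [hy]; ring, this]
    simp only [List.mem_cons, List.not_mem_nil, or_false] at hs
    rcases hs with rfl | rfl <;> norm_num [jz]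
  clear h hs13 hu13 hs hc
  have hz := congrArg (Int.cast (R := ZMod 5)) h'
  push_cast at hz
  have := z5_71 _ _ _ hz
  obtain ⟨z, hz⟩ : (5:ℤ) ∣ w - 2*y := by
    have : ((w : ℤ) : ZMod 5) = ((2*y : ℤ) : ZMod 5) := by push_cast; exact this
    exact_mod_cast dvd_of_zq this
  obtain rfl : w = 2*y+5*z := by omega
  by_cases h5r : (5:ℤ) ∣ r
  · obtain ⟨r, rfl⟩ := h5r
    have hrel : 22*y^7+448*y^6*z + 5*(672*y^5*z^2+2800*y^4*z^3+7000*y^3*z^4+10500*y^2*z^5+8750*y*z^6+3125*z^7) = 9*(5*r)^2 := by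
      have : 5*(22*y^7+448*y^6*z + 5*(672*y^5*z^2+2800*y^4*z^3+7000*y^3*z^4+10500*y^2*z^5+8750*y*z^6+3125*z^7)) = 5*(9*(5*r)^2) := by
        linear_combination h'
      exact mul_left_cancel₀ (by norm_num) this
    have hz := congrArg (Int.cast (R := ZMod 5)) hrel
    push_cast at hz
    rw [show (5:ZMod 5) = 0 by rfl, zero_mul, add_zero] at hz
    obtain ⟨k1, k2⟩ := z5_72 _ _ _ (five_ne h5y) hz
    have d2 : (5:ℤ) ∣ (4*y+z) := by
      have : ((4*y+z : ℤ) : ZMod 5) = ((0 : ℤ) : ZMod 5) := by push_cast; rw [k2]; ring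
      simpa using dvd_of_zq this
    obtain ⟨t, ht⟩ := d2
    obtain rfl : z = 5*t-4*y := by omega
    have e : 2*y+5*(5*t-4*y) = (-18)*y+25*t := by ring
    rw [e] at h' hcy hwo h13
    exact p7c1_b h' hcy hye hwo h5y h13
  · exact p7c1_a h' hcy hye hwo h5y h5r h13

def st29 : Bool :=
  allB (fun a => allB (fun b => (Nat.beq a 0 && Nat.beq b 0) ||
    (fun v => !(Nat.beq (v^5 % 29) v) || (!(Nat.beq v 0) && Nat.beq ((a*a+5*(b*b)) % 29) 0))
     ((2*(7*a^6*b+35*a^4*b^3*24+21*a^2*b^5*24^2+b^7*24^3) + 28*(a^7+21*a^5*b^2*24+35*a^3*b^4*24^2+7*a*b^6*24^3))*23 % 29)) 29) 29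
lemma st29_t : st29 = true := by decide +kernel

lemma k29_0 : (29:ZMod 29) = 0 := by decide
lemma k29_c : (9*5^5*23:ZMod 29) = 1 := by decide

lemma state29 {α : R5} (hne : ¬ (((29:ℕ):ℤ) ∣ α.re ∧ ((29:ℕ):ℤ) ∣ α.im)) {u : ℤ}
    (h : 2*(α^7).im - (α^7).re = 9*5^5*u^7) : (29:ℤ) ∣ α.norm ∧ ¬ (29:ℤ) ∣ u := by
  have : Fact (Nat.Prime 29) := ⟨by norm_num⟩
  obtain ⟨a, ha, b, hb, h1, h2, h3, h4⟩ := red_alpha (q := 29) (by norm_num) 7 α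
  have hc := allB_spec (allB_spec st29_t a ha) b hb
  have e1 := zq_of_dvd h1
  have e2 := zq_of_dvd h2
  have e3 := zq_of_dvd h3
  have e4 := zq_of_dvd h4
  have hpw : ((⟨a,b⟩:R5)^7) = ⟨(a:ℤ)^7-105*a^5*b^2+875*a^3*b^4-875*a*b^6, 7*a^6*b-175*a^4*b^3+525*a^2*b^5-125*b^7⟩ := by
    simp only [pow_succ, pow_zero, one_mul]
    ext <;> simp <;> ring
  rw [hpw] at e3 e4
  have e6 := congrArg (Int.cast (R := ZMod 29)) h
  push_cast at e1 e2 e3 e4 e6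
  rw [e3, e4] at e6
  have k29 := k29_0
  have kc := k29_c
  have e7 : (((2*(7*a^6*b+35*a^4*b^3*24+21*a^2*b^5*24^2+b^7*24^3) + 28*(a^7+21*a^5*b^2*24+35*a^3*b^4*24^2+7*a*b^6*24^3))*23 % 29 : ℕ) : ZMod 29) = (u:ZMod 29)^7 := by
    rw [ZMod.natCast_mod]
    push_cast
    linear_combination 23*e6 + (u:ZMod 29)^7*kc + 23*(2*(35*(a:ZMod 29)^4*b^3+21*19*a^2*b^5+481*b^7)+(a^7+21*a^5*b^2*24+35*a^3*b^4*24^2+7*a*b^6*24^3)-(21*a^5*b^2+35*19*a^3*b^4+7*481*a*b^6))*k29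
  have hvq : (2*(7*a^6*b+35*a^4*b^3*24+21*a^2*b^5*24^2+b^7*24^3) + 28*(a^7+21*a^5*b^2*24+35*a^3*b^4*24^2+7*a*b^6*24^3))*23 % 29 < 29 := Nat.mod_lt _ (by norm_num)
  generalize (2*(7*a^6*b+35*a^4*b^3*24+21*a^2*b^5*24^2+b^7*24^3) + 28*(a^7+21*a^5*b^2*24+35*a^3*b^4*24^2+7*a*b^6*24^3))*23 % 29 = v at *
  simp only [Bool.or_eq_true, Bool.and_eq_true, Bool.not_eq_true', Nat.beq_eq] at hc
  rcases hc with ⟨ha0, hb0⟩ | hv | ⟨hv, hS⟩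
  · exfalso; apply hne
    subst ha0 hb0
    simpa using And.intro h1 h2
  · exfalso
    have hv := Nat.ne_of_beq_eq_false hv
    apply hv
    have h5 : (((v^5 % 29 : ℕ)) : ZMod 29) = (v : ZMod 29) := by
      rw [ZMod.natCast_mod]; push_cast; rw [e7]
      by_cases h0 : (u : ZMod 29) = 0
      · rw [h0]; simp
      · have := ZMod.pow_card_sub_one_eq_one h0
        norm_num at this
        rw [← pow_mul, show 7*5 = 28+7 by norm_num, pow_add, this, one_mul]
    have := (ZMod.natCast_eq_natCast_iff' _ _ _).mp h5
    rwa [Nat.mod_mod, Nat.mod_eq_of_lt hvq] at this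
  · have hv := Nat.ne_of_beq_eq_false hv
    constructor
    · have h5 := congrArg (Nat.cast (R := ZMod 29)) hS
      rw [ZMod.natCast_mod] at h5
      push_cast at h5
      have : ((α.norm : ℤ) : ZMod 29) = ((0:ℤ) : ZMod 29) := by
        rw [norm5]; push_cast
        rw [e1, e2, ← h5]; ring
      simpa using dvd_of_zq this
    · intro hu
      have := (ZMod.intCast_zmod_eq_zero_iff_dvd u 29).mpr (by exact_mod_cast hu)
      rw [this, zero_pow (by norm_num)] at e7
      exact hv (Nat.eq_zero_of_dvd_of_lt ((ZMod.natCast_eq_zero_iff v 29).mp e7) hvq)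

lemma p7c2x {r : ℤ} (h : SolB 7 r 2) : ∃ w u : ℤ, w^7 = 9*5^11*u^14+36*r^2 ∧ Odd u ∧ ¬ (5:ℤ) ∣ r ∧ ¬ (3:ℤ) ∣ u ∧ (3:ℤ) ∣ w ∧
    IsCoprime w u ∧ (29:ℤ) ∣ w ∧ ¬ (29:ℤ) ∣ u := by
  have hr5 := sideB5 (by norm_num) (Or.inl rfl) h
  obtain ⟨α, A, B, Y, ρ, hc, he, hρ, hY, ho, h3, hcs⟩ := h
  have hρ2 : ρ^2 = r^2 := by rcases hρ with h | h <;> rw [h]; ring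
  rcases hcs with ⟨c, _⟩ | ⟨c, _⟩ | ⟨_, hB, hA⟩ | ⟨c, _⟩
  · norm_num at c
  · norm_num at c
  · have hY5 : (5:ℤ) ∣ Y := Int.Prime.dvd_pow' (k := 7) (p := 5) (by norm_num) ⟨5*B, by push_cast; rw [← hB]; ring⟩
    obtain ⟨u, rfl⟩ := hY5
    have hB' : B = 5^5*u^7 := by
      have : 25*B = 25*(5^5*u^7) := by rw [hB]; ring
      omega
    have hu3 : ¬ (3:ℤ) ∣ u := fun hh => h3 (Dvd.dvd.mul_left hh _)
    have huo : Odd u := by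
      by_contra hne
      rw [Int.not_odd_iff_even] at hne
      obtain ⟨k, rfl⟩ := hne
      rw [Int.odd_iff, hA, hB'] at ho
      have : (2*ρ)^2+5*(5^5*(k+k)^7)^2 = 2*(2*ρ^2+5*5^10*8192*k^14) := by ring
      omega
    have hn := norm_eqB he
    have e1 : (α^7).re = 2*A - 5*B := by rw [he]; simp; ring
    have e2 : (α^7).im = A + 2*B := by rw [he]; simp; ring
    have hlin : 2*(α^7).im - (α^7).re = 9*5^5*u^7 := by rw [e1, e2, hB']; ring
    have hw : α.norm^7 = 9*5^11*u^14+36*r^2 := by rw [hn, hA, hB']; linear_combination 36*hρ2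
    obtain ⟨k1, k2⟩ := state29 (alpha_prim (by norm_num) (by norm_num) (by norm_num) hc he) hlin
    refine ⟨α.norm, u, hw, huo, hr5, hu3, three_dvd_norm hn, ?_, k1, k2⟩
    apply cop_of
    intro l hl h1 h2
    have hlp := Nat.prime_iff_prime_int.mp hl
    have h6 : (l:ℤ) ∣ 36*r^2 := by
      have : 36*r^2 = α.norm^7 - 9*5^11*u^14 := by rw [hw]; ring
      rw [this]
      exact dvd_sub (dvd_pow h1 (by norm_num)) (Dvd.dvd.mul_left (dvd_pow h2 (by norm_num)) _)
    rcases hlp.dvd_or_dvd h6 with h7 | h7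
    · have h7' : l ∣ 36 := by exact_mod_cast h7
      have : l ∈ Nat.primeFactors 36 := by simp [hl, h7']
      have hpf : Nat.primeFactors 36 = {2,3} := by decide +kernel
      rw [hpf] at this
      simp at this
      rcases this with rfl | rfl
      · rw [Int.odd_iff] at huo; push_cast at h2; omega
      · exact hu3 h2
    · have h8 := hlp.dvd_of_dvd_pow h7
      refine hlp.not_isUnit (hc.isUnit_of_dvd' (x := (l:ℤ)) ?_ ?_)
      · rw [hA]; apply Dvd.dvd.mul_left; rcases hρ with h | h <;> rw [h]
        · exact h8
        · exact (dvd_neg).mpr h8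
      · rw [hB']; exact Dvd.dvd.mul_left (dvd_pow h2 (by norm_num)) _
  · norm_num at c

lemma z32a : ∀ w i : ZMod 32, w^7 = 9*5^11*(8*i+1)^7 → 3*w^2+(-75)*(w*(8*i+1))+1000*(8*i+1)^2 = 20 ∧ (-13)*w+225*(8*i+1) = 24 := by decide +kernel
lemma z32b : ∀ w i : ZMod 32, w^7 = 9*5^11*(8*i+1)^7+16 → 3*w^2+(-75)*(w*(8*i+1))+1000*(8*i+1)^2 = 4 ∧ (-13)*w+225*(8*i+1) = 8 := by decide +kernel
lemma z32c : ∀ w i : ZMod 32, w^7 = 9*5^11*(8*i+1)^7+4 → 3*w^2+(-75)*(w*(8*i+1))+1000*(8*i+1)^2 = 8 ∧ (-13)*w+225*(8*i+1) = 28 := by decide +kernel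

lemma odd_sq8 {u : ℤ} (h : Odd u) : ∃ i, u^2 = 8*i+1 := ⟨u^2/8, by have := sq8_odd h; omega⟩

lemma c2mod {w u r G m: ℤ} (h : w^7 = 9*5^11*(u^2)^7+36*r^2) (hu : Odd u) (hG : 3*w^2+(-75)*(w*u^2)+1000*(u^2)^2 = G) (hm : (-13)*w+225*u^2 = m) :
    (G % 32 = 20 ∧ m % 32 = 24) ∨ (G % 32 = 4 ∧ m % 32 = 8) ∨ (G % 32 = 8 ∧ m % 32 = 28) := by
  obtain ⟨i, hi⟩ := odd_sq8 hu
  have key : ∀ R : ℤ, (32:ℤ) ∣ 36*r^2 - R → (w:ZMod 32)^7 = 9*5^11*(8*(i:ZMod 32)+1)^7+((R:ℤ) : ZMod 32) := by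
    intro R hR
    have e := zq_of_dvd (q := 32) (x := 36*r^2) (y := R) (by exact_mod_cast hR)
    rw [← e]
    have := congrArg (Int.cast (R := ZMod 32)) h
    rw [hi] at this
    push_cast at this ⊢
    linear_combination this
  have fin : ∀ g t : ℤ, (3*(w:ZMod 32)^2+(-75)*(w*(8*(i:ZMod 32)+1))+1000*(8*(i:ZMod 32)+1)^2 = ((g:ℤ):ZMod 32) ∧ (-13)*(w:ZMod 32)+225*(8*(i:ZMod 32)+1) = ((t:ℤ) : ZMod 32)) →
      G % 32 = g % 32 ∧ m % 32 = t % 32 := by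
    rintro g t ⟨h1, h2⟩
    constructor
    · apply of_zmod (n := 32); rw [← hG, hi, ← h1]; push_cast; ring
    · apply of_zmod (n := 32); rw [← hm, hi, ← h2]; push_cast; ring
  rcases Int.even_or_odd r with ⟨s, rfl⟩ | hr
  · rcases Int.even_or_odd s with ⟨t, rfl⟩ | hs
    · left
      have := key 0 ⟨18*t^2, by ring⟩
      have k := z32a (w:ZMod 32) (i:ZMod 32) (by push_cast at this; linear_combination this)
      exact fin 20 24 ⟨by push_cast; exact k.1, by push_cast; exact k.2⟩
    · right; left
      obtain ⟨l, hl⟩ := odd_sq8 hs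
      have := key 16 ⟨36*l+4, by linear_combination 144*hl⟩
      have k := z32b (w:ZMod 32) (i:ZMod 32) (by push_cast at this; linear_combination this)
      exact fin 4 8 ⟨by push_cast; exact k.1, by push_cast; exact k.2⟩
  · right; right
    obtain ⟨l, hl⟩ := odd_sq8 hr
    have := key 4 ⟨9*l+1, by linear_combination 36*hl⟩
    have k := z32c (w:ZMod 32) (i:ZMod 32) (by push_cast at this; linear_combination this)
    exact fin 8 28 ⟨by push_cast; exact k.1, by push_cast; exact k.2⟩

lemma z49 : ∀ w U : ZMod 49, w^7 = 9*5^11*U^7 → 7*U = 0 := by decide +kernel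
lemma z7 : ∀ w U r : ZMod 7, w^7 = 9*5^11*U^7+36*r^2 → (-13)*w+225*U = r^2 := by decide +kernel
lemma z5c2 : ∀ w U r : ZMod 5, w^7 = 9*5^11*U^7+36*r^2 → w = (r^3)^2 := by decide +kernel

lemma jzpsq {q : ℕ} (hq : q.Prime) {y : ℤ} (h : ¬ (q:ℤ) ∣ y) (x : ℤ) : jz (x*y^2) q = jz x q := by
  rw [jz_mul, jz_sq (cop_prime hq h), mul_one]

/-- from b*m = a*y^2 mod q -/
lemma jz_of_rel {q : ℕ} (hq : q.Prime) {y m a b: ℤ} (h : ¬ (q:ℤ) ∣ y) (hd : (q:ℤ) ∣ b*m - a*y^2) (hb : jz b q * jz b q = 1) : jz m q = jz b q * jz a q := by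
  have h1 : jz (b*m) q = jz a q := by rw [jz_mod hd, jzpsq hq h]
  rw [jz_mul] at h1
  calc jz m q = (jz b q * jz b q) * jz m q := by rw [hb, one_mul]
    _ = jz b q * (jz b q * jz m q) := by ring
    _ = _ := by rw [h1]

lemma p7c2_core {w u r g m0 m' H G m : ℤ} (hG : 3*w^2+(-75)*(w*u^2)+1000*(u^2)^2 = G) (hm : (-13)*w+225*u^2 = m)
    (h : w^7 = 9*5^11*(u^2)^7+36*r^2) (hc : IsCoprime w u) (hgH : G = g*H) (hmm : m = m0*m') (hH3 : H % 3 ≠ 0)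
    (hG0 : 0 < H) (hHo : Odd H) (hmo : Odd m') (h5 : ¬ (5:ℤ) ∣ H) (hg : IsCoprime g m') :
    jz ((3*5*29)*m0) H * qs m' H * jz (g*101500) m' ≠ -1 := by
  have hcU : IsCoprime w (u^2) := hc.pow_right
  have hcUH : IsCoprime (u^2) H := cop_qf (w := w) (y := -75) (z := 1000) (g := g) 3 (Or.inr (Or.inr ⟨rfl, hH3⟩)) hcU (by rw [hG, hgH])
  have h5H : IsCoprime (5:ℤ) H := ((Int.prime_iff_natAbs_prime.mpr (by norm_num)).coprime_iff_not_dvd).mpr h5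
  rw [hgH] at hG
  refine jz_kill (a := -13) (b := 225) (w := w) (U := u^2) (s := 5^4*(u^2)^3) (z := 54*r) (by norm_num) hcU (by rw [hm, hmm]) ?_ ?_ ((h5H.pow_left).mul_left hcUH.pow_left) ?_ hHo hmo (Or.inl hG0) hg
  · rw [← hG]; exact ⟨m0*(-39*w+300*u^2), by rw [hmm] at hm; linear_combination (-39*w+300*u^2)*hm⟩
  · rw [← hG]; exact ⟨m0*(225*1000*u^2+(225*(-75)+13*1000)*w), by rw [hmm] at hm; linear_combination (225*1000*u^2+(225*(-75)+13*1000)*w)*hm⟩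
  · refine ⟨-3*g*(-24609375*(u^2)^5-1109375*w*(u^2)^4-9375*w^2*(u^2)^3+2625*w^3*(u^2)^2+225*w^4*u^2+9*w^5), ?_⟩
    linear_combination 81*h - 3*(-24609375*(u^2)^5-1109375*w*(u^2)^4-9375*w^2*(u^2)^3+2625*w^3*(u^2)^2+225*w^4*u^2+9*w^5)*hG

lemma c2sym1 {H m : ℤ} (hH0 : 0 < H) (hHo : Odd H) (hmo : Odd m) (hc5 : IsCoprime (20:ℤ) m)
    (a5 : jz H 5 = -1) (a29 : jz H 29 = -1) (a3 : jz H 3 = 1) (b5 : jz m 5 = 1) (b29 : jz m 29 = -1) (b7 : jz m 7 = 1)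
    (hcs : (H % 8 = 5 ∧ m % 4 = 3) ∨ (H % 8 = 1 ∧ m % 4 = 1)) : jz ((3*5*29)*8) H * qs m H * jz (4*101500) m = -1 := by
  have c2 : IsCoprime (2:ℤ) H := by simpa using cop_two hHo 1
  have e1 : jz ((3*5*29)*8) H = jz 2 H := by
    rw [show ((3*5*29)*8:ℤ) = 3*(5*(29*(2*2^2))) by norm_num, jz_mul, jz_mul, jz_mul, jz_mul, jz_sq c2,
      jz_rec (a := 3) (by decide) hHo (Or.inr hH0), jz_rec (a := 5) (by decide) hHo (Or.inr hH0),
      jz_rec (a := 29) (by decide) hHo (Or.inr hH0), a5, a29, a3, qs_one_left (a := 5) (by norm_num), qs_one_left (a := 29) (by norm_num),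
      qs_one_right (b := H) (by omega)]
    ring
  have e2 : jz (4*101500) m = - qs 7 m := by
    rw [show (4*101500:ℤ) = 20^2*(5*(7*29)) by norm_num, jz_mul, jz_mul, jz_mul, jz_sq hc5,
      jz_rec (a := 5) (by decide) hmo (Or.inl (by norm_num)), jz_rec (a := 7) (by decide) hmo (Or.inl (by norm_num)),
      jz_rec (a := 29) (by decide) hmo (Or.inl (by norm_num)), b5, b29, b7, qs_one_left (a := 5) (by norm_num), qs_one_left (a := 29) (by norm_num)]
    ring
  rw [e1, e2, jz_two hHo, qs_one_right (b := H) (by omega)]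
  rcases hcs with ⟨h1, h2⟩ | ⟨h1, h2⟩
  · rw [qs_neg (by norm_num) h2, if_neg (by omega)]; norm_num
  · rw [qs_one_right h2, if_pos (by omega)]; norm_num

lemma c2sym2 {H m : ℤ} (hH0 : 0 < H) (hHo : Odd H) (hmo : Odd m) (hc5 : IsCoprime (20:ℤ) m)
    (a5 : jz H 5 = 1) (a29 : jz H 29 = 1) (a3 : jz H 3 = -1) (b5 : jz m 5 = -1) (b29 : jz m 29 = 1) (b7 : jz m 7 = 1)
    (h1 : H % 4 = 1) (h2 : m % 8 = 7) : jz ((3*5*29)*4) H * qs m H * jz (8*101500) m = -1 := by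
  have c2 : IsCoprime (2:ℤ) H := by simpa using cop_two hHo 1
  have e1 : jz ((3*5*29)*4) H = -1 := by
    rw [show ((3*5*29)*4:ℤ) = 3*(5*(29*(2^2))) by norm_num, jz_mul, jz_mul, jz_mul, jz_sq c2,
      jz_rec (a := 3) (by decide) hHo (Or.inr hH0), jz_rec (a := 5) (by decide) hHo (Or.inr hH0),
      jz_rec (a := 29) (by decide) hHo (Or.inr hH0), a5, a29, a3, qs_one_left (a := 5) (by norm_num), qs_one_left (a := 29) (by norm_num),
      qs_one_right (b := H) (by omega)]
    norm_num
  have e2 : jz (8*101500) m = 1 := by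
    rw [show (8*101500:ℤ) = 20^2*(2*(5*(7*29))) by norm_num, jz_mul, jz_mul, jz_mul, jz_mul, jz_sq hc5,
      jz_rec (a := 5) (by decide) hmo (Or.inl (by norm_num)), jz_rec (a := 7) (by decide) hmo (Or.inl (by norm_num)),
      jz_rec (a := 29) (by decide) hmo (Or.inl (by norm_num)), b5, b29, b7, qs_one_left (a := 5) (by norm_num), qs_one_left (a := 29) (by norm_num),
      jz_two hmo, if_pos (by omega), qs_neg (a := 7) (by norm_num) (by omega)]
    norm_num
  rw [e1, e2, qs_one_right h1]; norm_num

lemma not_dvd_of_jz {q : ℕ} {x : ℤ} (hq : 2 ≤ q) (h : jz x q ≠ 0) : ¬ (q:ℤ) ∣ x := by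
  intro hh
  apply h
  rw [jz_mod (a' := 0) (by simpa using hh)]
  unfold jz
  rw [Int.natAbs_natCast]
  exact jacobiSym.zero_left (by omega)

lemma p7c2_fin {w u r G m : ℤ} (h5w : ¬ (5:ℤ) ∣ w) (h5r3 : ¬ (5:ℤ) ∣ r^3) (h29U : ¬ (29:ℤ) ∣ u^2) (h29u : ¬ (29:ℤ) ∣ u) (h7r : ¬ (7:ℤ) ∣ r)
    (g5 : (5:ℤ) ∣ G - 3*w^2) (m5 : (5:ℤ) ∣ m - 2*(r^3)^2) (g29 : (29:ℤ) ∣ G - 14*(u^2)^2) (m29 : (29:ℤ) ∣ m - 22*u^2)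
    (d7 : ((7:ℕ):ℤ) ∣ m - r^2) (g3 : G % 3 = 1) (hG0 : 0 < G)
    (cmod : (G%32=20 ∧ m%32=24) ∨ (G%32=4 ∧ m%32=8) ∨ (G%32=8 ∧ m%32=28))
    (fin : ∀ g m0 H m' : ℤ, G = g*H → m = m0*m' → H % 3 ≠ 0 → 0 < H → Odd H → Odd m' → ¬ (5:ℤ) ∣ H → IsCoprime g m' →
      jz ((3*5*29)*m0) H * qs m' H * jz (g*101500) m' = -1 → False) : False := by
  have R : ∀ (q : ℕ) (hq : q.Prime) (y M a b s t : ℤ), ¬ (q:ℤ) ∣ y → (q:ℤ) ∣ b*M - a*y^2 → jz b q = s → jz a q = t → s*s = 1 → jz M q = s*t := by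
    intro q hq y M a b s t h1 h2 h3 h4 h5
    rw [jz_of_rel hq h1 h2 (by rw [h3, h5]), h3, h4]
  have c20 : ∀ M : ℤ, Odd M → jz M 5 ≠ 0 → IsCoprime (20:ℤ) M := by
    intro M h1 h2
    have := not_dvd_of_jz (q := 5) (by norm_num) (by exact_mod_cast h2)
    rw [show (20:ℤ) = 2^2*5 by norm_num]
    exact (cop_two h1 2).mul_left (((Int.prime_iff_natAbs_prime.mpr (by norm_num)).coprime_iff_not_dvd).mpr (by exact_mod_cast this))
  have A : (∃ H m', G = 4*H ∧ m = 8*m' ∧ ((H % 8 = 5 ∧ m' % 4 = 3) ∨ (H % 8 = 1 ∧ m' % 4 = 1))) → False := by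
    rintro ⟨H, M, k1, k2, k3⟩
    have hHo : Odd H := Int.odd_iff.mpr (by clear * - k3; omega)
    have hmo : Odd M := Int.odd_iff.mpr (by clear * - k3; omega)
    have q0 : 0 < H := by clear * - k1 hG0; omega
    have q3 : H % 3 = 1 := by clear * - k1 g3; omega
    have q3' : H % 3 ≠ 0 := by clear * - q3; omega
    rw [k1] at g5 g29
    rw [k2] at m5 m29 d7
    have a5 := R 5 (by norm_num) w H 3 4 1 (-1) (by exact_mod_cast h5w) (by exact_mod_cast g5) (by norm_num [jz]) (by norm_num [jz]) (by norm_num)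
    have a29 := R 29 (by norm_num) (u^2) H 14 4 1 (-1) (by exact_mod_cast h29U) (by exact_mod_cast g29) (by norm_num [jz]) (by norm_num [jz]) (by norm_num)
    have b5 := R 5 (by norm_num) (r^3) M 2 8 (-1) (-1) (by exact_mod_cast h5r3) (by exact_mod_cast m5) (by norm_num [jz]) (by norm_num [jz]) (by norm_num)
    have b29 := R 29 (by norm_num) u M 22 8 (-1) 1 (by exact_mod_cast h29u) (by exact_mod_cast m29) (by norm_num [jz]) (by norm_num [jz]) (by norm_num)
    have b7 := R 7 (by norm_num) r M 1 8 1 1 (by exact_mod_cast h7r) (by rw [one_mul]; exact d7) (by norm_num [jz]) (by norm_num [jz]) (by norm_num)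
    have a3 : jz H 3 = 1 := by rw [jz_mod (a' := 1) (by clear * - q3; omega)]; norm_num [jz]
    push_cast at a5 a29 b5 b29 b7
    norm_num at a5 a29 b5 b29 b7
    have h5H := not_dvd_of_jz (q := 5) (x := H) (by norm_num) (by push_cast; rw [a5]; norm_num)
    exact fin 4 8 H M k1 k2 q3' q0 hHo hmo (by exact_mod_cast h5H) (cop_4 hmo)
      (c2sym1 q0 hHo hmo (c20 M hmo (by rw [b5]; norm_num)) a5 a29 a3 b5 b29 b7 k3)
  rcases cmod with ⟨k1, k2⟩ | ⟨k1, k2⟩ | ⟨k1, k2⟩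
  · clear * - k1 k2 A; exact A ⟨G/4, m/8, by omega, by omega, by omega⟩
  · clear * - k1 k2 A; exact A ⟨G/4, m/8, by omega, by omega, by omega⟩
  · obtain ⟨H, hH⟩ : ∃ H, G = 8*H := ⟨G/8, by clear * - k1; omega⟩
    obtain ⟨M, hM⟩ : ∃ M, m = 4*M := ⟨m/4, by clear * - k2; omega⟩
    have hH4 : H % 4 = 1 := by clear * - k1 hH; omega
    have hM8 : M % 8 = 7 := by clear * - k2 hM; omega
    have hHo : Odd H := Int.odd_iff.mpr (by clear * - hH4; omega)
    have hmo : Odd M := Int.odd_iff.mpr (by clear * - hM8; omega)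
    have q0 : 0 < H := by clear * - hH hG0; omega
    have q3 : H % 3 = 2 := by clear * - hH g3; omega
    have q3' : H % 3 ≠ 0 := by clear * - q3; omega
    rw [hH] at g5 g29
    rw [hM] at m5 m29 d7
    have a5 := R 5 (by norm_num) w H 3 8 (-1) (-1) (by exact_mod_cast h5w) (by exact_mod_cast g5) (by norm_num [jz]) (by norm_num [jz]) (by norm_num)
    have a29 := R 29 (by norm_num) (u^2) H 14 8 (-1) (-1) (by exact_mod_cast h29U) (by exact_mod_cast g29) (by norm_num [jz]) (by norm_num [jz]) (by norm_num)
    have b5 := R 5 (by norm_num) (r^3) M 2 4 1 (-1) (by exact_mod_cast h5r3) (by exact_mod_cast m5) (by norm_num [jz]) (by norm_num [jz]) (by norm_num)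
    have b29 := R 29 (by norm_num) u M 22 4 1 1 (by exact_mod_cast h29u) (by exact_mod_cast m29) (by norm_num [jz]) (by norm_num [jz]) (by norm_num)
    have b7 := R 7 (by norm_num) r M 1 4 1 1 (by exact_mod_cast h7r) (by rw [one_mul]; exact d7) (by norm_num [jz]) (by norm_num [jz]) (by norm_num)
    have a3 : jz H 3 = -1 := by rw [jz_mod (a' := 2) (by clear * - q3; omega)]; norm_num [jz]
    push_cast at a5 a29 b5 b29 b7
    norm_num at a5 a29 b5 b29 b7
    have h5H := not_dvd_of_jz (q := 5) (x := H) (by norm_num) (by push_cast; rw [a5]; norm_num)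
    exact fin 8 4 H M hH hM q3' q0 hHo hmo (by exact_mod_cast h5H) (by simpa using cop_two hmo 3)
      (c2sym2 q0 hHo hmo (c20 M hmo (by rw [b5]; norm_num)) a5 a29 a3 b5 b29 b7 hH4 hM8)

lemma p7c2 {r : ℤ} (h : SolB 7 r 2) : False := by
  obtain ⟨w, u, h, hu, h5r, h3u, h3w, hc, h29w, h29u⟩ := p7c2x h
  have h' : w^7 = 9*5^11*(u^2)^7+36*r^2 := by rw [h]; ring
  have hcU : IsCoprime w (u^2) := hc.pow_right
  obtain ⟨G, hG⟩ : ∃ G, 3*w^2+(-75)*(w*u^2)+1000*(u^2)^2 = G := ⟨_, rfl⟩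
  obtain ⟨m, hm⟩ : ∃ m, (-13)*w+225*u^2 = m := ⟨_, rfl⟩
  have h7r : ¬ (7:ℤ) ∣ r := by
    rintro ⟨k, rfl⟩
    have e := congrArg (Int.cast (R := ZMod 49)) h'
    push_cast at e
    rw [mul_pow, show ((7:ZMod 49)^2) = 0 by rfl, zero_mul, mul_zero, add_zero] at e
    have := z49 _ _ e
    have h2 : ((7*u^2 : ℤ) : ZMod 49) = ((0:ℤ) : ZMod 49) := by push_cast; exact this
    have h3 := dvd_of_zq h2
    push_cast at h3
    have h4 : (7:ℤ) ∣ u^2 := by clear * - h3; omega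
    have h5 : (7:ℤ) ∣ w^7 := by rw [h']; exact dvd_add (Dvd.dvd.mul_left (dvd_pow h4 (by norm_num)) _) ⟨36*(7*k^2), by ring⟩
    have h6 : (7:ℤ) ∣ w := by exact_mod_cast Int.Prime.dvd_pow' (p := 7) (by norm_num) (by exact_mod_cast h5)
    have := hcU.isUnit_of_dvd' h6 h4
    rw [Int.isUnit_iff] at this
    clear * - this; omega
  have d7 : ((7:ℕ):ℤ) ∣ m - r^2 := by
    apply dvd_of_zq
    have e := congrArg (Int.cast (R := ZMod 7)) h'
    push_cast at e
    rw [← hm]; push_cast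
    exact z7 _ _ _ e
  have d5 : (5:ℤ) ∣ w - (r^3)^2 := by
    have e := congrArg (Int.cast (R := ZMod 5)) h'
    push_cast at e
    have : ((w:ℤ) : ZMod 5) = (((r^3)^2 : ℤ) : ZMod 5) := by push_cast; exact z5c2 _ _ _ e
    exact_mod_cast dvd_of_zq this
  have h5r3 : ¬ (5:ℤ) ∣ r^3 := fun hh => h5r (by exact_mod_cast Int.Prime.dvd_pow' (p := 5) (by norm_num) (by exact_mod_cast hh))
  have h5w : ¬ (5:ℤ) ∣ w := by
    intro hh
    have : (5:ℤ) ∣ (r^3)^2 := by clear * - d5 hh; omega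
    exact h5r3 (by exact_mod_cast Int.Prime.dvd_pow' (p := 5) (by norm_num) (by exact_mod_cast this))
  have g5 : (5:ℤ) ∣ G - 3*w^2 := ⟨-15*(w*u^2)+200*(u^2)^2, by rw [← hG]; ring⟩
  have m5 : (5:ℤ) ∣ m - 2*(r^3)^2 := by clear * - d5 hm; omega
  have g29 : (29:ℤ) ∣ G - 14*(u^2)^2 := by
    obtain ⟨k, rfl⟩ := h29w
    exact ⟨3*29*k^2-75*k*u^2+34*(u^2)^2, by rw [← hG]; ring⟩
  have m29 : (29:ℤ) ∣ m - 22*u^2 := by clear * - h29w hm; omega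
  have h29U : ¬ (29:ℤ) ∣ u^2 := fun hh => h29u (by exact_mod_cast Int.Prime.dvd_pow' (p := 29) (by norm_num) (by exact_mod_cast hh))
  have g3 : G % 3 = 1 := by
    have h1 := sq3 h3u
    have h2 : ((u^2)^2) % 3 = 1 := by
      rw [pow_two (u^2), Int.mul_emod, h1]; norm_num
    rw [← hG]; generalize w^2 = a at *; generalize w*u^2 = b at *; clear * - h1 h2 h3w; omega
  have hG0 : 0 < G := by
    have h12 : 12*G = (6*w-75*u^2)^2+6375*(u^2)^2 := by rw [← hG]; ring
    have hu0 : u ≠ 0 := by rintro rfl; simp at h3u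
    have : 0 < (6*w-75*u^2)^2+6375*(u^2)^2 := by positivity
    clear * - this h12; omega
  have fin : ∀ g m0 H m' : ℤ, G = g*H → m = m0*m' → H % 3 ≠ 0 → 0 < H → Odd H → Odd m' → ¬ (5:ℤ) ∣ H → IsCoprime g m' →
      jz ((3*5*29)*m0) H * qs m' H * jz (g*101500) m' = -1 → False := by
    intro g m0 H m' h1 h2 h3 h4 h5 h6 h7 h8 h9
    exact p7c2_core hG hm h' hc h1 h2 h3 h4 h5 h6 h7 h8 h9
  exact p7c2_fin h5w h5r3 h29U h29u h7r g5 m5 g29 m29 d7 g3 hG0 (c2mod h' hu hG hm) fin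

lemma p7_false {r : ℤ} (hr0 : 0 < r) {cs : ℕ} (hcs : cs < 4) (h : SolB 7 r cs) : False := by
  interval_cases cs
  · exact p7c0 hr0 h
  · exact p7c1 h
  · exact p7c2 h
  · exact p7c3 h

/-- odd powers of `⟨a,b⟩`, expansion at `a = 0` -/
lemma oddpow_i (a b : ℤ) (k : ℕ) : ∃ t t' : ℤ, ((⟨a,b⟩:R5)^(2*k+1)).re = a*((2*k+1)*(-5*b^2)^k + a^2*t) ∧
    ((⟨a,b⟩:R5)^(2*k+1)).im = b*((-5*b^2)^k + a^2*t') := by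
  induction k with
  | zero => exact ⟨0, 0, by simp, by simp⟩
  | succ k ih =>
    obtain ⟨t, t', h1, h2⟩ := ih
    have e : (⟨a,b⟩:R5)^(2*(k+1)+1) = (⟨a,b⟩:R5)^(2*k+1) * ⟨a^2-5*b^2, 2*a*b⟩ := by
      rw [show 2*(k+1)+1 = (2*k+1)+2 by ring, pow_add]; congr 1
      rw [pow_two]; ext <;> simp <;> ring
    rw [e]
    refine ⟨(2*k+1)*(-5*b^2)^k + (a^2-5*b^2)*t - 10*b^2*t', (-5*b^2)^k + (a^2-5*b^2)*t' + 2*((2*k+1)*(-5*b^2)^k + a^2*t), ?_, ?_⟩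
    · simp only [Zsqrtd.re_mul, h1, h2]; push_cast; ring
    · simp only [Zsqrtd.im_mul, h1, h2]; push_cast; ring

lemma oddpow_ii (a b : ℤ) (k : ℕ) : ∃ t t' : ℤ, ((⟨a,b⟩:R5)^(2*k+1)).re = a*(a^(2*k) + 5*b^2*t) ∧
    ((⟨a,b⟩:R5)^(2*k+1)).im = b*((2*k+1)*a^(2*k) + 5*b^2*t') := by
  induction k with
  | zero => exact ⟨0, 0, by simp, by simp⟩
  | succ k ih =>
    obtain ⟨t, t', h1, h2⟩ := ih
    have e : (⟨a,b⟩:R5)^(2*(k+1)+1) = (⟨a,b⟩:R5)^(2*k+1) * ⟨a^2-5*b^2, 2*a*b⟩ := by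
      rw [show 2*(k+1)+1 = (2*k+1)+2 by ring, pow_add]; congr 1
      rw [pow_two]; ext <;> simp <;> ring
    rw [e]
    refine ⟨-a^(2*k) + (a^2-5*b^2)*t - 2*((2*k+1)*a^(2*k)+5*b^2*t'), -(2*k+1)*a^(2*k) + (a^2-5*b^2)*t' + 2*a^2*t, ?_, ?_⟩
    · simp only [Zsqrtd.re_mul, h1, h2]; push_cast; ring
    · simp only [Zsqrtd.im_mul, h1, h2]; push_cast; ring

lemma three_cube (x : ℤ) : (3:ℤ) ∣ x^3 - x := by
  have h : ∀ z : ZMod 3, z^3 = z := by decide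
  have : ((x^3:ℤ) : ZMod 3) = ((x:ℤ) : ZMod 3) := by push_cast; exact h _
  exact_mod_cast dvd_of_zq this

lemma oddpow_iii (a b : ℤ) (k : ℕ) : (3:ℤ) ∣ ((⟨a,b⟩:R5)^(2*k+1)).re - a ∧ (3:ℤ) ∣ ((⟨a,b⟩:R5)^(2*k+1)).im - b := by
  induction k with
  | zero => simp
  | succ k ih =>
    obtain ⟨⟨s, h1⟩, ⟨t, h2⟩⟩ := ih
    have e : (⟨a,b⟩:R5)^(2*(k+1)+1) = (⟨a,b⟩:R5)^(2*k+1) * ⟨a^2-5*b^2, 2*a*b⟩ := by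
      rw [show 2*(k+1)+1 = (2*k+1)+2 by ring, pow_add]; congr 1
      rw [pow_two]; ext <;> simp <;> ring
    rw [e]
    obtain ⟨x, hx⟩ := three_cube a
    obtain ⟨y, hy⟩ := three_cube b
    constructor
    · refine ⟨x + (a^2-5*b^2)*s - 10*a*b*t - 5*a*b^2, ?_⟩
      simp only [Zsqrtd.re_mul]
      linear_combination hx + (a^2-5*b^2)*h1 - 10*a*b*h2
    · refine ⟨-5*y + (a^2-5*b^2)*t + 2*a*b*s + a^2*b - 2*b, ?_⟩
      simp only [Zsqrtd.im_mul]
      linear_combination -5*hy + (a^2-5*b^2)*h2 + 2*a*b*h1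

lemma im_negB (a b : ℤ) (n : ℕ) : ((⟨a,-b⟩:R5)^n).im = -((⟨a,b⟩:R5)^n).im ∧ ((⟨a,-b⟩:R5)^n).re = ((⟨a,b⟩:R5)^n).re := by
  induction n with
  | zero => simp
  | succ n ih => simp only [pow_succ, Zsqrtd.re_mul, Zsqrtd.im_mul, ih.1, ih.2]; constructor <;> ring

lemma im_abs (a b : ℤ) (n : ℕ) : |((⟨|a|,|b|⟩:R5)^n).im| = |((⟨a,b⟩:R5)^n).im| := by
  have hb : ∀ a : ℤ, |((⟨a,|b|⟩:R5)^n).im| = |((⟨a,b⟩:R5)^n).im| := by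
    intro a
    rcases abs_choice b with h | h <;> rw [h]
    rw [(im_negB a b n).1, abs_neg]
  rw [hb]
  rcases abs_choice a with h | h <;> rw [h]
  have e : (⟨-a,b⟩:R5) = -⟨a,-b⟩ := by ext <;> simp
  rw [e]
  have h0 : (-⟨a,-b⟩:R5)^n = (⟨a,-b⟩:R5)^n ∨ (-⟨a,-b⟩:R5)^n = -(⟨a,-b⟩:R5)^n := by
    rcases Nat.even_or_odd n with h | h
    · exact Or.inl (h.neg_pow _)
    · exact Or.inr (h.neg_pow _)
  rcases h0 with h1 | h1 <;> rw [h1]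
  · rw [(im_negB a b n).1, abs_neg]
  · rw [Zsqrtd.im_neg, (im_negB a b n).1, neg_neg]

lemma sizeA {a b : ℤ} {p : ℕ} (ha : 0 < a) (hb : 0 < b) (h : 20*(p:ℤ)^2*b^2 ≤ a^2) (n : ℕ) (hn : n + 1 ≤ p) :
    0 < ((⟨a,b⟩:R5)^(n+1)).re ∧ a^n*b ≤ ((⟨a,b⟩:R5)^(n+1)).im ∧ a*((⟨a,b⟩:R5)^(n+1)).im ≤ 2*(n+1)*b*((⟨a,b⟩:R5)^(n+1)).re := by
  induction n with
  | zero => simp; refine ⟨ha, ?_⟩; nlinarith [mul_pos ha hb]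
  | succ n ih =>
    obtain ⟨h1, h2, h3⟩ := ih (by omega)
    rw [pow_succ (⟨a,b⟩:R5) (n+1), Zsqrtd.re_mul, Zsqrtd.im_mul]
    simp only
    generalize ((⟨a,b⟩:R5)^(n+1)).re = X at *
    generalize ((⟨a,b⟩:R5)^(n+1)).im = Y at *
    have hY : 0 < Y := lt_of_lt_of_le (by positivity) h2
    have hnp : ((n:ℤ)+2) ≤ p := by exact_mod_cast hn
    have hn0 : (0:ℤ) ≤ n := by positivity
    have key : 20*((n:ℤ)+1)*(n+2)*b^2 ≤ a^2 := by
      have : ((n:ℤ)+1)*(n+2) ≤ p^2 := by nlinarith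
      nlinarith [sq_nonneg b]
    have k2 : 10*((n:ℤ)+2)*b*Y ≤ a*X := by
      have e1 : 10*((n:ℤ)+2)*b*(a*Y) ≤ 10*((n:ℤ)+2)*b*(2*(n+1)*b*X) := by
        apply mul_le_mul_of_nonneg_left h3; positivity
      have e2 : 20*((n:ℤ)+1)*(n+2)*b^2*X ≤ a^2*X := mul_le_mul_of_nonneg_right key h1.le
      have e3 : a*(10*((n:ℤ)+2)*b*Y) ≤ a*(a*X) := by linarith
      exact le_of_mul_le_mul_left e3 ha
    have hbY : 0 < b*Y := mul_pos hb hY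
    refine ⟨?_, ?_, ?_⟩
    · nlinarith
    · have : a*(a^n*b) ≤ a*Y := mul_le_mul_of_nonneg_left h2 ha.le
      have e : a^(n+1)*b = a*(a^n*b) := by ring
      rw [e]
      nlinarith [mul_pos hb h1]
    · push_cast
      have e1 := mul_le_mul_of_nonneg_left h3 ha.le
      have e2 := mul_le_mul_of_nonneg_left k2 hb.le
      nlinarith

lemma killA {p : ℕ} {a b : ℤ} {K bd : ℤ} (hb : b ≠ 0) (hbd : bd < |a|^(p-1))
    (h : |b| * K ≤ |((⟨|a|,|b|⟩:R5)^p).im|) (hK : |a|^(p-1) ≤ K) (him : |((⟨a,b⟩:R5)^p).im| ≤ bd) : False := by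
  rw [im_abs] at h
  have : 1 ≤ |b| := Int.one_le_abs hb
  have h0 : 0 ≤ |a|^(p-1) := by positivity
  nlinarith

lemma kill_gen {p : ℕ} (hp : 1 ≤ p) {a b M bd : ℤ} (hb : b ≠ 0) (hbM : |b| ≤ M) (ha : 20*(p:ℤ)^2*M^2 ≤ |a|^2) (hbd : bd < |a|^(p-1))
    (him : |((⟨a,b⟩:R5)^p).im| ≤ bd) : False := by
  have hb1 : 0 < |b| := abs_pos.mpr hb
  have h1 : |b|^2 ≤ M^2 := by gcongr
  have hp0 : (0:ℤ) < p := by exact_mod_cast hp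
  have h2 : 20*(p:ℤ)^2*|b|^2 ≤ |a|^2 := le_trans (by gcongr) ha
  have ha0 : 0 < |a| := by
    rcases (abs_nonneg a).lt_or_eq with h | h
    · exact h
    · exfalso
      rw [← h] at h2
      have : 0 < 20*(p:ℤ)^2*|b|^2 := by positivity
      linarith
  have h3 := (sizeA ha0 hb1 h2 (p-1) (by omega)).2.1
  rw [Nat.sub_add_cancel hp] at h3
  exact killA (K := |a|^(p-1)) hb hbd (by rw [mul_comm]; exact h3.trans (le_abs_self _)) le_rfl him

/-- bisection certificate -/
def bis (P Q : ℕ → ℕ) (bd n : ℕ) : ℕ → ℕ → Bool :=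
  Nat.rec (fun _ _ => false) (fun _ ih l u =>
    Nat.blt (bd + l*Q u) (l*P l) || (Nat.blt (bd + l*P u) (l*Q l) ||
      (Nat.beq l u && Nat.beq (l%3) 0) || (Nat.blt l u && ih l ((l+u)/2) && ih ((l+u)/2+1) u))) n

lemma bis_aux {P Q : ℕ → ℕ} (hP : Monotone P) (hQ : Monotone Q) {bd l u b : ℕ} (h1 : l ≤ b) (h2 : b ≤ u) (h : bd + l*Q u < l*P l) :
    bd + b*Q b < b*P b := by
  have a1 := hP h1
  have a2 := hQ h2
  have a3 : Q u < P l := by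
    by_contra hh
    have : l*P l ≤ l*Q u := Nat.mul_le_mul_left _ (by omega)
    omega
  obtain ⟨d, hd⟩ := Nat.exists_eq_add_of_lt a3
  obtain ⟨e, he⟩ := Nat.exists_eq_add_of_le (show Q b + d + 1 ≤ P b by omega)
  rw [hd] at h
  have h4 : bd < l*(d+1) := by nlinarith
  have h5 : l*(d+1) ≤ b*(d+1) := Nat.mul_le_mul_right _ h1
  rw [he]
  nlinarith [Nat.zero_le (b*e)]

lemma bis_spec {P Q : ℕ → ℕ} (hP : Monotone P) (hQ : Monotone Q) {bd : ℕ} (n : ℕ) : ∀ l u, bis P Q bd n l u = true →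
    ∀ b, l ≤ b → b ≤ u → b % 3 ≠ 0 → bd + b*Q b < b*P b ∨ bd + b*P b < b*Q b := by
  induction n with
  | zero => intro l u h; simp [bis] at h
  | succ n ih =>
    intro l u h b h1 h2 h3
    have e : bis P Q bd (n+1) l u = (Nat.blt (bd + l*Q u) (l*P l) || (Nat.blt (bd + l*P u) (l*Q l) ||
      (Nat.beq l u && Nat.beq (l%3) 0) || (Nat.blt l u && bis P Q bd n l ((l+u)/2) && bis P Q bd n ((l+u)/2+1) u))) := rfl
    rw [e] at h
    simp only [Bool.or_eq_true, Bool.and_eq_true, Nat.blt_eq, Nat.beq_eq] at h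
    rcases h with h | (h | h) | h
    · exact Or.inl (bis_aux hP hQ h1 h2 h)
    · exact Or.inr (bis_aux hQ hP h1 h2 h)
    · exfalso; obtain ⟨rfl, h⟩ := h
      have : b = l := by omega
      subst this; exact h3 h
    · obtain ⟨⟨_, h4⟩, h5⟩ := h
      rcases Nat.lt_or_ge ((l+u)/2) b with h6 | h6
      · exact ih _ _ h5 b h6 h2 h3
      · exact ih _ _ h4 b h1 h6 h3

lemma kill_bis {P Q : ℕ → ℕ} (hP : Monotone P) (hQ : Monotone Q) {p n bd M : ℕ} {a b : ℤ} (h : bis P Q bd n 1 M = true)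
    (him : ∀ b : ℕ, ((⟨|a|,b⟩:R5)^p).im = b*((P b : ℤ) - Q b)) (hb : b ≠ 0) (hbM : |b| ≤ M) (hb3 : ¬ (3:ℤ) ∣ b)
    (hs : |((⟨a,b⟩:R5)^p).im| ≤ bd) : False := by
  have h1 := bis_spec hP hQ n 1 M h b.natAbs (by omega) (by rw [Int.abs_eq_natAbs] at hbM; omega) (by omega)
  rw [← im_abs, Int.abs_eq_natAbs b, him] at hs
  rw [abs_le] at hs
  zify at h1 hs
  rw [mul_sub] at hs
  omega

lemma pw2 (a b : ℤ) : (⟨a,b⟩:R5)^2 = ⟨(1)*a^2*b^0+(-5)*a^0*b^2, (2)*a^1*b^1⟩ := by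
  rw [show (⟨a,b⟩:R5)^2 = (⟨a,b⟩:R5)^1*(⟨a,b⟩:R5)^1 by rw [← pow_add], pow_one]
  ext
  · simp only [Zsqrtd.re_mul]; ring
  · simp only [Zsqrtd.im_mul]; ring
lemma pw4 (a b : ℤ) : (⟨a,b⟩:R5)^4 = ⟨(1)*a^4*b^0+(-30)*a^2*b^2+(25)*a^0*b^4, (4)*a^3*b^1+(-20)*a^1*b^3⟩ := by
  rw [show (⟨a,b⟩:R5)^4 = (⟨a,b⟩:R5)^2*(⟨a,b⟩:R5)^2 by rw [← pow_add], pw2]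
  ext
  · simp only [Zsqrtd.re_mul]; ring
  · simp only [Zsqrtd.im_mul]; ring
lemma pw5 (a b : ℤ) : (⟨a,b⟩:R5)^5 = ⟨(1)*a^5*b^0+(-50)*a^3*b^2+(125)*a^1*b^4, (5)*a^4*b^1+(-50)*a^2*b^3+(25)*a^0*b^5⟩ := by
  rw [show (⟨a,b⟩:R5)^5 = (⟨a,b⟩:R5)^4*(⟨a,b⟩:R5)^1 by rw [← pow_add], pow_one, pw4]
  ext
  · simp only [Zsqrtd.re_mul]; ring
  · simp only [Zsqrtd.im_mul]; ring
lemma pw7 (a b : ℤ) : (⟨a,b⟩:R5)^7 = ⟨(1)*a^7*b^0+(-105)*a^5*b^2+(875)*a^3*b^4+(-875)*a^1*b^6, (7)*a^6*b^1+(-175)*a^4*b^3+(525)*a^2*b^5+(-125)*a^0*b^7⟩ := by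
  rw [show (⟨a,b⟩:R5)^7 = (⟨a,b⟩:R5)^5*(⟨a,b⟩:R5)^2 by rw [← pow_add], pw2, pw5]
  ext
  · simp only [Zsqrtd.re_mul]; ring
  · simp only [Zsqrtd.im_mul]; ring
lemma pw11 (a b : ℤ) : (⟨a,b⟩:R5)^11 = ⟨(1)*a^11*b^0+(-275)*a^9*b^2+(8250)*a^7*b^4+(-57750)*a^5*b^6+(103125)*a^3*b^8+(-34375)*a^1*b^10, (11)*a^10*b^1+(-825)*a^8*b^3+(11550)*a^6*b^5+(-41250)*a^4*b^7+(34375)*a^2*b^9+(-3125)*a^0*b^11⟩ := by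
  rw [show (⟨a,b⟩:R5)^11 = (⟨a,b⟩:R5)^7*(⟨a,b⟩:R5)^4 by rw [← pow_add], pw4, pw7]
  ext
  · simp only [Zsqrtd.re_mul]; ring
  · simp only [Zsqrtd.im_mul]; ring
lemma pw13 (a b : ℤ) : (⟨a,b⟩:R5)^13 = ⟨(1)*a^13*b^0+(-390)*a^11*b^2+(17875)*a^9*b^4+(-214500)*a^7*b^6+(804375)*a^5*b^8+(-893750)*a^3*b^10+(203125)*a^1*b^12, (13)*a^12*b^1+(-1430)*a^10*b^3+(32175)*a^8*b^5+(-214500)*a^6*b^7+(446875)*a^4*b^9+(-243750)*a^2*b^11+(15625)*a^0*b^13⟩ := by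
  rw [show (⟨a,b⟩:R5)^13 = (⟨a,b⟩:R5)^11*(⟨a,b⟩:R5)^2 by rw [← pow_add], pw2, pw11]
  ext
  · simp only [Zsqrtd.re_mul]; ring
  · simp only [Zsqrtd.im_mul]; ring
lemma pw17 (a b : ℤ) : (⟨a,b⟩:R5)^17 = ⟨(1)*a^17*b^0+(-680)*a^15*b^2+(59500)*a^13*b^4+(-1547000)*a^11*b^6+(15193750)*a^9*b^8+(-60775000)*a^7*b^10+(96687500)*a^5*b^12+(-53125000)*a^3*b^14+(6640625)*a^1*b^16, (17)*a^16*b^1+(-3400)*a^14*b^3+(154700)*a^12*b^5+(-2431000)*a^10*b^7+(15193750)*a^8*b^9+(-38675000)*a^6*b^11+(37187500)*a^4*b^13+(-10625000)*a^2*b^15+(390625)*a^0*b^17⟩ := by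
  rw [show (⟨a,b⟩:R5)^17 = (⟨a,b⟩:R5)^13*(⟨a,b⟩:R5)^4 by rw [← pow_add], pw4, pw13]
  ext
  · simp only [Zsqrtd.re_mul]; ring
  · simp only [Zsqrtd.im_mul]; ring
lemma pw19 (a b : ℤ) : (⟨a,b⟩:R5)^19 = ⟨(1)*a^19*b^0+(-855)*a^17*b^2+(96900)*a^15*b^4+(-3391500)*a^13*b^6+(47238750)*a^11*b^8+(-288681250)*a^9*b^10+(787312500)*a^7*b^12+(-908437500)*a^5*b^14+(378515625)*a^3*b^16+(-37109375)*a^1*b^18, (19)*a^18*b^1+(-4845)*a^16*b^3+(290700)*a^14*b^5+(-6298500)*a^12*b^7+(57736250)*a^10*b^9+(-236193750)*a^8*b^11+(423937500)*a^6*b^13+(-302812500)*a^4*b^15+(66796875)*a^2*b^17+(-1953125)*a^0*b^19⟩ := by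
  rw [show (⟨a,b⟩:R5)^19 = (⟨a,b⟩:R5)^17*(⟨a,b⟩:R5)^2 by rw [← pow_add], pw2, pw17]
  ext
  · simp only [Zsqrtd.re_mul]; ring
  · simp only [Zsqrtd.im_mul]; ring

def P5 (a b : ℕ) : ℕ := 5*a^4*b^0+25*a^0*b^4
def Q5 (a b : ℕ) : ℕ := 50*a^2*b^2
lemma P5_mono (a : ℕ) : Monotone (P5 a) := by intro x y h; unfold P5; gcongr
lemma Q5_mono (a : ℕ) : Monotone (Q5 a) := by intro x y h; unfold Q5; gcongr
lemma im5 (a b : ℕ) : ((⟨a,b⟩:R5)^5).im = b*((P5 a b:ℤ) - Q5 a b) := by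
  rw [pw5]; unfold P5 Q5; push_cast; ring

def P7 (a b : ℕ) : ℕ := 7*a^6*b^0+525*a^2*b^4
def Q7 (a b : ℕ) : ℕ := 175*a^4*b^2+125*a^0*b^6
lemma P7_mono (a : ℕ) : Monotone (P7 a) := by intro x y h; unfold P7; gcongr
lemma Q7_mono (a : ℕ) : Monotone (Q7 a) := by intro x y h; unfold Q7; gcongr
lemma im7 (a b : ℕ) : ((⟨a,b⟩:R5)^7).im = b*((P7 a b:ℤ) - Q7 a b) := by
  rw [pw7]; unfold P7 Q7; push_cast; ring

def P11 (a b : ℕ) : ℕ := 11*a^10*b^0+11550*a^6*b^4+34375*a^2*b^8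
def Q11 (a b : ℕ) : ℕ := 825*a^8*b^2+41250*a^4*b^6+3125*a^0*b^10
lemma P11_mono (a : ℕ) : Monotone (P11 a) := by intro x y h; unfold P11; gcongr
lemma Q11_mono (a : ℕ) : Monotone (Q11 a) := by intro x y h; unfold Q11; gcongr
lemma im11 (a b : ℕ) : ((⟨a,b⟩:R5)^11).im = b*((P11 a b:ℤ) - Q11 a b) := by
  rw [pw11]; unfold P11 Q11; push_cast; ring

def P13 (a b : ℕ) : ℕ := 13*a^12*b^0+32175*a^8*b^4+446875*a^4*b^8+15625*a^0*b^12
def Q13 (a b : ℕ) : ℕ := 1430*a^10*b^2+214500*a^6*b^6+243750*a^2*b^10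
lemma P13_mono (a : ℕ) : Monotone (P13 a) := by intro x y h; unfold P13; gcongr
lemma Q13_mono (a : ℕ) : Monotone (Q13 a) := by intro x y h; unfold Q13; gcongr
lemma im13 (a b : ℕ) : ((⟨a,b⟩:R5)^13).im = b*((P13 a b:ℤ) - Q13 a b) := by
  rw [pw13]; unfold P13 Q13; push_cast; ring

def P17 (a b : ℕ) : ℕ := 17*a^16*b^0+154700*a^12*b^4+15193750*a^8*b^8+37187500*a^4*b^12+390625*a^0*b^16
def Q17 (a b : ℕ) : ℕ := 3400*a^14*b^2+2431000*a^10*b^6+38675000*a^6*b^10+10625000*a^2*b^14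
lemma P17_mono (a : ℕ) : Monotone (P17 a) := by intro x y h; unfold P17; gcongr
lemma Q17_mono (a : ℕ) : Monotone (Q17 a) := by intro x y h; unfold Q17; gcongr
lemma im17 (a b : ℕ) : ((⟨a,b⟩:R5)^17).im = b*((P17 a b:ℤ) - Q17 a b) := by
  rw [pw17]; unfold P17 Q17; push_cast; ring

def P19 (a b : ℕ) : ℕ := 19*a^18*b^0+290700*a^14*b^4+57736250*a^10*b^8+423937500*a^6*b^12+66796875*a^2*b^16
def Q19 (a b : ℕ) : ℕ := 4845*a^16*b^2+6298500*a^12*b^6+236193750*a^8*b^10+302812500*a^4*b^14+1953125*a^0*b^18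
lemma P19_mono (a : ℕ) : Monotone (P19 a) := by intro x y h; unfold P19; gcongr
lemma Q19_mono (a : ℕ) : Monotone (Q19 a) := by intro x y h; unfold Q19; gcongr
lemma im19 (a b : ℕ) : ((⟨a,b⟩:R5)^19).im = b*((P19 a b:ℤ) - Q19 a b) := by
  rw [pw19]; unfold P19 Q19; push_cast; ring

lemma bl50 : allB (fun s => bis (P5 (27*(s+1)^5)) (Q5 (27*(s+1)^5)) 2000000 22 1 2000000) 12 = true := by decide +kernel
lemma bl51 : allB (fun s => bis (P5 (108*(s+1)^5)) (Q5 (108*(s+1)^5)) 1000000 22 1 1000000) 8 = true := by decide +kernel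
lemma bl70 : allB (fun s => bis (P7 (243*(s+1)^7)) (Q7 (243*(s+1)^7)) 2000000 22 1 2000000) 4 = true := by decide +kernel
lemma bl71 : allB (fun s => bis (P7 (3888*(s+1)^7)) (Q7 (3888*(s+1)^7)) 1000000 22 1 1000000) 2 = true := by decide +kernel
lemma bl110 : allB (fun s => bis (P11 (19683*(s+1)^11)) (Q11 (19683*(s+1)^11)) 2000000 22 1 2000000) 2 = true := by decide +kernel
lemma bl111 : allB (fun s => bis (P11 (5038848*(s+1)^11)) (Q11 (5038848*(s+1)^11)) 1000000 22 1 1000000) 1 = true := by decide +kernel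
lemma bl130 : allB (fun s => bis (P13 (177147*(s+1)^13)) (Q13 (177147*(s+1)^13)) 2000000 22 1 2000000) 1 = true := by decide +kernel
lemma bl170 : allB (fun s => bis (P17 (14348907*(s+1)^17)) (Q17 (14348907*(s+1)^17)) 2000000 22 1 2000000) 1 = true := by decide +kernel
lemma bl190 : allB (fun s => bis (P19 (129140163*(s+1)^19)) (Q19 (129140163*(s+1)^19)) 2000000 22 1 2000000) 1 = true := by decide +kernel
lemma bl52 : allB (fun s => bis (P5 (3375*(s+1)^5)) (Q5 (3375*(s+1)^5)) 50000000 22 1 2000000) 4 = true := by decide +kernel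
lemma bl53 : allB (fun s => bis (P5 (13500*(s+1)^5)) (Q5 (13500*(s+1)^5)) 25000000 22 1 1000000) 3 = true := by decide +kernel
lemma bl72 : allB (fun s => bis (P7 (3796875*(s+1)^7)) (Q7 (3796875*(s+1)^7)) 250000000 22 1 2000000) 1 = true := by decide +kernel

lemma lt_pw {x M : ℤ} {k : ℕ} (hk : 1 ≤ k) (hx : 5 ≤ x) (hM : M < x) : 5^k*M < x^(2*k) := by
  have h1 : (5:ℤ)^k*x^k ≤ x^(2*k) := by
    rw [pow_mul, ← mul_pow]
    exact pow_le_pow_left₀ (by omega) (by nlinarith) k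
  have h2 : x ≤ x^k := le_self_pow₀ (by omega) (by omega)
  have h3 : (0:ℤ) < 5^k := by positivity
  nlinarith

lemma gt_of_sq {x M c : ℤ} (hx : 0 ≤ x) (hM : 5 ≤ M) (hc : 2 ≤ c) (h : c*M^2 ≤ x^2) : 5 ≤ x ∧ M < x := by
  have : M < x := by
    by_contra hh
    push Not at hh
    have : x^2 ≤ M^2 := by gcongr
    nlinarith
  exact ⟨by omega, this⟩

lemma kill_gen2 {k : ℕ} (hk : 1 ≤ k) {a b M : ℤ} (hM : 5 ≤ M) (hb : b ≠ 0) (hbM : |b| ≤ M) (ha : 20*(2*k+1:ℤ)^2*M^2 ≤ |a|^2)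
    (him : |((⟨a,b⟩:R5)^(2*k+1)).im| ≤ 5^k*M) : False := by
  have hk0 : (0:ℤ) ≤ k := by positivity
  obtain ⟨h5, hM⟩ := gt_of_sq (abs_nonneg a) hM (show (2:ℤ) ≤ 20*(2*k+1)^2 by nlinarith) ha
  exact kill_gen (p := 2*k+1) (by omega) hb hbM (by push_cast; exact ha) (lt_pw hk h5 hM) him

lemma kill5 {a b M : ℤ} (hM : 5 ≤ M) (hb : b ≠ 0) (hbM : |b| ≤ M) (ha : 13*M^2 ≤ |a|^2)
    (him : |((⟨a,b⟩:R5)^5).im| ≤ 5^2*M) : False := by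
  obtain ⟨h5, hM⟩ := gt_of_sq (abs_nonneg a) hM (by norm_num) ha
  have hb1 : 0 < |b| := abs_pos.mpr hb
  refine killA (p := 5) (K := |a|^4) hb (lt_pw (k := 2) (by norm_num) h5 hM) ?_ le_rfl him
  refine le_trans ?_ (le_abs_self _)
  rw [pw5]
  simp only
  have h1 : |b|^2 ≤ M^2 := by gcongr
  generalize |a| = x at *
  generalize |b| = y at *
  have h2 : 13*y^2 ≤ x^2 := by linarith
  have h3 : 0 ≤ (x^2-13*y^2)*(x^2) := mul_nonneg (by linarith) (by positivity)
  have h4 : 0 ≤ y*(4*((x^2-13*y^2)*x^2)+2*x^2*y^2+25*y^4) := by positivity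
  linarith

lemma kill7 {a b M : ℤ} (hM : 5 ≤ M) (hb : b ≠ 0) (hbM : |b| ≤ M) (ha : 30*M^2 ≤ |a|^2)
    (him : |((⟨a,b⟩:R5)^7).im| ≤ 5^3*M) : False := by
  obtain ⟨h5, hM⟩ := gt_of_sq (abs_nonneg a) hM (by norm_num) ha
  have hb1 : 0 < |b| := abs_pos.mpr hb
  refine killA (p := 7) (K := |a|^6) hb (lt_pw (k := 3) (by norm_num) h5 hM) ?_ le_rfl him
  refine le_trans ?_ (le_abs_self _)
  rw [pw7]
  simp only
  have h1 : |b|^2 ≤ M^2 := by gcongr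
  generalize |a| = x at *
  generalize |b| = y at *
  have h2 : 30*y^2 ≤ x^2 := by linarith
  have h3 : 0 ≤ (x^2-30*y^2)*(x^4) := mul_nonneg (by linarith) (by positivity)
  have h5 : 0 ≤ (x^2-30*y^2)*(y^4) := mul_nonneg (by linarith) (by positivity)
  have h4 : 0 ≤ y*(6*((x^2-30*y^2)*x^4)+5*x^4*y^2+525*((x^2-30*y^2)*y^4)+15625*y^6) := by positivity
  linarith

lemma kill_list {P Q : ℕ → ℕ → ℕ} (hP : ∀ a, Monotone (P a)) (hQ : ∀ a, Monotone (Q a)) {p c cnt bd M : ℕ}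
    (him : ∀ a b : ℕ, ((⟨a,b⟩:R5)^p).im = b*((P a b : ℤ) - Q a b))
    (hl : allB (fun s => bis (P (c*(s+1)^p)) (Q (c*(s+1)^p)) bd 22 1 M) cnt = true) {a b s : ℤ} (ha : a = c*s^p) (hs : s ≠ 0)
    (hsc : |s| ≤ cnt) (hb : b ≠ 0) (hbM : |b| ≤ M) (hb3 : ¬ (3:ℤ) ∣ b) (h : |((⟨a,b⟩:R5)^p).im| ≤ bd) : False := by
  have hl' := allB_spec hl (s.natAbs-1) (by rw [Int.abs_eq_natAbs] at hsc; omega)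
  rw [Nat.sub_add_cancel (by omega)] at hl'
  refine kill_bis (hP _) (hQ _) hl' ?_ hb hbM hb3 h
  intro b
  rw [← him]
  congr 3
  rw [ha, abs_mul, abs_pow, Int.abs_eq_natAbs s]; push_cast; simp

lemma pow_or {p : ℕ} (hp : p.Prime) (hp5 : 5 ≤ p) {c a F D t Y : ℤ} (hF : F = p*D + a^2*t) (haD : IsCoprime a D) (hcF : IsCoprime c F)
    (hY : c*a*F = Y^p) (hpc : ¬ (p:ℤ) ∣ c) : (∃ S, c*a = S^p) ∨ ((p:ℤ)^(p-1) ∣ a) := by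
  have hpp := Nat.prime_iff_prime_int.mp hp
  have hodd : Odd p := hp.odd_of_ne_two (by omega)
  by_cases hpa : (p:ℤ) ∣ a
  · right
    obtain ⟨d, hd⟩ := hpa
    have hDn : ¬ (p:ℤ) ∣ D := fun hh => hpp.not_isUnit (haD.isUnit_of_dvd' ⟨d, hd⟩ hh)
    have hF' : F = p*(D + p*(d^2*t)) := by rw [hF, hd]; ring
    have hn : ¬ (p:ℤ) ∣ D + p*(d^2*t) := fun hh => hDn ((dvd_add_left (Dvd.intro _ rfl)).mp hh)
    have hpY : (p:ℤ) ∣ Y := hpp.dvd_of_dvd_pow (n := p) (by rw [← hY, hF']; exact ⟨c*a*(D + p*(d^2*t)), by ring⟩)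
    have h1 : (p:ℤ)^p ∣ Y^p := pow_dvd_pow_of_dvd hpY p
    rw [← hY, hF'] at h1
    have e : (p:ℤ)^p = p*p^(p-1) := by rw [← pow_succ', Nat.sub_add_cancel (by omega)]
    rw [e, show c*a*(p*(D + p*(d^2*t))) = p*(a*(c*(D + p*(d^2*t)))) by ring] at h1
    have h2 := Int.dvd_of_mul_dvd_mul_left hpp.ne_zero h1
    refine IsCoprime.dvd_of_dvd_mul_right ?_ h2
    apply IsCoprime.pow_left
    exact IsCoprime.mul_right ((hpp.coprime_iff_not_dvd).mpr hpc) ((hpp.coprime_iff_not_dvd).mpr hn)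
  · left
    have hc : IsCoprime a F := by
      apply cop_of
      intro l hl h1 h2
      have hlp := Nat.prime_iff_prime_int.mp hl
      have h3 : (l:ℤ) ∣ p*D := by
        rw [hF] at h2
        exact (dvd_add_left (Dvd.dvd.mul_right (dvd_pow h1 (by norm_num)) _)).mp h2
      rcases hlp.dvd_or_dvd h3 with h4 | h4
      · have : l = p := (Nat.prime_dvd_prime_iff_eq hl hp).mp (by exact_mod_cast h4)
        subst this; exact hpa h1
      · exact hlp.not_isUnit (haD.isUnit_of_dvd' h1 h4)
    obtain ⟨S, v, h1, _⟩ := split_pow hodd (hcF.mul_left hc) hY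
    exact ⟨S, h1⟩

lemma le_abs_of_dvd {N a : ℤ} (ha : a ≠ 0) (h : N ∣ a) : N ≤ |a| := by
  have := Int.le_of_dvd (abs_pos.mpr ha) ((dvd_abs N a).mpr h)
  exact this

lemma abs_pow_ge {s : ℤ} {n : ℕ} {p : ℕ} (h : (n:ℤ) ≤ |s|) : (n:ℤ)^p ≤ |s^p| := by
  rw [abs_pow]; exact pow_le_pow_left₀ (by positivity) h p

lemma kN {p k : ℕ} (hpk : p = 2*k+1) (hk : 1 ≤ k) {a b M N : ℤ} (hM : 5 ≤ M) (hb : b ≠ 0) (hbM : |b| ≤ M) (hN0 : 0 ≤ N) (hN : N ≤ |a|)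
    (hs : 20*(2*k+1:ℤ)^2*M^2 ≤ N^2) (him : |((⟨a,b⟩:R5)^p).im| ≤ 5^k*M) : False := by
  subst hpk
  exact kill_gen2 hk hM hb hbM (hs.trans (by gcongr)) him

lemma root_s {q : ℕ} {S c c' a : ℤ} {p : ℕ} (hq : ∀ S : ℤ, c ∣ S^p → (q:ℤ) ∣ S) (hc : c ≠ 0) (hcc : (q:ℤ)^p = c*c') (h : c*a = S^p) : ∃ s, a = c'*s^p := by
  obtain ⟨s, rfl⟩ := hq S ⟨a, h.symm⟩
  refine ⟨s, mul_left_cancel₀ hc ?_⟩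
  rw [h, mul_pow, hcc]; ring

lemma dvd3 {S : ℤ} {p : ℕ} {c : ℤ} (hc : (3:ℤ) ∣ c) (h : c ∣ S^p) : (3:ℤ) ∣ S := by
  exact_mod_cast Int.Prime.dvd_pow' (p := 3) (by norm_num) (by exact_mod_cast hc.trans h)
lemma dvd2 {S : ℤ} {p : ℕ} {c : ℤ} (hc : (2:ℤ) ∣ c) (h : c ∣ S^p) : (2:ℤ) ∣ S := by
  exact_mod_cast Int.Prime.dvd_pow' (p := 2) (by norm_num) (by exact_mod_cast hc.trans h)
lemma dvd5 {S : ℤ} {p : ℕ} {c : ℤ} (hc : (5:ℤ) ∣ c) (h : c ∣ S^p) : (5:ℤ) ∣ S := by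
  exact_mod_cast Int.Prime.dvd_pow' (p := 5) (by norm_num) (by exact_mod_cast hc.trans h)

lemma nine_pow (n : ℕ) (hn : 21 ≤ n) : 80000000000000*((n:ℤ)+2)^2 ≤ 9^n := by
  induction n, hn using Nat.le_induction with
  | base => norm_num
  | succ n hn ih =>
    have : (21:ℤ) ≤ n := by exact_mod_cast hn
    push_cast; rw [pow_succ (9:ℤ) n]; nlinarith

/-- large s, or list -/
lemma s_split {c' s a : ℤ} {p cnt : ℕ} (hc : 0 ≤ c') (ha : a = c'*s^p) (h : ¬ |s| ≤ cnt) : c'*((cnt+1:ℕ):ℤ)^p ≤ |a| := by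
  rw [ha, abs_mul, abs_of_nonneg hc]
  exact mul_le_mul_of_nonneg_left (abs_pow_ge (by push_cast; omega)) hc

lemma s_ne {c' s a : ℤ} {p : ℕ} (hp : p ≠ 0) (ha0 : a ≠ 0) (ha : a = c'*s^p) : s ≠ 0 := by
  rintro rfl; rw [zero_pow hp, mul_zero] at ha; exact ha0 ha

lemma finA0 {p : ℕ} (hp : p.Prime) (hp5 : 5 ≤ p) {a b : ℤ} (ha : a ≠ 0) (hb : b ≠ 0) (hbM : |b| ≤ 2000000) (hb3 : ¬ (3:ℤ) ∣ b)
    (him : |((⟨a,b⟩:R5)^p).im| ≤ 2000000) (h3 : (3:ℤ)^(p-2) ∣ a) (hor : (∃ S, 9*a = S^p) ∨ ((p:ℤ)^(p-1) ∣ a ∧ p ≠ 5)) : False := by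
  rcases Nat.lt_or_ge p 23 with hlt | hge
  · have hpr : p = 5 ∨ p = 7 ∨ p = 11 ∨ p = 13 ∨ p = 17 ∨ p = 19 := by
      interval_cases p <;> first | omega | (exfalso; revert hp; norm_num)
    have A3 := le_abs_of_dvd ha h3
    rcases hor with ⟨S, hS⟩ | ⟨hpd, hp55⟩
    · rcases hpr with rfl | rfl | rfl | rfl | rfl | rfl
      · obtain ⟨s, hs⟩ := root_s (q := 3) (c' := 27) (fun S h => dvd3 (by norm_num) h) (by norm_num) (by norm_num) hS
        by_cases hle : |s| ≤ (12:ℕ)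
        · exact kill_list P5_mono Q5_mono im5 bl50 hs (s_ne (by norm_num) ha hs) hle hb hbM hb3 him
        · have hN := s_split (by norm_num) hs hle
          norm_num at hN
          exact kill5 (M := 2000000) (by norm_num) hb hbM (le_trans (by norm_num) (pow_le_pow_left₀ (by norm_num) hN 2)) (him.trans (by norm_num))
      · obtain ⟨s, hs⟩ := root_s (q := 3) (c' := 243) (fun S h => dvd3 (by norm_num) h) (by norm_num) (by norm_num) hS
        by_cases hle : |s| ≤ (4:ℕ)
        · exact kill_list P7_mono Q7_mono im7 bl70 hs (s_ne (by norm_num) ha hs) hle hb hbM hb3 him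
        · have hN := s_split (by norm_num) hs hle
          norm_num at hN
          exact kill7 (M := 2000000) (by norm_num) hb hbM (le_trans (by norm_num) (pow_le_pow_left₀ (by norm_num) hN 2)) (him.trans (by norm_num))
      · obtain ⟨s, hs⟩ := root_s (q := 3) (c' := 19683) (fun S h => dvd3 (by norm_num) h) (by norm_num) (by norm_num) hS
        by_cases hle : |s| ≤ (2:ℕ)
        · exact kill_list P11_mono Q11_mono im11 bl110 hs (s_ne (by norm_num) ha hs) hle hb hbM hb3 him
        · have hN := s_split (by norm_num) hs hle
          norm_num at hN
          exact kN (p := 11) (k := 5) (M := 2000000) (by norm_num) (by norm_num) (by norm_num) hb hbM (by norm_num) hN (by norm_num) (him.trans (by norm_num))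
      · obtain ⟨s, hs⟩ := root_s (q := 3) (c' := 177147) (fun S h => dvd3 (by norm_num) h) (by norm_num) (by norm_num) hS
        by_cases hle : |s| ≤ (1:ℕ)
        · exact kill_list P13_mono Q13_mono im13 bl130 hs (s_ne (by norm_num) ha hs) hle hb hbM hb3 him
        · have hN := s_split (by norm_num) hs hle
          norm_num at hN
          exact kN (p := 13) (k := 6) (M := 2000000) (by norm_num) (by norm_num) (by norm_num) hb hbM (by norm_num) hN (by norm_num) (him.trans (by norm_num))
      · obtain ⟨s, hs⟩ := root_s (q := 3) (c' := 14348907) (fun S h => dvd3 (by norm_num) h) (by norm_num) (by norm_num) hS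
        by_cases hle : |s| ≤ (1:ℕ)
        · exact kill_list P17_mono Q17_mono im17 bl170 hs (s_ne (by norm_num) ha hs) hle hb hbM hb3 him
        · have hN := s_split (by norm_num) hs hle
          norm_num at hN
          exact kN (p := 17) (k := 8) (M := 2000000) (by norm_num) (by norm_num) (by norm_num) hb hbM (by norm_num) hN (by norm_num) (him.trans (by norm_num))
      · obtain ⟨s, hs⟩ := root_s (q := 3) (c' := 129140163) (fun S h => dvd3 (by norm_num) h) (by norm_num) (by norm_num) hS
        by_cases hle : |s| ≤ (1:ℕ)
        · exact kill_list P19_mono Q19_mono im19 bl190 hs (s_ne (by norm_num) ha hs) hle hb hbM hb3 him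
        · have hN := s_split (by norm_num) hs hle
          norm_num at hN
          exact kN (p := 19) (k := 9) (M := 2000000) (by norm_num) (by norm_num) (by norm_num) hb hbM (by norm_num) hN (by norm_num) (him.trans (by norm_num))
    · rcases hpr with rfl | rfl | rfl | rfl | rfl | rfl
      · exact hp55 rfl
      · have h6 : (28588707:ℤ) ∣ a := by norm_num at h3 hpd; omega
        have hN := le_abs_of_dvd ha h6
        exact kill7 (M := 2000000) (by norm_num) hb hbM (le_trans (by norm_num) (pow_le_pow_left₀ (by norm_num) hN 2)) (him.trans (by norm_num))
      · have hN := le_abs_of_dvd ha hpd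
        exact kN (p := 11) (k := 5) (M := 2000000) (by norm_num) (by norm_num) (by norm_num) hb hbM (by norm_num) hN (by norm_num) (him.trans (by norm_num))
      · have hN := le_abs_of_dvd ha hpd
        exact kN (p := 13) (k := 6) (M := 2000000) (by norm_num) (by norm_num) (by norm_num) hb hbM (by norm_num) hN (by norm_num) (him.trans (by norm_num))
      · have hN := le_abs_of_dvd ha hpd
        exact kN (p := 17) (k := 8) (M := 2000000) (by norm_num) (by norm_num) (by norm_num) hb hbM (by norm_num) hN (by norm_num) (him.trans (by norm_num))
      · have hN := le_abs_of_dvd ha hpd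
        exact kN (p := 19) (k := 9) (M := 2000000) (by norm_num) (by norm_num) (by norm_num) hb hbM (by norm_num) hN (by norm_num) (him.trans (by norm_num))
  · obtain ⟨k, hk⟩ := hp.odd_of_ne_two (by omega)
    have hN := le_abs_of_dvd ha h3
    have h9 := nine_pow (p-2) (by omega)
    refine kN hk (by omega) (M := 2000000) (by norm_num) hb hbM (by positivity) hN ?_ (him.trans ?_)
    · rw [← pow_mul, mul_comm (p-2), pow_mul]
      have e : (((p-2:ℕ):ℤ)+2) = 2*k+1 := by omega
      rw [e] at h9
      norm_num
      nlinarith [sq_nonneg (2*(k:ℤ)+1)]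
    · have : (1:ℤ) ≤ 5^k := one_le_pow₀ (by norm_num)
      linarith

lemma finA1 {p : ℕ} (hp : p.Prime) (hp5 : 5 ≤ p) {a b : ℤ} (ha : a ≠ 0) (hb : b ≠ 0) (hbM : |b| ≤ 1000000) (hb3 : ¬ (3:ℤ) ∣ b)
    (him : |((⟨a,b⟩:R5)^p).im| ≤ 1000000) (h3 : (3:ℤ)^(p-2) ∣ a) (h2 : (2:ℤ)^(p-3) ∣ a) (hor : (∃ S, 72*a = S^p) ∨ ((p:ℤ)^(p-1) ∣ a ∧ p ≠ 5)) : False := by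
  rcases Nat.lt_or_ge p 23 with hlt | hge
  · have hpr : p = 5 ∨ p = 7 ∨ p = 11 ∨ p = 13 ∨ p = 17 ∨ p = 19 := by
      interval_cases p <;> first | omega | (exfalso; revert hp; norm_num)
    have A3 := le_abs_of_dvd ha h3
    rcases hor with ⟨S, hS⟩ | ⟨hpd, hp55⟩
    · rcases hpr with rfl | rfl | rfl | rfl | rfl | rfl
      · obtain ⟨s, hs⟩ := root_s (q := 6) (c' := 108) (fun S h => (by have h2 := dvd2 (by norm_num) h; have h3 := dvd3 (by norm_num) h; push_cast; omega)) (by norm_num) (by norm_num) hS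
        by_cases hle : |s| ≤ (8:ℕ)
        · exact kill_list P5_mono Q5_mono im5 bl51 hs (s_ne (by norm_num) ha hs) hle hb hbM hb3 him
        · have hN := s_split (by norm_num) hs hle
          norm_num at hN
          exact kill5 (M := 1000000) (by norm_num) hb hbM (le_trans (by norm_num) (pow_le_pow_left₀ (by norm_num) hN 2)) (him.trans (by norm_num))
      · obtain ⟨s, hs⟩ := root_s (q := 6) (c' := 3888) (fun S h => (by have h2 := dvd2 (by norm_num) h; have h3 := dvd3 (by norm_num) h; push_cast; omega)) (by norm_num) (by norm_num) hS
        by_cases hle : |s| ≤ (2:ℕ)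
        · exact kill_list P7_mono Q7_mono im7 bl71 hs (s_ne (by norm_num) ha hs) hle hb hbM hb3 him
        · have hN := s_split (by norm_num) hs hle
          norm_num at hN
          exact kill7 (M := 1000000) (by norm_num) hb hbM (le_trans (by norm_num) (pow_le_pow_left₀ (by norm_num) hN 2)) (him.trans (by norm_num))
      · obtain ⟨s, hs⟩ := root_s (q := 6) (c' := 5038848) (fun S h => (by have h2 := dvd2 (by norm_num) h; have h3 := dvd3 (by norm_num) h; push_cast; omega)) (by norm_num) (by norm_num) hS
        by_cases hle : |s| ≤ (1:ℕ)
        · exact kill_list P11_mono Q11_mono im11 bl111 hs (s_ne (by norm_num) ha hs) hle hb hbM hb3 him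
        · have hN := s_split (by norm_num) hs hle
          norm_num at hN
          exact kN (p := 11) (k := 5) (M := 1000000) (by norm_num) (by norm_num) (by norm_num) hb hbM (by norm_num) hN (by norm_num) (him.trans (by norm_num))
      · have h6 : (181398528:ℤ) ∣ a := by norm_num at h2 h3; omega
        have hN := le_abs_of_dvd ha h6
        exact kN (p := 13) (k := 6) (M := 1000000) (by norm_num) (by norm_num) (by norm_num) hb hbM (by norm_num) hN (by norm_num) (him.trans (by norm_num))
      · have h6 : (235092492288:ℤ) ∣ a := by norm_num at h2 h3; omega
        have hN := le_abs_of_dvd ha h6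
        exact kN (p := 17) (k := 8) (M := 1000000) (by norm_num) (by norm_num) (by norm_num) hb hbM (by norm_num) hN (by norm_num) (him.trans (by norm_num))
      · have h6 : (8463329722368:ℤ) ∣ a := by norm_num at h2 h3; omega
        have hN := le_abs_of_dvd ha h6
        exact kN (p := 19) (k := 9) (M := 1000000) (by norm_num) (by norm_num) (by norm_num) hb hbM (by norm_num) hN (by norm_num) (him.trans (by norm_num))
    · rcases hpr with rfl | rfl | rfl | rfl | rfl | rfl
      · exact hp55 rfl
      · have h6 : (28588707:ℤ) ∣ a := by norm_num at h3 hpd; omega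
        have hN := le_abs_of_dvd ha h6
        exact kill7 (M := 1000000) (by norm_num) hb hbM (le_trans (by norm_num) (pow_le_pow_left₀ (by norm_num) hN 2)) (him.trans (by norm_num))
      · have hN := le_abs_of_dvd ha hpd
        exact kN (p := 11) (k := 5) (M := 1000000) (by norm_num) (by norm_num) (by norm_num) hb hbM (by norm_num) hN (by norm_num) (him.trans (by norm_num))
      · have hN := le_abs_of_dvd ha hpd
        exact kN (p := 13) (k := 6) (M := 1000000) (by norm_num) (by norm_num) (by norm_num) hb hbM (by norm_num) hN (by norm_num) (him.trans (by norm_num))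
      · have hN := le_abs_of_dvd ha hpd
        exact kN (p := 17) (k := 8) (M := 1000000) (by norm_num) (by norm_num) (by norm_num) hb hbM (by norm_num) hN (by norm_num) (him.trans (by norm_num))
      · have hN := le_abs_of_dvd ha hpd
        exact kN (p := 19) (k := 9) (M := 1000000) (by norm_num) (by norm_num) (by norm_num) hb hbM (by norm_num) hN (by norm_num) (him.trans (by norm_num))
  · obtain ⟨k, hk⟩ := hp.odd_of_ne_two (by omega)
    have hN := le_abs_of_dvd ha h3
    have h9 := nine_pow (p-2) (by omega)
    refine kN hk (by omega) (M := 1000000) (by norm_num) hb hbM (by positivity) hN ?_ (him.trans ?_)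
    · rw [← pow_mul, mul_comm (p-2), pow_mul]
      have e : (((p-2:ℕ):ℤ)+2) = 2*k+1 := by omega
      rw [e] at h9
      norm_num
      nlinarith [sq_nonneg (2*(k:ℤ)+1)]
    · have : (1:ℤ) ≤ 5^k := one_le_pow₀ (by norm_num)
      linarith


lemma pow15 (n : ℕ) (hn : 9 ≤ n) : 80000000000000*((n:ℤ)+2)^2 ≤ 225^n := by
  induction n, hn using Nat.le_induction with
  | base => norm_num
  | succ n hn ih =>
    have : (9:ℤ) ≤ n := by exact_mod_cast hn
    push_cast; rw [pow_succ (225:ℤ) n]; nlinarith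

/-- p at least 11 for cases 2, 3; the roles are c = 5 b0, b -/
lemma finA23_big {p k : ℕ} (hk : p = 2*k+1) (hp : 11 ≤ p) {a b : ℤ} (ha : a ≠ 0) (hb : b ≠ 0) (hbM : |b| ≤ 2000000)
    (him : |((⟨a,b⟩:R5)^p).im| ≤ 5^k*2000000) (h15 : (15:ℤ)^(p-2) ∣ a) : False := by
  have hN := le_abs_of_dvd ha h15
  have h9 := pow15 (p-2) (by omega)
  refine kN hk (by omega) (M := 2000000) (by norm_num) hb hbM (by positivity) hN ?_ him
  rw [← pow_mul, mul_comm (p-2), pow_mul]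
  have e : (((p-2:ℕ):ℤ)+2) = 2*k+1 := by omega
  rw [e] at h9
  norm_num
  nlinarith [sq_nonneg (2*(k:ℤ)+1)]

lemma finA2_7 {a b : ℤ} (ha : a ≠ 0) (hb : b ≠ 0) (hbM : |b| ≤ 2000000) (hb3 : ¬ (3:ℤ) ∣ b)
    (him : |((⟨5*a,b⟩:R5)^7).im| ≤ 5^3*2000000) (h15 : (15:ℤ)^5 ∣ a) (hor : (∃ S, 225*a = S^7) ∨ (7:ℤ)^6 ∣ a) : False := by
  have ha5 : 5*a ≠ 0 := by omega
  rcases hor with ⟨S, hS⟩ | h7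
  · obtain ⟨s, hs⟩ := root_s (q := 15) (c' := 759375) (fun S h => (by have h2 := dvd5 (by norm_num) h; have h3 := dvd3 (by norm_num) h; push_cast; omega)) (by norm_num) (by norm_num) hS
    have hs' : 5*a = 3796875*s^7 := by rw [hs]; ring
    by_cases hle : |s| ≤ (1:ℕ)
    · exact kill_list P7_mono Q7_mono im7 bl72 hs' (s_ne (by norm_num) ha hs) hle hb hbM hb3 (him.trans (by norm_num))
    · have hN := s_split (by norm_num) hs' hle
      exact kill7 (M := 2000000) (by norm_num) hb hbM (le_trans (by norm_num) (pow_le_pow_left₀ (by norm_num) hN 2)) him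
  · have h6 : (28588707*3125:ℤ) ∣ 5*a := by norm_num at h15 h7 ⊢; omega
    have hN := le_abs_of_dvd ha5 h6
    exact kill7 (M := 2000000) (by norm_num) hb hbM (le_trans (by norm_num) (pow_le_pow_left₀ (by norm_num) hN 2)) him

lemma finA3_7 {a b : ℤ} (ha : a ≠ 0) (hb : b ≠ 0) (hbM : |b| ≤ 1000000)
    (him : |((⟨5*a,b⟩:R5)^7).im| ≤ 5^3*1000000) (h15 : (15:ℤ)^5 ∣ a) (h2 : (2:ℤ)^4 ∣ a) : False := by
  have ha5 : 5*a ≠ 0 := by omega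
  have h6 : (12150000:ℤ) ∣ 5*a := by norm_num at h15 h2 ⊢; omega
  have hN := le_abs_of_dvd ha5 h6
  exact kill7 (M := 1000000) (by norm_num) hb hbM (le_trans (by norm_num) (pow_le_pow_left₀ (by norm_num) hN 2)) him

lemma finA2_5 {a b : ℤ} (ha : a ≠ 0) (hb : b ≠ 0) (hbM : |b| ≤ 2000000) (hb3 : ¬ (3:ℤ) ∣ b)
    (him : |((⟨5*a,b⟩:R5)^5).im| ≤ 5^2*2000000) (hor : ∃ S, 1125*a = S^5) : False := by
  obtain ⟨S, hS⟩ := hor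
  obtain ⟨s, hs⟩ := root_s (q := 15) (c' := 675) (fun S h => (by have h2 := dvd5 (by norm_num) h; have h3 := dvd3 (by norm_num) h; push_cast; omega)) (by norm_num) (by norm_num) hS
  have hs' : 5*a = 3375*s^5 := by rw [hs]; ring
  by_cases hle : |s| ≤ (4:ℕ)
  · exact kill_list P5_mono Q5_mono im5 bl52 hs' (s_ne (by norm_num) ha hs) hle hb hbM hb3 (him.trans (by norm_num))
  · have hN := s_split (by norm_num) hs' hle
    exact kill5 (M := 2000000) (by norm_num) hb hbM (le_trans (by norm_num) (pow_le_pow_left₀ (by norm_num) hN 2)) him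

lemma finA3_5 {a b : ℤ} (ha : a ≠ 0) (hb : b ≠ 0) (hbM : |b| ≤ 1000000) (hb3 : ¬ (3:ℤ) ∣ b)
    (him : |((⟨5*a,b⟩:R5)^5).im| ≤ 5^2*1000000) (hor : ∃ S, 9000*a = S^5) : False := by
  obtain ⟨S, hS⟩ := hor
  obtain ⟨s, hs⟩ := root_s (q := 30) (c' := 2700) (fun S h => (by have h1 := dvd2 (by norm_num) h; have h2 := dvd5 (by norm_num) h; have h3 := dvd3 (by norm_num) h; push_cast; omega)) (by norm_num) (by norm_num) hS
  have hs' : 5*a = 13500*s^5 := by rw [hs]; ring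
  by_cases hle : |s| ≤ (3:ℕ)
  · exact kill_list P5_mono Q5_mono im5 bl53 hs' (s_ne (by norm_num) ha hs) hle hb hbM hb3 (him.trans (by norm_num))
  · have hN := s_split (by norm_num) hs' hle
    exact kill5 (M := 1000000) (by norm_num) hb hbM (le_trans (by norm_num) (pow_le_pow_left₀ (by norm_num) hN 2)) him

/-- multiply by the square root of -5 -/
lemma im_twist (a b : ℤ) (k : ℕ) : |((⟨5*b,a⟩:R5)^(2*k+1)).im| = 5^k*|((⟨a,b⟩:R5)^(2*k+1)).re| := by
  have e : (⟨-(5*b),a⟩:R5) = ⟨a,b⟩*⟨0,1⟩ := by ext <;> simp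
  have e2 : (⟨0,1⟩:R5)^(2*k+1) = ⟨0, (-5)^k⟩ := by
    induction k with
    | zero => simp
    | succ k ih =>
      rw [show 2*(k+1)+1 = (2*k+1)+1+1 by ring, pow_succ, pow_succ, ih]
      ext
      · simp
      · simp; ring
  have h1 : ((⟨-(5*b),a⟩:R5)^(2*k+1)).im = (-5)^k*((⟨a,b⟩:R5)^(2*k+1)).re := by
    rw [e, mul_pow, e2, Zsqrtd.im_mul]; simp; ring
  rw [← im_abs, ← abs_neg (5*b), im_abs, h1, abs_mul, abs_pow]; norm_num

lemma pdiv {q : ℕ} (hq : q.Prime) {p e : ℕ} (he : e ≤ p) {x W Y : ℤ} (hY : (q:ℤ) ∣ Y) (h : (q:ℤ)^e*(x*W) = Y^p) (hW : ¬ (q:ℤ) ∣ W) :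
    (q:ℤ)^(p-e) ∣ x := by
  have hqp := Nat.prime_iff_prime_int.mp hq
  have h1 : (q:ℤ)^p ∣ Y^p := pow_dvd_pow_of_dvd hY p
  rw [← h, show (q:ℤ)^p = q^e*q^(p-e) by rw [← pow_add]; congr 1; omega] at h1
  have h2 := Int.dvd_of_mul_dvd_mul_left (pow_ne_zero _ hqp.ne_zero) h1
  exact IsCoprime.dvd_of_dvd_mul_right (((hqp.coprime_iff_not_dvd).mpr hW).pow_left) h2

lemma p1800 {p : ℕ} (hp : p.Prime) (h : (p:ℤ) ∣ 1800) : p = 2 ∨ p = 3 ∨ p = 5 := by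
  have h' : p ∣ 1800 := by exact_mod_cast h
  have : p ∈ Nat.primeFactors 1800 := by simp [hp, h']
  have hpf : Nat.primeFactors 1800 = {2,3,5} := by decide +kernel
  rw [hpf] at this
  simpa using this

lemma p3' : Prime (3:ℤ) := Int.prime_three
lemma p5' : Prime (5:ℤ) := Int.prime_iff_natAbs_prime.mpr (by norm_num)

lemma cop_ab {p k : ℕ} (hpk : p = 2*k+1) {a b A B : ℤ} (he : (⟨a,b⟩:R5)^p = ⟨A,B⟩) (hc : IsCoprime A B) : a ∣ A ∧ b ∣ B ∧ IsCoprime a b := by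
  subst hpk
  obtain ⟨t, t', h1, h2⟩ := oddpow_i a b k
  rw [he] at h1 h2
  simp only at h1 h2
  have ha : a ∣ A := ⟨_, h1⟩
  have hb : b ∣ B := ⟨_, h2⟩
  exact ⟨ha, hb, (hc.of_isCoprime_of_dvd_left ha).of_isCoprime_of_dvd_right hb⟩

lemma par_ab {p : ℕ} (hp : 1 ≤ p) {a b A B : ℤ} (he : (⟨a,b⟩:R5)^p = ⟨A,B⟩) (ho : Odd (A^2+5*B^2)) : Odd (a^2+5*b^2) := by
  have h : ((⟨a,b⟩:R5).norm)^p = A^2+5*B^2 := by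
    have := congrArg Zsqrtd.norm he
    rw [norm5 ⟨A,B⟩] at this
    rw [← this]
    exact (map_pow (Zsqrtd.normMonoidHom (d := -5)) (⟨a,b⟩:R5) p).symm
  rw [← h, norm5] at ho
  exact (Int.odd_pow' (by omega)).mp ho

lemma even_of {x y Y c : ℤ} {p : ℕ} (hp : 5 ≤ p) (h : 8*(c*x) = Y^p) (hc : Odd c) (ho : Odd (x^2+5*y^2) ∨ Odd (y^2+5*x^2)) : Even x ∧ Odd y ∧ (2:ℤ) ∣ Y := by
  have hY : (2:ℤ) ∣ Y := dvd2 (p := p) (c := 8) (by norm_num) ⟨_, h.symm⟩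
  have hx : Even x := by
    have h1 := (pow_dvd_pow_of_dvd hY 4).trans (pow_dvd_pow Y (show 4 ≤ p by omega))
    rw [← h] at h1
    have h2 : (2:ℤ) ∣ c*x := by norm_num at h1; omega
    have h3 : Even (c*x) := even_iff_two_dvd.mpr h2
    rcases Int.even_mul.mp h3 with h4 | h4
    · exact absurd hc (Int.not_odd_iff_even.mpr h4)
    · exact h4
  refine ⟨hx, ?_, hY⟩
  by_contra hy
  rw [Int.not_odd_iff_even] at hy
  obtain ⟨u, rfl⟩ := hx
  obtain ⟨v, rfl⟩ := hy
  rcases ho with ho | ho <;> rw [Int.odd_iff] at ho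
  · have : (u+u)^2+5*(v+v)^2 = 2*(2*u^2+10*v^2) := by ring
    omega
  · have : (v+v)^2+5*(u+u)^2 = 2*(2*v^2+10*u^2) := by ring
    omega

lemma even_of' {x y : ℤ} (hy : Odd y) (ho : Odd (x^2+5*y^2) ∨ Odd (y^2+5*x^2)) : Even x := by
  by_contra hx
  rw [Int.not_even_iff_odd] at hx
  have h1 := sq8_odd hx
  have h2 := sq8_odd hy
  rcases ho with ho | ho <;> rw [Int.odd_iff] at ho <;> omega

/-- cases 0 and 1 -/
lemma A01 {p : ℕ} (hp : p.Prime) (hp5 : 5 ≤ p) {a b A B Y c0 : ℤ} (he : (⟨a,b⟩:R5)^p = ⟨A,B⟩) (hc : IsCoprime A B) (hY : Y ≠ 0)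
    (h3 : (3:ℤ) ∣ Y) (hc0 : c0 = 1 ∨ c0 = 8) (hA : 9*c0*A = Y^p) (hB : B ≠ 0) (h5 : ¬ (5:ℤ) ∣ A) (ho : Odd (A^2+5*B^2)) :
    a ≠ 0 ∧ b ≠ 0 ∧ ¬ (3:ℤ) ∣ b ∧ |b| ≤ |B| ∧ (3:ℤ)^(p-2) ∣ a ∧ (c0 = 8 → (2:ℤ)^(p-3) ∣ a) ∧ ((∃ S, (9*c0)*a = S^p) ∨ ((p:ℤ)^(p-1) ∣ a ∧ p ≠ 5)) := by
  obtain ⟨k, hk⟩ := hp.odd_of_ne_two (by omega)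
  have hodd : Odd p := ⟨k, hk⟩
  obtain ⟨haA, hbB, hab⟩ := cop_ab hk he hc
  have hpar := par_ab (by omega) he ho
  obtain ⟨t, t', e1, -⟩ := oddpow_i a b k
  obtain ⟨i1, i2⟩ := oddpow_iii a b k
  rw [← hk, he] at e1 i1 i2
  simp only at e1 i1 i2
  have hpk : (2*(k:ℤ)+1) = p := by rw [hk]; push_cast; ring
  rw [hpk] at e1
  have hpp := Nat.prime_iff_prime_int.mp hp
  have hA0 : A ≠ 0 := by
    rintro rfl
    exact pow_ne_zero p hY (by rw [← hA]; ring)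
  have ha0 : a ≠ 0 := by rintro rfl; exact hA0 (zero_dvd_iff.mp haA)
  have hb0 : b ≠ 0 := by rintro rfl; exact hB (zero_dvd_iff.mp hbB)
  have h5a : ¬ (5:ℤ) ∣ a := fun h => h5 (h.trans haA)
  have h3A : (3:ℤ) ∣ A := by
    have h1 := (pow_dvd_pow_of_dvd h3 3).trans (pow_dvd_pow Y (show 3 ≤ p by omega))
    rw [← hA] at h1
    norm_num at h1
    rcases hc0 with rfl | rfl <;> omega
  have h3a : (3:ℤ) ∣ a := by omega
  have h3b : ¬ (3:ℤ) ∣ b := fun h => p3'.not_isUnit (hab.isUnit_of_dvd' h3a h)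
  obtain ⟨F, hF⟩ : ∃ F, F = (p:ℤ)*(-5*b^2)^k + a^2*t := ⟨_, rfl⟩
  rw [← hF] at e1
  have haD : IsCoprime a ((-5*b^2)^k) := by
    apply IsCoprime.pow_right
    apply IsCoprime.mul_right
    · rw [show (-5:ℤ) = -(5) by norm_num, IsCoprime.neg_right_iff]
      exact ((p5'.coprime_iff_not_dvd).mpr h5a).symm
    · exact hab.pow_right
  have hp3 : ¬ (3:ℤ) ∣ p := by
    intro h
    have := (Nat.prime_dvd_prime_iff_eq Nat.prime_three hp).mp (by exact_mod_cast h)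
    omega
  have h3F : ¬ (3:ℤ) ∣ F := by
    intro h
    rw [hF] at h
    have h1 := (dvd_add_left (Dvd.dvd.mul_right (dvd_pow h3a (by norm_num)) _)).mp h
    rcases p3'.dvd_or_dvd h1 with h2 | h2
    · exact hp3 h2
    · exact p3'.not_isUnit (haD.isUnit_of_dvd' h3a h2)
  have h2F : c0 = 8 → Odd F ∧ (2:ℤ) ∣ Y := by
    intro h8
    rw [h8] at hA
    obtain ⟨_, k2, k3⟩ := even_of (c := 9) hp5 (by rw [← hA]; ring) (by decide) (Or.inl ho)
    have hbo : Odd b := Int.Odd.of_mul_right (m := B / b) (by rw [Int.ediv_mul_cancel hbB]; exact k2)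
    have hae : Even a := even_of' hbo (Or.inl hpar)
    refine ⟨?_, k3⟩
    rw [hF]
    apply Odd.add_even
    · apply Odd.mul (by exact_mod_cast hodd)
      apply Odd.pow
      exact Odd.mul (by decide) hbo.pow
    · exact Even.mul_right (hae.pow_of_ne_zero (by norm_num)) _
  have hcF : IsCoprime (9*c0) F := by
    have h9 : IsCoprime (9:ℤ) F := by
      rw [show (9:ℤ) = 3^2 by norm_num]; exact ((p3'.coprime_iff_not_dvd).mpr h3F).pow_left
    rcases hc0 with h | h
    · rw [h]; simpa using h9
    · rw [h]; exact h9.mul_left (by simpa using cop_two (h2F h).1 3)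
  have hYF : 9*c0*a*F = Y^p := by rw [← hA, e1]; ring
  refine ⟨ha0, hb0, h3b, ?_, ?_, ?_, ?_⟩
  · have := Int.le_of_dvd (abs_pos.mpr hB) ((abs_dvd_abs b B).mpr hbB)
    exact this
  · have h3c : ¬ (3:ℤ) ∣ c0*F := by
      intro h
      rcases p3'.dvd_or_dvd h with h1 | h1
      · rcases hc0 with rfl | rfl <;> omega
      · exact h3F h1
    have := pdiv (q := 3) (p := p) (e := 2) (x := a) (W := c0*F) (Y := Y) (by norm_num) (by omega) (by exact_mod_cast h3) (by rw [← hYF]; push_cast; ring) (by exact_mod_cast h3c)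
    exact_mod_cast this
  · intro h8
    obtain ⟨k1, k2⟩ := h2F h8
    have : ¬ (2:ℤ) ∣ 9*F := by rw [Int.odd_iff] at k1; omega
    have := pdiv (q := 2) (p := p) (e := 3) (x := a) (W := 9*F) (Y := Y) (by norm_num) (by omega) (by exact_mod_cast k2) (by rw [← hYF, h8]; push_cast; ring) (by exact_mod_cast this)
    exact_mod_cast this
  · have hpc : ¬ (p:ℤ) ∣ 9*c0 := by
      intro h
      have h1 : (p:ℤ) ∣ 72 := by rcases hc0 with rfl | rfl <;> [exact h.trans (by norm_num); exact h]
      rcases p1800 hp (h1.trans (by norm_num)) with rfl | rfl | rfl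
      · omega
      · omega
      · norm_num at h1
    rcases pow_or hp hp5 hF haD hcF hYF hpc with h | h
    · exact Or.inl h
    · refine Or.inr ⟨h, ?_⟩
      rintro rfl
      exact h5a ((dvd_pow_self (5:ℤ) (n := 4) (by norm_num)).trans (by exact_mod_cast h))

/-- cases 2 and 3 -/
lemma A23 {p k : ℕ} (hp : p.Prime) (hp5 : 5 ≤ p) (hk : p = 2*k+1) {a b A B Y c0 : ℤ} (he : (⟨a,b⟩:R5)^p = ⟨A,B⟩) (hc : IsCoprime A B) (hY : Y ≠ 0)
    (h3 : (3:ℤ) ∣ Y) (hc0 : c0 = 1 ∨ c0 = 8) (hB : 225*c0*B = Y^p) (hA : A ≠ 0) (ho : Odd (A^2+5*B^2)) :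
    a ≠ 0 ∧ b ≠ 0 ∧ ¬ (3:ℤ) ∣ a ∧ |a| ≤ |A| ∧ |((⟨5*b,a⟩:R5)^p).im| = 5^k*|A| ∧
    ((p ≠ 5 ∧ (15:ℤ)^(p-2) ∣ b ∧ (c0 = 8 → (2:ℤ)^(p-3) ∣ b) ∧ ((∃ S, (225*c0)*b = S^p) ∨ (p:ℤ)^(p-1) ∣ b)) ∨
      (p = 5 ∧ ∃ S, (1125*c0)*b = S^5)) := by
  have hodd : Odd p := ⟨k, hk⟩
  obtain ⟨haA, hbB, hab⟩ := cop_ab hk he hc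
  have hpar := par_ab (by omega) he ho
  obtain ⟨-, t, -, e1⟩ := oddpow_ii a b k
  obtain ⟨i1, i2⟩ := oddpow_iii a b k
  have tw := im_twist a b k
  rw [← hk, he] at e1 i1 i2 tw
  simp only at e1 i1 i2 tw
  have hpk : (2*(k:ℤ)+1) = p := by rw [hk]; push_cast; ring
  rw [hpk] at e1
  have hB0 : B ≠ 0 := by
    rintro rfl
    exact pow_ne_zero p hY (by rw [← hB]; ring)
  have ha0 : a ≠ 0 := by rintro rfl; exact hA (zero_dvd_iff.mp haA)
  have hb0 : b ≠ 0 := by rintro rfl; exact hB0 (zero_dvd_iff.mp hbB)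
  have h3B : (3:ℤ) ∣ B := by
    have h1 := (pow_dvd_pow_of_dvd h3 3).trans (pow_dvd_pow Y (show 3 ≤ p by omega))
    rw [← hB] at h1
    norm_num at h1
    rcases hc0 with rfl | rfl <;> omega
  have h5Y : (5:ℤ) ∣ Y := dvd5 (p := p) (c := 225) (by norm_num) ⟨c0*B, by rw [← hB]; ring⟩
  have h5B : (5:ℤ) ∣ B := by
    have h1 := (pow_dvd_pow_of_dvd h5Y 3).trans (pow_dvd_pow Y (show 3 ≤ p by omega))
    rw [← hB] at h1
    norm_num at h1
    rcases hc0 with rfl | rfl <;> omega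
  have h3b : (3:ℤ) ∣ b := by omega
  have h3a : ¬ (3:ℤ) ∣ a := fun h => p3'.not_isUnit (hab.isUnit_of_dvd' h h3b)
  have h5a : ¬ (5:ℤ) ∣ a := fun h => p5'.not_isUnit (hc.isUnit_of_dvd' (h.trans haA) h5B)
  have h3D : ¬ (3:ℤ) ∣ a^(2*k) := fun h => h3a (p3'.dvd_of_dvd_pow h)
  have h5D : ¬ (5:ℤ) ∣ a^(2*k) := fun h => h5a (p5'.dvd_of_dvd_pow h)
  have hbD : IsCoprime b (a^(2*k)) := hab.symm.pow_right
  have hpq : ∀ q : ℕ, q.Prime → (q:ℤ) ∣ p → p = q := fun q hq h =>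
    ((Nat.prime_dvd_prime_iff_eq hq hp).mp (by exact_mod_cast h)).symm
  have h2 : c0 = 8 → Odd a ∧ Even b ∧ (2:ℤ) ∣ Y := by
    intro h8
    rw [h8] at hB
    obtain ⟨_, k2, k3⟩ := even_of (c := 225) hp5 (by rw [← hB]; ring) (by decide) (Or.inr ho)
    have hao : Odd a := Int.Odd.of_mul_right (m := A / a) (by rw [Int.ediv_mul_cancel haA]; exact k2)
    exact ⟨hao, even_of' hao (Or.inr hpar), k3⟩
  refine ⟨ha0, hb0, h3a, Int.le_of_dvd (abs_pos.mpr hA) ((abs_dvd_abs a A).mpr haA), tw, ?_⟩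
  by_cases h5 : p = 5
  · right
    refine ⟨h5, ?_⟩
    subst h5
    obtain rfl : k = 2 := by omega
    obtain ⟨F, hF⟩ : ∃ F, F = a^4 + b^2*(5*b^2-10*a^2) := ⟨_, rfl⟩
    have e2 : B = 5*(b*F) := by
      have := congrArg Zsqrtd.im he
      rw [pw5] at this
      simp only at this
      rw [← this, hF]; ring
    have hbF : IsCoprime b F := by
      rw [hF, show a^4 + b^2*(5*b^2-10*a^2) = a^4 + b*(b*(5*b^2-10*a^2)) by ring]
      exact IsCoprime.add_mul_left_right hbD _
    have h3F : ¬ (3:ℤ) ∣ F := fun h => p3'.not_isUnit (hbF.isUnit_of_dvd' h3b h)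
    have h5F : ¬ (5:ℤ) ∣ F := by
      intro h
      apply h5D
      rw [hF] at h
      exact (dvd_add_left ⟨b^2*(b^2-2*a^2), by ring⟩).mp h
    have hcF : IsCoprime (1125*c0) F := by
      have h9 : IsCoprime (1125:ℤ) F := by
        rw [show (1125:ℤ) = 3^2*5^3 by norm_num]
        exact ((p3'.coprime_iff_not_dvd).mpr h3F).pow_left.mul_left ((p5'.coprime_iff_not_dvd).mpr h5F).pow_left
      rcases hc0 with h | h
      · rw [h]; simpa using h9
      · rw [h]
        refine h9.mul_left ?_
        have : Odd F := by
          rw [hF]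
          exact (h2 h).1.pow.add_even (((h2 h).2.1.pow_of_ne_zero (by norm_num)).mul_right _)
        simpa using cop_two this 3
    obtain ⟨S, v, hS, -⟩ := split_pow hodd (hcF.mul_left hbF) (show 1125*c0*b*F = Y^5 by rw [← hB, e2]; ring)
    exact ⟨S, hS⟩
  · left
    obtain ⟨F, hF⟩ : ∃ F, F = (p:ℤ)*a^(2*k) + 5*b^2*t := ⟨_, rfl⟩
    rw [← hF] at e1
    have hF' : F = (p:ℤ)*a^(2*k) + b^2*(5*t) := by rw [hF]; ring
    have h3F : ¬ (3:ℤ) ∣ F := by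
      intro h
      rw [hF'] at h
      have h1 := (dvd_add_left (Dvd.dvd.mul_right (dvd_pow h3b (by norm_num)) _)).mp h
      rcases p3'.dvd_or_dvd h1 with h2 | h2
      · have := hpq 3 Nat.prime_three h2
        omega
      · exact h3D h2
    have h5F : ¬ (5:ℤ) ∣ F := by
      intro h
      rw [hF] at h
      have h1 := (dvd_add_left (Dvd.intro _ (by rw [mul_assoc]))).mp h
      rcases p5'.dvd_or_dvd h1 with h2 | h2
      · exact h5 (hpq 5 Nat.prime_five h2)
      · exact h5D h2
    have h2F : c0 = 8 → Odd F := by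
      intro h8
      obtain ⟨k1, k2, -⟩ := h2 h8
      rw [hF']
      exact (Odd.mul (by exact_mod_cast hodd) k1.pow).add_even ((k2.pow_of_ne_zero (by norm_num)).mul_right _)
    have hcF : IsCoprime (225*c0) F := by
      have h9 : IsCoprime (225:ℤ) F := by
        rw [show (225:ℤ) = 3^2*5^2 by norm_num]
        exact ((p3'.coprime_iff_not_dvd).mpr h3F).pow_left.mul_left ((p5'.coprime_iff_not_dvd).mpr h5F).pow_left
      rcases hc0 with h | h
      · rw [h]; simpa using h9
      · rw [h]; exact h9.mul_left (by simpa using cop_two (h2F h) 3)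
    have hYF : 225*c0*b*F = Y^p := by rw [← hB, e1]; ring
    refine ⟨h5, ?_, ?_, ?_⟩
    · have h3c : ¬ (3:ℤ) ∣ 25*c0*F := by
        intro h
        rcases p3'.dvd_or_dvd h with h1 | h1
        · rcases hc0 with rfl | rfl <;> omega
        · exact h3F h1
      have h5c : ¬ (5:ℤ) ∣ 9*c0*F := by
        intro h
        rcases p5'.dvd_or_dvd h with h1 | h1
        · rcases hc0 with rfl | rfl <;> omega
        · exact h5F h1
      have u1 := pdiv (q := 3) (p := p) (e := 2) (x := b) (W := 25*c0*F) (Y := Y) (by norm_num) (by omega) (by exact_mod_cast h3) (by rw [← hYF]; push_cast; ring) (by exact_mod_cast h3c)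
      have u2 := pdiv (q := 5) (p := p) (e := 2) (x := b) (W := 9*c0*F) (Y := Y) (by norm_num) (by omega) (by exact_mod_cast h5Y) (by rw [← hYF]; push_cast; ring) (by exact_mod_cast h5c)
      rw [show (15:ℤ) = 3*5 by norm_num, mul_pow]
      refine IsCoprime.mul_dvd (IsCoprime.pow ?_) (by exact_mod_cast u1) (by exact_mod_cast u2)
      exact ⟨2, -1, by norm_num⟩
    · intro h8
      have k1 := h2F h8
      have k2 := (h2 h8).2.2
      have : ¬ (2:ℤ) ∣ 225*F := by rw [Int.odd_iff] at k1; omega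
      have := pdiv (q := 2) (p := p) (e := 3) (x := b) (W := 225*F) (Y := Y) (by norm_num) (by omega) (by exact_mod_cast k2) (by rw [← hYF, h8]; push_cast; ring) (by exact_mod_cast this)
      exact_mod_cast this
    · refine pow_or hp hp5 hF' hbD hcF hYF ?_
      intro h
      have h1 : (p:ℤ) ∣ 1800 := by rcases hc0 with rfl | rfl <;> [exact h.trans (by norm_num); exact h]
      rcases p1800 hp h1 with rfl | rfl | rfl
      · omega
      · omega
      · omega

lemma solA_false {p : ℕ} (hp : p.Prime) (hp5 : 5 ≤ p) {r : ℤ} (hr0 : 0 < r) (hr : r ≤ 10^6) {cs : ℕ} (h : SolA p r cs) : False := by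
  obtain ⟨⟨a, b⟩, A, B, Y, hc, he, hY, ho, h3, h⟩ := h
  have him : |((⟨a,b⟩:R5)^p).im| = |B| := by rw [he]
  obtain ⟨k, hk⟩ := hp.odd_of_ne_two (by omega)
  norm_num at hr
  rcases h with ⟨-, h1, h2, h5⟩ | ⟨-, h1, h2, h5⟩ | ⟨-, h1, h2⟩ | ⟨-, h1, h2⟩
  · have hB : |B| ≤ 2000000 := by rw [h2, abs_le]; constructor <;> omega
    obtain ⟨k1, k2, k3, k4, k5, -, k6⟩ := A01 (c0 := 1) hp hp5 he hc hY h3 (Or.inl rfl) (by rw [← h1]; ring) (by omega) h5 ho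
    exact finA0 hp hp5 k1 k2 (k4.trans hB) k3 (him.le.trans hB) k5 (by simpa using k6)
  · have hB : |B| ≤ 1000000 := by rw [h2, abs_le]; constructor <;> omega
    obtain ⟨k1, k2, k3, k4, k5, k7, k6⟩ := A01 (c0 := 8) hp hp5 he hc hY h3 (Or.inr rfl) (by rw [← h1]; ring) (by omega) h5 ho
    exact finA1 hp hp5 k1 k2 (k4.trans hB) k3 (him.le.trans hB) k5 (k7 rfl) (by simpa using k6)
  · have hA : |A| ≤ 2000000 := by rw [h2, abs_le]; constructor <;> omega
    obtain ⟨k1, k2, k3, k4, k5, k6⟩ := A23 (c0 := 1) hp hp5 hk he hc hY h3 (Or.inl rfl) (by rw [← h1]; ring) (by omega) ho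
    have hi : |((⟨5*b,a⟩:R5)^p).im| ≤ 5^k*2000000 := by rw [k5]; gcongr
    rcases k6 with ⟨m1, m2, -, m3⟩ | ⟨rfl, m3⟩
    · rcases le_or_gt 11 p with h11 | h11
      · exact finA23_big hk h11 (by omega) k1 (k4.trans hA) hi (m2.mul_left _)
      · obtain rfl : p = 7 := by interval_cases p <;> revert hp <;> first | omega | norm_num
        obtain rfl : k = 3 := by omega
        exact finA2_7 k2 k1 (k4.trans hA) k3 hi m2 (by simpa using m3)
    · obtain rfl : k = 2 := by omega
      exact finA2_5 k2 k1 (k4.trans hA) k3 hi (by simpa using m3)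
  · have hA : |A| ≤ 1000000 := by rw [h2, abs_le]; constructor <;> omega
    obtain ⟨k1, k2, k3, k4, k5, k6⟩ := A23 (c0 := 8) hp hp5 hk he hc hY h3 (Or.inr rfl) (by rw [← h1]; ring) (by omega) ho
    have hi : |((⟨5*b,a⟩:R5)^p).im| ≤ 5^k*1000000 := by rw [k5]; gcongr
    rcases k6 with ⟨m1, m2, m4, m3⟩ | ⟨rfl, m3⟩
    · rcases le_or_gt 11 p with h11 | h11
      · exact finA23_big hk h11 (by omega) k1 (k4.trans (hA.trans (by norm_num))) (hi.trans (by gcongr; norm_num)) (m2.mul_left _)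
      · obtain rfl : p = 7 := by interval_cases p <;> revert hp <;> first | omega | norm_num
        obtain rfl : k = 3 := by omega
        exact finA3_7 k2 k1 (k4.trans hA) hi m2 (m4 rfl)
    · obtain rfl : k = 2 := by omega
      exact finA3_5 k2 k1 (k4.trans hA) k3 hi (by simpa using m3)
theorem sum_nine_cubes_AP_eq_perfect_power (p : ℕ) (hp : p.Prime) (hp5 : 5 ≤ p)
    (x r y : ℤ) (hr0 : 0 < r) (hr : r ≤ 10 ^ 6) (hgcd : Int.gcd x r = 1)
    (h : (x - 4*r)^3 + (x - 3*r)^3 + (x - 2*r)^3 + (x - r)^3 + x^3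
        + (x + r)^3 + (x + 2*r)^3 + (x + 3*r)^3 + (x + 4*r)^3 = y ^ p) :
    x * y = 0 := by
  by_cases hx : x = 0
  · simp [hx]
  exfalso
  have h9 : 9*x*(x^2+20*r^2) = y^p := by rw [← h]; ring
  obtain ⟨cs, hcs, hA | hB⟩ := reduction hp hp5 hgcd hx h9
  · exact solA_false hp hp5 hr0 hr hA
  · rcases le_or_gt 19600 p with h1 | h1
    · exact large_p h1 hr0 hr hB
    rcases le_or_gt 11 p with h2 | h2
    · exact masks_exc (sieve_all hp h2 h1 hcs hB) hr0 hr hB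
    have h57 : p = 5 ∨ p = 7 := by
      interval_cases p <;> first | omega | (exfalso; revert hp; norm_num)
    rcases h57 with rfl | rfl
    · exact p5_false hB
    · exact p7_false hr0 hcs hB
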